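/- Let 865/886 < γ < 1, a ∈ ℤ \ {0}, 1 < c < 3 with c ≠ 2, and A > 0 be fixed, and let ε > 0 be sufficiently small. Set θ = (443/55)γ − 173/22 − ε and D = X^θ. Then for all sufficiently large X and all real t with |t| < X^(1/4 − c), one has Σ_{d ≤ D, gcd(d,a)=1} | Σ_{p ≤ X, p ≡ a (mod d)} p^{1−γ} ((p+1)^γ − p^γ) e(t p^c) log p − (γ/φ(d)) ∫_2^X e(t y^c) dy | ≪ X / (log X)^A. -/

import Mathlib

/-- `e(t) = exp(2πit)`. -/
noncomputable def e (t : ℝ) : ℂ := Complex.exp (2 * Real.pi * Complex.I * t)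

namespace TwistedBV

open Complex Set Filter Topology MeasureTheory Asymptotics

/-- The truncated Mellin-type integral `∫_N^∞ E(x) x^{-s-1} dx`. -/
noncomputable def tailMellin (N : ℕ) (E : ℝ → ℂ) (s : ℂ) : ℂ :=
  ∫ x in Ioi (N : ℝ), E x * (x : ℂ) ^ (-(s + 1))

lemma tailMellin_eq_mellin {N : ℕ} (E : ℝ → ℂ) (s : ℂ) :
    tailMellin N E s = mellin (indicator (Ioi (N : ℝ)) E) (-s) := by
  have h0 : (0 : ℝ) ≤ N := Nat.cast_nonneg N
  rw [tailMellin, mellin, ← integral_indicator measurableSet_Ioi,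
    ← integral_indicator measurableSet_Ioi]
  congr 1
  ext x
  by_cases hx : (N : ℝ) < x
  · rw [indicator_of_mem (mem_Ioi.2 hx), indicator_of_mem (mem_Ioi.2 (h0.trans_lt hx)),
      indicator_of_mem (mem_Ioi.2 hx), smul_eq_mul, mul_comm]
    congr 2
    ring
  · by_cases hx0 : 0 < x
    · simp [indicator, hx]
    · simp [indicator, hx, hx0]

lemma locallyIntegrableOn_of_bounded {f : ℝ → ℂ} {K : ℝ} (hm : Measurable f)
    (hb : ∀ x, ‖f x‖ ≤ K) (s : Set ℝ) : LocallyIntegrableOn f s :=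
  ((locallyIntegrable_const K).mono hm.aestronglyMeasurable (ae_of_all _ fun x ↦ by
    rw [Real.norm_eq_abs]; exact (hb x).trans (le_abs_self K))).locallyIntegrableOn s

lemma norm_indicator_le {N : ℕ} {E : ℝ → ℂ} {K : ℝ} (hK : 0 ≤ K)
    (hb : ∀ x, (N : ℝ) < x → ‖E x‖ ≤ K) (x : ℝ) : ‖indicator (Ioi (N : ℝ)) E x‖ ≤ K := by
  by_cases hx : (N : ℝ) < x
  · rw [indicator_of_mem (mem_Ioi.2 hx)]; exact hb x hx
  · rw [indicator_of_notMem (by simpa using hx)]; simpa using hK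

lemma indicator_bigO_bot {N : ℕ} (hN : 1 ≤ N) {E : ℝ → ℂ} (b : ℝ) :
    indicator (Ioi (N : ℝ)) E =O[𝓝[>] 0] (· ^ (-b)) := by
  have h1 : (1 : ℝ) ≤ N := by exact_mod_cast hN
  have : indicator (Ioi (N : ℝ)) E =ᶠ[𝓝[>] 0] fun _ ↦ 0 := by
    filter_upwards [nhdsWithin_le_nhds (Iio_mem_nhds (show (0 : ℝ) < 1 by norm_num))] with x hx
    rw [indicator_of_notMem]
    have : x < 1 := hx
    simp only [mem_Ioi, not_lt]; linarith
  exact this.trans_isBigO (isBigO_zero _ _)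

lemma indicator_bigO_top {N : ℕ} {E : ℝ → ℂ} {K : ℝ} (hK : 0 ≤ K)
    (hb : ∀ x, (N : ℝ) < x → ‖E x‖ ≤ K) :
    indicator (Ioi (N : ℝ)) E =O[atTop] (· ^ (-(0 : ℝ))) := by
  refine IsBigO.of_bound K (Eventually.of_forall fun x ↦ ?_)
  simpa using norm_indicator_le hK hb x

lemma differentiableAt_tailMellin {N : ℕ} (hN : 1 ≤ N) {E : ℝ → ℂ} {K : ℝ} (hK : 0 ≤ K)
    (hm : Measurable E) (hb : ∀ x, (N : ℝ) < x → ‖E x‖ ≤ K) {s : ℂ} (hs : 0 < s.re) :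
    DifferentiableAt ℂ (tailMellin N E) s := by
  have : tailMellin N E = fun s ↦ mellin (indicator (Ioi (N : ℝ)) E) (-s) := by
    ext s; exact tailMellin_eq_mellin E s
  rw [this]
  refine DifferentiableAt.comp (𝕜 := ℂ) (g := mellin (indicator (Ioi (N : ℝ)) E)) s
    (f := fun s : ℂ ↦ -s) ?_ (by fun_prop)
  exact mellin_differentiableAt_of_isBigO_rpow (a := 0) (b := -s.re - 1)
    (locallyIntegrableOn_of_bounded (hm.indicator measurableSet_Ioi) (norm_indicator_le hK hb) _)
    (indicator_bigO_top hK hb) (by simpa using hs) (indicator_bigO_bot hN _) (by simp)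

lemma integrableOn_tailMellin {N : ℕ} (hN : 1 ≤ N) {E : ℝ → ℂ} {K : ℝ}
    (hm : Measurable E) (hb : ∀ x, (N : ℝ) < x → ‖E x‖ ≤ K) {s : ℂ} (hs : 0 < s.re) :
    IntegrableOn (fun x : ℝ ↦ E x * (x : ℂ) ^ (-(s + 1))) (Ioi (N : ℝ)) := by
  have h1 : (0 : ℝ) < N := by exact_mod_cast hN
  refine Integrable.bdd_mul (c := K) ?_ hm.aestronglyMeasurable ?_
  · exact integrableOn_Ioi_cpow_of_lt (by simp; linarith) h1
  · exact (ae_restrict_iff' measurableSet_Ioi).2 (ae_of_all _ fun x hx ↦ hb x hx)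

lemma norm_tailMellin_le {N : ℕ} (hN : 1 ≤ N) {E : ℝ → ℂ} {K : ℝ}
    (hb : ∀ x, (N : ℝ) < x → ‖E x‖ ≤ K) {s : ℂ} (hs : 0 < s.re) :
    ‖tailMellin N E s‖ ≤ K * (N : ℝ) ^ (-s.re) / s.re := by
  have h1 : (0 : ℝ) < N := by exact_mod_cast hN
  have hi : IntegrableOn (fun x : ℝ ↦ K * x ^ (-s.re - 1)) (Ioi (N : ℝ)) :=
    (integrableOn_Ioi_rpow_of_lt (by linarith) h1).const_mul K
  calc ‖tailMellin N E s‖ ≤ ∫ x in Ioi (N : ℝ), K * x ^ (-s.re - 1) := by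
        refine norm_integral_le_of_norm_le hi ?_
        refine (ae_restrict_iff' measurableSet_Ioi).2 (ae_of_all _ fun x hx ↦ ?_)
        have hx0 : 0 < x := h1.trans hx
        rw [norm_mul, norm_cpow_eq_rpow_re_of_pos hx0]
        have : (-(s + 1)).re = -s.re - 1 := by simp; ring
        rw [this]
        gcongr
        exact hb x hx
    _ = K * (N : ℝ) ^ (-s.re) / s.re := by
        rw [integral_const_mul, integral_Ioi_rpow_of_lt (by linarith) h1]
        have : -s.re - 1 + 1 = -s.re := by ring
        rw [this]
        field_simp

/-- The deviation of the summatory function of `a` beyond `N` from linear growth of slope `κ`. -/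
noncomputable def sumError (a : ℕ → ℂ) (κ : ℂ) (N : ℕ) (x : ℝ) : ℂ :=
  ∑ k ∈ Finset.Ioc N ⌊x⌋₊, a k - κ * (x - N)

lemma measurable_sumError (a : ℕ → ℂ) (κ : ℂ) (N : ℕ) : Measurable (sumError a κ N) := by
  have h : Measurable fun x : ℝ ↦ ∑ k ∈ Finset.Ioc N ⌊x⌋₊, a k :=
    (measurable_from_nat (f := fun n ↦ ∑ k ∈ Finset.Ioc N n, a k)).comp Nat.measurable_floor
  exact h.sub (by fun_prop)

lemma LSeries_eq_truncation {a : ℕ → ℂ} (ha : ∀ n, ‖a n‖ ≤ 1) {κ : ℂ} {K : ℝ} {N : ℕ}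
    (hN : 1 ≤ N) (hE : ∀ x, (N : ℝ) < x → ‖sumError a κ N x‖ ≤ K) {s : ℂ} (hs : 1 < s.re) :
    LSeries a s = ∑ n ∈ Finset.Icc 1 N, a n * (n : ℂ) ^ (-s) + κ * (N : ℂ) ^ (1 - s) / (s - 1)
      + s * tailMellin N (sumError a κ N) s := by
  have hN0 : (0 : ℝ) < N := by exact_mod_cast hN
  have hN1 : (1 : ℝ) ≤ N := by exact_mod_cast hN
  have hs0 : s ≠ 0 := fun h ↦ by simp [h] at hs; linarith
  have hs1 : s - 1 ≠ 0 := fun h ↦ by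
    have := sub_eq_zero.1 h
    simp [this] at hs
  set b : ℕ → ℂ := fun n ↦ if n ≤ N then 0 else a n with hb
  set f : ℕ → ℂ := fun n ↦ if n ≤ N then a n else 0 with hf
  have hbn : ∀ n, ‖b n‖ ≤ 1 := fun n ↦ by
    simp only [hb]; split_ifs <;> simp [ha n]
  have hfn : ∀ n, ‖f n‖ ≤ 1 := fun n ↦ by
    simp only [hf]; split_ifs <;> simp [ha n]
  have hbs := LSeriesSummable_of_bounded_of_one_lt_re (fun n _ ↦ hbn n) hs
  have hfs := LSeriesSummable_of_bounded_of_one_lt_re (fun n _ ↦ hfn n) hs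
  have hab : a = f + b := by
    ext n; simp only [hf, hb, Pi.add_apply]; split_ifs <;> simp
  have h1 : LSeries f s = ∑ n ∈ Finset.Icc 1 N, a n * (n : ℂ) ^ (-s) := by
    rw [LSeries, tsum_eq_sum (s := Finset.Icc 1 N)]
    · refine Finset.sum_congr rfl fun n hn ↦ ?_
      rw [Finset.mem_Icc] at hn
      rw [LSeries.term_of_ne_zero (by omega), hf]
      simp only [hn.2, if_true]
      rw [cpow_neg, div_eq_mul_inv]
    · intro n hn
      rw [Finset.mem_Icc] at hn
      rcases Nat.eq_zero_or_pos n with rfl | h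
      · simp
      · rw [LSeries.term_of_ne_zero (by omega), hf]
        simp only [show ¬ n ≤ N by omega, if_false, zero_div]
  have hsum : ∀ n, ∑ k ∈ Finset.Icc 1 n, b k = ∑ k ∈ Finset.Ioc N n, a k := by
    intro n
    rw [← Finset.sum_subset (s₁ := Finset.Ioc N n)]
    · refine Finset.sum_congr rfl fun k hk ↦ ?_
      rw [Finset.mem_Ioc] at hk
      simp only [hb, show ¬ k ≤ N by omega, if_false]
    · intro k hk
      rw [Finset.mem_Ioc] at hk
      rw [Finset.mem_Icc]; omega
    · intro k hk hk'
      rw [Finset.mem_Icc] at hk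
      rw [Finset.mem_Ioc] at hk'
      simp only [hb, show k ≤ N by omega, if_true]
  have h2 : LSeries b s = s * ∫ t in Ioi (1 : ℝ),
      (∑ k ∈ Finset.Ioc N ⌊t⌋₊, a k) * (t : ℂ) ^ (-(s + 1)) := by
    have hO : (fun n ↦ ∑ k ∈ Finset.Icc 1 n, ‖b k‖) =O[atTop] fun n ↦ (n : ℝ) ^ (1 : ℝ) := by
      refine IsBigO.of_bound 1 (Eventually.of_forall fun n ↦ ?_)
      rw [Real.rpow_one, one_mul, Real.norm_of_nonneg (Finset.sum_nonneg fun _ _ ↦ norm_nonneg _)]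
      calc ∑ k ∈ Finset.Icc 1 n, ‖b k‖ ≤ ∑ k ∈ Finset.Icc 1 n, (1 : ℝ) :=
            Finset.sum_le_sum fun k _ ↦ hbn k
        _ ≤ ‖(n : ℝ)‖ := by simp
    rw [LSeries_eq_mul_integral' b zero_le_one hs hO]
    simp_rw [hsum]
  have h3 : ∫ t in Ioi (1 : ℝ), (∑ k ∈ Finset.Ioc N ⌊t⌋₊, a k) * (t : ℂ) ^ (-(s + 1)) =
      ∫ t in Ioi (N : ℝ), (∑ k ∈ Finset.Ioc N ⌊t⌋₊, a k) * (t : ℂ) ^ (-(s + 1)) := by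
    refine setIntegral_eq_of_subset_of_forall_sdiff_eq_zero measurableSet_Ioi
      (Ioi_subset_Ioi hN1) fun x hx ↦ ?_
    have hx2 : x ≤ N := by simpa using hx.2
    have : ⌊x⌋₊ ≤ N := Nat.floor_le_of_le hx2
    rw [Finset.Ioc_eq_empty (by omega), Finset.sum_empty, zero_mul]
  have hsre : 0 < s.re := by linarith
  have hi1 := integrableOn_tailMellin hN (measurable_sumError a κ N) hE hsre
  have hi2 : IntegrableOn (fun x : ℝ ↦ κ * (x : ℂ) ^ (-s)) (Ioi (N : ℝ)) :=
    (integrableOn_Ioi_cpow_of_lt (by simp; linarith) hN0).const_mul _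
  have hi3 : IntegrableOn (fun x : ℝ ↦ κ * N * (x : ℂ) ^ (-(s + 1))) (Ioi (N : ℝ)) :=
    (integrableOn_Ioi_cpow_of_lt (by simp; linarith) hN0).const_mul _
  have h4 : ∫ t in Ioi (N : ℝ), (∑ k ∈ Finset.Ioc N ⌊t⌋₊, a k) * (t : ℂ) ^ (-(s + 1)) =
      tailMellin N (sumError a κ N) s +
        ((∫ x in Ioi (N : ℝ), κ * (x : ℂ) ^ (-s)) -
          ∫ x in Ioi (N : ℝ), κ * N * (x : ℂ) ^ (-(s + 1)))
      := by
    rw [tailMellin, ← integral_sub hi2 hi3, ← integral_add hi1 (by exact hi2.sub hi3)]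
    refine setIntegral_congr_fun measurableSet_Ioi fun x hx ↦ ?_
    have hx0 : (x : ℂ) ≠ 0 := by exact_mod_cast (hN0.trans hx).ne'
    have : (x : ℂ) ^ (-s) = x * (x : ℂ) ^ (-(s + 1)) := by
      rw [show -s = 1 + (-(s + 1)) by ring, cpow_add _ _ hx0, cpow_one]
    simp only [sumError, this]
    ring
  have hNc : (N : ℂ) ≠ 0 := by exact_mod_cast hN0.ne'
  have hpow : (N : ℂ) ^ (1 - s) = N * (N : ℂ) ^ (-s) := by
    rw [sub_eq_add_neg, cpow_add _ _ hNc, cpow_one]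
  rw [hab, LSeries_add hfs hbs, ← hab, h1, h2, h3, h4, integral_const_mul, integral_const_mul,
    integral_Ioi_cpow_of_lt (by simp; linarith) hN0,
    integral_Ioi_cpow_of_lt (by simp; linarith) hN0]
  have e1 : -s + 1 = 1 - s := by ring
  have e2 : -(s + 1) + 1 = -s := by ring
  rw [e1, e2]
  push_cast
  rw [hpow]
  have e3 : (1 - s) ≠ 0 := fun h ↦ hs1 (by linear_combination -h)
  have e4 : (1 - s) = -(s - 1) := by ring
  rw [e4]
  field_simp
  ring

/-- Continuation to the right half plane of the truncated representation of an `L`-series. -/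
lemma continuation_eq_truncation {a : ℕ → ℂ} (ha : ∀ n, ‖a n‖ ≤ 1) {κ : ℂ} {K : ℝ} (hK : 0 ≤ K)
    {N : ℕ} (hN : 1 ≤ N) (hE : ∀ x, (N : ℝ) < x → ‖sumError a κ N x‖ ≤ K) {G : ℂ → ℂ}
    (hG : DifferentiableOn ℂ G {s | 0 < s.re})
    (hGL : ∀ s : ℂ, 1 < s.re → G s = (s - 1) * LSeries a s) {s : ℂ} (hs : 0 < s.re) :
    G s = (s - 1) * ∑ n ∈ Finset.Icc 1 N, a n * (n : ℂ) ^ (-s) + κ * (N : ℂ) ^ (1 - s)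
      + (s - 1) * (s * tailMellin N (sumError a κ N) s) := by
  have hopen : IsOpen {s : ℂ | 0 < s.re} := isOpen_lt continuous_const continuous_re
  have hNc : (N : ℂ) ≠ 0 := by exact_mod_cast (show N ≠ 0 by omega)
  set R : ℂ → ℂ := fun s ↦ (s - 1) * ∑ n ∈ Finset.Icc 1 N, a n * (n : ℂ) ^ (-s)
    + κ * (N : ℂ) ^ (1 - s) + (s - 1) * (s * tailMellin N (sumError a κ N) s) with hR
  have hRd : DifferentiableOn ℂ R {s | 0 < s.re} := by
    intro z hz
    have hT := differentiableAt_tailMellin hN hK (measurable_sumError a κ N) hE hz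
    have h1 : DifferentiableAt ℂ (fun s : ℂ ↦ ∑ n ∈ Finset.Icc 1 N, a n * (n : ℂ) ^ (-s)) z := by
      refine DifferentiableAt.fun_sum fun n hn ↦ ?_
      have : (n : ℂ) ≠ 0 := by
        rw [Finset.mem_Icc] at hn
        exact_mod_cast (show n ≠ 0 by omega)
      exact (differentiableAt_id.neg.const_cpow (Or.inl this)).const_mul _
    have h2 : DifferentiableAt ℂ (fun s : ℂ ↦ (N : ℂ) ^ (1 - s)) z :=
      (differentiableAt_id.const_sub 1).const_cpow (Or.inl hNc)
    have h3 : DifferentiableAt ℂ (fun s : ℂ ↦ s - 1) z := by fun_prop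
    exact (((h3.mul h1).add (h2.const_mul κ)).add
      (h3.mul (differentiableAt_id.mul hT))).differentiableWithinAt
  have hconv : IsPreconnected {s : ℂ | 0 < s.re} := (convex_halfSpace_re_gt 0).isPreconnected
  refine (hG.analyticOnNhd hopen).eqOn_of_preconnected_of_eventuallyEq (hRd.analyticOnNhd hopen)
    hconv (z₀ := 2) (by simp) ?_ hs
  have : {s : ℂ | 1 < s.re} ∈ 𝓝 (2 : ℂ) :=
    (isOpen_lt continuous_const continuous_re).mem_nhds (by simp)
  filter_upwards [this] with z hz
  have hz1 : z - 1 ≠ 0 := fun h ↦ by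
    rw [sub_eq_zero.1 h] at hz
    simp at hz
  rw [hGL z hz, LSeries_eq_truncation ha hN hE hz, hR]
  field_simp

end TwistedBV

namespace TwistedBV

open Complex Set Filter Topology MeasureTheory Asymptotics

lemma norm_sum_range_sub_le_of_periodic {a : ℕ → ℂ} {q : ℕ} (hq : 0 < q)
    (hp : ∀ n, a (n + q) = a n) (ha : ∀ n, ‖a n‖ ≤ 1) (n : ℕ) :
    ‖∑ k ∈ Finset.range n, a k - (∑ k ∈ Finset.range q, a k) / q * n‖ ≤ 2 * q := by
  set κ := (∑ k ∈ Finset.range q, a k) / q with hκ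
  have hqc : (q : ℂ) ≠ 0 := by exact_mod_cast hq.ne'
  have hq0 : (0 : ℝ) < q := by exact_mod_cast hq
  have hκ1 : ‖κ‖ ≤ 1 := by
    rw [hκ, norm_div, Complex.norm_natCast, div_le_one hq0]
    calc ‖∑ k ∈ Finset.range q, a k‖ ≤ ∑ k ∈ Finset.range q, ‖a k‖ := norm_sum_le _ _
      _ ≤ ∑ k ∈ Finset.range q, (1 : ℝ) := Finset.sum_le_sum fun k _ ↦ ha k
      _ = q := by simp
  have hstep : ∀ n, ∑ k ∈ Finset.range (n + q), a k
      = ∑ k ∈ Finset.range n, a k + ∑ k ∈ Finset.range q, a k := by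
    intro n
    induction n with
    | zero => simp
    | succ n ih =>
      rw [show n + 1 + q = (n + q) + 1 by ring, Finset.sum_range_succ, ih, Finset.sum_range_succ,
        hp]
      ring
  have hrep : ∀ m r, ∑ k ∈ Finset.range (r + m * q), a k - κ * (r + m * q : ℕ)
      = ∑ k ∈ Finset.range r, a k - κ * r := by
    intro m r
    induction m with
    | zero => simp
    | succ m ih =>
      rw [show r + (m + 1) * q = (r + m * q) + q by ring, hstep, ← ih]
      push_cast
      have : ∑ k ∈ Finset.range q, a k = κ * q := by rw [hκ]; field_simp
      rw [this]; ring
  have hn : n = n % q + n / q * q := by rw [mul_comm]; exact (Nat.mod_add_div n q).symm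
  rw [hn, hrep]
  have hr : ((n % q : ℕ) : ℝ) ≤ q := by exact_mod_cast (Nat.mod_lt n hq).le
  calc ‖∑ k ∈ Finset.range (n % q), a k - κ * (n % q : ℕ)‖
      ≤ ‖∑ k ∈ Finset.range (n % q), a k‖ + ‖κ * (n % q : ℕ)‖ := norm_sub_le _ _
    _ ≤ (n % q : ℕ) + 1 * (n % q : ℕ) := by
        gcongr
        · calc ‖∑ k ∈ Finset.range (n % q), a k‖ ≤ ∑ k ∈ Finset.range (n % q), ‖a k‖ :=
              norm_sum_le _ _
            _ ≤ ∑ k ∈ Finset.range (n % q), (1 : ℝ) := Finset.sum_le_sum fun k _ ↦ ha k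
            _ = (n % q : ℕ) := by simp
        · rw [norm_mul, Complex.norm_natCast]; gcongr
    _ ≤ 2 * q := by linarith

lemma norm_mean_le {a : ℕ → ℂ} {q : ℕ} (hq : 0 < q) (ha : ∀ n, ‖a n‖ ≤ 1) :
    ‖(∑ k ∈ Finset.range q, a k) / q‖ ≤ 1 := by
  have hq0 : (0 : ℝ) < q := by exact_mod_cast hq
  rw [norm_div, Complex.norm_natCast, div_le_one hq0]
  calc ‖∑ k ∈ Finset.range q, a k‖ ≤ ∑ k ∈ Finset.range q, ‖a k‖ := norm_sum_le _ _
    _ ≤ ∑ k ∈ Finset.range q, (1 : ℝ) := Finset.sum_le_sum fun k _ ↦ ha k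
    _ = q := by simp

lemma norm_sumError_le_of_periodic {a : ℕ → ℂ} {q : ℕ} (hq : 0 < q)
    (hp : ∀ n, a (n + q) = a n) (ha : ∀ n, ‖a n‖ ≤ 1) (N : ℕ) (x : ℝ) (hx : (N : ℝ) < x) :
    ‖sumError a ((∑ k ∈ Finset.range q, a k) / q) N x‖ ≤ 5 * q := by
  have hq1 : (1 : ℝ) ≤ q := by exact_mod_cast hq
  have hκ := norm_mean_le hq ha
  have hB := norm_sum_range_sub_le_of_periodic hq hp ha
  set κ := (∑ k ∈ Finset.range q, a k) / q
  have hx0 : 0 ≤ x := (Nat.cast_nonneg N).trans hx.le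
  have hNx : N ≤ ⌊x⌋₊ := Nat.le_floor hx.le
  have hfl : |(⌊x⌋₊ : ℝ) - x| ≤ 1 := by
    rw [abs_le]
    constructor <;> linarith [Nat.floor_le hx0, Nat.lt_floor_add_one x]
  have hdec : sumError a κ N x
      = (∑ k ∈ Finset.range (⌊x⌋₊ + 1), a k - κ * (⌊x⌋₊ + 1 : ℕ))
        - (∑ k ∈ Finset.range (N + 1), a k - κ * (N + 1 : ℕ)) + κ * ((⌊x⌋₊ : ℝ) - x : ℝ) := by
    have : ∑ k ∈ Finset.Ioc N ⌊x⌋₊, a k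
        = ∑ k ∈ Finset.range (⌊x⌋₊ + 1), a k - ∑ k ∈ Finset.range (N + 1), a k := by
      rw [← Finset.sum_Ico_eq_sub _ (by omega)]
      congr 1
      ext k; simp only [Finset.mem_Ioc, Finset.mem_Ico]; omega
    rw [sumError, this]
    push_cast
    ring
  rw [hdec]
  refine (norm_add_le _ _).trans ?_
  have h1 := (norm_sub_le (∑ k ∈ Finset.range (⌊x⌋₊ + 1), a k - κ * (⌊x⌋₊ + 1 : ℕ))
    (∑ k ∈ Finset.range (N + 1), a k - κ * (N + 1 : ℕ)))
  have h2 : ‖κ * ((⌊x⌋₊ : ℝ) - x : ℝ)‖ ≤ 1 * 1 := by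
    rw [norm_mul]
    gcongr
    rwa [Complex.norm_real]
  linarith [hB (⌊x⌋₊ + 1), hB (N + 1)]

lemma sum_rpow_le {ε : ℝ} (hε : 0 ≤ ε) {σ : ℝ} (hσ : 1 - ε ≤ σ) (N : ℕ) :
    ∑ n ∈ Finset.Icc 1 N, (n : ℝ) ^ (-σ) ≤ (N : ℝ) ^ ε * (1 + Real.log N) := by
  have h := harmonic_le_one_add_log N
  rw [harmonic_eq_sum_Icc] at h
  push_cast at h
  calc ∑ n ∈ Finset.Icc 1 N, (n : ℝ) ^ (-σ) ≤ ∑ n ∈ Finset.Icc 1 N, (N : ℝ) ^ ε * (n : ℝ)⁻¹ := by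
        refine Finset.sum_le_sum fun n hn ↦ ?_
        rw [Finset.mem_Icc] at hn
        have h1 : (1 : ℝ) ≤ n := by exact_mod_cast hn.1
        have h2 : (n : ℝ) ≤ N := by exact_mod_cast hn.2
        calc (n : ℝ) ^ (-σ) ≤ (n : ℝ) ^ (ε - 1) :=
              Real.rpow_le_rpow_of_exponent_le h1 (by linarith)
          _ = (n : ℝ) ^ ε * (n : ℝ)⁻¹ := by
              rw [Real.rpow_sub_one (by positivity), div_eq_mul_inv]
          _ ≤ (N : ℝ) ^ ε * (n : ℝ)⁻¹ := by gcongr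
    _ = (N : ℝ) ^ ε * ∑ n ∈ Finset.Icc 1 N, (n : ℝ)⁻¹ := by rw [Finset.mul_sum]
    _ ≤ _ := by gcongr

/-- Bound for the continuation `G(s) = (s-1)L(s)` of an `L`-series with bounded
summatory error term. -/
lemma norm_continuation_le {a : ℕ → ℂ} (ha : ∀ n, ‖a n‖ ≤ 1) {κ : ℂ} {K : ℝ} (hK : 0 ≤ K)
    {N : ℕ} (hN : 1 ≤ N) (hE : ∀ x, (N : ℝ) < x → ‖sumError a κ N x‖ ≤ K) {G : ℂ → ℂ}
    (hG : DifferentiableOn ℂ G {s | 0 < s.re})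
    (hGL : ∀ s : ℂ, 1 < s.re → G s = (s - 1) * LSeries a s) {s : ℂ} {ε : ℝ} (hε : 0 ≤ ε)
    (hε2 : ε ≤ 1 / 2) (hs : 1 - ε ≤ s.re) (hNs : ‖s‖ * K ≤ N) :
    ‖G s‖ ≤ (N : ℝ) ^ ε * (‖s - 1‖ * (3 + Real.log N) + ‖κ‖) := by
  have hs0 : 0 < s.re := by linarith
  have hN0 : (0 : ℝ) < N := by exact_mod_cast hN
  have hN1 : (1 : ℝ) ≤ N := by exact_mod_cast hN
  rw [continuation_eq_truncation ha hK hN hE hG hGL hs0]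
  have h1 : ‖∑ n ∈ Finset.Icc 1 N, a n * (n : ℂ) ^ (-s)‖ ≤ (N : ℝ) ^ ε * (1 + Real.log N) := by
    refine (norm_sum_le _ _).trans (le_trans ?_ (sum_rpow_le hε hs N))
    refine Finset.sum_le_sum fun n hn ↦ ?_
    rw [Finset.mem_Icc] at hn
    rw [norm_mul, norm_natCast_cpow_of_pos (by omega), neg_re]
    exact mul_le_of_le_one_left (by positivity) (ha n)
  have h2 : ‖κ * (N : ℂ) ^ (1 - s)‖ ≤ (N : ℝ) ^ ε * ‖κ‖ := by
    rw [norm_mul, norm_natCast_cpow_of_pos hN, mul_comm]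
    gcongr
    simp; linarith
  have h3 : ‖s * tailMellin N (sumError a κ N) s‖ ≤ (N : ℝ) ^ ε * 2 := by
    rw [norm_mul]
    calc ‖s‖ * ‖tailMellin N (sumError a κ N) s‖ ≤ ‖s‖ * (K * (N : ℝ) ^ (-s.re) / s.re) := by
          gcongr
          exact norm_tailMellin_le hN hE hs0
      _ = (‖s‖ * K) * (N : ℝ) ^ (-s.re) / s.re := by ring
      _ ≤ N * (N : ℝ) ^ (ε - 1) / (1 / 2) := by
          gcongr
          · linarith
          · linarith
      _ = (N : ℝ) ^ ε * 2 := by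
          rw [Real.rpow_sub_one hN0.ne']; field_simp
  calc _ ≤ ‖s - 1‖ * ‖∑ n ∈ Finset.Icc 1 N, a n * (n : ℂ) ^ (-s)‖ + ‖κ * (N : ℂ) ^ (1 - s)‖
        + ‖s - 1‖ * ‖s * tailMellin N (sumError a κ N) s‖ := by
        refine (norm_add_le _ _).trans ?_
        rw [norm_mul (s - 1)]
        gcongr
        refine (norm_add_le _ _).trans ?_
        rw [norm_mul (s - 1)]
    _ ≤ ‖s - 1‖ * ((N : ℝ) ^ ε * (1 + Real.log N)) + (N : ℝ) ^ ε * ‖κ‖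
        + ‖s - 1‖ * ((N : ℝ) ^ ε * 2) := by gcongr
    _ = _ := by ring

/-- The function `(s - 1) L(s, χ)`, continued to `s = 1`. -/
noncomputable def LRes {q : ℕ} [NeZero q] (χ : DirichletCharacter ℂ q) : ℂ → ℂ :=
  open scoped Classical in
  if χ = 1 then DirichletCharacter.LFunctionTrivChar₁ q
  else fun s ↦ (s - 1) * DirichletCharacter.LFunction χ s

variable {q : ℕ} [NeZero q]

lemma LRes_of_ne {χ : DirichletCharacter ℂ q} {s : ℂ} (hs : s ≠ 1) :
    LRes χ s = (s - 1) * DirichletCharacter.LFunction χ s := by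
  rw [LRes]
  split_ifs with h
  · subst h
    rw [DirichletCharacter.LFunctionTrivChar₁, Function.update_of_ne hs]
  · rfl

lemma differentiable_LRes (χ : DirichletCharacter ℂ q) : Differentiable ℂ (LRes χ) := by
  rw [LRes]
  split_ifs with h
  · exact DirichletCharacter.differentiable_LFunctionTrivChar₁ q
  · exact (differentiable_id.sub_const 1).mul (DirichletCharacter.differentiable_LFunction h)

lemma LRes_eq_mul_LSeries (χ : DirichletCharacter ℂ q) {s : ℂ} (hs : 1 < s.re) :
    LRes χ s = (s - 1) * LSeries (fun n ↦ χ n) s := by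
  have : s ≠ 1 := fun h ↦ by simp [h] at hs
  rw [LRes_of_ne this, DirichletCharacter.LFunction_eq_LSeries χ hs]

/-- The mean value of a Dirichlet character. -/
noncomputable def charMean (χ : DirichletCharacter ℂ q) : ℂ := (∑ k ∈ Finset.range q, χ k) / q

lemma norm_charMean_le (χ : DirichletCharacter ℂ q) : ‖charMean χ‖ ≤ 1 :=
  norm_mean_le (NeZero.pos q) fun n ↦ χ.norm_le_one n

lemma sum_range_char (χ : DirichletCharacter ℂ q) :
    ∑ k ∈ Finset.range q, χ k = ∑ a : ZMod q, χ a := by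
  refine Finset.sum_bij' (fun k _ ↦ (k : ZMod q)) (fun a _ ↦ a.val) ?_ ?_ ?_ ?_ ?_
  · simp
  · intro a _; simpa using ZMod.val_lt a
  · intro k hk; exact ZMod.val_cast_of_lt (by simpa using hk)
  · intro a _; simp
  · simp

lemma charMean_of_ne_one {χ : DirichletCharacter ℂ q} (hχ : χ ≠ 1) : charMean χ = 0 := by
  rw [charMean, sum_range_char, MulChar.sum_eq_zero_of_ne_one hχ, zero_div]

lemma norm_sumError_char_le (χ : DirichletCharacter ℂ q) (N : ℕ) (x : ℝ) (hx : (N : ℝ) < x) :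
    ‖sumError (fun n ↦ χ n) (charMean χ) N x‖ ≤ 5 * q :=
  norm_sumError_le_of_periodic (NeZero.pos q) (a := fun n ↦ χ n) (fun n ↦ by simp)
    (fun n ↦ χ.norm_le_one n) N x hx

lemma norm_LRes_le (χ : DirichletCharacter ℂ q) {s : ℂ} {ε : ℝ} (hε : 0 < ε) (hε2 : ε ≤ 1 / 2)
    (hs : 1 - ε ≤ s.re) (hs3 : s.re ≤ 4) :
    ‖LRes χ s‖ ≤ (‖s - 1‖ + ‖charMean χ‖) * (44 / ε * (q * (|s.im| + 2)) ^ (2 * ε)) := by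
  have hq1 : (1 : ℝ) ≤ q := by exact_mod_cast NeZero.one_le (n := q)
  set N : ℕ := ⌈‖s‖ * (5 * q)⌉₊ + 1 with hNdef
  have hN : 1 ≤ N := by omega
  have hN1 : (1 : ℝ) ≤ N := by exact_mod_cast hN
  have hNs : ‖s‖ * (5 * q) ≤ N := by
    rw [hNdef]; push_cast; linarith [Nat.le_ceil (‖s‖ * (5 * q))]
  have hnorm : ‖s‖ ≤ |s.im| + 4 := by
    refine (Complex.norm_le_abs_re_add_abs_im s).trans ?_
    rw [abs_of_pos (by linarith)]; linarith
  have hNle : (N : ℝ) ≤ 11 * (q * (|s.im| + 2)) := by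
    have := Nat.ceil_lt_add_one (show 0 ≤ ‖s‖ * (5 * q) by positivity)
    rw [hNdef]; push_cast
    have h2 : ‖s‖ * (5 * q) ≤ (|s.im| + 4) * (5 * q) := by gcongr
    nlinarith [abs_nonneg s.im]
  have hb := norm_continuation_le (a := fun n ↦ χ n) (fun n ↦ χ.norm_le_one n)
    (K := 5 * q) (by positivity) hN (norm_sumError_char_le χ N)
    (differentiable_LRes χ).differentiableOn (fun s hs ↦ LRes_eq_mul_LSeries χ hs) hε.le hε2 hs hNs
  have hlog : Real.log N ≤ (N : ℝ) ^ ε / ε := Real.log_le_rpow_div (by positivity) hε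
  have hNe : 1 ≤ (N : ℝ) ^ ε := Real.one_le_rpow hN1 hε.le
  have h4 : 3 + Real.log N ≤ 4 / ε * (N : ℝ) ^ ε := by
    have h5 : 3 ≤ 3 / ε * (N : ℝ) ^ ε := by
      calc (3 : ℝ) = 3 * 1 := by ring
        _ ≤ 3 / ε * (N : ℝ) ^ ε := by
          gcongr
          rw [le_div_iff₀ hε]; linarith
    calc 3 + Real.log N ≤ 3 / ε * (N : ℝ) ^ ε + (N : ℝ) ^ ε / ε := by gcongr
      _ = _ := by ring
  have h6 : (1 : ℝ) ≤ 4 / ε * (N : ℝ) ^ ε := by linarith [Real.log_nonneg hN1]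
  have h7 : (N : ℝ) ^ (2 * ε) ≤ 11 * (q * (|s.im| + 2)) ^ (2 * ε) := by
    calc (N : ℝ) ^ (2 * ε) ≤ (11 * (q * (|s.im| + 2))) ^ (2 * ε) := by gcongr
      _ = 11 ^ (2 * ε) * (q * (|s.im| + 2)) ^ (2 * ε) := by
          rw [Real.mul_rpow (by norm_num) (by positivity)]
      _ ≤ 11 ^ (1 : ℝ) * (q * (|s.im| + 2)) ^ (2 * ε) := by
          gcongr
          · norm_num
          · linarith
      _ = _ := by rw [Real.rpow_one]
  calc ‖LRes χ s‖ ≤ (N : ℝ) ^ ε * (‖s - 1‖ * (3 + Real.log N) + ‖charMean χ‖) := hb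
    _ ≤ (N : ℝ) ^ ε * (‖s - 1‖ * (4 / ε * (N : ℝ) ^ ε)
        + ‖charMean χ‖ * (4 / ε * (N : ℝ) ^ ε)) := by
        gcongr
        exact le_mul_of_one_le_right (norm_nonneg _) h6
    _ = (‖s - 1‖ + ‖charMean χ‖) * (4 / ε * (N : ℝ) ^ (2 * ε)) := by
        rw [two_mul, Real.rpow_add (by positivity)]; ring
    _ ≤ (‖s - 1‖ + ‖charMean χ‖) * (4 / ε * (11 * (q * (|s.im| + 2)) ^ (2 * ε))) := by gcongr
    _ = _ := by ring

lemma norm_LFunction_le_of_ne {χ : DirichletCharacter ℂ q} {s : ℂ} (h1 : s ≠ 1) {ε : ℝ}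
    (hε : 0 < ε) (hε2 : ε ≤ 1 / 2) (hs : 1 - ε ≤ s.re) (hs3 : s.re ≤ 4) :
    ‖DirichletCharacter.LFunction χ s‖ ≤
      (1 + 1 / ‖s - 1‖) * (44 / ε * (q * (|s.im| + 2)) ^ (2 * ε)) := by
  have h := norm_LRes_le χ hε hε2 hs hs3
  have h0 : 0 < ‖s - 1‖ := norm_pos_iff.2 (sub_ne_zero.2 h1)
  rw [LRes_of_ne h1, norm_mul] at h
  have h2 : ‖s - 1‖ * ‖DirichletCharacter.LFunction χ s‖ ≤
      ‖s - 1‖ * ((1 + 1 / ‖s - 1‖) * (44 / ε * (q * (|s.im| + 2)) ^ (2 * ε))) := by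
    refine h.trans ?_
    rw [← mul_assoc ‖s - 1‖, mul_add ‖s - 1‖, mul_one, mul_one_div_cancel h0.ne']
    gcongr
    exact norm_charMean_le χ
  exact le_of_mul_le_mul_left h2 h0

lemma norm_LFunction_le {χ : DirichletCharacter ℂ q} (hχ : χ ≠ 1) {s : ℂ} {ε : ℝ}
    (hε : 0 < ε) (hε2 : ε ≤ 1 / 2) (hs : 1 - ε ≤ s.re) (hs3 : s.re ≤ 4) :
    ‖DirichletCharacter.LFunction χ s‖ ≤ 44 / ε * (q * (|s.im| + 2)) ^ (2 * ε) := by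
  have key : ∀ s : ℂ, s ≠ 1 → 1 - ε ≤ s.re → s.re ≤ 4 →
      ‖DirichletCharacter.LFunction χ s‖ ≤ 44 / ε * (q * (|s.im| + 2)) ^ (2 * ε) := by
    intro s h1 hs hs3
    have h := norm_LRes_le χ hε hε2 hs hs3
    have h0 : 0 < ‖s - 1‖ := norm_pos_iff.2 (sub_ne_zero.2 h1)
    rw [LRes_of_ne h1, norm_mul, charMean_of_ne_one hχ, norm_zero, add_zero] at h
    exact le_of_mul_le_mul_left h h0
  by_cases h1 : s = 1
  · subst h1
    have hc : Continuous fun u : ℝ ↦ ‖DirichletCharacter.LFunction χ (1 + u * I)‖ :=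
      ((DirichletCharacter.differentiable_LFunction hχ).continuous.comp (by fun_prop)).norm
    have hr : Continuous fun u : ℝ ↦ 44 / ε * (q * (|u| + 2)) ^ (2 * ε) := by
      refine continuous_const.mul (Continuous.rpow_const (by fun_prop) fun u ↦ ?_)
      right; linarith
    have hq := closure_minimal (s := {u : ℝ | u ≠ 0})
      (t := {u : ℝ | ‖DirichletCharacter.LFunction χ (1 + u * I)‖ ≤
        44 / ε * (q * (|u| + 2)) ^ (2 * ε)}) ?_ (isClosed_le hc hr)
    · have := hq (show (0 : ℝ) ∈ closure {u : ℝ | u ≠ 0} by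
        rw [show {u : ℝ | u ≠ 0} = {0}ᶜ from rfl, closure_compl_singleton]; trivial)
      simpa using this
    · intro u hu
      have hne : (1 + u * I : ℂ) ≠ 1 := by
        simpa using hu
      simpa using key (1 + u * I) hne (by simp; linarith) (by norm_num)
  · exact key s h1 hs hs3

end TwistedBV

namespace TwistedBV

open Complex Set Filter Topology MeasureTheory Asymptotics
open scoped ComplexOrder

lemma im_eq_zero_of_real_on_half_line {P : ℂ → ℂ} (hP : Differentiable ℂ P)
    (h : ∀ x : ℝ, 1 < x → (P x).im = 0) (x : ℝ) : (P x).im = 0 := by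
  have hc : Differentiable ℂ (starRingEnd ℂ ∘ P ∘ starRingEnd ℂ) := fun z ↦
    differentiableAt_conj_conj_iff.2 (hP _)
  have hfreq : ∃ᶠ z in 𝓝[≠] (2 : ℂ), P z = (starRingEnd ℂ ∘ P ∘ starRingEnd ℂ) z := by
    have hmap : Tendsto (fun x : ℝ ↦ (x : ℂ)) (𝓝[>] (2 : ℝ)) (𝓝[≠] (2 : ℂ)) := by
      refine tendsto_nhdsWithin_iff.2 ⟨?_, ?_⟩
      · have : Tendsto (fun x : ℝ ↦ (x : ℂ)) (𝓝 2) (𝓝 ((2 : ℝ) : ℂ)) :=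
          continuous_ofReal.tendsto 2
        simpa using this.mono_left nhdsWithin_le_nhds
      · filter_upwards [self_mem_nhdsWithin] with x hx
        have hx' : (2 : ℝ) < x := hx
        simp only [mem_compl_iff, mem_singleton_iff]
        exact_mod_cast hx'.ne'
    refine hmap.frequently (Eventually.frequently ?_)
    filter_upwards [self_mem_nhdsWithin] with x hx
    have hx' : (2 : ℝ) < x := hx
    simp only [Function.comp_apply, conj_ofReal]
    exact (conj_eq_iff_im.2 (h x (by linarith))).symm
  have heq := AnalyticOnNhd.eq_of_frequently_eq
    (hP.differentiableOn.analyticOnNhd isOpen_univ) (hc.differentiableOn.analyticOnNhd isOpen_univ)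
    hfreq
  have := congrFun heq x
  simp only [Function.comp_apply, conj_ofReal] at this
  exact conj_eq_iff_im.1 this.symm

lemma iteratedDeriv_inv_sub_one (k : ℕ) :
    iteratedDeriv k (fun s : ℂ ↦ (s - 1)⁻¹) 2 = (-1) ^ k * k.factorial := by
  have h := congrFun (iter_deriv_inv_linear_sub (𝕜 := ℂ) k 1 1) 2
  rw [iteratedDeriv_eq_iterate]
  norm_num at h
  simpa using h

/-- Quantitative positivity at `1` for a Dirichlet series with nonnegative coefficients and a
simple pole, given nonnegativity at a point to the left of `1`. -/
lemma le_residue_of_nonneg {P : ℂ → ℂ} (hP : Differentiable ℂ P) {f : ℕ → ℂ} (hf : 0 ≤ f)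
    (hf1 : f 1 = 1) (hsum : LSeries.abscissaOfAbsConv f ≤ 1)
    (hPf : ∀ s : ℂ, 1 < s.re → P s = (s - 1) * LSeries f s) {M : ℝ} (hM1 : 1 ≤ M)
    (hM : ∀ s ∈ Metric.closedBall (2 : ℂ) (3 / 2), ‖P s‖ ≤ M) {x : ℝ} (hx : 7 / 8 ≤ x)
    (hx1 : x < 1) (hPx : 0 ≤ (P x).re) :
    (1 - x) / 2 * Real.exp (-1) * (32 * M) ^ (-(4 * (1 - x))) ≤ (P 1).re := by
  have hlt : LSeries.abscissaOfAbsConv f < ((2 : ℝ) : EReal) :=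
    hsum.trans_lt (by exact_mod_cast (show (1 : ℝ) < 2 by norm_num))
  set H := dslope P 1 with hH
  have hHd : Differentiable ℂ H := by
    rw [← differentiableOn_univ] at hP ⊢
    exact (Complex.differentiableOn_dslope univ_mem).2 hP
  have hopen : IsOpen {s : ℂ | 1 < s.re} := isOpen_lt continuous_const continuous_re
  have hHeq : EqOn H (fun s ↦ LSeries f s - P 1 * (s - 1)⁻¹) {s | 1 < s.re} := by
    intro s hs
    have hs1 : s ≠ 1 := fun h ↦ by simp [h] at hs
    have : s - 1 ≠ 0 := sub_ne_zero.2 hs1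
    simp only [hH]
    rw [dslope_of_ne _ hs1, slope_def_field, hPf s hs]
    field_simp
  set b : ℕ → ℝ := fun k ↦ ((-1) ^ k * iteratedDeriv k (LSeries f) 2).re / k.factorial with hb
  have hb0 : ∀ k, 0 ≤ b k := fun k ↦ by
    have := LSeries.iteratedDeriv_alternating hf hlt k
    refine div_nonneg ?_ (by positivity)
    simpa using (Complex.le_def.1 this).1
  have hbz : 1 ≤ b 0 := by
    have hs : LSeriesSummable f 2 := LSeriesSummable_of_abscissaOfAbsConv_lt_re (by simpa using hlt)
    have h1 : LSeries.term f 2 1 ≤ LSeries f 2 :=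
      hs.le_tsum 1 fun n _ ↦ by simpa using LSeries.term_nonneg (hf n) 2
    have := (Complex.le_def.1 h1).1
    simpa [hb, LSeries.term, hf1] using this
  have hder : ∀ k, iteratedDeriv k H 2
      = iteratedDeriv k (LSeries f) 2 - P 1 * ((-1) ^ k * k.factorial) := by
    intro k
    have hcd : ContDiffAt ℂ k (LSeries f) 2 := by
      have : AnalyticAt ℂ (LSeries f) 2 := by
        refine DifferentiableOn.analyticAt (s := {s | 1 < s.re}) ?_ (hopen.mem_nhds (by simp))
        refine (LSeries_differentiableOn f).mono fun s hs ↦ ?_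
        exact hsum.trans_lt (by exact_mod_cast hs)
      exact this.contDiffAt
    have hcd2 : ContDiffAt ℂ k (fun s : ℂ ↦ (s - 1)⁻¹) 2 :=
      (contDiffAt_id.sub contDiffAt_const).inv (by norm_num)
    rw [hHeq.iteratedDeriv_of_isOpen hopen k (by simp),
      iteratedDeriv_fun_sub hcd (contDiffAt_const.mul hcd2), iteratedDeriv_const_mul_field,
      iteratedDeriv_inv_sub_one]
  set h : ℕ → ℝ := fun k ↦ b k - (P 1).re with hh
  have hhre : ∀ k, ((-1) ^ k * iteratedDeriv k H 2).re / k.factorial = h k := by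
    intro k
    have hk : (k.factorial : ℝ) ≠ 0 := by positivity
    have h1 : ((-1) ^ k * iteratedDeriv k H 2 : ℂ)
        = (-1) ^ k * iteratedDeriv k (LSeries f) 2 - P 1 * (k.factorial : ℝ) := by
      rw [hder]
      have : ((-1 : ℂ) ^ k) * (-1) ^ k = 1 := by rw [← mul_pow]; simp
      push_cast
      linear_combination (-P 1 * k.factorial) * this
    rw [h1, sub_re, re_mul_ofReal, sub_div, mul_div_cancel_right₀ _ hk]
  have hHs : ∀ s ∈ Metric.sphere (2 : ℂ) (3 / 2), ‖H s‖ ≤ 4 * M := by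
    intro s hs
    have hs2 : ‖s - 2‖ = 3 / 2 := by simpa [dist_eq_norm] using hs
    have hs3 : 1 / 2 ≤ ‖s - 1‖ := by
      have := norm_sub_norm_le (s - 2) (-1)
      rw [hs2, norm_neg, norm_one, show s - 2 - -1 = s - 1 by ring] at this
      linarith
    have hs1 : s ≠ 1 := fun h ↦ by
      rw [h] at hs3; norm_num at hs3
    simp only [hH]
    rw [dslope_of_ne _ hs1, slope_def_field, norm_div, div_le_iff₀ (by linarith)]
    have h1 := hM s (Metric.sphere_subset_closedBall hs)
    have h2 := hM 1 (by rw [Metric.mem_closedBall, dist_eq_norm]; norm_num)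
    have := norm_sub_le (P s) (P 1)
    nlinarith
  have hhb : ∀ k, |h k| ≤ 4 * M * (2 / 3) ^ k := by
    intro k
    have := Complex.norm_iteratedDeriv_le_of_forall_mem_sphere_norm_le k
      (show (0 : ℝ) < 3 / 2 by norm_num) hHd.diffContOnCl hHs
    rw [← hhre, abs_div, Nat.abs_cast, div_le_iff₀ (by positivity)]
    refine (abs_re_le_norm _).trans ?_
    rw [norm_mul, norm_pow, norm_neg, norm_one, one_pow, one_mul]
    refine this.trans (le_of_eq ?_)
    rw [div_pow, div_pow]
    field_simp
  have hx0 : 0 < 1 - x := by linarith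
  set y : ℝ := 2 - x with hy
  have hy1 : 1 < y := by linarith
  have hy2 : y ≤ 9 / 8 := by linarith
  have hHsum : HasSum (fun k ↦ h k * y ^ k) (H x).re := by
    have h1 := Complex.hasSum_taylorSeries_of_entire hHd 2 (x : ℂ)
    convert! Complex.hasSum_re h1 using 1
    ext k
    have e1 : ((x : ℂ) - 2) = ((-1 : ℝ) * y : ℝ) := by rw [hy]; push_cast; ring
    rw [← hhre, e1, smul_eq_mul, smul_eq_mul]
    have e2 : ((k.factorial : ℂ)⁻¹ * (((-1 : ℝ) * y : ℝ) ^ k * iteratedDeriv k H 2))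
        = (((k.factorial : ℝ)⁻¹ * y ^ k : ℝ) : ℂ) * ((-1) ^ k * iteratedDeriv k H 2) := by
      push_cast
      rw [mul_pow]; ring
    rw [e2, re_ofReal_mul]
    ring
  have hHx : (H x).re ≤ (P 1).re / (1 - x) := by
    have hxne : (x : ℂ) ≠ 1 := by exact_mod_cast hx1.ne
    simp only [hH]
    rw [dslope_of_ne _ hxne, slope_def_field]
    have e1 : (x : ℂ) - 1 = ((-(1 - x) : ℝ) : ℂ) := by push_cast; ring
    rw [e1, div_ofReal_re, div_neg, ← neg_div, sub_re]
    gcongr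
    linarith
  obtain ⟨K, hK1, hK2⟩ : ∃ K : ℕ, 4 * Real.log (32 * M) ≤ K ∧ (K : ℝ) ≤ 4 * Real.log (32 * M) + 1 :=
    ⟨⌈4 * Real.log (32 * M)⌉₊, Nat.le_ceil _,
      (Nat.ceil_lt_add_one (by
        have := Real.log_nonneg (show 1 ≤ 32 * M by linarith)
        linarith)).le⟩
  have hgeom : Summable fun k : ℕ ↦ (3 / 4 : ℝ) ^ k :=
    summable_geometric_of_lt_one (by norm_num) (by norm_num)
  have htail : |∑' k, h (k + K) * y ^ (k + K)| ≤ 1 / 2 := by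
    have hle : ∀ k, |h (k + K) * y ^ (k + K)| ≤ 4 * M * (3 / 4) ^ K * (3 / 4) ^ k := by
      intro k
      rw [abs_mul, abs_of_pos (show 0 < y ^ (k + K) by positivity)]
      calc |h (k + K)| * y ^ (k + K) ≤ 4 * M * (2 / 3) ^ (k + K) * (9 / 8) ^ (k + K) := by
            gcongr
            exact hhb _
        _ = 4 * M * ((2 / 3) * (9 / 8)) ^ (k + K) := by rw [mul_pow]; ring
        _ = _ := by rw [pow_add]; norm_num; ring
    have h1 : |∑' k, h (k + K) * y ^ (k + K)| ≤ ∑' k : ℕ, 4 * M * (3 / 4) ^ K * (3 / 4) ^ k := by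
      rw [← Real.norm_eq_abs]
      exact tsum_of_norm_bounded (hgeom.mul_left _).hasSum fun k ↦ by
        rw [Real.norm_eq_abs]; exact hle k
    rw [tsum_mul_left, tsum_geometric_of_lt_one (by norm_num) (by norm_num)] at h1
    have h2 : (3 / 4 : ℝ) ^ K ≤ (32 * M)⁻¹ := by
      have hl : Real.log (3 / 4) ≤ -(1 / 4) := by
        have := Real.log_le_sub_one_of_pos (show (0 : ℝ) < 3 / 4 by norm_num)
        linarith
      have hpos : 0 < 32 * M := by linarith
      rw [← Real.log_le_log_iff (by positivity) (by positivity), Real.log_pow, Real.log_inv]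
      have hK0 : (0 : ℝ) ≤ K := Nat.cast_nonneg K
      nlinarith
    have hMpos : 0 < M := by linarith
    calc _ ≤ 4 * M * (3 / 4) ^ K * (1 - 3 / 4)⁻¹ := h1
      _ ≤ 4 * M * (32 * M)⁻¹ * (1 - 3 / 4)⁻¹ := by
          gcongr
      _ = 1 / 2 := by field_simp; norm_num
  have hK0 : 1 ≤ K := by
    have : 0 < Real.log (32 * M) := Real.log_pos (by linarith)
    have : (0 : ℝ) < K := by linarith
    exact_mod_cast this
  have hhead : 1 - (P 1).re * ((y ^ K - 1) / (y - 1)) ≤ ∑ k ∈ Finset.range K, h k * y ^ k := by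
    have e1 : ∑ k ∈ Finset.range K, h k * y ^ k
        = ∑ k ∈ Finset.range K, b k * y ^ k - (P 1).re * ((y ^ K - 1) / (y - 1)) := by
      rw [← geom_sum_eq hy1.ne', Finset.mul_sum, ← Finset.sum_sub_distrib]
      refine Finset.sum_congr rfl fun k _ ↦ ?_
      simp only [hh]; ring
    rw [e1]
    have := Finset.single_le_sum (f := fun k ↦ b k * y ^ k) (s := Finset.range K)
      (fun k _ ↦ mul_nonneg (hb0 k) (by positivity)) (Finset.mem_range.2 hK0)
    simp only [pow_zero, mul_one] at this
    linarith
  have hsplit := hHsum.summable.sum_add_tsum_nat_add K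
  rw [hHsum.tsum_eq] at hsplit
  have hmain : 1 / 2 ≤ (P 1).re * y ^ K / (1 - x) := by
    have e2 : y - 1 = 1 - x := by rw [hy]; ring
    rw [e2] at hhead
    have e3 : (P 1).re * y ^ K / (1 - x)
        = (P 1).re / (1 - x) + (P 1).re * ((y ^ K - 1) / (1 - x)) := by ring
    rw [e3]
    linarith [(abs_le.1 htail).1]
  have hyK : y ^ K ≤ Real.exp 1 * (32 * M) ^ (4 * (1 - x)) := by
    have h1 : y ≤ Real.exp (1 - x) := by
      have := Real.add_one_le_exp (1 - x)
      linarith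
    calc y ^ K ≤ Real.exp (1 - x) ^ K := by gcongr
      _ = Real.exp (K * (1 - x)) := by rw [← Real.exp_nat_mul]
      _ ≤ Real.exp (1 + Real.log (32 * M) * (4 * (1 - x))) := by
          gcongr
          nlinarith
      _ = _ := by
          rw [Real.exp_add, Real.rpow_def_of_pos (by linarith)]
  have hPpos : 0 ≤ (P 1).re := by
    by_contra hneg
    push Not at hneg
    have : (P 1).re * y ^ K / (1 - x) ≤ 0 :=
      div_nonpos_of_nonpos_of_nonneg (mul_nonpos_of_nonpos_of_nonneg hneg.le (by positivity)) hx0.le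
    linarith
  rw [le_div_iff₀ hx0] at hmain
  have hMp : 0 < (32 * M) ^ (4 * (1 - x)) := Real.rpow_pos_of_pos (by linarith) _
  have h5 : (1 - x) / 2 ≤ (P 1).re * (Real.exp 1 * (32 * M) ^ (4 * (1 - x))) := by
    calc (1 - x) / 2 = 1 / 2 * (1 - x) := by ring
      _ ≤ (P 1).re * y ^ K := hmain
      _ ≤ _ := by gcongr
  rw [Real.exp_neg, Real.rpow_neg (by linarith)]
  calc (1 - x) / 2 * (Real.exp 1)⁻¹ * ((32 * M) ^ (4 * (1 - x)))⁻¹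
      ≤ (P 1).re * (Real.exp 1 * (32 * M) ^ (4 * (1 - x))) * (Real.exp 1)⁻¹
        * ((32 * M) ^ (4 * (1 - x)))⁻¹ := by gcongr
    _ = (P 1).re := by
        have := Real.exp_pos 1
        field_simp

end TwistedBV

namespace TwistedBV

open Complex Set Filter Topology MeasureTheory Asymptotics
open scoped ComplexOrder ArithmeticFunction.vonMangoldt

lemma nonneg_of_log_mul_eq {f g : ArithmeticFunction ℂ}
    (h : ∀ n : ℕ, (Real.log n : ℂ) * f n = (f * g) n) (hg : ∀ n, 0 ≤ g n) (hg1 : g 1 = 0)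
    (hf1 : 0 ≤ f 1) (n : ℕ) : 0 ≤ f n := by
  induction n using Nat.strong_induction_on with
  | _ n ih =>
    rcases Nat.lt_or_ge n 2 with hn | hn
    · interval_cases n
      · simp
      · exact hf1
    · have hlog : 0 < Real.log n := Real.log_pos (by exact_mod_cast hn)
      have hnn : 0 ≤ (f * g) n := by
        rw [ArithmeticFunction.mul_apply]
        refine Finset.sum_nonneg fun d hd ↦ ?_
        obtain ⟨hd1, hd2⟩ := Nat.mem_divisorsAntidiagonal.1 hd
        rcases eq_or_ne d.2 1 with h1 | h1
        · rw [h1, hg1, mul_zero]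
        · refine mul_nonneg (ih _ ?_) (hg _)
          have h20 : d.2 ≠ 0 := fun h0 ↦ by simp [h0] at hd1; omega
          have h10 : d.1 ≠ 0 := fun h0 ↦ by simp [h0] at hd1; omega
          rw [← hd1]
          exact lt_mul_of_one_lt_right (by omega) (by omega)
      rw [← h n] at hnn
      have : f n = ((Real.log n)⁻¹ : ℝ) * ((Real.log n : ℂ) * f n) := by
        have : (Real.log n : ℂ) ≠ 0 := by exact_mod_cast hlog.ne'
        rw [ofReal_inv, inv_mul_cancel_left₀ this]
      rw [this]
      exact mul_nonneg (by exact_mod_cast (inv_pos.2 hlog).le) hnn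

lemma log_mul_mul {f₁ f₂ g₁ g₂ : ArithmeticFunction ℂ}
    (h₁ : ∀ n : ℕ, (Real.log n : ℂ) * f₁ n = (f₁ * g₁) n)
    (h₂ : ∀ n : ℕ, (Real.log n : ℂ) * f₂ n = (f₂ * g₂) n) (n : ℕ) :
    (Real.log n : ℂ) * (f₁ * f₂) n = ((f₁ * f₂) * (g₁ + g₂)) n := by
  have e : (f₁ * f₂) * (g₁ + g₂) = (f₁ * g₁) * f₂ + f₁ * (f₂ * g₂) := by ring
  rw [e, ArithmeticFunction.add_apply, ArithmeticFunction.mul_apply,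
    ArithmeticFunction.mul_apply (f := f₁ * g₁), ArithmeticFunction.mul_apply (f := f₁),
    Finset.mul_sum, ← Finset.sum_add_distrib]
  refine Finset.sum_congr rfl fun d hd ↦ ?_
  obtain ⟨hd1, hd2⟩ := Nat.mem_divisorsAntidiagonal.1 hd
  have h20 : d.2 ≠ 0 := fun h0 ↦ by simp [h0] at hd1; omega
  have h10 : d.1 ≠ 0 := fun h0 ↦ by simp [h0] at hd1; omega
  rw [← h₁, ← h₂, ← hd1, Nat.cast_mul, Real.log_mul (by exact_mod_cast h10) (by exact_mod_cast h20)]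
  push_cast
  ring

/-- The arithmetic function of a multiplicative map twisted by `Λ` is its logarithmic derivation. -/
lemma log_mul_toArithmeticFunction {u : ℕ → ℂ} (hu : ∀ m n, u (m * n) = u m * u n) (n : ℕ) :
    (Real.log n : ℂ) * toArithmeticFunction u n
      = (toArithmeticFunction u * toArithmeticFunction (fun n ↦ u n * (Λ n : ℂ))) n := by
  rw [ArithmeticFunction.mul_apply]
  rcases eq_or_ne n 0 with rfl | hn
  · simp
  have : ∀ d ∈ n.divisorsAntidiagonal, toArithmeticFunction u d.1 *
      toArithmeticFunction (fun n ↦ u n * (Λ n : ℂ)) d.2 = u n * (Λ d.2 : ℂ) := by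
    intro d hd
    obtain ⟨hd1, hd2⟩ := Nat.mem_divisorsAntidiagonal.1 hd
    have h20 : d.2 ≠ 0 := fun h0 ↦ by simp [h0] at hd1; omega
    have h10 : d.1 ≠ 0 := fun h0 ↦ by simp [h0] at hd1; omega
    simp only [toArithmeticFunction, ArithmeticFunction.coe_mk, h20, h10, if_false]
    rw [← hd1, hu]; ring
  rw [Finset.sum_congr rfl this, ← Finset.mul_sum,
    Nat.sum_divisorsAntidiagonal' (f := fun _ b ↦ (Λ b : ℂ)), ← ofReal_sum,
    ArithmeticFunction.vonMangoldt_sum]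
  simp only [toArithmeticFunction, ArithmeticFunction.coe_mk, hn, if_false]
  ring

lemma toArithmeticFunction_apply {u : ℕ → ℂ} {n : ℕ} (hn : n ≠ 0) :
    toArithmeticFunction u n = u n := by
  simp [toArithmeticFunction, hn]

lemma LSeries_toArithmeticFunction (u : ℕ → ℂ) (s : ℂ) :
    LSeries (toArithmeticFunction u) s = LSeries u s :=
  LSeries_congr (fun hn ↦ toArithmeticFunction_apply hn) s

lemma LSeriesSummable_toArithmeticFunction {u : ℕ → ℂ} (hu : ∀ n, ‖u n‖ ≤ 1) {s : ℂ}
    (hs : 1 < s.re) : LSeriesSummable (toArithmeticFunction u) s :=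
  (LSeriesSummable_congr s fun hn ↦ toArithmeticFunction_apply hn).2
    (LSeriesSummable_of_bounded_of_one_lt_re (fun n _ ↦ hu n) hs)

lemma quadratic_values {q : ℕ} {χ : DirichletCharacter ℂ q} (hχ : χ ^ 2 = 1) (n : ℕ) :
    χ n = 0 ∨ χ n = 1 ∨ χ n = -1 :=
  MulChar.isQuadratic_iff_sq_eq_one.mpr hχ n

lemma one_add_quadratic_nonneg {q : ℕ} {χ : DirichletCharacter ℂ q} (hχ : χ ^ 2 = 1) (n : ℕ) :
    0 ≤ 1 + χ n := by
  rcases quadratic_values hχ n with h | h | h <;> rw [h] <;> norm_num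

/-- Coefficients of `ζ(s) L(s, χ)`. -/
noncomputable def coeffTwo {q : ℕ} (χ : DirichletCharacter ℂ q) : ArithmeticFunction ℂ :=
  toArithmeticFunction (fun _ ↦ 1) * toArithmeticFunction (fun n ↦ χ n)

/-- Coefficients of `ζ(s) L(s, χ₁) L(s, χ₂) L(s, χ₁χ₂)`. -/
noncomputable def coeffFour {q₁ q₂ : ℕ} (χ₁ : DirichletCharacter ℂ q₁)
    (χ₂ : DirichletCharacter ℂ q₂) : ArithmeticFunction ℂ :=
  coeffTwo χ₁ * (toArithmeticFunction (fun n ↦ χ₂ n) * toArithmeticFunction (fun n ↦ χ₁ n * χ₂ n))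

lemma coeffTwo_one {q : ℕ} (χ : DirichletCharacter ℂ q) : coeffTwo χ 1 = 1 := by
  rw [coeffTwo, ArithmeticFunction.mul_apply]
  simp [toArithmeticFunction_apply]

lemma coeffFour_one {q₁ q₂ : ℕ} (χ₁ : DirichletCharacter ℂ q₁) (χ₂ : DirichletCharacter ℂ q₂) :
    coeffFour χ₁ χ₂ 1 = 1 := by
  rw [coeffFour, ArithmeticFunction.mul_apply]
  simp only [Nat.divisorsAntidiagonal_one, Finset.sum_singleton, coeffTwo_one,
    ArithmeticFunction.mul_apply]
  simp [toArithmeticFunction_apply]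

lemma log_mul_coeffTwo {q : ℕ} (χ : DirichletCharacter ℂ q) (n : ℕ) :
    (Real.log n : ℂ) * coeffTwo χ n = (coeffTwo χ *
      (toArithmeticFunction (fun n ↦ 1 * (Λ n : ℂ))
        + toArithmeticFunction (fun n ↦ χ n * (Λ n : ℂ)))) n :=
  log_mul_mul (log_mul_toArithmeticFunction (u := fun _ ↦ 1) (by simp))
    (log_mul_toArithmeticFunction (u := fun n ↦ χ n) (by simp)) n

lemma coeffTwo_nonneg {q : ℕ} {χ : DirichletCharacter ℂ q} (hχ : χ ^ 2 = 1) (n : ℕ) :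
    0 ≤ coeffTwo χ n := by
  refine nonneg_of_log_mul_eq (log_mul_coeffTwo χ) (fun n ↦ ?_)
    (by simp [toArithmeticFunction_apply])
    (by rw [coeffTwo_one]; exact zero_le_one) n
  rcases eq_or_ne n 0 with rfl | hn
  · simp
  rw [ArithmeticFunction.add_apply, toArithmeticFunction_apply hn, toArithmeticFunction_apply hn,
    ← add_mul]
  exact mul_nonneg (one_add_quadratic_nonneg hχ n)
    (by exact_mod_cast ArithmeticFunction.vonMangoldt_nonneg)

lemma coeffFour_nonneg {q₁ q₂ : ℕ} {χ₁ : DirichletCharacter ℂ q₁} {χ₂ : DirichletCharacter ℂ q₂}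
    (hχ₁ : χ₁ ^ 2 = 1) (hχ₂ : χ₂ ^ 2 = 1) (n : ℕ) : 0 ≤ coeffFour χ₁ χ₂ n := by
  refine nonneg_of_log_mul_eq (log_mul_mul (log_mul_coeffTwo χ₁) (log_mul_mul
    (log_mul_toArithmeticFunction (u := fun n ↦ χ₂ n) (by simp))
    (log_mul_toArithmeticFunction (u := fun n ↦ χ₁ n * χ₂ n)
      (fun m n ↦ by simp; ring)))) (fun n ↦ ?_) (by simp [toArithmeticFunction_apply])
    ((coeffFour_one χ₁ χ₂).symm ▸ zero_le_one) n
  rcases eq_or_ne n 0 with rfl | hn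
  · simp
  simp only [ArithmeticFunction.add_apply, toArithmeticFunction_apply hn]
  have : 1 * (Λ n : ℂ) + χ₁ n * (Λ n : ℂ) + (χ₂ n * (Λ n : ℂ) + χ₁ n * χ₂ n * (Λ n : ℂ))
      = (1 + χ₁ n) * (1 + χ₂ n) * (Λ n : ℂ) := by ring
  rw [this]
  exact mul_nonneg (mul_nonneg (one_add_quadratic_nonneg hχ₁ n) (one_add_quadratic_nonneg hχ₂ n))
    (by exact_mod_cast ArithmeticFunction.vonMangoldt_nonneg)

lemma summable_coeffTwo {q : ℕ} (χ : DirichletCharacter ℂ q) {s : ℂ} (hs : 1 < s.re) :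
    LSeriesSummable (coeffTwo χ) s :=
  ArithmeticFunction.LSeriesSummable_mul
    (LSeriesSummable_toArithmeticFunction (by simp) hs)
    (LSeriesSummable_toArithmeticFunction (fun n ↦ χ.norm_le_one n) hs)

lemma LSeries_coeffTwo {q : ℕ} (χ : DirichletCharacter ℂ q) {s : ℂ} (hs : 1 < s.re) :
    LSeries (coeffTwo χ) s = LSeries (fun _ ↦ 1) s * LSeries (fun n ↦ χ n) s := by
  rw [coeffTwo, ArithmeticFunction.LSeries_mul'
    (LSeriesSummable_toArithmeticFunction (by simp) hs)
    (LSeriesSummable_toArithmeticFunction (fun n ↦ χ.norm_le_one n) hs),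
    LSeries_toArithmeticFunction, LSeries_toArithmeticFunction]

lemma norm_char_mul_le {q₁ q₂ : ℕ} (χ₁ : DirichletCharacter ℂ q₁) (χ₂ : DirichletCharacter ℂ q₂)
    (n : ℕ) : ‖χ₁ n * χ₂ n‖ ≤ 1 := by
  rw [norm_mul]
  exact mul_le_one₀ (χ₁.norm_le_one n) (norm_nonneg _) (χ₂.norm_le_one n)

lemma summable_coeffFour {q₁ q₂ : ℕ} (χ₁ : DirichletCharacter ℂ q₁) (χ₂ : DirichletCharacter ℂ q₂)
    {s : ℂ} (hs : 1 < s.re) : LSeriesSummable (coeffFour χ₁ χ₂) s :=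
  ArithmeticFunction.LSeriesSummable_mul (summable_coeffTwo χ₁ hs)
    (ArithmeticFunction.LSeriesSummable_mul
      (LSeriesSummable_toArithmeticFunction (fun n ↦ χ₂.norm_le_one n) hs)
      (LSeriesSummable_toArithmeticFunction (norm_char_mul_le χ₁ χ₂) hs))

lemma LSeries_coeffFour {q₁ q₂ : ℕ} (χ₁ : DirichletCharacter ℂ q₁) (χ₂ : DirichletCharacter ℂ q₂)
    {s : ℂ} (hs : 1 < s.re) :
    LSeries (coeffFour χ₁ χ₂) s = LSeries (fun _ ↦ 1) s * LSeries (fun n ↦ χ₁ n) s *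
      (LSeries (fun n ↦ χ₂ n) s * LSeries (fun n ↦ χ₁ n * χ₂ n) s) := by
  have h1 := LSeriesSummable_toArithmeticFunction (fun n ↦ χ₂.norm_le_one n) hs
  have h2 := LSeriesSummable_toArithmeticFunction (norm_char_mul_le χ₁ χ₂) hs
  rw [coeffFour, ArithmeticFunction.LSeries_mul' (summable_coeffTwo χ₁ hs)
    (ArithmeticFunction.LSeriesSummable_mul h1 h2), LSeries_coeffTwo χ₁ hs,
    ArithmeticFunction.LSeries_mul' h1 h2,
    LSeries_toArithmeticFunction, LSeries_toArithmeticFunction]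

lemma abscissa_le_one_of_summable {f : ℕ → ℂ} (h : ∀ s : ℂ, 1 < s.re → LSeriesSummable f s) :
    LSeries.abscissaOfAbsConv f ≤ 1 := by
  refine LSeries.abscissaOfAbsConv_le_of_forall_lt_LSeriesSummable (x := 1) fun y hy ↦ ?_
  exact h y (by simpa using hy)

end TwistedBV

namespace TwistedBV

open Complex Set Filter Topology MeasureTheory Asymptotics
open scoped ComplexOrder

/-- `(s - 1) ζ(s)` as an entire function. -/
noncomputable def zetaRes : ℂ → ℂ := LRes (1 : DirichletCharacter ℂ 1)

lemma differentiable_zetaRes : Differentiable ℂ zetaRes := differentiable_LRes _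

lemma zetaRes_one : zetaRes 1 = 1 := by
  simp [zetaRes, LRes]

lemma zetaRes_eq {s : ℂ} (hs : 1 < s.re) : zetaRes s = (s - 1) * LSeries (fun _ ↦ 1) s := by
  rw [zetaRes, LRes_eq_mul_LSeries _ hs]
  congr 2
  funext n
  rw [Subsingleton.elim (n : ZMod 1) 1]
  simp

lemma mem_closedBall_two {s : ℂ} (hs : s ∈ Metric.closedBall (2 : ℂ) (3 / 2)) :
    1 / 2 ≤ s.re ∧ s.re ≤ 4 ∧ |s.im| ≤ 3 / 2 ∧ ‖s - 1‖ ≤ 5 / 2 := by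
  rw [Metric.mem_closedBall, dist_eq_norm] at hs
  have h1 := (Complex.abs_re_le_norm (s - 2)).trans hs
  have h2 := (Complex.abs_im_le_norm (s - 2)).trans hs
  simp only [sub_re, re_ofNat, sub_im, im_ofNat, sub_zero] at h1 h2
  rw [abs_le] at h1
  refine ⟨by linarith, by linarith, h2, ?_⟩
  calc ‖s - 1‖ = ‖(s - 2) + 1‖ := by congr 1; ring
    _ ≤ ‖s - 2‖ + ‖(1 : ℂ)‖ := norm_add_le _ _
    _ ≤ 5 / 2 := by rw [norm_one]; linarith

lemma norm_zetaRes_le_of_mem {s : ℂ} (hs : s ∈ Metric.closedBall (2 : ℂ) (3 / 2)) :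
    ‖zetaRes s‖ ≤ 1232 := by
  obtain ⟨h1, h2, h3, h4⟩ := mem_closedBall_two hs
  have h := norm_LRes_le (1 : DirichletCharacter ℂ 1) (ε := 1 / 2) (by norm_num) le_rfl
    (by linarith) h2
  have hm := norm_charMean_le (1 : DirichletCharacter ℂ 1)
  norm_num at h
  refine h.trans ?_
  have : |s.im| + 2 ≤ 7 / 2 := by linarith
  calc _ ≤ (5 / 2 + 1) * (88 * (7 / 2 : ℝ)) := by gcongr
    _ ≤ 1232 := by norm_num

lemma norm_LFunction_le_of_mem {q : ℕ} [NeZero q] {χ : DirichletCharacter ℂ q} (hχ : χ ≠ 1) {s : ℂ}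
    (hs : s ∈ Metric.closedBall (2 : ℂ) (3 / 2)) :
    ‖DirichletCharacter.LFunction χ s‖ ≤ 308 * q := by
  obtain ⟨h1, h2, h3, -⟩ := mem_closedBall_two hs
  have h := norm_LFunction_le hχ (s := s) (ε := 1 / 2) (by norm_num) le_rfl (by linarith) h2
  norm_num at h
  refine h.trans ?_
  have : |s.im| + 2 ≤ 7 / 2 := by linarith
  calc _ ≤ 88 * (q * (7 / 2 : ℝ)) := by gcongr
    _ = 308 * q := by ring

/-- If `(s - 1) ζ(s) L(s, χ)` has no zero on `[x, 1]`, then `L(1, χ)` is not small. -/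
lemma le_norm_LFunction_one_of_no_zero {q : ℕ} [NeZero q] {χ : DirichletCharacter ℂ q}
    (hχ : χ ≠ 1) (hχ2 : χ ^ 2 = 1) {x : ℝ} (hx : 7 / 8 ≤ x) (hx1 : x < 1)
    (hZ : ∀ y : ℝ, x ≤ y → y ≤ 1 → zetaRes y ≠ 0)
    (hL : ∀ y : ℝ, x ≤ y → y < 1 → DirichletCharacter.LFunction χ y ≠ 0) :
    (1 - x) / 2 * Real.exp (-1) * (32 * (1232 * (308 * q))) ^ (-(4 * (1 - x)))
      ≤ ‖DirichletCharacter.LFunction χ 1‖ := by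
  set P : ℂ → ℂ := fun s ↦ zetaRes s * DirichletCharacter.LFunction χ s with hP
  have hPd : Differentiable ℂ P :=
    differentiable_zetaRes.mul (DirichletCharacter.differentiable_LFunction hχ)
  have hPf : ∀ s : ℂ, 1 < s.re → P s = (s - 1) * LSeries (coeffTwo χ) s := fun s hs ↦ by
    rw [hP, LSeries_coeffTwo χ hs]
    simp only
    rw [zetaRes_eq hs, DirichletCharacter.LFunction_eq_LSeries χ hs, mul_assoc]
  have hnn : (0 : ℕ → ℂ) ≤ ⇑(coeffTwo χ) := coeffTwo_nonneg hχ2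
  have habs : LSeries.abscissaOfAbsConv (coeffTwo χ) ≤ 1 :=
    abscissa_le_one_of_summable fun s hs ↦ summable_coeffTwo χ hs
  have hpos : ∀ y : ℝ, 1 < y → 0 < P y := fun y hy ↦ by
    rw [hPf y (by simpa using hy)]
    refine mul_pos (by rw [sub_pos]; exact_mod_cast hy) (LSeries.positive hnn ?_ ?_)
    · rw [coeffTwo_one]; exact zero_lt_one
    · exact habs.trans_lt (by exact_mod_cast hy)
  have him : ∀ y : ℝ, (P y).im = 0 := im_eq_zero_of_real_on_half_line hPd fun y hy ↦
    ((Complex.pos_iff.1 (hpos y hy)).2).symm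
  have hne : ∀ y : ℝ, x ≤ y → P y ≠ 0 := fun y hy ↦ by
    rcases lt_trichotomy y 1 with h | h | h
    · exact mul_ne_zero (hZ y hy h.le) (hL y hy h)
    · subst h
      exact mul_ne_zero (hZ 1 hy le_rfl)
        (by simpa using DirichletCharacter.LFunction_apply_one_ne_zero hχ)
    · exact (hpos y h).ne'
  have hPx : 0 ≤ (P x).re := by
    by_contra! hneg
    have hcont : ContinuousOn (fun y : ℝ ↦ (P y).re) (Icc x 2) :=
      (Complex.continuous_re.comp (hPd.continuous.comp Complex.continuous_ofReal)).continuousOn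
    have h2 : 0 < (P (2 : ℝ)).re := (Complex.pos_iff.1 (hpos 2 (by norm_num))).1
    obtain ⟨y, hy, hy0⟩ := intermediate_value_Icc (by linarith) hcont ⟨hneg.le, h2.le⟩
    exact hne y hy.1 (Complex.ext hy0 (him y))
  have hq : (1 : ℝ) ≤ q := by exact_mod_cast NeZero.one_le
  have key := le_residue_of_nonneg hPd hnn (coeffTwo_one χ) habs hPf
    (M := 1232 * (308 * q)) (by nlinarith) (fun s hs ↦ ?_) hx hx1 hPx
  · refine key.trans ((Complex.re_le_norm _).trans ?_)
    simp [hP, zetaRes_one]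
  · simp only [hP, norm_mul]
    exact mul_le_mul (norm_zetaRes_le_of_mem hs) (norm_LFunction_le_of_mem hχ hs)
      (norm_nonneg _) (by norm_num)

/-- The product of two Dirichlet characters, as a character modulo the product of the moduli. -/
noncomputable def prodChar {q₁ q₂ : ℕ} (χ₁ : DirichletCharacter ℂ q₁)
    (χ₂ : DirichletCharacter ℂ q₂) : DirichletCharacter ℂ (q₁ * q₂) :=
  DirichletCharacter.changeLevel (Nat.dvd_mul_right q₁ q₂) χ₁ *
    DirichletCharacter.changeLevel (Nat.dvd_mul_left q₂ q₁) χ₂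

lemma prodChar_apply {q₁ q₂ : ℕ} (χ₁ : DirichletCharacter ℂ q₁)
    (χ₂ : DirichletCharacter ℂ q₂) (n : ℕ) : prodChar χ₁ χ₂ n = χ₁ n * χ₂ n := by
  by_cases hn : n.Coprime (q₁ * q₂)
  · have hu : IsUnit (n : ZMod (q₁ * q₂)) := (ZMod.isUnit_iff_coprime n _).2 hn
    obtain ⟨u, hu⟩ := hu
    rw [prodChar, MulChar.mul_apply, ← hu, DirichletCharacter.changeLevel_eq_cast_of_dvd,
      DirichletCharacter.changeLevel_eq_cast_of_dvd, hu, ZMod.cast_natCast (Nat.dvd_mul_right _ _),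
      ZMod.cast_natCast (Nat.dvd_mul_left _ _)]
  · have h0 : prodChar χ₁ χ₂ n = 0 :=
      MulChar.map_nonunit _ fun h ↦ hn ((ZMod.isUnit_iff_coprime n _).1 h)
    rw [h0, eq_comm, mul_eq_zero]
    rw [Nat.coprime_mul_iff_right, not_and_or] at hn
    refine hn.imp (fun h ↦ ?_) (fun h ↦ ?_)
    · exact MulChar.map_nonunit _ fun hunit ↦ h ((ZMod.isUnit_iff_coprime n _).1 hunit)
    · exact MulChar.map_nonunit _ fun hunit ↦ h ((ZMod.isUnit_iff_coprime n _).1 hunit)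

/-- If `L(x, χ₁) = 0`, then `L(1, χ₂)` is not small. -/
lemma le_norm_LFunction_one_of_zero {q₁ q₂ : ℕ} [NeZero q₁] [NeZero q₂]
    {χ₁ : DirichletCharacter ℂ q₁} {χ₂ : DirichletCharacter ℂ q₂} (hχ₁ : χ₁ ≠ 1) (hχ₂ : χ₂ ≠ 1)
    (hψ : prodChar χ₁ χ₂ ≠ 1) (h2₁ : χ₁ ^ 2 = 1) (h2₂ : χ₂ ^ 2 = 1) {x : ℝ} (hx : 7 / 8 ≤ x)
    (hx1 : x < 1) (h0 : DirichletCharacter.LFunction χ₁ x = 0) :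
    (1 - x) / 2 * Real.exp (-1) * (32 * (1232 * (308 * q₁) * (308 * q₂ * (308 * (q₁ * q₂)))))
        ^ (-(4 * (1 - x)))
      ≤ ‖DirichletCharacter.LFunction χ₁ 1‖ * (‖DirichletCharacter.LFunction χ₂ 1‖ *
          ‖DirichletCharacter.LFunction (prodChar χ₁ χ₂) 1‖) := by
  set P : ℂ → ℂ := fun s ↦ zetaRes s * DirichletCharacter.LFunction χ₁ s *
    (DirichletCharacter.LFunction χ₂ s * DirichletCharacter.LFunction (prodChar χ₁ χ₂) s) with hP
  have hPd : Differentiable ℂ P :=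
    (differentiable_zetaRes.mul (DirichletCharacter.differentiable_LFunction hχ₁)).mul
      ((DirichletCharacter.differentiable_LFunction hχ₂).mul
        (DirichletCharacter.differentiable_LFunction hψ))
  have hPf : ∀ s : ℂ, 1 < s.re → P s = (s - 1) * LSeries (coeffFour χ₁ χ₂) s := fun s hs ↦ by
    rw [hP, LSeries_coeffFour χ₁ χ₂ hs]
    simp only
    rw [zetaRes_eq hs, DirichletCharacter.LFunction_eq_LSeries χ₁ hs,
      DirichletCharacter.LFunction_eq_LSeries χ₂ hs, DirichletCharacter.LFunction_eq_LSeries _ hs]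
    simp only [prodChar_apply]
    ring
  have hnn : (0 : ℕ → ℂ) ≤ ⇑(coeffFour χ₁ χ₂) := coeffFour_nonneg h2₁ h2₂
  have habs : LSeries.abscissaOfAbsConv (coeffFour χ₁ χ₂) ≤ 1 :=
    abscissa_le_one_of_summable fun s hs ↦ summable_coeffFour χ₁ χ₂ hs
  have hPx : 0 ≤ (P x).re := by simp [hP, h0]
  have hq₁ : (1 : ℝ) ≤ q₁ := by exact_mod_cast NeZero.one_le
  have hq₂ : (1 : ℝ) ≤ q₂ := by exact_mod_cast NeZero.one_le
  have key := le_residue_of_nonneg hPd hnn (coeffFour_one χ₁ χ₂) habs hPf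
    (M := 1232 * (308 * q₁) * (308 * q₂ * (308 * (q₁ * q₂)))) ?_ (fun s hs ↦ ?_) hx hx1 hPx
  · refine key.trans ((Complex.re_le_norm _).trans ?_)
    simp [hP, zetaRes_one]
  · have h12 : (1 : ℝ) ≤ q₁ * q₂ := one_le_mul_of_one_le_of_one_le hq₁ hq₂
    refine one_le_mul_of_one_le_of_one_le ?_ (one_le_mul_of_one_le_of_one_le ?_ ?_) <;> linarith
  · have h3 := norm_LFunction_le_of_mem hψ hs
    push_cast at h3
    simp only [hP, norm_mul]
    have ha := norm_zetaRes_le_of_mem hs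
    have hb := norm_LFunction_le_of_mem hχ₁ hs
    have hc := norm_LFunction_le_of_mem hχ₂ hs
    gcongr

lemma inv_card_add_one_le_prod (S : Finset ℕ) (hS : ∀ i ∈ S, 2 ≤ i) :
    ((S.card : ℝ) + 1)⁻¹ ≤ ∏ i ∈ S, (1 - (i : ℝ)⁻¹) := by
  induction S using Finset.induction_on_max with
  | empty => simp
  | insert a s hmax ih =>
    have ha : a ∉ s := fun h ↦ (hmax a h).false
    rw [Finset.prod_insert ha, Finset.card_insert_of_notMem ha]
    have ih' := ih fun i hi ↦ hS i (Finset.mem_insert_of_mem hi)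
    have hcard : s.card + 2 ≤ a := by
      have hsub : s ⊆ Finset.Ico 2 a := fun i hi ↦
        Finset.mem_Ico.2 ⟨hS i (Finset.mem_insert_of_mem hi), hmax i hi⟩
      have := Finset.card_le_card hsub
      have h2 := hS a (Finset.mem_insert_self _ _)
      rw [Nat.card_Ico] at this
      omega
    have hc : (s.card : ℝ) + 2 ≤ a := by exact_mod_cast hcard
    have h0 : (0 : ℝ) ≤ s.card := by positivity
    have h1 : ((s.card : ℝ) + 1) / (s.card + 2) ≤ 1 - (a : ℝ)⁻¹ := by
      have : (a : ℝ)⁻¹ ≤ ((s.card : ℝ) + 2)⁻¹ := inv_anti₀ (by positivity) hc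
      have e1 : ((s.card : ℝ) + 1) / (s.card + 2) = 1 - ((s.card : ℝ) + 2)⁻¹ := by
        field_simp; ring
      linarith
    calc (((s.card + 1 : ℕ) : ℝ) + 1)⁻¹
        = ((s.card : ℝ) + 1) / (s.card + 2) * ((s.card : ℝ) + 1)⁻¹ := by
          push_cast; field_simp; ring
      _ ≤ _ := by
          apply mul_le_mul h1 ih' (by positivity)
          exact le_trans (by positivity) h1

lemma card_primeFactors_le_log (n : ℕ) : n.primeFactors.card ≤ Nat.log 2 n := by
  rcases eq_or_ne n 0 with rfl | hn
  · simp
  refine Nat.le_log_of_pow_le one_lt_two ?_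
  calc 2 ^ n.primeFactors.card ≤ ∏ p ∈ n.primeFactors, p :=
        Finset.pow_card_le_prod _ _ _ fun p hp ↦ (Nat.prime_of_mem_primeFactors hp).two_le
    _ ≤ n := Nat.le_of_dvd (Nat.pos_of_ne_zero hn) (Nat.prod_primeFactors_dvd n)

lemma inv_log_le_prod_primeFactors (n : ℕ) :
    ((Nat.log 2 n : ℝ) + 1)⁻¹ ≤ ∏ p ∈ n.primeFactors, (1 - (p : ℝ)⁻¹) := by
  refine le_trans (inv_anti₀ (by positivity) ?_) (inv_card_add_one_le_prod _
    fun p hp ↦ (Nat.prime_of_mem_primeFactors hp).two_le)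
  have : (n.primeFactors.card : ℝ) ≤ Nat.log 2 n := by exact_mod_cast card_primeFactors_le_log n
  linarith

lemma le_totient_mul_log (n : ℕ) : (n : ℝ) ≤ n.totient * (Nat.log 2 n + 1) := by
  have h : (n.totient : ℝ) = n * ∏ p ∈ n.primeFactors, (1 - (p : ℝ)⁻¹) := by
    have := congrArg (fun x : ℚ ↦ (x : ℝ)) (Nat.totient_eq_mul_prod_factors n)
    simpa using this
  have := inv_log_le_prod_primeFactors n
  rw [h, mul_assoc]
  have h1 : (1 : ℝ) ≤ (∏ p ∈ n.primeFactors, (1 - (p : ℝ)⁻¹)) * (Nat.log 2 n + 1) := by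
    rwa [inv_le_iff_one_le_mul₀ (by positivity)] at this
  nlinarith [Nat.cast_nonneg (α := ℝ) n]

lemma natLog_add_one_le {n : ℕ} (hn : n ≠ 0) {ε : ℝ} (hε : 0 < ε) :
    (Nat.log 2 n : ℝ) + 1 ≤ (2 / ε + 1) * (n : ℝ) ^ ε := by
  have hn1 : (1 : ℝ) ≤ n := by exact_mod_cast Nat.one_le_iff_ne_zero.2 hn
  have h1 : (Nat.log 2 n : ℝ) ≤ 2 * Real.log n := by
    have h := Real.natLog_le_logb n 2
    rw [Real.logb] at h
    refine h.trans ?_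
    have hl := Real.log_two_gt_d9
    have : 0 ≤ Real.log n := Real.log_nonneg hn1
    rw [div_le_iff₀ (by push_cast; linarith)]
    push_cast
    nlinarith
  have h2 := Real.log_le_rpow_div (by positivity : (0 : ℝ) ≤ n) hε
  have h3 : 1 ≤ (n : ℝ) ^ ε := Real.one_le_rpow hn1 hε.le
  calc (Nat.log 2 n : ℝ) + 1 ≤ 2 * ((n : ℝ) ^ ε / ε) + (n : ℝ) ^ ε := by linarith
    _ = _ := by ring

lemma one_sub_inv_le_norm_euler {q : ℕ} (χ : DirichletCharacter ℂ q) {p : ℕ} (hp : p.Prime) :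
    1 - (p : ℝ)⁻¹ ≤ ‖1 - χ p * (p : ℂ) ^ (-1 : ℂ)‖ ∧
      ‖1 - χ p * (p : ℂ) ^ (-1 : ℂ)‖ ≤ (1 - (p : ℝ)⁻¹)⁻¹ := by
  have hp2 : (2 : ℝ) ≤ p := by exact_mod_cast hp.two_le
  have hn : ‖χ p * (p : ℂ) ^ (-1 : ℂ)‖ ≤ (p : ℝ)⁻¹ := by
    rw [norm_mul, cpow_neg_one, norm_inv, norm_natCast]
    exact mul_le_of_le_one_left (by positivity) (χ.norm_le_one _)
  have hi : (p : ℝ)⁻¹ ≤ 2⁻¹ := inv_anti₀ (by norm_num) hp2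
  constructor
  · have := norm_sub_norm_le (1 : ℂ) (χ p * (p : ℂ) ^ (-1 : ℂ))
    rw [norm_one] at this
    linarith
  · have := norm_sub_le (1 : ℂ) (χ p * (p : ℂ) ^ (-1 : ℂ))
    rw [norm_one] at this
    refine this.trans ?_
    rw [le_inv_comm₀ (by positivity) (by linarith), ← one_div (1 + _), le_div_iff₀ (by positivity)]
    nlinarith [norm_nonneg (χ p * (p : ℂ) ^ (-1 : ℂ)), inv_nonneg.2 (by linarith : (0 : ℝ) ≤ p)]

lemma norm_LFunction_one_le_of_prodChar_eq_one {q₁ q₂ : ℕ} [NeZero q₁] [NeZero q₂]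
    {χ₁ : DirichletCharacter ℂ q₁} {χ₂ : DirichletCharacter ℂ q₂} (hχ₁ : χ₁ ≠ 1) (hχ₂ : χ₂ ≠ 1)
    (hψ : prodChar χ₁ χ₂ = 1) (h2₁ : χ₁ ^ 2 = 1) :
    ‖DirichletCharacter.LFunction χ₁ 1‖
      ≤ ‖DirichletCharacter.LFunction χ₂ 1‖ * ((Nat.log 2 (q₁ * q₂) : ℝ) + 1) ^ 2 := by
  have heq : DirichletCharacter.changeLevel (Nat.dvd_mul_right q₁ q₂) χ₁ =
      DirichletCharacter.changeLevel (Nat.dvd_mul_left q₂ q₁) χ₂ := by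
    rw [prodChar] at hψ
    have h1 : DirichletCharacter.changeLevel (Nat.dvd_mul_right q₁ q₂) χ₁ ^ 2 = 1 := by
      rw [← map_pow, h2₁, map_one]
    rw [eq_inv_of_mul_eq_one_right hψ, eq_inv_iff_mul_eq_one, ← sq, h1]
  have h := congrArg (fun χ ↦ ‖DirichletCharacter.LFunction χ 1‖) heq
  simp only [DirichletCharacter.LFunction_changeLevel _ _ (Or.inl hχ₁ : χ₁ ≠ 1 ∨ (1 : ℂ) ≠ 1),
    DirichletCharacter.LFunction_changeLevel _ _ (Or.inl hχ₂ : χ₂ ≠ 1 ∨ (1 : ℂ) ≠ 1), norm_mul,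
    norm_prod] at h
  set n := q₁ * q₂
  set W := ∏ p ∈ n.primeFactors, (1 - (p : ℝ)⁻¹) with hW
  have hpos : ∀ p ∈ n.primeFactors, (0 : ℝ) < 1 - (p : ℝ)⁻¹ := fun p hp ↦ by
    have hp2 : (2 : ℝ) ≤ p := by exact_mod_cast (Nat.prime_of_mem_primeFactors hp).two_le
    have := inv_anti₀ (by norm_num) hp2
    linarith
  have hW0 : 0 < W := Finset.prod_pos hpos
  have hA : W ≤ ∏ p ∈ n.primeFactors, ‖1 - χ₁ p * (p : ℂ) ^ (-1 : ℂ)‖ :=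
    Finset.prod_le_prod (fun p hp ↦ (hpos p hp).le) fun p hp ↦
      (one_sub_inv_le_norm_euler χ₁ (Nat.prime_of_mem_primeFactors hp)).1
  have hB : ∏ p ∈ n.primeFactors, ‖1 - χ₂ p * (p : ℂ) ^ (-1 : ℂ)‖ ≤ W⁻¹ := by
    rw [hW, ← Finset.prod_inv_distrib]
    exact Finset.prod_le_prod (fun p hp ↦ norm_nonneg _) fun p hp ↦
      (one_sub_inv_le_norm_euler χ₂ (Nat.prime_of_mem_primeFactors hp)).2
  have hlog : W⁻¹ ≤ (Nat.log 2 n : ℝ) + 1 :=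
    inv_le_of_inv_le₀ (by positivity) (inv_log_le_prod_primeFactors n)
  have h1 : ‖DirichletCharacter.LFunction χ₁ 1‖ * W ≤ ‖DirichletCharacter.LFunction χ₂ 1‖ * W⁻¹ :=
    calc _ ≤ _ := mul_le_mul_of_nonneg_left hA (norm_nonneg _)
      _ = _ := h
      _ ≤ _ := mul_le_mul_of_nonneg_left hB (norm_nonneg _)
  calc ‖DirichletCharacter.LFunction χ₁ 1‖
      = ‖DirichletCharacter.LFunction χ₁ 1‖ * W * W⁻¹ := by field_simp
    _ ≤ ‖DirichletCharacter.LFunction χ₂ 1‖ * W⁻¹ * W⁻¹ := by gcongr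
    _ = ‖DirichletCharacter.LFunction χ₂ 1‖ * W⁻¹ ^ 2 := by ring
    _ ≤ _ := by gcongr

/-- **Siegel's theorem**. -/
theorem siegel {ε : ℝ} (hε : 0 < ε) : ∃ c : ℝ, 0 < c ∧ ∀ (q : ℕ) [NeZero q]
    (χ : DirichletCharacter ℂ q), χ ≠ 1 → χ ^ 2 = 1 →
      c * (q : ℝ) ^ (-ε) ≤ ‖DirichletCharacter.LFunction χ 1‖ := by
  obtain ⟨δ₀, hδ₀, hZ⟩ : ∃ δ₀ > 0, ∀ y : ℝ, 1 - δ₀ ≤ y → y ≤ 1 → zetaRes y ≠ 0 := by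
    have hev : ∀ᶠ y : ℝ in 𝓝 1, zetaRes y ≠ 0 := by
      have hc : Continuous fun y : ℝ ↦ zetaRes y :=
        differentiable_zetaRes.continuous.comp Complex.continuous_ofReal
      exact hc.continuousAt.eventually_ne (by simp [zetaRes_one])
    obtain ⟨r, hr, h⟩ := Metric.eventually_nhds_iff.1 hev
    refine ⟨r / 2, by positivity, fun y h1 h2 ↦ h ?_⟩
    rw [Real.dist_eq, abs_lt]
    constructor <;> linarith
  set δ := min δ₀ (min (1 / 8) (ε / 16)) with hδ
  have hδpos : 0 < δ := by positivity
  have hδ1 : δ ≤ δ₀ := min_le_left _ _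
  have hδ2 : δ ≤ 1 / 8 := (min_le_right _ _).trans (min_le_left _ _)
  have hδ3 : δ ≤ ε / 16 := (min_le_right _ _).trans (min_le_right _ _)
  by_cases hA : ∃ (q₁ : ℕ) (_ : NeZero q₁) (χ₁ : DirichletCharacter ℂ q₁) (x : ℝ),
      χ₁ ≠ 1 ∧ χ₁ ^ 2 = 1 ∧ 1 - δ ≤ x ∧ x < 1 ∧ DirichletCharacter.LFunction χ₁ x = 0
  · obtain ⟨q₁, _, χ₁, x, hχ₁, h2₁, hx, hx1, h0⟩ := hA
    have hL₁ : 0 < ‖DirichletCharacter.LFunction χ₁ 1‖ :=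
      norm_pos_iff.2 (DirichletCharacter.LFunction_apply_one_ne_zero hχ₁)
    have hq₁ : (1 : ℝ) ≤ q₁ := by exact_mod_cast NeZero.one_le
    set K : ℝ := 32 * (1232 * (308 * q₁) * (308 * (308 * q₁))) with hK
    have hK0 : 0 < K := by positivity
    set η : ℝ := min (ε / 4) (1 / 2) with hη
    have hη0 : 0 < η := by positivity
    set c₁ := (1 - x) / 2 * Real.exp (-1) * K ^ (-(4 * (1 - x))) /
      (‖DirichletCharacter.LFunction χ₁ 1‖ * (44 / η * (q₁ * 2) ^ (2 * η))) with hc₁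
    have hx1' : 0 < 1 - x := by linarith
    have hc₁0 : 0 < c₁ := by positivity
    set c₂ := ‖DirichletCharacter.LFunction χ₁ 1‖ /
      ((2 / (ε / 2) + 1) * (q₁ : ℝ) ^ (ε / 2)) ^ 2 with hc₂
    have hc₂0 : 0 < c₂ := by positivity
    refine ⟨min c₁ c₂, lt_min hc₁0 hc₂0, fun q _ χ hχ h2 ↦ ?_⟩
    have hq : (1 : ℝ) ≤ q := by exact_mod_cast NeZero.one_le
    have hq0 : (0 : ℝ) < q := by linarith
    by_cases hψ : prodChar χ₁ χ = 1
    · have h := norm_LFunction_one_le_of_prodChar_eq_one hχ₁ hχ hψ h2₁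
      have hl := natLog_add_one_le (n := q₁ * q) (NeZero.ne _) (half_pos hε)
      have hlog0 : (0 : ℝ) < (Nat.log 2 (q₁ * q) : ℝ) + 1 := by positivity
      calc min c₁ c₂ * (q : ℝ) ^ (-ε) ≤ c₂ * (q : ℝ) ^ (-ε) := by
            gcongr; exact min_le_right _ _
        _ = ‖DirichletCharacter.LFunction χ₁ 1‖ /
            ((2 / (ε / 2) + 1) * ((q₁ * q : ℕ) : ℝ) ^ (ε / 2)) ^ 2 := by
            push_cast
            rw [Real.mul_rpow (by positivity) (by positivity), hc₂, Real.rpow_neg hq0.le,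
              show (q : ℝ) ^ ε = ((q : ℝ) ^ (ε / 2)) ^ 2 by
                rw [← Real.rpow_natCast, ← Real.rpow_mul hq0.le]; norm_num]
            field_simp
        _ ≤ ‖DirichletCharacter.LFunction χ₁ 1‖ / ((Nat.log 2 (q₁ * q) : ℝ) + 1) ^ 2 := by
            gcongr
        _ ≤ _ := by rwa [div_le_iff₀ (by positivity)]
    · have h := le_norm_LFunction_one_of_zero hχ₁ hχ hψ h2₁ h2 (by linarith) hx1 h0
      have hb := norm_LFunction_le hψ (s := 1) hη0 (min_le_right _ _) (by simp; linarith)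
        (by norm_num)
      simp only [Nat.cast_mul, one_im, abs_zero, zero_add] at hb
      have hqq : (q : ℝ) ^ (-(ε / 2)) ≤ ((q : ℝ) * q) ^ (-(4 * (1 - x))) := by
        rw [Real.mul_rpow hq0.le hq0.le, ← Real.rpow_add hq0]
        exact Real.rpow_le_rpow_of_exponent_le hq (by linarith)
      have hqη : (q : ℝ) ^ (2 * η) ≤ (q : ℝ) ^ (ε / 2) :=
        Real.rpow_le_rpow_of_exponent_le hq (by have := min_le_left (ε / 4) (1 / 2); linarith)
      have e1 : (32 * (1232 * (308 * (q₁ : ℝ)) * (308 * q * (308 * (q₁ * q)))))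
          ^ (-(4 * (1 - x))) = K ^ (-(4 * (1 - x))) * ((q : ℝ) * q) ^ (-(4 * (1 - x))) := by
        rw [← Real.mul_rpow hK0.le (by positivity), hK]
        congr 1; ring
      have e2 : ((q₁ : ℝ) * q * 2) ^ (2 * η) = (q₁ * 2) ^ (2 * η) * (q : ℝ) ^ (2 * η) := by
        rw [← Real.mul_rpow (by positivity) (by positivity)]; congr 1; ring
      rw [e1] at h
      rw [e2] at hb
      have h' : (1 - x) / 2 * Real.exp (-1) * (K ^ (-(4 * (1 - x))) * (q : ℝ) ^ (-(ε / 2)))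
          ≤ ‖DirichletCharacter.LFunction χ₁ 1‖ * (‖DirichletCharacter.LFunction χ 1‖ *
            (44 / η * ((q₁ * 2) ^ (2 * η) * (q : ℝ) ^ (ε / 2)))) := by
        refine le_trans ?_ (h.trans ?_)
        · gcongr
        · have hb' := hb.trans (b := 44 / η * ((q₁ * 2) ^ (2 * η) * (q : ℝ) ^ (2 * η)))
            (c := 44 / η * ((q₁ * 2) ^ (2 * η) * (q : ℝ) ^ (ε / 2))) (by gcongr)
          gcongr
      calc min c₁ c₂ * (q : ℝ) ^ (-ε) ≤ c₁ * (q : ℝ) ^ (-ε) := by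
            gcongr; exact min_le_left _ _
        _ = (1 - x) / 2 * Real.exp (-1) * (K ^ (-(4 * (1 - x))) * (q : ℝ) ^ (-(ε / 2))) /
            (‖DirichletCharacter.LFunction χ₁ 1‖ *
              (44 / η * ((q₁ * 2) ^ (2 * η) * (q : ℝ) ^ (ε / 2)))) := by
            rw [hc₁, show -ε = -(ε / 2) + -(ε / 2) by ring, Real.rpow_add hq0,
              Real.rpow_neg hq0.le]
            field_simp
        _ ≤ _ := by
            rw [div_le_iff₀ (by positivity)]
            refine h'.trans (le_of_eq ?_)
            ring
  · push Not at hA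
    refine ⟨δ / 2 * Real.exp (-1) * (32 * (1232 * 308)) ^ (-(4 * δ)), by positivity,
      fun q _ χ hχ h2 ↦ ?_⟩
    have hq : (1 : ℝ) ≤ q := by exact_mod_cast NeZero.one_le
    have h := le_norm_LFunction_one_of_no_zero hχ h2 (x := 1 - δ) (by linarith) (by linarith)
      (fun y h1 h2 ↦ hZ y (by linarith) h2)
      (fun y h1 h2' ↦ hA q inferInstance χ y hχ h2 h1 h2')
    refine le_trans ?_ h
    rw [sub_sub_cancel, show (32 * (1232 * (308 * (q : ℝ)))) = (32 * (1232 * 308)) * q by ring,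
      Real.mul_rpow (x := 32 * (1232 * 308)) (by norm_num) (by positivity),
      ← mul_assoc (_ * _)]
    have := Real.rpow_le_rpow_of_exponent_le hq (by linarith : -ε ≤ -(4 * δ))
    gcongr

end TwistedBV

namespace TwistedBV

open Complex Set Filter Topology MeasureTheory Asymptotics

section LowerBound

variable {q : ℕ} [NeZero q] {χ : DirichletCharacter ℂ q}

lemma one_le_conductor (q : ℕ) [NeZero q] (t : ℝ) : 1 ≤ (q : ℝ) * (|t| + 2) := by
  have hq : (1 : ℝ) ≤ q := by exact_mod_cast NeZero.one_le
  nlinarith [abs_nonneg t]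

lemma norm_LFunction_le_local {s : ℂ} (h : χ ≠ 1 ∨ 3 / 4 ≤ |s.im|) {κ : ℝ} (hκ : 0 < κ)
    (hκ1 : κ ≤ 1 / 2) (hs : 1 - κ / 2 ≤ s.re) (hs4 : s.re ≤ 4) :
    ‖DirichletCharacter.LFunction χ s‖ ≤ 264 / κ * (q * (|s.im| + 2)) ^ κ := by
  have e1 : 44 / (κ / 2) * (q * (|s.im| + 2)) ^ (2 * (κ / 2))
      = 88 / κ * (q * (|s.im| + 2)) ^ κ := by
    rw [mul_div_cancel₀ _ (two_ne_zero)]; field_simp; ring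
  have h0 : 0 ≤ 88 / κ * (q * (|s.im| + 2)) ^ κ := by positivity
  have e2 : 264 / κ * (q * (|s.im| + 2)) ^ κ = 3 * (88 / κ * (q * (|s.im| + 2)) ^ κ) := by ring
  rw [e2]
  rcases h with h | h
  · have := norm_LFunction_le h (half_pos hκ) (by linarith) hs hs4
    rw [e1] at this
    linarith
  · have h1 : s ≠ 1 := by
      rintro rfl
      norm_num at h
    have := norm_LFunction_le_of_ne (χ := χ) h1 (half_pos hκ) (by linarith) hs hs4
    rw [e1] at this
    have h2 : 3 / 4 ≤ ‖s - 1‖ := h.trans (by simpa using Complex.abs_im_le_norm (s - 1))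
    have h3 : 1 / ‖s - 1‖ ≤ 2 := by
      rw [div_le_iff₀ (by linarith)]; linarith
    refine this.trans ?_
    gcongr
    linarith

lemma norm_LFunction_le_of_mem_sphere {s z : ℂ} (h : χ ≠ 1 ∨ 1 ≤ |s.im|) {κ : ℝ} (hκ : 0 < κ)
    (hκ1 : κ ≤ 1 / 2) (hs : 1 ≤ s.re) (hs3 : s.re ≤ 3) (hz : ‖z - s‖ ≤ κ / 2) :
    (χ ≠ 1 ∨ z ≠ 1) ∧
      ‖DirichletCharacter.LFunction χ z‖ ≤ 528 / κ * (q * (|s.im| + 2)) ^ κ := by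
  have hre := (Complex.abs_re_le_norm (z - s)).trans hz
  have him := (Complex.abs_im_le_norm (z - s)).trans hz
  rw [sub_re, abs_le] at hre
  rw [sub_im] at him
  have h1 : |z.im| ≤ |s.im| + 1 / 4 := by
    have := abs_add_le (z.im - s.im) s.im
    rw [sub_add_cancel] at this
    linarith
  have h2 : |s.im| ≤ |z.im| + 1 / 4 := by
    have := abs_sub_abs_le_abs_sub s.im z.im
    rw [abs_sub_comm] at this
    linarith
  have h34 : χ ≠ 1 ∨ 3 / 4 ≤ |z.im| := h.imp_right fun h ↦ by linarith
  refine ⟨h34.imp_right fun h ↦ ?_, ?_⟩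
  · rintro rfl
    norm_num at h
  refine (norm_LFunction_le_local h34 hκ hκ1 (by linarith) (by linarith)).trans ?_
  have h3 : ((q : ℝ) * (|z.im| + 2)) ^ κ ≤ (2 * (q * (|s.im| + 2))) ^ κ := by
    refine Real.rpow_le_rpow (by positivity) ?_ hκ.le
    have : (0 : ℝ) ≤ q := by positivity
    nlinarith [abs_nonneg s.im]
  have h4 : (2 * ((q : ℝ) * (|s.im| + 2))) ^ κ ≤ 2 * (q * (|s.im| + 2)) ^ κ := by
    rw [Real.mul_rpow (by norm_num) (by positivity)]
    gcongr
    calc (2 : ℝ) ^ κ ≤ 2 ^ (1 : ℝ) := Real.rpow_le_rpow_of_exponent_le (by norm_num) (by linarith)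
      _ = 2 := by norm_num
  calc 264 / κ * ((q : ℝ) * (|z.im| + 2)) ^ κ ≤ 264 / κ * (2 * (q * (|s.im| + 2)) ^ κ) := by
        gcongr; exact h3.trans h4
    _ = _ := by ring

lemma differentiableAt_LFunction_of {s : ℂ} (h : χ ≠ 1 ∨ s ≠ 1) :
    DifferentiableAt ℂ (DirichletCharacter.LFunction χ) s :=
  DirichletCharacter.differentiableAt_LFunction χ s h.symm

lemma norm_deriv_LFunction_le {s : ℂ} (h : χ ≠ 1 ∨ 1 ≤ |s.im|) {κ : ℝ} (hκ : 0 < κ)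
    (hκ1 : κ ≤ 1 / 2) (hs : 1 ≤ s.re) (hs3 : s.re ≤ 3) :
    ‖deriv (DirichletCharacter.LFunction χ) s‖ ≤ 1056 / κ ^ 2 * (q * (|s.im| + 2)) ^ κ := by
  have key := Complex.norm_deriv_le_of_forall_mem_sphere_norm_le (c := s) (R := κ / 2)
    (f := DirichletCharacter.LFunction χ) (C := 528 / κ * (q * (|s.im| + 2)) ^ κ) (half_pos hκ)
    (DifferentiableOn.diffContOnCl fun z hz ↦ ?_) fun z hz ↦ ?_
  · refine key.trans (le_of_eq ?_)
    field_simp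
    ring
  · rw [closure_ball _ (half_pos hκ).ne', mem_closedBall_iff_norm] at hz
    exact (differentiableAt_LFunction_of
      (norm_LFunction_le_of_mem_sphere h hκ hκ1 hs hs3 hz).1).differentiableWithinAt
  · exact (norm_LFunction_le_of_mem_sphere h hκ hκ1 hs hs3
      (mem_sphere_iff_norm.1 hz).le).2

/-- Lower bound for `L(1 + x + iy, χ)` from the inequality `3 + 4 cos θ + cos 2θ ≥ 0`. -/
lemma le_norm_LFunction_pow_four {κ x y m : ℝ} (hκ : 0 < κ) (hκ1 : κ ≤ 1 / 2)
    (hx : 0 < x) (hx1 : x ≤ 1) (hm : 0 < m) (hm1 : m ≤ 1)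
    (h : χ ^ 2 ≠ 1 ∨ m ≤ ‖(x : ℂ) + 2 * I * y‖) :
    x ^ 3 * m / (32 * (264 / κ) ^ 4 * ((q * (|y| + 2)) ^ κ) ^ 4)
      ≤ ‖DirichletCharacter.LFunction χ (1 + x + I * y)‖ ^ 4 := by
  set U := ((q : ℝ) * (|y| + 2)) ^ κ with hU
  have hU1 : 1 ≤ U := Real.one_le_rpow (one_le_conductor q y) hκ.le
  set K := 264 / κ with hK
  have hK0 : 0 < K := by positivity
  have h341 := DirichletCharacter.norm_LFunction_product_ge_one χ hx y
  rw [norm_mul, norm_mul, norm_pow, norm_pow] at h341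
  have hq0 : (0 : ℝ) ≤ q := by positivity
  have hx1' : 1 ≤ 1 / x := by rw [le_div_iff₀ hx]; linarith
  have hA : ‖DirichletCharacter.LFunctionTrivChar q (1 + x)‖ ≤ 2 / x * (K * U) := by
    have := norm_LFunction_le_of_ne (χ := (1 : DirichletCharacter ℂ q)) (s := 1 + x)
      (by simpa using hx.ne') (half_pos hκ) (by linarith) (by simp; linarith)
      (by simp; linarith)
    rw [mul_div_cancel₀ _ (two_ne_zero)] at this
    simp only [add_sub_cancel_left, Complex.norm_real, Real.norm_eq_abs, abs_of_pos hx, add_im,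
      one_im, ofReal_im, add_zero, abs_zero, zero_add] at this
    refine this.trans ?_
    have h1 : ((q : ℝ) * 2) ^ κ ≤ U := Real.rpow_le_rpow (by positivity)
      (by nlinarith [abs_nonneg y]) hκ.le
    have h2 : 44 / (κ / 2) ≤ K := by
      rw [hK, div_div_eq_mul_div]
      gcongr; norm_num
    calc (1 + 1 / x) * (44 / (κ / 2) * ((q : ℝ) * 2) ^ κ) ≤ (1 / x + 1 / x) * (K * U) := by gcongr
      _ = _ := by ring
  have hB : ‖DirichletCharacter.LFunction (χ ^ 2) (1 + x + 2 * I * y)‖ ≤ 4 * K * U / m := by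
    have h1 : ((q : ℝ) * (|2 * y| + 2)) ^ κ ≤ 2 * U := by
      calc ((q : ℝ) * (|2 * y| + 2)) ^ κ ≤ (2 * (q * (|y| + 2))) ^ κ := by
            refine Real.rpow_le_rpow (by positivity) ?_ hκ.le
            rw [abs_mul, abs_two]
            nlinarith [abs_nonneg y]
        _ = 2 ^ κ * U := Real.mul_rpow (by norm_num) (by positivity)
        _ ≤ 2 ^ (1 : ℝ) * U := by
            gcongr
            · norm_num
            · linarith
        _ = 2 * U := by norm_num
    have hm' : 1 ≤ 1 / m := by rw [le_div_iff₀ hm]; linarith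
    have h2 : 44 / (κ / 2) ≤ K := by
      rw [hK, div_div_eq_mul_div]
      gcongr; norm_num
    rcases h with h | h
    · have := norm_LFunction_le h (s := 1 + x + 2 * I * y) (half_pos hκ) (by linarith)
        (by simp; linarith) (by simp; linarith)
      rw [mul_div_cancel₀ _ (two_ne_zero)] at this
      simp only [add_im, one_im, ofReal_im, add_zero, mul_im, mul_re, re_ofNat, I_re, im_ofNat,
        I_im, ofReal_re, mul_zero, mul_one, zero_add, sub_zero] at this
      calc _ ≤ _ := this
        _ ≤ K * (2 * U) := by gcongr
        _ ≤ 1 / m * (4 * K * U) := by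
          have : 0 ≤ K * U := by positivity
          nlinarith
        _ = _ := by ring
    · have h3 : (1 + x + 2 * I * y - 1 : ℂ) = x + 2 * I * y := by ring
      have := norm_LFunction_le_of_ne (χ := χ ^ 2) (s := 1 + x + 2 * I * y) (fun h' ↦ ?_)
        (half_pos hκ) (by linarith) (by simp; linarith) (by simp; linarith)
      · rw [mul_div_cancel₀ _ (two_ne_zero), h3] at this
        simp only [add_im, one_im, ofReal_im, add_zero, mul_im, mul_re, re_ofNat, I_re, im_ofNat,
          I_im, ofReal_re, mul_zero, mul_one, zero_add, sub_zero] at this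
        calc _ ≤ _ := this
          _ ≤ (1 / m + 1 / m) * (K * (2 * U)) := by gcongr
          _ = _ := by ring
      · rw [← h3, h', sub_self, norm_zero] at h
        linarith
  rw [div_le_iff₀ (by positivity)]
  set N := ‖DirichletCharacter.LFunction χ (1 + x + I * y)‖
  have h5 : 1 ≤ (2 / x * (K * U)) ^ 3 * N ^ 4 * (4 * K * U / m) := by
    refine h341.le.trans ?_
    gcongr
  have h6 : (2 / x * (K * U)) ^ 3 * N ^ 4 * (4 * K * U / m)
      = N ^ 4 * (32 * K ^ 4 * U ^ 4) / (x ^ 3 * m) := by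
    field_simp; ring
  rw [h6, le_div_iff₀ (by positivity)] at h5
  linarith

end LowerBound

set_option maxHeartbeats 1000000 in
/-- A lower bound for Dirichlet `L`-functions to the right of the line `Re s = 1`. -/
theorem exists_le_norm_LFunction {ε : ℝ} (hε : 0 < ε) : ∃ c : ℝ, 0 < c ∧ ∀ (q : ℕ) [NeZero q]
    (χ : DirichletCharacter ℂ q) (s : ℂ), (χ ≠ 1 ∨ 1 ≤ |s.im|) → 1 < s.re → s.re ≤ 2 →
      c * (q * (|s.im| + 2)) ^ (-ε) ≤ ‖DirichletCharacter.LFunction χ s‖ := by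
  set κ : ℝ := min (ε / 11) (1 / 2) with hκdef
  have hκ : 0 < κ := by positivity
  have hκ1 : κ ≤ 1 / 2 := min_le_right _ _
  obtain ⟨c', hc', hsiegel⟩ := siegel hκ
  set c := min c' 1 with hc
  have hc0 : 0 < c := by positivity
  have hc1 : c ≤ 1 := min_le_right _ _
  set K := 264 / κ with hK
  have hK1 : 1 ≤ K := by rw [hK, le_div_iff₀ hκ]; linarith
  set K' := 1056 / κ ^ 2 with hK'
  have hK'1 : 1 ≤ K' := by rw [hK', le_div_iff₀ (by positivity)]; nlinarith
  refine ⟨c / (4 * K' * (512 * K ^ 4 * K' ^ 4) * (3 * K)), by positivity,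
    fun q _ χ s h hs1 hs2 ↦ ?_⟩
  obtain ⟨x, hxs⟩ : ∃ x : ℝ, x = s.re - 1 := ⟨_, rfl⟩
  obtain ⟨y, hys⟩ : ∃ y : ℝ, y = s.im := ⟨_, rfl⟩
  have hs : s = 1 + x + I * y := by
    apply Complex.ext <;> simp [hxs, hys]
  have hx0 : 0 < x := by linarith
  have hx1 : x ≤ 1 := by linarith
  rw [← hys] at h ⊢
  set Q := (q : ℝ) * (|y| + 2) with hQ
  have hQ1 : 1 ≤ Q := one_le_conductor q y
  set U := Q ^ κ with hU
  have hU1 : 1 ≤ U := Real.one_le_rpow hQ1 hκ.le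
  have hU0 : 0 < U := by linarith
  set η := c / (4 * K' * U ^ 2) with hη
  have hη0 : 0 < η := by positivity
  have hηc : η ≤ c := by
    rw [hη]
    apply div_le_self hc0.le
    have : 1 ≤ U ^ 2 := one_le_pow₀ hU1
    nlinarith
  set x₁ := η / (512 * K ^ 4 * K' ^ 4 * U ^ 8) with hx₁
  have hx₁0 : 0 < x₁ := by positivity
  have hx₁η : x₁ ≤ η := by
    apply div_le_self hη0.le
    have h1 : 1 ≤ K ^ 4 * K' ^ 4 * U ^ 8 := one_le_mul_of_one_le_of_one_le
      (one_le_mul_of_one_le_of_one_le (one_le_pow₀ hK1) (one_le_pow₀ hK'1)) (one_le_pow₀ hU1)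
    nlinarith
  have hKU : 1 ≤ K * U := one_le_mul_of_one_le_of_one_le hK1 hU1
  have hfinal : c / (4 * K' * (512 * K ^ 4 * K' ^ 4) * (3 * K)) * Q ^ (-ε) ≤
      x₁ / (3 * (K * U)) := by
    have hUε : Q ^ (-ε) ≤ (U ^ 11)⁻¹ := by
      rw [hU, ← Real.rpow_natCast, ← Real.rpow_mul (by positivity), ← Real.rpow_neg (by positivity)]
      apply Real.rpow_le_rpow_of_exponent_le hQ1
      have := min_le_left (ε / 11) (1 / 2)
      push_cast
      linarith
    calc _ ≤ c / (4 * K' * (512 * K ^ 4 * K' ^ 4) * (3 * K)) * (U ^ 11)⁻¹ := by gcongr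
      _ = _ := by rw [hx₁, hη]; field_simp
  refine hfinal.trans ?_
  rw [hs]
  rcases le_or_gt x₁ x with hxx | hxx
  · have h4 := le_norm_LFunction_pow_four (χ := χ) (y := y) (m := x) hκ hκ1 hx0 hx1 hx0 hx1
      (Or.inr (by
        have := Complex.abs_re_le_norm ((x : ℂ) + 2 * I * y)
        simpa [abs_of_pos hx0] using this))
    have h5 : (x / (3 * (K * U))) ^ 4 ≤ ‖DirichletCharacter.LFunction χ (1 + x + I * y)‖ ^ 4 := by
      refine le_trans ?_ h4
      rw [← hK, ← hQ, ← hU, div_pow, show x ^ 3 * x = x ^ 4 by ring]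
      gcongr
      have : 0 ≤ K ^ 4 * U ^ 4 := by positivity
      nlinarith
    have h6 := le_of_pow_le_pow_left₀ (by norm_num) (norm_nonneg _) h5
    refine le_trans ?_ h6
    gcongr
  · by_cases hsmall : χ ^ 2 = 1 ∧ |y| < η
    · have hχ : χ ≠ 1 := h.resolve_right (by linarith [hsmall.2])
      have hL1 := hsiegel q χ hχ hsmall.1
      have hcq : c / U ≤ c' * (q : ℝ) ^ (-κ) := by
        have hq1 : (1 : ℝ) ≤ q := by exact_mod_cast NeZero.one_le
        have hqQ : (q : ℝ) ≤ Q := by rw [hQ]; nlinarith [abs_nonneg y]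
        have h1 : (q : ℝ) ^ κ ≤ U := Real.rpow_le_rpow (by positivity) hqQ hκ.le
        rw [Real.rpow_neg (by positivity), ← div_eq_mul_inv]
        gcongr
        exact min_le_left _ _
      have hlip := Convex.norm_image_sub_le_of_norm_deriv_le (𝕜 := ℂ)
        (f := DirichletCharacter.LFunction χ) (C := K' * U)
        (s := {z : ℂ | 1 ≤ z.re} ∩ ({z : ℂ | z.re ≤ 3} ∩
          ({z : ℂ | -|y| ≤ z.im} ∩ {z : ℂ | z.im ≤ |y|})))
        (x := 1) (y := 1 + x + I * y)
        (fun z _ ↦ differentiableAt_LFunction_of (Or.inl hχ)) (fun z hz ↦ ?_)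
        ((convex_halfSpace_re_ge 1).inter ((convex_halfSpace_re_le 3).inter
          ((convex_halfSpace_im_ge _).inter (convex_halfSpace_im_le _)))) (by simp)
        (by simp; exact ⟨hx0.le, by linarith, neg_abs_le y, le_abs_self y⟩)
      · have hn : ‖(1 + x + I * y - 1 : ℂ)‖ ≤ 2 * η := by
          rw [show (1 + x + I * y - 1 : ℂ) = x + I * y by ring]
          refine (norm_add_le _ _).trans ?_
          rw [norm_mul, norm_I, one_mul, norm_real, norm_real, Real.norm_eq_abs, Real.norm_eq_abs,
            abs_of_pos hx0]
          linarith [hsmall.2]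
        have h7 : ‖DirichletCharacter.LFunction χ (1 + x + I * y) -
            DirichletCharacter.LFunction χ 1‖ ≤ c / (2 * U) := by
          refine hlip.trans ?_
          calc K' * U * ‖(1 + x + I * y - 1 : ℂ)‖ ≤ K' * U * (2 * η) := by gcongr
            _ = c / (2 * U) := by rw [hη]; field_simp; norm_num
        have h8 := norm_sub_norm_le (DirichletCharacter.LFunction χ 1)
          (DirichletCharacter.LFunction χ (1 + x + I * y))
        rw [norm_sub_rev] at h8
        have h9 : c / (2 * U) ≤ ‖DirichletCharacter.LFunction χ (1 + x + I * y)‖ := by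
          have : c / U = c / (2 * U) + c / (2 * U) := by field_simp; ring
          linarith
        refine le_trans ?_ h9
        rw [div_le_div_iff₀ (by positivity) (by positivity)]
        have hx₁c : x₁ ≤ c := hx₁η.trans hηc
        calc x₁ * (2 * U) ≤ c * (2 * (K * U)) := by
              gcongr
              nlinarith
          _ ≤ c * (3 * (K * U)) := by gcongr; norm_num
      · obtain ⟨h1, h2, h3, h4⟩ := hz
        have him : |z.im| ≤ |y| := abs_le.2 ⟨h3, h4⟩
        refine (norm_deriv_LFunction_le (Or.inl hχ) hκ hκ1 h1 h2).trans ?_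
        rw [hU, hQ, hK']
        gcongr
    · rw [not_and_or, not_lt] at hsmall
      have hx₁1 : x₁ ≤ 1 := by linarith
      have h4 := le_norm_LFunction_pow_four (χ := χ) (y := y) (m := η) hκ hκ1 hx₁0 hx₁1 hη0
        (by linarith) (hsmall.imp_right fun h ↦ by
        have := Complex.abs_im_le_norm ((x₁ : ℂ) + 2 * I * y)
        simp only [add_im, ofReal_im, mul_im, mul_re, re_ofNat, I_re, im_ofNat, I_im, ofReal_re,
          mul_zero, mul_one, zero_add, sub_zero, add_zero, abs_mul, abs_two] at this
        linarith [abs_nonneg y])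
      rw [← hK, ← hQ, ← hU] at h4
      have h5 : (2 * (x₁ * (K' * U))) ^ 4
          ≤ ‖DirichletCharacter.LFunction χ (1 + x₁ + I * y)‖ ^ 4 := by
        refine le_trans (le_of_eq ?_) h4
        have : η = x₁ * (512 * K ^ 4 * K' ^ 4 * U ^ 8) := by rw [hx₁]; field_simp
        rw [this]
        field_simp
        ring
      have h6 := le_of_pow_le_pow_left₀ (by norm_num) (norm_nonneg _) h5
      have hlip := Convex.norm_image_sub_le_of_norm_deriv_le (𝕜 := ℂ)
        (f := DirichletCharacter.LFunction χ) (C := K' * U)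
        (s := {z : ℂ | 1 < z.re} ∩ ({z : ℂ | z.re ≤ 3} ∩ ({z : ℂ | y ≤ z.im} ∩ {z : ℂ | z.im ≤ y})))
        (x := 1 + x + I * y) (y := 1 + x₁ + I * y)
        (fun z hz ↦ differentiableAt_LFunction_of (Or.inr fun h1 ↦ by
          have : (1 : ℝ) < z.re := hz.1
          rw [h1] at this
          simp at this)) (fun z hz ↦ ?_)
        ((convex_halfSpace_re_gt 1).inter ((convex_halfSpace_re_le 3).inter
          ((convex_halfSpace_im_ge _).inter (convex_halfSpace_im_le _))))
        (by simp; exact ⟨hx0, by linarith⟩) (by simp; exact ⟨hx₁0, by linarith⟩)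
      · have hn : ‖(1 + x₁ + I * y - (1 + x + I * y) : ℂ)‖ ≤ x₁ := by
          rw [show (1 + x₁ + I * y - (1 + x + I * y) : ℂ) = ((x₁ - x : ℝ) : ℂ) by push_cast; ring,
            norm_real, Real.norm_eq_abs, abs_of_nonneg (by linarith)]
          linarith
        have h7 := hlip.trans (mul_le_mul_of_nonneg_left hn (by positivity))
        have h8 := norm_sub_norm_le (DirichletCharacter.LFunction χ (1 + x₁ + I * y))
          (DirichletCharacter.LFunction χ (1 + x + I * y))
        have h9 : x₁ * (K' * U) ≤ ‖DirichletCharacter.LFunction χ (1 + x + I * y)‖ := by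
          linarith
        refine le_trans ?_ h9
        rw [div_le_iff₀ (by positivity)]
        have h10 : 1 ≤ K' * U * (3 * (K * U)) :=
          one_le_mul_of_one_le_of_one_le (one_le_mul_of_one_le_of_one_le hK'1 hU1) (by linarith)
        rw [mul_assoc]
        exact le_mul_of_one_le_right hx₁0.le h10
      · obtain ⟨h1, h2, h3, h4⟩ := hz
        have him : z.im = y := le_antisymm h4 h3
        have h1' : 1 ≤ z.re := le_of_lt h1
        have := norm_deriv_LFunction_le (χ := χ) (by rwa [him]) hκ hκ1 h1' h2
        rwa [him] at this

end TwistedBV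

namespace TwistedBV

open Complex Set Filter Topology MeasureTheory Asymptotics
open scoped ArithmeticFunction.vonMangoldt

/-- Bound for the derivatives of a logarithmic derivative, in terms of an upper bound on a disc and
a lower bound at the centre. -/
lemma norm_iteratedDeriv_logDeriv_le {f : ℂ → ℂ} {s : ℂ} {R M m : ℝ} (hR : 0 < R) (hm : 0 < m)
    (hf : ∀ z ∈ Metric.closedBall s R, DifferentiableAt ℂ f z)
    (hM : ∀ z ∈ Metric.closedBall s R, ‖f z‖ ≤ M) (hs : m ≤ ‖f s‖) (k : ℕ) :
    ‖iteratedDeriv k (fun z ↦ deriv f z / f z) s‖ ≤ k.factorial * (4 * M / (R * m)) ^ (k + 1) := by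
  have hmM : m ≤ M := hs.trans (hM s (Metric.mem_closedBall_self hR.le))
  have hM0 : 0 < M := hm.trans_le hmM
  set r := R * m / (4 * M) with hr
  have hr0 : 0 < r := by positivity
  have hr4 : r ≤ R / 4 := by
    rw [hr, div_le_div_iff₀ (by positivity) (by norm_num)]
    nlinarith
  have hder : ∀ z ∈ Metric.closedBall s r, ‖deriv f z‖ ≤ 2 * M / R := fun z hz ↦ by
    have hsub : Metric.closedBall z (R / 2) ⊆ Metric.closedBall s R :=
      Metric.closedBall_subset_closedBall' (by rw [Metric.mem_closedBall] at hz; linarith)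
    have := Complex.norm_deriv_le_of_forall_mem_sphere_norm_le (c := z) (R := R / 2) (C := M)
      (f := f) (half_pos hR) (DifferentiableOn.diffContOnCl fun w hw ↦ ?_)
      fun w hw ↦ hM w (hsub (Metric.sphere_subset_closedBall hw))
    · refine this.trans (le_of_eq ?_)
      field_simp
    · rw [closure_ball _ (half_pos hR).ne'] at hw
      exact (hf w (hsub hw)).differentiableWithinAt
  have hsubr : Metric.closedBall s r ⊆ Metric.closedBall s R :=
    Metric.closedBall_subset_closedBall (by linarith)
  have hlow : ∀ z ∈ Metric.closedBall s r, m / 2 ≤ ‖f z‖ := fun z hz ↦ by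
    have h1 := Convex.norm_image_sub_le_of_norm_deriv_le (𝕜 := ℂ) (f := f)
      (fun w hw ↦ hf w (hsubr hw)) hder (convex_closedBall s r) (Metric.mem_closedBall_self hr0.le)
      hz
    have h2 : ‖z - s‖ ≤ r := by rwa [← dist_eq_norm]
    have h3 : 2 * M / R * ‖z - s‖ ≤ m / 2 := by
      calc 2 * M / R * ‖z - s‖ ≤ 2 * M / R * r := by gcongr
        _ = m / 2 := by rw [hr]; field_simp; norm_num
    have h4 := norm_sub_norm_le (f s) (f z)
    rw [norm_sub_rev] at h4
    linarith
  have key := Complex.norm_iteratedDeriv_le_of_forall_mem_sphere_norm_le (c := s) (R := r)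
    (C := 4 * M / (R * m)) (f := fun z ↦ deriv f z / f z) k hr0
    (DifferentiableOn.diffContOnCl fun z hz ↦ ?_) fun z hz ↦ ?_
  · refine key.trans (le_of_eq ?_)
    rw [pow_succ', hr, ← inv_div (R * m) (4 * M), inv_pow]
    field_simp
  · rw [closure_ball _ hr0.ne'] at hz
    have hne : f z ≠ 0 := fun h ↦ by
      have := hlow z hz
      rw [h, norm_zero] at this
      linarith
    have hzR : z ∈ Metric.ball s R :=
      Metric.closedBall_subset_ball (by linarith : r < R) hz
    have han : AnalyticAt ℂ f z := DifferentiableOn.analyticAt (s := Metric.ball s R)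
      (fun w hw ↦ (hf w (Metric.ball_subset_closedBall hw)).differentiableWithinAt)
      (Metric.isOpen_ball.mem_nhds hzR)
    exact (han.deriv.differentiableAt.div han.differentiableAt hne).differentiableWithinAt
  · have hz' := Metric.sphere_subset_closedBall hz
    rw [norm_div]
    calc ‖deriv f z‖ / ‖f z‖ ≤ 2 * M / R / (m / 2) := by
          gcongr
          exacts [hder z hz', hlow z hz']
      _ = _ := by field_simp; norm_num

lemma iterate_logMul_apply (f : ℕ → ℂ) (k n : ℕ) :
    LSeries.logMul^[k] f n = (Real.log n : ℂ) ^ k * f n := by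
  induction k with
  | zero => simp
  | succ k ih =>
    rw [Function.iterate_succ_apply', LSeries.logMul, ih, natCast_log]
    ring

lemma LSeries_logMul_iterate {f : ℕ → ℂ} (hf : ∀ s : ℂ, 1 < s.re → LSeriesSummable f s) (k : ℕ)
    {s : ℂ} (hs : 1 < s.re) :
    ‖LSeries (LSeries.logMul^[k] f) s‖ = ‖iteratedDeriv k (LSeries f) s‖ := by
  rw [LSeries_iteratedDeriv k ((abscissa_le_one_of_summable hf).trans_lt (by exact_mod_cast hs))]
  simp

lemma eventually_one_lt_re {s : ℂ} (hs : 1 < s.re) : ∀ᶠ z in 𝓝 s, 1 < z.re :=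
  (isOpen_lt continuous_const continuous_re).mem_nhds hs

lemma LSeries_twist_eventuallyEq {q : ℕ} [NeZero q] (χ : DirichletCharacter ℂ q) {s : ℂ}
    (hs : 1 < s.re) : LSeries (fun n ↦ χ n * (Λ n : ℂ)) =ᶠ[𝓝 s] fun z ↦
      -(deriv (DirichletCharacter.LFunction χ) z / DirichletCharacter.LFunction χ z) := by
  filter_upwards [eventually_one_lt_re hs] with z hz
  rw [DirichletCharacter.deriv_LFunction_eq_deriv_LSeries χ hz,
    DirichletCharacter.LFunction_eq_LSeries χ hz, ← neg_div]
  exact DirichletCharacter.LSeries_twist_vonMangoldt_eq χ hz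

lemma iteratedDeriv_twist {q : ℕ} [NeZero q] (χ : DirichletCharacter ℂ q) {s : ℂ}
    (hs : 1 < s.re) (k : ℕ) : ‖iteratedDeriv k (LSeries (fun n ↦ χ n * (Λ n : ℂ))) s‖ =
      ‖iteratedDeriv k (fun z ↦
        deriv (DirichletCharacter.LFunction χ) z / DirichletCharacter.LFunction χ z) s‖ := by
  rw [(LSeries_twist_eventuallyEq χ hs).iteratedDeriv_eq, iteratedDeriv_fun_neg, norm_neg]

/-- Bounds for the derivatives of the logarithmic derivative of `L` to the right of the line `Re s = 1`. -/
lemma exists_norm_iteratedDeriv_logDeriv_LFunction_le {ε : ℝ} (hε : 0 < ε) (k : ℕ) :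
    ∃ C : ℝ, 0 < C ∧ ∀ (q : ℕ) [NeZero q] (χ : DirichletCharacter ℂ q) (s : ℂ),
      (χ ≠ 1 ∨ 1 ≤ |s.im|) → 1 < s.re → s.re ≤ 2 →
      ‖iteratedDeriv k (LSeries (fun n ↦ χ n * (Λ n : ℂ))) s‖ ≤ C * (q * (|s.im| + 2)) ^ ε := by
  set κ : ℝ := min (ε / (2 * (k + 1))) (1 / 2) with hκdef
  have hκ : 0 < κ := by positivity
  have hκ1 : κ ≤ 1 / 2 := min_le_right _ _
  obtain ⟨c, hc, hlow⟩ := exists_le_norm_LFunction hκ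
  refine ⟨k.factorial * (4 * (528 / κ) / (κ / 2 * c)) ^ (k + 1), by positivity,
    fun q _ χ s h hs1 hs2 ↦ ?_⟩
  have hQ1 : 1 ≤ (q : ℝ) * (|s.im| + 2) := one_le_conductor q s.im
  set Q := (q : ℝ) * (|s.im| + 2) with hQ
  have hQ0 : 0 < Q := by linarith
  rw [iteratedDeriv_twist χ hs1]
  have key := norm_iteratedDeriv_logDeriv_le (f := DirichletCharacter.LFunction χ) (s := s)
    (R := κ / 2) (M := 528 / κ * Q ^ κ) (m := c * Q ^ (-κ)) (half_pos hκ) (by positivity)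
    (fun z hz ↦ differentiableAt_LFunction_of (norm_LFunction_le_of_mem_sphere h hκ hκ1 hs1.le
      (by linarith) (by rwa [← dist_eq_norm])).1)
    (fun z hz ↦ (norm_LFunction_le_of_mem_sphere h hκ hκ1 hs1.le
      (by linarith) (by rwa [← dist_eq_norm])).2)
    (hlow q χ s h hs1 hs2) k
  refine key.trans ?_
  have e1 : 4 * (528 / κ * Q ^ κ) / (κ / 2 * (c * Q ^ (-κ)))
      = 4 * (528 / κ) / (κ / 2 * c) * Q ^ (2 * κ) := by
    rw [two_mul κ, Real.rpow_add hQ0, Real.rpow_neg hQ0.le]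
    field_simp
  rw [e1, mul_pow, ← mul_assoc]
  gcongr
  rw [← Real.rpow_natCast, ← Real.rpow_mul hQ0.le]
  apply Real.rpow_le_rpow_of_exponent_le hQ1
  have := min_le_left (ε / (2 * (k + 1))) (1 / 2)
  rw [← hκdef, le_div_iff₀ (by positivity)] at this
  push_cast
  linarith

/-- Bounds for the Dirichlet series of `χ(n) Λ(n) (log n)^k`. -/
theorem exists_norm_LSeries_twist_le {ε : ℝ} (hε : 0 < ε) (k : ℕ) :
    ∃ C : ℝ, 0 < C ∧ ∀ (q : ℕ) [NeZero q] (χ : DirichletCharacter ℂ q) (s : ℂ),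
      χ ≠ 1 → 1 < s.re → s.re ≤ 2 →
      ‖LSeries (LSeries.logMul^[k] (fun n ↦ χ n * (Λ n : ℂ))) s‖
        ≤ C * (q * (|s.im| + 2)) ^ ε := by
  obtain ⟨C, hC, h⟩ := exists_norm_iteratedDeriv_logDeriv_LFunction_le hε k
  refine ⟨C, hC, fun q _ χ s hχ hs1 hs2 ↦ ?_⟩
  rw [LSeries_logMul_iterate (f := fun n ↦ χ n * (Λ n : ℂ))
    (fun z hz ↦ DirichletCharacter.LSeriesSummable_twist_vonMangoldt χ hz) k hs1]
  exact h q χ s (Or.inl hχ) hs1 hs2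

lemma zetaRes_eq_riemannZeta {s : ℂ} (hs : s ≠ 1) : zetaRes s = (s - 1) * riemannZeta s := by
  rw [zetaRes, LRes_of_ne hs, DirichletCharacter.LFunction_modOne_eq]

lemma zetaRes_ne_zero {s : ℂ} (hs : 1 ≤ s.re) : zetaRes s ≠ 0 := by
  rcases eq_or_ne s 1 with rfl | h
  · simp [zetaRes_one]
  · rw [zetaRes_eq_riemannZeta h]
    exact mul_ne_zero (sub_ne_zero.2 h) (riemannZeta_ne_zero_of_one_le_re hs)

lemma summable_vonMangoldt_sub_one {s : ℂ} (hs : 1 < s.re) :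
    LSeriesSummable (fun n ↦ (Λ n : ℂ) - 1) s :=
  (ArithmeticFunction.LSeriesSummable_vonMangoldt hs).sub (LSeriesSummable_one_iff.2 hs)

lemma LSeries_vonMangoldt_sub_one {s : ℂ} (hs : 1 < s.re) :
    LSeries (fun n ↦ (Λ n : ℂ) - 1) s = -(deriv riemannZeta s / riemannZeta s) - riemannZeta s := by
  rw [← neg_div, ← ArithmeticFunction.LSeries_vonMangoldt_eq_deriv_riemannZeta_div hs,
    ← LSeries_one_eq_riemannZeta hs]
  exact LSeries_sub (ArithmeticFunction.LSeriesSummable_vonMangoldt hs)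
    (LSeriesSummable_one_iff.2 hs)

lemma LSeries_vonMangoldt_sub_one_eq_dslope {s : ℂ} (hs : 1 < s.re) :
    LSeries (fun n ↦ (Λ n : ℂ) - 1) s = -(deriv zetaRes s / zetaRes s) - dslope zetaRes 1 s := by
  have hs1 : s ≠ 1 := fun h ↦ by simp [h] at hs
  have hs1' : s - 1 ≠ 0 := sub_ne_zero.2 hs1
  have hz := riemannZeta_ne_zero_of_one_le_re hs.le
  have hd : deriv zetaRes s = riemannZeta s + (s - 1) * deriv riemannZeta s := by
    have : zetaRes =ᶠ[𝓝 s] fun z ↦ (z - 1) * riemannZeta z := by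
      filter_upwards [isOpen_ne.mem_nhds hs1] with z hz using zetaRes_eq_riemannZeta hz
    rw [this.deriv_eq, deriv_fun_mul (by fun_prop) (differentiableAt_riemannZeta hs1)]
    simp
  rw [LSeries_vonMangoldt_sub_one hs, dslope_of_ne _ hs1, slope_def_field, hd,
    zetaRes_eq_riemannZeta hs1, zetaRes_one]
  field_simp
  ring

/-- Bounds for the Dirichlet series of `(Λ(n) - 1) (log n)^k`. -/
theorem exists_norm_LSeries_vonMangoldt_sub_one_le {ε : ℝ} (hε : 0 < ε) (k : ℕ) :
    ∃ C : ℝ, 0 < C ∧ ∀ s : ℂ, 1 < s.re → s.re ≤ 2 →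
      ‖LSeries (LSeries.logMul^[k] (fun n ↦ (Λ n : ℂ) - 1)) s‖ ≤ C * (|s.im| + 2) ^ ε := by
  have hG : AnalyticOnNhd ℂ (fun s ↦ -(deriv zetaRes s / zetaRes s) - dslope zetaRes 1 s)
      {s | 1 ≤ s.re} := fun s hs ↦ by
    have h1 : AnalyticAt ℂ zetaRes s := differentiable_zetaRes.analyticAt s
    have h2 : Differentiable ℂ (dslope zetaRes 1) := differentiableOn_univ.1
      ((Complex.differentiableOn_dslope univ_mem).2 differentiable_zetaRes.differentiableOn)
    exact (h1.deriv.div h1 (zetaRes_ne_zero hs)).neg.sub (h2.analyticAt s)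
  have hcont : ContinuousOn (iteratedDeriv k
      (fun s ↦ -(deriv zetaRes s / zetaRes s) - dslope zetaRes 1 s)) {s | 1 ≤ s.re} := by
    rw [iteratedDeriv_eq_iterate]
    exact (hG.iterated_deriv k).continuousOn
  obtain ⟨B, hB⟩ := ((isCompact_Icc (a := (1 : ℝ)) (b := 2)).reProdIm
    (isCompact_Icc (a := (-1 : ℝ)) (b := 1))).exists_bound_of_continuousOn
    (hcont.mono fun z hz ↦ (mem_reProdIm.1 hz).1.1)
  obtain ⟨C, hC, h⟩ := exists_norm_iteratedDeriv_logDeriv_LFunction_le hε k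
  set κ : ℝ := min ε (1 / 2) with hκdef
  have hκ : 0 < κ := by positivity
  have hκ1 : κ ≤ 1 / 2 := min_le_right _ _
  refine ⟨|B| + (C + k.factorial * (528 / κ) / (κ / 2) ^ k), by positivity, fun s hs1 hs2 ↦ ?_⟩
  rw [LSeries_logMul_iterate (fun z hz ↦ summable_vonMangoldt_sub_one hz) k hs1]
  have hQ1 : 1 ≤ |s.im| + 2 := by linarith [abs_nonneg s.im]
  have hQε : 1 ≤ (|s.im| + 2) ^ ε := Real.one_le_rpow hQ1 hε.le
  rcases le_total |s.im| 1 with him | him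
  · have heq : LSeries (fun n ↦ (Λ n : ℂ) - 1) =ᶠ[𝓝 s]
        fun s ↦ -(deriv zetaRes s / zetaRes s) - dslope zetaRes 1 s := by
      filter_upwards [eventually_one_lt_re hs1] with z hz
      exact LSeries_vonMangoldt_sub_one_eq_dslope hz
    rw [heq.iteratedDeriv_eq]
    refine (hB s (mem_reProdIm.2 ⟨⟨hs1.le, hs2⟩, abs_le.1 him⟩)).trans ?_
    have h0 : 0 ≤ C + k.factorial * (528 / κ) / (κ / 2) ^ k := by positivity
    have h1 := le_abs_self B
    have h2 := abs_nonneg B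
    nlinarith
  · have heq : LSeries (fun n ↦ (Λ n : ℂ) - 1) =ᶠ[𝓝 s]
        LSeries (fun n ↦ (1 : DirichletCharacter ℂ 1) n * (Λ n : ℂ)) -
          DirichletCharacter.LFunction (1 : DirichletCharacter ℂ 1) := by
      filter_upwards [eventually_one_lt_re hs1,
        LSeries_twist_eventuallyEq (1 : DirichletCharacter ℂ 1) hs1] with z hz hz2
      rw [Pi.sub_apply, hz2, LSeries_vonMangoldt_sub_one hz,
        DirichletCharacter.LFunction_modOne_eq]
    have hχ : (1 : DirichletCharacter ℂ 1) ≠ 1 ∨ 1 ≤ |s.im| := Or.inr him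
    have hs1' : s ≠ 1 := fun h ↦ by simp [h] at hs1
    have han1 : AnalyticAt ℂ (LSeries (fun n ↦ (1 : DirichletCharacter ℂ 1) n * (Λ n : ℂ))) s :=
      LSeries_analyticOnNhd _ _ ((abscissa_le_one_of_summable fun z hz ↦
        DirichletCharacter.LSeriesSummable_twist_vonMangoldt 1 hz).trans_lt (by exact_mod_cast hs1))
    have han2 : AnalyticAt ℂ (DirichletCharacter.LFunction (1 : DirichletCharacter ℂ 1)) s := by
      rw [DirichletCharacter.LFunction_modOne_eq]
      exact DifferentiableOn.analyticAt (s := {1}ᶜ)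
        (fun z hz ↦ (differentiableAt_riemannZeta hz).differentiableWithinAt)
        (isOpen_compl_singleton.mem_nhds hs1')
    rw [heq.iteratedDeriv_eq, iteratedDeriv_sub han1.contDiffAt han2.contDiffAt]
    have hb1 := h 1 1 s hχ hs1 hs2
    have hb2 := Complex.norm_iteratedDeriv_le_of_forall_mem_sphere_norm_le (c := s) (R := κ / 2)
      (f := DirichletCharacter.LFunction (1 : DirichletCharacter ℂ 1))
      (C := 528 / κ * ((1 : ℕ) * (|s.im| + 2)) ^ κ) k (half_pos hκ)
      (DifferentiableOn.diffContOnCl fun z hz ↦ (differentiableAt_LFunction_of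
        (norm_LFunction_le_of_mem_sphere (z := z) hχ hκ hκ1 hs1.le (by linarith) (by
          rwa [closure_ball _ (half_pos hκ).ne', mem_closedBall_iff_norm]
            at hz)).1).differentiableWithinAt)
      (fun z hz ↦ (norm_LFunction_le_of_mem_sphere hχ hκ hκ1 hs1.le (by linarith)
        (mem_sphere_iff_norm.1 hz).le).2)
    rw [Nat.cast_one, one_mul] at hb1 hb2
    have hκε : (|s.im| + 2) ^ κ ≤ (|s.im| + 2) ^ ε :=
      Real.rpow_le_rpow_of_exponent_le hQ1 (min_le_left _ _)
    have hb3 : k.factorial * (528 / κ * (|s.im| + 2) ^ κ) / (κ / 2) ^ k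
        ≤ k.factorial * (528 / κ) / (κ / 2) ^ k * (|s.im| + 2) ^ ε := by
      calc _ = k.factorial * (528 / κ) / (κ / 2) ^ k * (|s.im| + 2) ^ κ := by ring
        _ ≤ _ := by gcongr
    refine (norm_sub_le _ _).trans ?_
    have h2 := mul_nonneg (abs_nonneg B) (zero_le_one.trans hQε)
    calc _ ≤ C * (|s.im| + 2) ^ ε + k.factorial * (528 / κ) / (κ / 2) ^ k * (|s.im| + 2) ^ ε :=
          add_le_add hb1 (hb2.trans hb3)
      _ ≤ _ := by rw [add_mul, add_mul]; linarith

end TwistedBV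

namespace TwistedBV

open Complex Set Filter Topology MeasureTheory Asymptotics
open scoped ArithmeticFunction.vonMangoldt

/-- The Mellin transform of `u ↦ max (1 - u) 0`. -/
noncomputable def rieszKernel (s : ℂ) : ℂ := 1 / s - 1 / (s + 1)

lemma norm_rieszKernel_le {σ : ℝ} (hσ : 1 ≤ σ) (y : ℝ) :
    ‖rieszKernel (σ + y * I)‖ ≤ (1 + y ^ 2)⁻¹ := by
  have h1 : ∀ τ : ℝ, 1 ≤ τ → √(1 + y ^ 2) ≤ ‖(τ + y * I : ℂ)‖ := by
    intro τ hτ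
    rw [Complex.norm_add_mul_I]
    exact Real.sqrt_le_sqrt (by nlinarith)
  have hpos : 0 < √(1 + y ^ 2) := Real.sqrt_pos.2 (by positivity)
  have hs := h1 σ hσ
  have hs1 := h1 (σ + 1) (by linarith)
  have e1 : ((σ + 1 : ℝ) + y * I : ℂ) = σ + y * I + 1 := by push_cast; ring
  rw [e1] at hs1
  have hs0 : (σ + y * I : ℂ) ≠ 0 := norm_pos_iff.1 (hpos.trans_le hs)
  have hs10 : (σ + y * I + 1 : ℂ) ≠ 0 := norm_pos_iff.1 (hpos.trans_le hs1)
  have : rieszKernel (σ + y * I) = ((σ + y * I) * (σ + y * I + 1))⁻¹ := by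
    rw [rieszKernel]; field_simp; ring
  rw [this, norm_inv, norm_mul]
  apply inv_anti₀ (by positivity)
  calc 1 + y ^ 2 = √(1 + y ^ 2) * √(1 + y ^ 2) := (Real.mul_self_sqrt (by positivity)).symm
    _ ≤ _ := by gcongr

lemma continuous_rieszKernel {σ : ℝ} (hσ : 1 ≤ σ) :
    Continuous fun y : ℝ ↦ rieszKernel (σ + y * I) := by
  have hre : ∀ y : ℝ, (σ + y * I : ℂ) ≠ 0 ∧ (σ + y * I + 1 : ℂ) ≠ 0 := by
    refine fun y ↦ ⟨fun h ↦ ?_, fun h ↦ ?_⟩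
    · have := congrArg Complex.re h; simp at this; linarith
    · have := congrArg Complex.re h; simp at this; linarith
  unfold rieszKernel
  exact (continuous_const.div (by fun_prop) fun y ↦ (hre y).1).sub
    (continuous_const.div (by fun_prop) fun y ↦ (hre y).2)

lemma mellinInv_rieszKernel {σ : ℝ} (hσ : 1 ≤ σ) {u : ℝ} (hu : 0 < u) :
    mellinInv σ rieszKernel u = (max (1 - u) 0 : ℝ) := by
  set f : ℝ → ℂ := fun u ↦ (Ioc (0 : ℝ) 1).indicator (fun _ ↦ (1 : ℂ)) u -
    (Ioc (0 : ℝ) 1).indicator (fun t ↦ (t : ℂ) ^ (1 : ℂ)) u with hf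
  have hM : ∀ s : ℂ, 0 < s.re → HasMellin f s (rieszKernel s) := by
    intro s hs
    have h1 := hasMellin_one_Ioc hs
    have h2 := hasMellin_cpow_Ioc 1 (s := s) (by simp; linarith)
    have := hasMellin_sub h1.1 h2.1
    rwa [h1.2, h2.2] at this
  have hfe : ∀ v : ℝ, 0 < v → f v = (max (1 - v) 0 : ℝ) := by
    intro v hv
    simp only [hf]
    by_cases h : v ≤ 1
    · have hm : v ∈ Ioc (0 : ℝ) 1 := ⟨hv, h⟩
      rw [indicator_of_mem hm, indicator_of_mem hm, max_eq_left (by linarith)]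
      simp
    · rw [indicator_of_notMem (fun h' ↦ h h'.2), indicator_of_notMem (fun h' ↦ h h'.2),
        max_eq_right (by linarith)]
      simp
  have hfc : ContinuousAt f u := by
    have : f =ᶠ[𝓝 u] fun v ↦ ((max (1 - v) 0 : ℝ) : ℂ) := by
      filter_upwards [lt_mem_nhds hu] with v hv using hfe v hv
    rw [continuousAt_congr this]
    fun_prop
  have hline : ∀ y : ℝ, mellin f (σ + y * I) = rieszKernel (σ + y * I) := fun y ↦
    (hM _ (by simp; linarith)).2
  have := mellinInv_mellin_eq σ f hu (hM σ (by simp; linarith)).1 ?_ hfc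
  · rw [hfe u hu] at this
    rw [← this, mellinInv, mellinInv]
    simp_rw [hline]
  · unfold Complex.VerticalIntegrable
    simp_rw [hline]
    exact integrable_inv_one_add_sq.mono' (continuous_rieszKernel hσ).aestronglyMeasurable
      (ae_of_all _ (norm_rieszKernel_le hσ))

lemma half_power_div_le (y : ℝ) :
    (|y| + 2) ^ (1 / 2 : ℝ) * (1 + y ^ 2)⁻¹ ≤ 4 * (1 + ‖y‖) ^ (-(3 / 2) : ℝ) := by
  have hy : 0 ≤ |y| := abs_nonneg y
  rw [Real.norm_eq_abs, ← div_eq_mul_inv, div_le_iff₀ (by positivity)]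
  have h1 : (|y| + 2) ^ (1 / 2 : ℝ) ≤ 2 * (1 + |y|) ^ (1 / 2 : ℝ) := by
    calc (|y| + 2) ^ (1 / 2 : ℝ) ≤ (4 * (1 + |y|)) ^ (1 / 2 : ℝ) := by gcongr; linarith
      _ = _ := by
        rw [Real.mul_rpow (by norm_num) (by positivity), ← Real.sqrt_eq_rpow 4]
        congr 1
        rw [Real.sqrt_eq_iff_mul_self_eq] <;> norm_num
  have h2 : (1 + |y|) ^ (1 / 2 : ℝ) = (1 + |y|) ^ (-(3 / 2) : ℝ) * (1 + |y|) ^ 2 := by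
    rw [← Real.rpow_natCast, ← Real.rpow_add (by positivity)]; norm_num
  have h3 : (1 + |y|) ^ 2 ≤ 2 * (1 + y ^ 2) := by
    have := sq_abs y; nlinarith [sq_nonneg (|y| - 1)]
  calc _ ≤ _ := h1
    _ = 2 * (1 + |y|) ^ (-(3 / 2) : ℝ) * (1 + |y|) ^ 2 := by rw [h2]; ring
    _ ≤ 2 * (1 + |y|) ^ (-(3 / 2) : ℝ) * (2 * (1 + y ^ 2)) := by gcongr
    _ = _ := by ring

/-- Riesz means of the coefficients of a Dirichlet series that grows slowly on a vertical line. -/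
lemma norm_sum_riesz_le {b : ℕ → ℂ} {σ x K : ℝ} (hσ : 1 ≤ σ) (hx : 0 < x)
    (hb : LSeriesSummable b σ)
    (hK : ∀ y : ℝ, ‖LSeries b (σ + y * I)‖ ≤ K * (|y| + 2) ^ (1 / 2 : ℝ)) :
    ‖∑ n ∈ Finset.Icc 1 ⌊x⌋₊, b n * ((1 - n / x : ℝ) : ℂ)‖ ≤
      4 * (∫ y : ℝ, (1 + ‖y‖) ^ (-(3 / 2) : ℝ)) * K * x ^ σ := by
  have hK0 : 0 ≤ K := by
    have := (norm_nonneg _).trans (hK 0)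
    exact nonneg_of_mul_nonneg_left this (by positivity)
  set F : ℕ → ℝ → ℂ := fun n y ↦
    LSeries.term b (σ + y * I) n * (x : ℂ) ^ (σ + y * I : ℂ) * rieszKernel (σ + y * I) with hF
  have hterm : ∀ n (y : ℝ), ‖LSeries.term b (σ + y * I) n‖ = ‖LSeries.term b σ n‖ := by
    intro n y
    rw [LSeries.norm_term_eq, LSeries.norm_term_eq]; simp
  have hxs : ∀ y : ℝ, ‖(x : ℂ) ^ (σ + y * I : ℂ)‖ = x ^ σ := by
    intro y
    rw [Complex.norm_cpow_eq_rpow_re_of_pos hx]; simp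
  have hFn : ∀ n y, ‖F n y‖ ≤ ‖LSeries.term b σ n‖ * x ^ σ * (1 + y ^ 2)⁻¹ := by
    intro n y
    rw [hF]
    simp only [norm_mul, hterm, hxs]
    gcongr
    exact norm_rieszKernel_le hσ y
  have hcpow : Continuous fun y : ℝ ↦ (x : ℂ) ^ (σ + y * I : ℂ) :=
    Continuous.const_cpow (by fun_prop) (Or.inl (by exact_mod_cast hx.ne'))
  have hFc : ∀ n, Continuous (F n) := by
    intro n
    refine (Continuous.mul ?_ hcpow).mul (continuous_rieszKernel hσ)
    rcases eq_or_ne n 0 with rfl | hn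
    · simpa using continuous_const
    · simp_rw [LSeries.term_of_ne_zero hn]
      exact continuous_const.div (Continuous.const_cpow (by fun_prop)
        (Or.inl (by exact_mod_cast hn))) fun y ↦ by simp [Complex.cpow_eq_zero_iff, hn]
  have hFi : ∀ n, Integrable (F n) := fun n ↦
    (integrable_inv_one_add_sq.const_mul _).mono' (hFc n).aestronglyMeasurable
      (ae_of_all _ (hFn n))
  have hsum : Summable fun n ↦ ∫ y, ‖F n y‖ := by
    have hs : Summable fun n ↦ ‖LSeries.term b σ n‖ * x ^ σ * ∫ y : ℝ, (1 + y ^ 2)⁻¹ :=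
      (hb.norm.mul_right _).mul_right _
    refine hs.of_nonneg_of_le (fun n ↦ integral_nonneg fun _ ↦ norm_nonneg _) fun n ↦ ?_
    rw [← integral_const_mul]
    exact integral_mono (hFi n).norm (integrable_inv_one_add_sq.const_mul _) (hFn n)
  have hintegral := hasSum_integral_of_summable_integral_norm hFi hsum
  have hval : ∀ n, ∫ y, F n y = 2 * Real.pi * (if n ∈ Finset.Icc 1 ⌊x⌋₊ then
      b n * ((1 - n / x : ℝ) : ℂ) else 0) := by
    intro n
    rcases eq_or_ne n 0 with rfl | hn
    · simp [hF]
    have hn0 : (0 : ℝ) < n := by positivity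
    have h := mellinInv_rieszKernel hσ (u := n / x) (by positivity)
    have h2 : ∀ y : ℝ, F n y = b n * (((n / x : ℝ) : ℂ) ^ (-(σ + y * I) : ℂ) •
        rieszKernel (σ + y * I)) := by
      intro y
      have : ((n / x : ℝ) : ℂ) ^ (-(σ + y * I) : ℂ) =
          (x : ℂ) ^ (σ + y * I : ℂ) / (n : ℂ) ^ (σ + y * I : ℂ) := by
        rw [div_eq_mul_inv, Complex.ofReal_mul,
          Complex.mul_cpow_ofReal_nonneg hn0.le (by positivity),
          Complex.cpow_neg, Complex.ofReal_inv, Complex.inv_cpow, Complex.cpow_neg, inv_inv]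
        · simp; ring
        · rw [Complex.arg_ofReal_of_nonneg hx.le]; exact Real.pi_pos.ne
      rw [hF]
      simp only [LSeries.term_of_ne_zero hn, this, smul_eq_mul]
      ring
    simp_rw [h2]
    rw [integral_const_mul]
    rw [mellinInv, Complex.real_smul] at h
    have hpi : (Real.pi : ℂ) ≠ 0 := by exact_mod_cast Real.pi_pos.ne'
    have h3 : ∫ y : ℝ, ((n / x : ℝ) : ℂ) ^ (-(σ + y * I) : ℂ) • rieszKernel (σ + y * I) =
        2 * Real.pi * ((max (1 - n / x) 0 : ℝ) : ℂ) := by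
      rw [← h, ← mul_assoc]
      have : (2 * Real.pi * ((1 / (2 * Real.pi) : ℝ) : ℂ)) = 1 := by push_cast; field_simp
      rw [this, one_mul]
    rw [h3]
    split_ifs with hmem
    · rw [Finset.mem_Icc] at hmem
      have : (n : ℝ) ≤ x := (Nat.le_floor_iff hx.le).1 hmem.2
      rw [max_eq_left (by rw [sub_nonneg, div_le_one hx]; exact this)]
      ring
    · have : x ≤ n := by
        by_contra hlt
        exact hmem (Finset.mem_Icc.2 ⟨Nat.one_le_iff_ne_zero.2 hn,
          Nat.le_floor (not_le.1 hlt).le⟩)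
      rw [max_eq_right (by rw [sub_nonpos, one_le_div hx]; exact this)]
      simp
  have hsum2 : HasSum (fun n ↦ ∫ y, F n y)
      (2 * Real.pi * ∑ n ∈ Finset.Icc 1 ⌊x⌋₊, b n * ((1 - n / x : ℝ) : ℂ)) := by
    simp_rw [hval]
    apply HasSum.mul_left
    rw [← Finset.sum_congr rfl fun n hn ↦ if_pos hn]
    exact hasSum_sum_of_ne_finset_zero fun n hn ↦ if_neg hn
  have heq := hsum2.unique hintegral
  have htsum : ∀ y : ℝ, ∑' n, F n y =
      LSeries b (σ + y * I) * ((x : ℂ) ^ (σ + y * I : ℂ) * rieszKernel (σ + y * I)) := by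
    intro y
    simp_rw [hF, mul_assoc]
    rw [tsum_mul_right, LSeries]
  have hbound : ‖∫ y, ∑' n, F n y‖ ≤ ∫ y : ℝ, K * x ^ σ * (4 * (1 + ‖y‖) ^ (-(3 / 2) : ℝ)) := by
    refine norm_integral_le_of_norm_le ?_ (ae_of_all _ fun y ↦ ?_)
    · exact ((integrable_one_add_norm (by norm_num)).const_mul 4).const_mul _
    · rw [htsum, norm_mul, norm_mul, hxs]
      calc _ ≤ K * (|y| + 2) ^ (1 / 2 : ℝ) * (x ^ σ * (1 + y ^ 2)⁻¹) := by
            gcongr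
            · exact hK y
            · exact norm_rieszKernel_le hσ y
        _ = K * x ^ σ * ((|y| + 2) ^ (1 / 2 : ℝ) * (1 + y ^ 2)⁻¹) := by ring
        _ ≤ _ := mul_le_mul_of_nonneg_left (half_power_div_le y) (by positivity)
  rw [← heq, integral_const_mul, integral_const_mul, norm_mul] at hbound
  have h2pi : (1 : ℝ) ≤ ‖(2 * Real.pi : ℂ)‖ := by
    rw [norm_mul]
    simp only [Complex.norm_ofNat, Complex.norm_real, Real.norm_eq_abs, abs_of_pos Real.pi_pos]
    linarith [Real.pi_gt_three]
  calc _ ≤ ‖(2 * Real.pi : ℂ)‖ * ‖∑ n ∈ Finset.Icc 1 ⌊x⌋₊, b n * ((1 - n / x : ℝ) : ℂ)‖ :=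
        le_mul_of_one_le_left (norm_nonneg _) h2pi
    _ ≤ _ := hbound
    _ = _ := by ring

/-- Abel's inequality for a decreasing weight. -/
lemma norm_sum_antitone_mul_le {f : ℕ → ℂ} {w : ℕ → ℝ} {B : ℝ} {n : ℕ}
    (hw : ∀ i < n, w (i + 1) ≤ w i) (hwn : 0 ≤ w n)
    (hB : ∀ j ≤ n, ‖∑ i ∈ Finset.range j, f i‖ ≤ B) :
    ‖∑ i ∈ Finset.range n, (w i : ℂ) * f i‖ ≤ w 0 * B := by
  have key : ∀ j ≤ n, ‖∑ i ∈ Finset.range j, (w i : ℂ) * f i -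
      w j * ∑ i ∈ Finset.range j, f i‖ ≤ (w 0 - w j) * B := by
    intro j
    induction j with
    | zero => simp
    | succ j ih =>
      intro hj
      have e1 : ∑ i ∈ Finset.range (j + 1), (w i : ℂ) * f i -
          w (j + 1) * ∑ i ∈ Finset.range (j + 1), f i =
          (∑ i ∈ Finset.range j, (w i : ℂ) * f i - w j * ∑ i ∈ Finset.range j, f i) +
          ((w j - w (j + 1) : ℝ) : ℂ) * ∑ i ∈ Finset.range (j + 1), f i := by
        rw [Finset.sum_range_succ, Finset.sum_range_succ]; push_cast; ring
      rw [e1]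
      refine (norm_add_le _ _).trans ?_
      have h1 := ih (by omega)
      have h2 := hw j (by omega)
      have h3 : ‖((w j - w (j + 1) : ℝ) : ℂ) * ∑ i ∈ Finset.range (j + 1), f i‖ ≤
          (w j - w (j + 1)) * B := by
        rw [norm_mul, Complex.norm_real, Real.norm_of_nonneg (by linarith)]
        exact mul_le_mul_of_nonneg_left (hB _ hj) (by linarith)
      linarith
  have h1 := key n le_rfl
  have h2 : ‖(w n : ℂ) * ∑ i ∈ Finset.range n, f i‖ ≤ w n * B := by
    rw [norm_mul, Complex.norm_real, Real.norm_of_nonneg hwn]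
    exact mul_le_mul_of_nonneg_left (hB n le_rfl) hwn
  calc _ = ‖(∑ i ∈ Finset.range n, (w i : ℂ) * f i - w n * ∑ i ∈ Finset.range n, f i) +
        w n * ∑ i ∈ Finset.range n, f i‖ := by congr 1; ring
    _ ≤ _ := norm_add_le _ _
    _ ≤ _ := by linarith

lemma rpow_one_add_inv_le {x : ℝ} (hx : 1 ≤ x) :
    x ^ (1 + 1 / (1 + Real.log x)) ≤ 3 * x := by
  have hl := Real.log_nonneg hx
  have hx0 : 0 < x := by linarith
  rw [Real.rpow_add hx0, Real.rpow_one, mul_comm]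
  gcongr
  rw [Real.rpow_def_of_pos hx0]
  refine le_trans (Real.exp_le_exp.2 (?_ : _ ≤ (1 : ℝ))) (by linarith [Real.exp_one_lt_d9])
  rw [mul_one_div, div_le_one (by positivity)]
  linarith

/-- Removal of the smoothing in a Riesz mean. -/
lemma exists_norm_sum_log_mul_le (m : ℕ) : ∃ C, 0 < C ∧ ∀ (a : ℕ → ℂ) (K : ℝ),
    (∀ n, 1 ≤ n → ‖a n‖ ≤ 1 + Real.log n) → LSeries.abscissaOfAbsConv a ≤ 1 →
    (∀ s : ℂ, 1 < s.re → s.re ≤ 2 →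
      ‖LSeries (LSeries.logMul^[2 * m] a) s‖ ≤ K * (|s.im| + 2) ^ (1 / 2 : ℝ)) →
    ∀ N : ℕ, 1 ≤ N → ‖∑ n ∈ Finset.Icc 1 N, (Real.log n : ℂ) ^ (2 * m) * a n‖ ≤
      C * (1 + K) * N * (1 + Real.log (2 * N)) ^ (m + 1) := by
  set J : ℝ := ∫ y : ℝ, (1 + ‖y‖) ^ (-(3 / 2) : ℝ) with hJ
  have hJ0 : 0 ≤ J := integral_nonneg fun y ↦ by positivity
  refine ⟨60 * J + 1, by positivity, fun a K ha habs hK N hN ↦ ?_⟩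
  have hK0 : 0 ≤ K := by
    have := (norm_nonneg _).trans (hK 2 (by simp) (by simp))
    exact nonneg_of_mul_nonneg_left this (by positivity)
  set b : ℕ → ℂ := LSeries.logMul^[2 * m] a with hb
  have hbn : ∀ n, b n = (Real.log n : ℂ) ^ (2 * m) * a n := fun n ↦ iterate_logMul_apply a (2 * m) n
  simp_rw [← hbn]
  have hR : ∀ x : ℝ, 1 ≤ x →
      ‖∑ n ∈ Finset.Icc 1 ⌊x⌋₊, b n * ((x - n : ℝ) : ℂ)‖ ≤ 12 * J * K * x ^ 2 := by
    intro x hx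
    have hx0 : 0 < x := by linarith
    have hl := Real.log_nonneg hx
    set σ := 1 + 1 / (1 + Real.log x) with hσ
    have hσ1 : 1 < σ := by rw [hσ]; linarith [show 0 < 1 / (1 + Real.log x) by positivity]
    have hσ2 : σ ≤ 2 := by
      have : 1 / (1 + Real.log x) ≤ 1 := by rw [div_le_one (by positivity)]; linarith
      linarith
    have hsum : LSeriesSummable b σ := by
      apply LSeriesSummable_of_abscissaOfAbsConv_lt_re
      rw [hb, LSeries.absicssaOfAbsConv_logPowMul]
      refine habs.trans_lt ?_
      simp only [Complex.ofReal_re]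
      exact_mod_cast hσ1
    have := norm_sum_riesz_le hσ1.le hx0 hsum (K := K) fun y ↦ by
      simpa using hK (σ + y * I) (by simpa using hσ1) (by simpa using hσ2)
    have e1 : ∑ n ∈ Finset.Icc 1 ⌊x⌋₊, b n * ((x - n : ℝ) : ℂ) =
        x * ∑ n ∈ Finset.Icc 1 ⌊x⌋₊, b n * ((1 - n / x : ℝ) : ℂ) := by
      rw [Finset.mul_sum]
      refine Finset.sum_congr rfl fun n _ ↦ ?_
      have : (x : ℂ) ≠ 0 := by exact_mod_cast hx0.ne'
      push_cast; field_simp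
    rw [e1, norm_mul, Complex.norm_real, Real.norm_of_nonneg hx0.le]
    calc _ ≤ x * (4 * J * K * (3 * x)) := by
          gcongr
          refine this.trans ?_
          gcongr
          exact rpow_one_add_inv_le hx
      _ = _ := by ring
  have hN1 : (1 : ℝ) ≤ N := by exact_mod_cast hN
  set l := 1 + Real.log (2 * N) with hl
  have hl1 : 1 ≤ l := by rw [hl]; linarith [Real.log_nonneg (show (1 : ℝ) ≤ 2 * N by linarith)]
  have hbl : ∀ n ∈ Finset.Icc 1 (2 * N), ‖b n‖ ≤ l ^ (2 * m + 1) := by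
    intro n hn
    rw [Finset.mem_Icc] at hn
    have hn1 : (1 : ℝ) ≤ n := by exact_mod_cast hn.1
    have hlog : 0 ≤ Real.log n := Real.log_nonneg hn1
    have hnl : 1 + Real.log n ≤ l := by
      rw [hl]; gcongr; exact_mod_cast hn.2
    rw [hbn, norm_mul, norm_pow, Complex.norm_real, Real.norm_of_nonneg hlog, pow_succ]
    have := ha n hn.1
    gcongr
    · linarith
    · linarith
  set h : ℝ := N / l ^ m with hh
  have hh0 : 0 < h := by positivity
  have hhN : h ≤ N := div_le_self (by positivity) (one_le_pow₀ hl1)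
  have hfl : N ≤ ⌊(N : ℝ) + h⌋₊ := Nat.le_floor (by linarith)
  have hfl2 : ((⌊(N : ℝ) + h⌋₊ : ℕ) : ℝ) ≤ N + h := Nat.floor_le (by positivity)
  have hsplit : ∑ n ∈ Finset.Icc 1 ⌊(N : ℝ) + h⌋₊, b n * ((N + h - n : ℝ) : ℂ) =
      ∑ n ∈ Finset.Icc 1 N, b n * ((N + h - n : ℝ) : ℂ) +
      ∑ n ∈ Finset.Ioc N ⌊(N : ℝ) + h⌋₊, b n * ((N + h - n : ℝ) : ℂ) := by
    rw [← Finset.sum_union]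
    · congr 1; ext n; simp only [Finset.mem_Icc, Finset.mem_union, Finset.mem_Ioc]; omega
    · rw [Finset.disjoint_left]; intro n; simp only [Finset.mem_Icc, Finset.mem_Ioc]; omega
  have hmain : (h : ℂ) * ∑ n ∈ Finset.Icc 1 N, b n =
      ∑ n ∈ Finset.Icc 1 ⌊(N : ℝ) + h⌋₊, b n * ((N + h - n : ℝ) : ℂ) -
      ∑ n ∈ Finset.Icc 1 ⌊(N : ℝ)⌋₊, b n * ((N - n : ℝ) : ℂ) -
      ∑ n ∈ Finset.Ioc N ⌊(N : ℝ) + h⌋₊, b n * ((N + h - n : ℝ) : ℂ) := by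
    rw [hsplit, Nat.floor_natCast, add_sub_right_comm, add_sub_assoc, sub_self, add_zero,
      ← Finset.sum_sub_distrib, Finset.mul_sum]
    refine Finset.sum_congr rfl fun n _ ↦ ?_
    push_cast; ring
  have htail : ‖∑ n ∈ Finset.Ioc N ⌊(N : ℝ) + h⌋₊, b n * ((N + h - n : ℝ) : ℂ)‖ ≤
      h * (l ^ (2 * m + 1) * h) := by
    have : ∀ n ∈ Finset.Ioc N ⌊(N : ℝ) + h⌋₊,
        ‖b n * ((N + h - n : ℝ) : ℂ)‖ ≤ l ^ (2 * m + 1) * h := by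
      intro n hn
      rw [Finset.mem_Ioc] at hn
      have hn1 : (N : ℝ) < n := by exact_mod_cast hn.1
      have hn2 : (n : ℝ) ≤ N + h := (Nat.cast_le.2 hn.2).trans hfl2
      have hn3 : n ≤ 2 * N := by
        have : (n : ℝ) ≤ 2 * N := by linarith
        exact_mod_cast this
      rw [norm_mul, Complex.norm_real, Real.norm_of_nonneg (by linarith)]
      gcongr
      · exact hbl n (Finset.mem_Icc.2 ⟨by omega, hn3⟩)
      · linarith
    refine (norm_sum_le_of_le _ this).trans ?_
    rw [Finset.sum_const, Nat.card_Ioc, nsmul_eq_mul, Nat.cast_sub hfl]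
    gcongr
    linarith
  have hfin : h * ‖∑ n ∈ Finset.Icc 1 N, b n‖ ≤
      12 * J * K * (N + h) ^ 2 + 12 * J * K * N ^ 2 + h * (l ^ (2 * m + 1) * h) := by
    have e : h * ‖∑ n ∈ Finset.Icc 1 N, b n‖ = ‖(h : ℂ) * ∑ n ∈ Finset.Icc 1 N, b n‖ := by
      rw [norm_mul, Complex.norm_real, Real.norm_of_nonneg hh0.le]
    rw [e, hmain]
    refine (norm_sub_le _ _).trans (add_le_add ((norm_sub_le _ _).trans (add_le_add ?_ ?_)) htail)
    · exact hR _ (by linarith)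
    · exact hR _ hN1
  have hlm : 0 < l ^ m := by positivity
  have hhl : h * l ^ m = N := by rw [hh]; field_simp
  have h1 : 12 * J * K * (N + h) ^ 2 + 12 * J * K * N ^ 2 ≤ 60 * J * K * N ^ 2 := by
    have : (N + h) ^ 2 ≤ (2 * N) ^ 2 := by gcongr; linarith
    have h2 : 0 ≤ 12 * J * K := by positivity
    nlinarith
  have h2 : h * ‖∑ n ∈ Finset.Icc 1 N, b n‖ ≤
      h * (60 * J * K * N * l ^ m + N * l ^ (m + 1)) := by
    refine hfin.trans ((add_le_add_left h1 _).trans (le_of_eq ?_))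
    have e1 : l ^ (2 * m + 1) * h = N * l ^ (m + 1) := by rw [← hhl]; ring
    rw [e1]
    have e2 : 60 * J * K * (N : ℝ) ^ 2 = h * (60 * J * K * N * l ^ m) := by
      rw [sq]; nth_rewrite 2 [← hhl]; ring
    rw [e2]; ring
  refine (le_of_mul_le_mul_left h2 hh0).trans ?_
  have h3 : l ^ m ≤ l ^ (m + 1) := pow_le_pow_right₀ hl1 (by omega)
  calc _ ≤ 60 * J * K * N * l ^ (m + 1) + N * l ^ (m + 1) := by gcongr
    _ = (60 * J * K + 1) * N * l ^ (m + 1) := by ring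
    _ ≤ (60 * J + 1) * (1 + K) * N * l ^ (m + 1) := by gcongr; nlinarith

end TwistedBV

namespace TwistedBV

open Complex Set Filter Topology MeasureTheory Asymptotics
open scoped ArithmeticFunction.vonMangoldt

lemma log_pow_le_factorial_mul_sqrt (m : ℕ) {x : ℝ} (hx : 1 ≤ x) :
    Real.log x ^ m ≤ 2 ^ m * m.factorial * √x := by
  have h := Real.pow_div_factorial_le_exp (Real.log x / 2) (by
    have := Real.log_nonneg hx; positivity) m
  have e : Real.exp (Real.log x / 2) = √x := by
    rw [Real.exp_half, Real.exp_log (by linarith)]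
  rw [e, div_pow, div_div, div_le_iff₀ (by positivity)] at h
  linarith

lemma Icc_eq_Ico_succ (N : ℕ) : Finset.Icc 1 N = Finset.Ico 1 (N + 1) := by
  ext; simp only [Finset.mem_Icc, Finset.mem_Ico]; omega

/-- Cancellation in the partial sums of coefficients whose Dirichlet series, along with its
derivatives, grows slowly to the right of the line `Re s = 1`. -/
lemma exists_norm_sum_le_of_LSeries (m : ℕ) : ∃ C, 0 < C ∧ ∀ (a : ℕ → ℂ) (K : ℝ),
    (∀ n, 1 ≤ n → ‖a n‖ ≤ 1 + Real.log n) → LSeries.abscissaOfAbsConv a ≤ 1 →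
    (∀ s : ℂ, 1 < s.re → s.re ≤ 2 →
      ‖LSeries (LSeries.logMul^[2 * m] a) s‖ ≤ K * (|s.im| + 2) ^ (1 / 2 : ℝ)) →
    ∀ N : ℕ, 2 ≤ N → ‖∑ n ∈ Finset.Icc 1 N, a n‖ ≤
      C * (1 + K) * N * Real.log N / Real.log N ^ m := by
  obtain ⟨C, hC, hS⟩ := exists_norm_sum_log_mul_le m
  refine ⟨3 * 2 ^ m * m.factorial + 2 * C * 4 ^ (m + 1) * 4 ^ m, by positivity,
    fun a K ha habs hK N hN ↦ ?_⟩
  have hK0 : 0 ≤ K := by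
    have := (norm_nonneg _).trans (hK 2 (by simp) (by simp))
    exact nonneg_of_mul_nonneg_left this (by positivity)
  replace hS := hS a K ha habs hK
  have hN2 : (2 : ℝ) ≤ N := by exact_mod_cast hN
  set L := Real.log N with hL
  have hL2 : (0.69 : ℝ) ≤ L := by
    have := Real.log_le_log (by norm_num) hN2
    linarith [Real.log_two_gt_d9]
  have hL0 : 0 < L := by linarith
  set M := Nat.sqrt N with hM
  have hM1 : 1 ≤ M := by rw [hM, Nat.le_sqrt]; omega
  have hMN : M ≤ N := Nat.sqrt_le_self N
  have hMsq : (M : ℝ) ≤ √N := Real.nat_sqrt_le_real_sqrt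
  have hMlog : ∀ n : ℕ, M + 1 ≤ n → L / 2 ≤ Real.log n := by
    intro n hn
    have h1 : (N : ℝ) ≤ (n : ℝ) ^ 2 := by
      have : N < (M + 1) ^ 2 := by rw [sq]; exact Nat.lt_succ_sqrt N
      have h2 : (M + 1) ^ 2 ≤ n ^ 2 := Nat.pow_le_pow_left hn 2
      exact_mod_cast (this.trans_le h2).le
    have h2 := Real.log_le_log (by linarith) h1
    rw [Real.log_pow] at h2
    push_cast at h2; linarith
  have hsplit : ∑ n ∈ Finset.Icc 1 N, a n = ∑ n ∈ Finset.Icc 1 M, a n +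
      ∑ i ∈ Finset.range (N - M), ((1 / Real.log (M + 1 + i : ℕ) ^ (2 * m) : ℝ) : ℂ) *
        ((Real.log (M + 1 + i : ℕ) : ℂ) ^ (2 * m) * a (M + 1 + i)) := by
    rw [Icc_eq_Ico_succ, Icc_eq_Ico_succ,
      ← Finset.sum_Ico_consecutive a (show 1 ≤ M + 1 by omega) (show M + 1 ≤ N + 1 by omega),
      Finset.sum_Ico_eq_sum_range a (M + 1) (N + 1), Nat.add_sub_add_right]
    congr 1
    refine Finset.sum_congr rfl fun i _ ↦ ?_
    have : (Real.log (M + 1 + i : ℕ) : ℂ) ≠ 0 := by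
      have := hMlog (M + 1 + i) (by omega)
      exact_mod_cast (show 0 < Real.log (M + 1 + i : ℕ) by linarith).ne'
    push_cast at this ⊢
    field_simp
  have h1 : ‖∑ n ∈ Finset.Icc 1 M, a n‖ ≤ √N * (3 * L) := by
    have : ∀ n ∈ Finset.Icc 1 M, ‖a n‖ ≤ 3 * L := by
      intro n hn
      rw [Finset.mem_Icc] at hn
      refine (ha n hn.1).trans ?_
      have : Real.log n ≤ L := Real.log_le_log (by exact_mod_cast hn.1)
        (by exact_mod_cast hn.2.trans hMN)
      linarith
    refine (norm_sum_le_of_le _ this).trans ?_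
    rw [Finset.sum_const, Nat.card_Icc, nsmul_eq_mul, Nat.add_sub_cancel]
    gcongr
  set B := C * (1 + K) * N * (1 + Real.log (2 * N)) ^ (m + 1) with hBdef
  have hSle : ∀ j, 1 ≤ j → j ≤ N →
      ‖∑ n ∈ Finset.Icc 1 j, (Real.log n : ℂ) ^ (2 * m) * a n‖ ≤ B := by
    intro j hj hjN
    refine (hS j hj).trans ?_
    have hj1 : (1 : ℝ) ≤ j := by exact_mod_cast hj
    have : 0 ≤ Real.log (2 * j) := Real.log_nonneg (by linarith)
    rw [hBdef]
    have hjN' : (j : ℝ) ≤ N := by exact_mod_cast hjN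
    gcongr
  have h2 : ‖∑ i ∈ Finset.range (N - M), ((1 / Real.log (M + 1 + i : ℕ) ^ (2 * m) : ℝ) : ℂ) *
        ((Real.log (M + 1 + i : ℕ) : ℂ) ^ (2 * m) * a (M + 1 + i))‖ ≤
      1 / Real.log (M + 1 + 0 : ℕ) ^ (2 * m) * (2 * B) := by
    refine norm_sum_antitone_mul_le
      (w := fun i ↦ 1 / Real.log (M + 1 + i : ℕ) ^ (2 * m))
      (f := fun i ↦ (Real.log (M + 1 + i : ℕ) : ℂ) ^ (2 * m) * a (M + 1 + i)) ?_ ?_ ?_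
    · intro i _
      have := hMlog (M + 1 + i) (by omega)
      have h3 : 0 < Real.log (M + 1 + i : ℕ) := by linarith
      have h4 : Real.log (M + 1 + i : ℕ) ≤ Real.log (M + 1 + (i + 1) : ℕ) :=
        Real.log_le_log (by positivity) (by push_cast; linarith)
      exact one_div_le_one_div_of_le (by positivity) (by gcongr)
    · have := hMlog (M + 1 + (N - M)) (by omega)
      positivity
    · intro j hj
      have e : ∑ i ∈ Finset.range j, (Real.log (M + 1 + i : ℕ) : ℂ) ^ (2 * m) * a (M + 1 + i) =
          ∑ n ∈ Finset.Icc 1 (M + j), (Real.log n : ℂ) ^ (2 * m) * a n -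
          ∑ n ∈ Finset.Icc 1 M, (Real.log n : ℂ) ^ (2 * m) * a n := by
        rw [Icc_eq_Ico_succ, Icc_eq_Ico_succ,
          ← Finset.sum_Ico_consecutive _ (show 1 ≤ M + 1 by omega)
            (show M + 1 ≤ M + j + 1 by omega),
          Finset.sum_Ico_eq_sum_range _ (M + 1) (M + j + 1), add_sub_cancel_left]
        congr 2; omega
      rw [e]
      refine (norm_sub_le _ _).trans ?_
      linarith [hSle (M + j) (by omega) (by omega), hSle M hM1 hMN]
  have hlogM : L / 2 ≤ Real.log (M + 1 + 0 : ℕ) := hMlog _ (by omega)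
  have hl4 : 1 + Real.log (2 * N) ≤ 4 * L := by
    rw [Real.log_mul (by norm_num) (by positivity)]
    linarith [Real.log_two_lt_d9]
  have h0l : 0 ≤ 1 + Real.log (2 * N) := by
    have := Real.log_nonneg (show (1 : ℝ) ≤ 2 * N by linarith); linarith
  have hlm : 0 < L ^ m := by positivity
  rw [hsplit, le_div_iff₀ hlm]
  have h3 : 1 / Real.log (M + 1 + 0 : ℕ) ^ (2 * m) * (2 * B) * L ^ m ≤
      2 * C * 4 ^ (m + 1) * 4 ^ m * (1 + K) * N * L := by
    calc _ ≤ 1 / (L / 2) ^ (2 * m) * (2 * (C * (1 + K) * N * (4 * L) ^ (m + 1))) * L ^ m := by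
          rw [hBdef]; gcongr
      _ = _ := by
          rw [div_pow, mul_pow, show (2 : ℝ) ^ (2 * m) = 4 ^ m by rw [pow_mul]; norm_num,
            show L ^ (2 * m) = L ^ m * L ^ m by ring]
          field_simp
          ring
  have h4 : √N * (3 * L) * L ^ m ≤ 3 * 2 ^ m * m.factorial * (1 + K) * N * L := by
    have := log_pow_le_factorial_mul_sqrt m (show (1 : ℝ) ≤ N by linarith)
    calc √N * (3 * L) * L ^ m ≤ √N * (3 * L) * (2 ^ m * m.factorial * √N) := by gcongr
      _ = 3 * 2 ^ m * m.factorial * (√N * √N) * L := by ring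
      _ = 3 * 2 ^ m * m.factorial * 1 * N * L := by
          rw [Real.mul_self_sqrt (by positivity)]; ring
      _ ≤ _ := by gcongr; linarith
  calc _ ≤ (√N * (3 * L) + 1 / Real.log (M + 1 + 0 : ℕ) ^ (2 * m) * (2 * B)) * L ^ m := by
        gcongr; exact (norm_add_le _ _).trans (add_le_add h1 h2)
    _ ≤ _ := by rw [add_mul]; linarith

lemma exists_norm_sum_char_mul_vonMangoldt_le (A : ℕ) : ∃ C, 0 < C ∧
    ∀ (q : ℕ) [NeZero q] (χ : DirichletCharacter ℂ q), χ ≠ 1 → ∀ N : ℕ, 2 ≤ N →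
    ‖∑ n ∈ Finset.Icc 1 N, χ n * (Λ n : ℂ)‖ ≤ C * q * N / Real.log N ^ A := by
  obtain ⟨C, hC, h⟩ := exists_norm_sum_le_of_LSeries (A + 1)
  obtain ⟨K, hK, hk⟩ := exists_norm_LSeries_twist_le (ε := 1 / 2) (by norm_num) (2 * (A + 1))
  refine ⟨C * (1 + K), by positivity, fun q _ χ hχ N hN ↦ ?_⟩
  have hq : (1 : ℝ) ≤ q := by exact_mod_cast NeZero.one_le
  have hL : 0 < Real.log N := Real.log_pos (by exact_mod_cast hN)
  refine (h (fun n ↦ χ n * (Λ n : ℂ)) (K * q) ?_ ?_ ?_ N hN).trans ?_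
  · intro n hn
    have h0 := ArithmeticFunction.vonMangoldt_nonneg (n := n)
    have h1 := ArithmeticFunction.vonMangoldt_le_log (n := n)
    rw [norm_mul, Complex.norm_real, Real.norm_of_nonneg h0]
    nlinarith [DirichletCharacter.norm_le_one χ (n : ZMod q)]
  · exact abscissa_le_one_of_summable fun s hs ↦
      DirichletCharacter.LSeriesSummable_twist_vonMangoldt χ hs
  · intro s h1 h2
    refine (hk q χ s hχ h1 h2).trans ?_
    rw [Real.mul_rpow (by positivity) (by positivity), mul_assoc]
    gcongr
    calc (q : ℝ) ^ (1 / 2 : ℝ) ≤ (q : ℝ) ^ (1 : ℝ) :=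
          Real.rpow_le_rpow_of_exponent_le hq (by norm_num)
      _ = q := Real.rpow_one _
  · rw [div_le_div_iff₀ (by positivity) (by positivity), pow_succ]
    have : 1 + K * q ≤ (1 + K) * q := by nlinarith
    calc C * (1 + K * q) * N * Real.log N * Real.log N ^ A
        ≤ C * ((1 + K) * q) * N * Real.log N * Real.log N ^ A := by gcongr
      _ = _ := by ring

lemma exists_abs_sum_vonMangoldt_sub_le (A : ℕ) : ∃ C, 0 < C ∧ ∀ N : ℕ, 2 ≤ N →
    |∑ n ∈ Finset.Icc 1 N, Λ n - N| ≤ C * N / Real.log N ^ A := by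
  obtain ⟨C, hC, h⟩ := exists_norm_sum_le_of_LSeries (A + 1)
  obtain ⟨K, hK, hk⟩ := exists_norm_LSeries_vonMangoldt_sub_one_le (ε := 1 / 2) (by norm_num)
    (2 * (A + 1))
  refine ⟨C * (1 + K), by positivity, fun N hN ↦ ?_⟩
  have hL : 0 < Real.log N := Real.log_pos (by exact_mod_cast hN)
  have h1 := h (fun n ↦ (Λ n : ℂ) - 1) K (fun n hn ↦ ?_)
    (abscissa_le_one_of_summable fun s hs ↦ summable_vonMangoldt_sub_one hs) hk N hN
  · have e : ∑ n ∈ Finset.Icc 1 N, ((Λ n : ℂ) - 1) =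
        ((∑ n ∈ Finset.Icc 1 N, Λ n - N : ℝ) : ℂ) := by
      push_cast; simp
    rw [e, Complex.norm_real, Real.norm_eq_abs] at h1
    refine h1.trans (le_of_eq ?_)
    rw [pow_succ]; field_simp
  · have h0 := ArithmeticFunction.vonMangoldt_nonneg (n := n)
    have h1 := ArithmeticFunction.vonMangoldt_le_log (n := n)
    refine (norm_sub_le _ _).trans ?_
    rw [Complex.norm_real, Real.norm_of_nonneg h0, norm_one]
    linarith

lemma natLog_two_le {N : ℕ} (hN : 1 ≤ N) : (Nat.log 2 N : ℝ) ≤ 2 * Real.log N := by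
  have h : (2 : ℝ) ^ Nat.log 2 N ≤ N := by exact_mod_cast Nat.pow_log_le_self 2 (by omega)
  have h2 := Real.log_le_log (by positivity) h
  rw [Real.log_pow] at h2
  have : (0 : ℝ) ≤ Nat.log 2 N := by positivity
  nlinarith [Real.log_two_gt_d9]

/-- Prime powers not coprime to the modulus contribute little. -/
lemma sum_vonMangoldt_not_coprime_le {q : ℕ} (hq : q ≠ 0) {N : ℕ} (hN : 1 ≤ N) :
    ∑ n ∈ (Finset.Icc 1 N).filter (fun n ↦ ¬ n.Coprime q), Λ n ≤
      2 * Nat.log 2 q * Real.log N ^ 2 := by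
  classical
  rw [← Finset.sum_filter_ne_zero]
  set T := ((Finset.Icc 1 N).filter (fun n ↦ ¬ n.Coprime q)).filter (fun n ↦ Λ n ≠ 0) with hT
  have hsub : T ⊆ (q.primeFactors ×ˢ Finset.Icc 1 (Nat.log 2 N)).image (fun x ↦ x.1 ^ x.2) := by
    intro n hn
    simp only [hT, Finset.mem_filter, Finset.mem_Icc, ArithmeticFunction.vonMangoldt_ne_zero_iff]
      at hn
    obtain ⟨⟨⟨-, hnN⟩, hco⟩, hpp⟩ := hn
    obtain ⟨p, k, hp, hk, rfl⟩ := (isPrimePow_nat_iff n).1 hpp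
    rw [Finset.mem_image]
    refine ⟨(p, k), ?_, rfl⟩
    rw [Finset.mem_product, Nat.mem_primeFactors, Finset.mem_Icc]
    refine ⟨⟨hp, ?_, hq⟩, hk, ?_⟩
    · by_contra hdvd
      exact hco (Nat.Coprime.pow_left k ((Nat.Prime.coprime_iff_not_dvd hp).2 hdvd))
    · exact Nat.le_log_of_pow_le (by norm_num)
        ((Nat.pow_le_pow_left hp.two_le k).trans hnN)
  have hcard : (T.card : ℝ) ≤ Nat.log 2 q * (2 * Real.log N) := by
    have h1 := (Finset.card_le_card hsub).trans Finset.card_image_le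
    rw [Finset.card_product, Nat.card_Icc, Nat.add_sub_cancel] at h1
    have h2 := card_primeFactors_le_log q
    calc (T.card : ℝ) ≤ (q.primeFactors.card : ℝ) * (Nat.log 2 N : ℝ) := by exact_mod_cast h1
      _ ≤ Nat.log 2 q * (2 * Real.log N) := by
        gcongr
        exact natLog_two_le hN
  have hle : ∀ n ∈ T, Λ n ≤ Real.log N := by
    intro n hn
    simp only [hT, Finset.mem_filter, Finset.mem_Icc] at hn
    exact ArithmeticFunction.vonMangoldt_le_log.trans
      (Real.log_le_log (by exact_mod_cast hn.1.1.1) (by exact_mod_cast hn.1.1.2))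
  refine (Finset.sum_le_card_nsmul T _ _ hle).trans ?_
  rw [nsmul_eq_mul]
  have := Real.log_nonneg (show (1 : ℝ) ≤ N by exact_mod_cast hN)
  calc _ ≤ Nat.log 2 q * (2 * Real.log N) * Real.log N := by gcongr
    _ = _ := by ring

/-- The Siegel–Walfisz theorem, with polynomial dependence on the modulus. -/
theorem siegel_walfisz (A : ℕ) : ∃ C, 0 < C ∧ ∀ (q : ℕ) [NeZero q] (a : ZMod q), IsUnit a →
    ∀ N : ℕ, 2 ≤ N →
    |∑ n ∈ (Finset.Icc 1 N).filter (fun n : ℕ ↦ (n : ZMod q) = a), Λ n - N / q.totient| ≤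
      C * q * N / Real.log N ^ A := by
  classical
  obtain ⟨C₁, hC₁, h₁⟩ := exists_norm_sum_char_mul_vonMangoldt_le A
  obtain ⟨C₂, hC₂, h₂⟩ := exists_abs_sum_vonMangoldt_sub_le A
  refine ⟨C₁ + C₂ + 2 * (2 ^ (A + 2) * (A + 2).factorial), by positivity,
    fun q _ a ha N hN ↦ ?_⟩
  have hq : (1 : ℝ) ≤ q := by exact_mod_cast NeZero.one_le
  have hN1 : (1 : ℝ) ≤ N := by exact_mod_cast (by omega : 1 ≤ N)
  have hL : 0 < Real.log N := Real.log_pos (by exact_mod_cast hN)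
  set φ : ℕ := q.totient with hφ
  have hφ0 : 0 < φ := Nat.totient_pos.2 (Nat.pos_of_ne_zero (NeZero.ne q))
  have hφ0' : (0 : ℝ) < φ := by exact_mod_cast hφ0
  have hφc : (φ : ℂ) ≠ 0 := by exact_mod_cast hφ0.ne'
  set S := ∑ n ∈ (Finset.Icc 1 N).filter (fun n : ℕ ↦ (n : ZMod q) = a), Λ n with hS
  have horth : (φ : ℂ) * (S : ℂ) = ∑ χ : DirichletCharacter ℂ q,
      χ a⁻¹ * ∑ n ∈ Finset.Icc 1 N, χ n * (Λ n : ℂ) := by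
    simp_rw [Finset.mul_sum]
    rw [Finset.sum_comm, hS, Finset.sum_filter]
    push_cast
    rw [Finset.mul_sum]
    refine Finset.sum_congr rfl fun n _ ↦ ?_
    simp_rw [← mul_assoc]
    rw [← Finset.sum_mul, DirichletCharacter.sum_char_inv_mul_char_eq ℂ ha]
    by_cases h : (n : ZMod q) = a
    · simp [h, hφ]
    · simp [h, Ne.symm h]
  rw [← Finset.add_sum_erase _ _ (Finset.mem_univ (1 : DirichletCharacter ℂ q))] at horth
  have hinv : (1 : DirichletCharacter ℂ q) a⁻¹ = 1 := by
    have : IsUnit a⁻¹ := by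
      obtain ⟨u, rfl⟩ := ha
      exact ⟨u⁻¹, (ZMod.inv_coe_unit u).symm⟩
    exact MulChar.one_apply this
  have hprin : ∑ n ∈ Finset.Icc 1 N, (1 : DirichletCharacter ℂ q) n * (Λ n : ℂ) =
      ((∑ n ∈ Finset.Icc 1 N, Λ n -
        ∑ n ∈ (Finset.Icc 1 N).filter (fun n ↦ ¬ n.Coprime q), Λ n : ℝ) : ℂ) := by
    rw [Finset.sum_filter, ← Finset.sum_sub_distrib]
    push_cast
    refine Finset.sum_congr rfl fun n _ ↦ ?_
    by_cases h : n.Coprime q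
    · have : (1 : DirichletCharacter ℂ q) n = 1 :=
        MulChar.one_apply ((ZMod.isUnit_iff_coprime n q).2 h)
      simp [h, this]
    · have : (1 : DirichletCharacter ℂ q) n = 0 :=
        MulChar.map_nonunit _ fun h' ↦ h ((ZMod.isUnit_iff_coprime n q).1 h')
      simp [h, this]
  rw [hinv, one_mul, hprin] at horth
  set P := ∑ n ∈ (Finset.Icc 1 N).filter (fun n ↦ ¬ n.Coprime q), Λ n with hP
  have hP0 : 0 ≤ P := Finset.sum_nonneg fun n _ ↦ ArithmeticFunction.vonMangoldt_nonneg
  have hPle := sum_vonMangoldt_not_coprime_le (NeZero.ne q) (show 1 ≤ N by omega)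
  rw [← hP] at hPle
  set E := C₁ * q * N / Real.log N ^ A with hE
  have hrest : ‖∑ χ ∈ Finset.univ.erase (1 : DirichletCharacter ℂ q),
      χ a⁻¹ * ∑ n ∈ Finset.Icc 1 N, χ n * (Λ n : ℂ)‖ ≤ φ * E := by
    have : ∀ χ ∈ Finset.univ.erase (1 : DirichletCharacter ℂ q),
        ‖χ a⁻¹ * ∑ n ∈ Finset.Icc 1 N, χ n * (Λ n : ℂ)‖ ≤ E := by
      intro χ hχ
      rw [norm_mul]
      have h3 := h₁ q χ (Finset.ne_of_mem_erase hχ) N hN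
      have h4 := DirichletCharacter.norm_le_one χ a⁻¹
      calc _ ≤ 1 * E := by gcongr
        _ = E := one_mul _
    refine (norm_sum_le_of_le _ this).trans ?_
    rw [Finset.sum_const, nsmul_eq_mul]
    have hcard : (Finset.univ.erase (1 : DirichletCharacter ℂ q)).card ≤ φ := by
      refine (Finset.card_le_card (Finset.erase_subset _ _)).trans (le_of_eq ?_)
      rw [Finset.card_univ, ← Nat.card_eq_fintype_card,
        DirichletCharacter.card_eq_totient_of_hasEnoughRootsOfUnity ℂ q]
    gcongr
  have hmain : (φ : ℝ) * |S - N / φ| ≤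
      |∑ n ∈ Finset.Icc 1 N, Λ n - N| + P + φ * E := by
    have e : (φ : ℝ) * |S - N / φ| = ‖(φ : ℂ) * S - N‖ := by
      rw [← abs_of_pos hφ0', ← abs_mul, abs_of_pos hφ0', ← Real.norm_eq_abs, ← Complex.norm_real]
      congr 1; push_cast; field_simp
    rw [e, horth]
    set R := ∑ χ ∈ Finset.univ.erase (1 : DirichletCharacter ℂ q),
      χ a⁻¹ * ∑ n ∈ Finset.Icc 1 N, χ n * (Λ n : ℂ) with hR
    have e2 : (((∑ n ∈ Finset.Icc 1 N, Λ n - P : ℝ) : ℂ) + R - N) =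
        ((∑ n ∈ Finset.Icc 1 N, Λ n - N : ℝ) : ℂ) - (P : ℂ) + R := by
      push_cast; ring
    rw [e2]
    refine (norm_add_le _ _).trans (add_le_add ((norm_sub_le _ _).trans ?_) hrest)
    rw [Complex.norm_real, Complex.norm_real, Real.norm_eq_abs, Real.norm_of_nonneg hP0]
  have hP2 : P ≤ 2 * (2 ^ (A + 2) * (A + 2).factorial) * q * N / Real.log N ^ A := by
    refine hPle.trans ?_
    rw [le_div_iff₀ (by positivity)]
    have h5 := log_pow_le_factorial_mul_sqrt (A + 2) hN1
    have h6 : √(N : ℝ) ≤ N := Real.sqrt_le_iff.2 ⟨by positivity, by nlinarith⟩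
    have h8 : (Nat.log 2 q : ℝ) ≤ q := by exact_mod_cast Nat.log_le_self 2 q
    calc 2 * Nat.log 2 q * Real.log N ^ 2 * Real.log N ^ A
        ≤ 2 * q * Real.log N ^ 2 * Real.log N ^ A := by gcongr
      _ = 2 * q * Real.log N ^ (A + 2) := by ring
      _ ≤ 2 * q * (2 ^ (A + 2) * (A + 2).factorial * N) := by
        gcongr; exact h5.trans (by gcongr)
      _ = _ := by ring
  have h7 : |∑ n ∈ Finset.Icc 1 N, Λ n - N| ≤ C₂ * q * N / Real.log N ^ A := by
    refine (h₂ N hN).trans ?_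
    gcongr
    exact le_mul_of_one_le_right hC₂.le hq
  set W : ℝ := q * N / Real.log N ^ A with hW
  have hW0 : 0 ≤ W := by positivity
  have hφ1 : (1 : ℝ) ≤ φ := by exact_mod_cast hφ0
  have h8 : (φ : ℝ) * |S - N / φ| ≤
      φ * ((C₁ + C₂ + 2 * (2 ^ (A + 2) * (A + 2).factorial)) * W) := by
    calc _ ≤ C₂ * W + 2 * (2 ^ (A + 2) * (A + 2).factorial) * W + φ * (C₁ * W) := by
          refine hmain.trans (add_le_add (add_le_add (h7.trans ?_) (hP2.trans ?_)) ?_)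
          · rw [hW, mul_div_assoc', mul_assoc]
          · rw [hW, mul_div_assoc', mul_assoc (2 * _)]
          · exact le_of_eq (by rw [hE, hW]; ring)
      _ ≤ φ * (C₂ * W + 2 * (2 ^ (A + 2) * (A + 2).factorial) * W) + φ * (C₁ * W) := by
          gcongr
          exact le_mul_of_one_le_left (by positivity) hφ1
      _ = _ := by ring
  refine (le_of_mul_le_mul_left h8 hφ0').trans (le_of_eq ?_)
  rw [hW, mul_div_assoc', mul_assoc _ (q : ℝ)]

end TwistedBV

namespace TwistedBV

open Finset
open scoped ArithmeticFunction.vonMangoldt ArithmeticFunction.Moebius ArithmeticFunction.zeta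

lemma sum_inv_Icc_le (N : ℕ) : ∑ n ∈ Icc 1 N, (1 / n : ℝ) ≤ 1 + Real.log N := by
  have h := harmonic_le_one_add_log N
  rw [harmonic_eq_sum_Icc] at h
  push_cast at h
  simpa [one_div] using h

lemma sum_inv_multiples_le {g : ℕ} (hg : 1 ≤ g) (D : ℕ) :
    ∑ d ∈ (Icc 1 D).filter (g ∣ ·), (1 / d : ℝ) ≤ 1 / g * (1 + Real.log D) := by
  have hsub : (Icc 1 D).filter (g ∣ ·) ⊆ (Icc 1 D).image (g * ·) := by
    intro d hd
    rw [mem_filter, mem_Icc] at hd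
    obtain ⟨⟨h1, h2⟩, k, rfl⟩ := hd
    have hk : 1 ≤ k := Nat.pos_of_ne_zero (by rintro rfl; simp at h1)
    exact mem_image.2 ⟨k, mem_Icc.2 ⟨hk, (Nat.le_mul_of_pos_left k hg).trans h2⟩, rfl⟩
  refine (sum_le_sum_of_subset_of_nonneg hsub fun _ _ _ ↦ by positivity).trans ?_
  rw [sum_image fun x _ y _ h ↦ Nat.eq_of_mul_eq_mul_left hg h]
  have : ∀ k ∈ Icc 1 D, (1 / ((g * k : ℕ) : ℝ)) = 1 / g * (1 / k) := by
    intro k _; push_cast; rw [one_div_mul_one_div]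
  rw [sum_congr rfl this, ← mul_sum]
  gcongr
  exact sum_inv_Icc_le D

lemma sum_inv_lcm_le (D : ℕ) :
    ∑ d₁ ∈ Icc 1 D, ∑ d₂ ∈ Icc 1 D, (1 / (d₁.lcm d₂ : ℕ) : ℝ) ≤ (1 + Real.log D) ^ 3 := by
  rcases Nat.eq_zero_or_pos D with rfl | hD
  · simp
  have hlog : 0 ≤ Real.log D := Real.log_nonneg (by exact_mod_cast hD)
  have h1 : ∀ d₁ ∈ Icc 1 D, ∀ d₂ ∈ Icc 1 D, (1 / (d₁.lcm d₂ : ℕ) : ℝ) ≤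
      ∑ g ∈ Icc 1 D, (if g ∣ d₁ then (1 / d₁ : ℝ) else 0) *
        (if g ∣ d₂ then (1 / d₂ : ℝ) else 0) * g := by
    intro d₁ hd₁ d₂ hd₂
    rw [mem_Icc] at hd₁ hd₂
    have hg : d₁.gcd d₂ ∈ Icc 1 D :=
      mem_Icc.2 ⟨Nat.gcd_pos_of_pos_left _ hd₁.1, (Nat.gcd_le_left _ hd₁.1).trans hd₁.2⟩
    refine le_trans (le_of_eq ?_) (single_le_sum (f := fun g : ℕ ↦
      (if g ∣ d₁ then (1 / d₁ : ℝ) else 0) * (if g ∣ d₂ then (1 / d₂ : ℝ) else 0) * g)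
      (fun g _ ↦ by positivity) hg)
    simp only [Nat.gcd_dvd_left, Nat.gcd_dvd_right, if_true]
    have hmul : ((d₁.gcd d₂ : ℕ) : ℝ) * (d₁.lcm d₂ : ℕ) = d₁ * d₂ := by
      exact_mod_cast Nat.gcd_mul_lcm d₁ d₂
    have hl : ((d₁.lcm d₂ : ℕ) : ℝ) ≠ 0 := by
      exact_mod_cast Nat.lcm_ne_zero (by omega) (by omega)
    have h2 : (d₁ : ℝ) ≠ 0 := by exact_mod_cast (by omega : d₁ ≠ 0)
    have h3 : (d₂ : ℝ) ≠ 0 := by exact_mod_cast (by omega : d₂ ≠ 0)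
    field_simp
    linarith
  calc _ ≤ ∑ d₁ ∈ Icc 1 D, ∑ d₂ ∈ Icc 1 D, ∑ g ∈ Icc 1 D,
        (if g ∣ d₁ then (1 / d₁ : ℝ) else 0) * (if g ∣ d₂ then (1 / d₂ : ℝ) else 0) * g :=
        sum_le_sum fun d₁ hd₁ ↦ sum_le_sum fun d₂ hd₂ ↦ h1 d₁ hd₁ d₂ hd₂
    _ = ∑ g ∈ Icc 1 D, (∑ d ∈ (Icc 1 D).filter (g ∣ ·), (1 / d : ℝ)) *
        (∑ d ∈ (Icc 1 D).filter (g ∣ ·), (1 / d : ℝ)) * g := by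
        rw [sum_congr rfl fun d₁ _ ↦ sum_comm, sum_comm]
        refine sum_congr rfl fun g _ ↦ ?_
        rw [sum_filter, sum_mul_sum, sum_mul]
        exact sum_congr rfl fun _ _ ↦ by rw [sum_mul]
    _ ≤ ∑ g ∈ Icc 1 D, (1 / g * (1 + Real.log D)) * (1 / g * (1 + Real.log D)) * g := by
        refine sum_le_sum fun g hg ↦ ?_
        rw [mem_Icc] at hg
        have := sum_inv_multiples_le hg.1 D
        have h0 : 0 ≤ ∑ d ∈ (Icc 1 D).filter (g ∣ ·), (1 / d : ℝ) :=
          sum_nonneg fun _ _ ↦ by positivity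
        gcongr
    _ = (∑ g ∈ Icc 1 D, (1 / g : ℝ)) * (1 + Real.log D) ^ 2 := by
        rw [sum_mul]
        refine sum_congr rfl fun g hg ↦ ?_
        rw [mem_Icc] at hg
        have : (g : ℝ) ≠ 0 := by exact_mod_cast (by omega : g ≠ 0)
        field_simp
    _ ≤ (1 + Real.log D) * (1 + Real.log D) ^ 2 := by
        gcongr; exact sum_inv_Icc_le D
    _ = _ := by ring

lemma card_multiples_le {q : ℕ} (N : ℕ) :
    (((Icc 1 N).filter (q ∣ ·)).card : ℝ) ≤ N * (1 / q) := by
  have h : ((Icc 1 N).filter (q ∣ ·)).card = N / q := by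
    rw [← Nat.Ioc_filter_dvd_card_eq_div N q]; rfl
  rw [h, mul_one_div]
  exact Nat.cast_div_le

lemma sum_card_divisors_sq_le (N : ℕ) :
    ∑ m ∈ Icc 1 N, (m.divisors.card : ℝ) ^ 2 ≤ N * (1 + Real.log N) ^ 3 := by
  have h1 : ∀ m ∈ Icc 1 N, (m.divisors.card : ℝ) ^ 2 =
      ∑ d₁ ∈ Icc 1 N, ∑ d₂ ∈ Icc 1 N, if d₁.lcm d₂ ∣ m then (1 : ℝ) else 0 := by
    intro m hm
    rw [mem_Icc] at hm
    have h2 : m.divisors = (Icc 1 N).filter (· ∣ m) := by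
      ext d
      simp only [Nat.mem_divisors, mem_filter, mem_Icc]
      constructor
      · rintro ⟨h, _⟩
        exact ⟨⟨Nat.pos_of_dvd_of_pos h hm.1, (Nat.le_of_dvd hm.1 h).trans hm.2⟩, h⟩
      · rintro ⟨_, h⟩; exact ⟨h, by omega⟩
    have h3 : (m.divisors.card : ℝ) = ∑ d ∈ Icc 1 N, if d ∣ m then (1 : ℝ) else 0 := by
      rw [h2, card_filter]; push_cast; rfl
    rw [h3, sq, sum_mul_sum]
    refine sum_congr rfl fun d₁ _ ↦ sum_congr rfl fun d₂ _ ↦ ?_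
    simp only [Nat.lcm_dvd_iff]
    split_ifs <;> simp_all
  rw [sum_congr rfl h1, sum_comm, sum_congr rfl fun d₁ _ ↦ sum_comm]
  calc _ ≤ ∑ d₁ ∈ Icc 1 N, ∑ d₂ ∈ Icc 1 N, (N * (1 / (d₁.lcm d₂ : ℕ)) : ℝ) := by
        refine sum_le_sum fun d₁ _ ↦ sum_le_sum fun d₂ _ ↦ ?_
        rw [← sum_filter, sum_const, nsmul_eq_mul, mul_one]
        exact card_multiples_le N
    _ = N * ∑ d₁ ∈ Icc 1 N, ∑ d₂ ∈ Icc 1 N, (1 / (d₁.lcm d₂ : ℕ) : ℝ) := by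
        simp_rw [mul_sum]
    _ ≤ _ := by gcongr; exact sum_inv_lcm_le N

/-- Summation of a Dirichlet convolution against an arbitrary weight. -/
lemma sum_mul_arith_eq (f g : ArithmeticFunction ℝ) (Φ : ℕ → ℂ) (N : ℕ) :
    ∑ n ∈ Icc 1 N, ((f * g) n : ℂ) * Φ n =
      ∑ m ∈ Icc 1 N, (f m : ℂ) * ∑ n ∈ Icc 1 (N / m), (g n : ℂ) * Φ (m * n) := by
  simp_rw [ArithmeticFunction.mul_apply, mul_sum]
  push_cast
  simp_rw [sum_mul]
  rw [sum_sigma', sum_sigma']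
  refine sum_bij' (fun x _ ↦ ⟨x.2.1, x.2.2⟩) (fun x _ ↦ ⟨x.1 * x.2, (x.1, x.2)⟩) ?_ ?_ ?_ ?_ ?_
  · rintro ⟨n, a, b⟩ h
    simp only [mem_sigma, mem_Icc, Nat.mem_divisorsAntidiagonal] at h ⊢
    obtain ⟨⟨h1, h2⟩, rfl, h3⟩ := h
    have ha : 0 < a := Nat.pos_of_ne_zero (by rintro rfl; simp at h3)
    have hb : 0 < b := Nat.pos_of_ne_zero (by rintro rfl; simp at h3)
    refine ⟨⟨ha, (Nat.le_mul_of_pos_right a hb).trans h2⟩, hb, ?_⟩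
    rw [Nat.le_div_iff_mul_le ha, mul_comm]; exact h2
  · rintro ⟨a, b⟩ h
    simp only [mem_sigma, mem_Icc, Nat.mem_divisorsAntidiagonal] at h ⊢
    obtain ⟨⟨h1, h2⟩, h3, h4⟩ := h
    rw [Nat.le_div_iff_mul_le (by omega), mul_comm] at h4
    have : 0 < a * b := Nat.mul_pos (by omega) (by omega)
    exact ⟨⟨this, h4⟩, trivial, this.ne'⟩
  · rintro ⟨n, a, b⟩ h
    simp only [mem_sigma, Nat.mem_divisorsAntidiagonal] at h
    obtain ⟨_, rfl, _⟩ := h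
    rfl
  · rintro ⟨a, b⟩ _; rfl
  · rintro ⟨n, a, b⟩ h
    simp only [mem_sigma, Nat.mem_divisorsAntidiagonal] at h
    obtain ⟨_, rfl, _⟩ := h
    ring

lemma arith_sub_apply (f g : ArithmeticFunction ℝ) (n : ℕ) : (f - g) n = f n - g n := by
  rw [sub_eq_add_neg, ArithmeticFunction.add_apply, ArithmeticFunction.neg_apply, sub_eq_add_neg]

/-- Truncation of an arithmetic function to arguments at most `U`. -/
noncomputable def truncate (U : ℕ) (f : ArithmeticFunction ℝ) : ArithmeticFunction ℝ :=
  ⟨fun n ↦ if n ≤ U then f n else 0, by simp⟩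

lemma truncate_apply (U : ℕ) (f : ArithmeticFunction ℝ) (n : ℕ) :
    truncate U f n = if n ≤ U then f n else 0 := rfl

/-- The coefficients of the first variable in the bilinear part of Vaughan's identity. -/
noncomputable def bilinearCoeff (U : ℕ) : ArithmeticFunction ℝ :=
  ((μ : ArithmeticFunction ℝ) - truncate U μ) * ζ

lemma vaughan_identity (U V : ℕ) :
    Λ = truncate V Λ + truncate U μ * ArithmeticFunction.log -
      truncate U μ * truncate V Λ * ζ + bilinearCoeff U * (Λ - truncate V Λ) := by
  have h1 : (μ * ζ : ArithmeticFunction ℝ) = 1 := ArithmeticFunction.coe_moebius_mul_coe_zeta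
  have h2 : (Λ * ζ : ArithmeticFunction ℝ) = ArithmeticFunction.log :=
    ArithmeticFunction.vonMangoldt_mul_zeta
  rw [bilinearCoeff, ← h2]
  linear_combination (truncate V Λ - Λ) * h1

lemma abs_moebius_le_one (n : ℕ) : |((μ n : ℤ) : ℝ)| ≤ 1 := by
  exact_mod_cast ArithmeticFunction.abs_moebius_le_one (n := n)

lemma abs_bilinearCoeff_le (U m : ℕ) : |bilinearCoeff U m| ≤ m.divisors.card := by
  rw [bilinearCoeff, ArithmeticFunction.coe_mul_zeta_apply]
  refine (abs_sum_le_sum_abs _ _).trans ?_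
  rw [card_eq_sum_ones]
  push_cast
  refine sum_le_sum fun d _ ↦ ?_
  rw [arith_sub_apply, truncate_apply, ArithmeticFunction.intCoe_apply]
  split_ifs
  · simp
  · simpa using abs_moebius_le_one d

lemma bilinearCoeff_eq_zero {U m : ℕ} (hm : m ≤ U) : bilinearCoeff U m = 0 := by
  rw [bilinearCoeff, ArithmeticFunction.coe_mul_zeta_apply]
  refine sum_eq_zero fun d hd ↦ ?_
  have : d ≤ U := (Nat.divisor_le hd).trans hm
  rw [arith_sub_apply, truncate_apply, if_pos this, sub_self]

lemma norm_sum_log_mul_le {f : ℕ → ℂ} {B : ℝ} {Y : ℕ}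
    (hB : ∀ y ≤ Y, ‖∑ e ∈ Icc 1 y, f e‖ ≤ B) :
    ‖∑ e ∈ Icc 1 Y, (Real.log e : ℂ) * f e‖ ≤ 2 * Real.log Y * B := by
  rcases Nat.eq_zero_or_pos Y with rfl | hY
  · simp
  have hlog : 0 ≤ Real.log Y := Real.log_nonneg (by exact_mod_cast hY)
  have hr : ∀ (g : ℕ → ℂ) (y : ℕ), ∑ e ∈ Icc 1 y, g e = ∑ i ∈ range y, g (1 + i) := by
    intro g y
    rw [Icc_eq_Ico_succ, sum_Ico_eq_sum_range, Nat.add_sub_cancel]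
  have h1 := norm_sum_antitone_mul_le (f := fun i ↦ f (1 + i))
    (w := fun i ↦ Real.log Y - Real.log (min (1 + i) Y : ℕ)) (B := B) (n := Y)
    (fun i hi ↦ by
      apply sub_le_sub_left
      exact Real.log_le_log (by rw [min_eq_left (by omega)]; positivity)
        (by exact_mod_cast min_le_min_right Y (by omega)))
    (by simp) (fun j hj ↦ by rw [← hr]; exact hB j hj)
  have h2 : ∑ e ∈ Icc 1 Y, (Real.log e : ℂ) * f e = (Real.log Y : ℂ) * ∑ e ∈ Icc 1 Y, f e -
      ∑ i ∈ range Y, ((Real.log Y - Real.log (min (1 + i) Y : ℕ) : ℝ) : ℂ) * f (1 + i) := by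
    rw [hr, hr, mul_sum, ← sum_sub_distrib]
    refine sum_congr rfl fun i hi ↦ ?_
    rw [mem_range] at hi
    rw [min_eq_left (by omega)]
    push_cast; ring
  rw [h2]
  refine (norm_sub_le _ _).trans ?_
  have h3 : ‖(Real.log Y : ℂ) * ∑ e ∈ Icc 1 Y, f e‖ ≤ Real.log Y * B := by
    rw [norm_mul, Complex.norm_real, Real.norm_of_nonneg hlog]
    gcongr
    exact hB Y le_rfl
  rw [min_eq_left (by omega)] at h1
  simp only [add_zero, Nat.cast_one, Real.log_one, sub_zero] at h1
  linarith

lemma abs_mul_truncate_le (U V k : ℕ) :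
    |(truncate U μ * truncate V Λ) k| ≤ Real.log k := by
  rw [← ArithmeticFunction.log_apply, ← ArithmeticFunction.zeta_mul_vonMangoldt,
    ArithmeticFunction.mul_apply, ArithmeticFunction.mul_apply]
  refine (abs_sum_le_sum_abs _ _).trans (sum_le_sum fun x hx ↦ ?_)
  have hx1 : x.1 ≠ 0 := by
    have := Nat.mem_divisorsAntidiagonal.1 hx
    rintro h; simp only [h, zero_mul] at this; exact this.2 this.1.symm
  rw [abs_mul, truncate_apply, truncate_apply, ArithmeticFunction.intCoe_apply,
    ArithmeticFunction.natCoe_apply, ArithmeticFunction.zeta_apply, if_neg hx1]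
  have h0 := ArithmeticFunction.vonMangoldt_nonneg (n := x.2)
  have h1 := abs_moebius_le_one x.1
  refine mul_le_mul ?_ ?_ (abs_nonneg _) (by simp)
  · split_ifs <;> simp [h1]
  · split_ifs
    · rw [abs_of_nonneg h0]
    · simp [h0]

lemma mul_truncate_eq_zero {U V k : ℕ} (hk : U * V < k) :
    (truncate U μ * truncate V Λ) k = 0 := by
  rw [ArithmeticFunction.mul_apply]
  refine sum_eq_zero fun x hx ↦ ?_
  rw [truncate_apply, truncate_apply]
  split_ifs with h1 h2
  · have := (Nat.mem_divisorsAntidiagonal.1 hx).1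
    have := Nat.mul_le_mul h1 h2
    omega
  all_goals simp

/-- Vaughan's inequality: a sum over primes is bounded in terms of linear and bilinear sums. -/
lemma norm_sum_vonMangoldt_mul_le {N U V : ℕ} (hV : 1 ≤ V) (hN : U * V ≤ N)
    (Φ : ℕ → ℂ) (T : ℕ → ℝ)
    (hT : ∀ k ∈ Icc 1 (U * V), ∀ y ≤ N / k, ‖∑ e ∈ Icc 1 y, Φ (k * e)‖ ≤ T k) :
    ‖∑ n ∈ Icc 1 N, (Λ n : ℂ) * Φ n‖ ≤ ∑ n ∈ Icc 1 V, Λ n * ‖Φ n‖ +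
      3 * Real.log N * ∑ k ∈ Icc 1 (U * V), T k +
      ‖∑ m ∈ Icc 1 N, (bilinearCoeff U m : ℂ) *
        ∑ n ∈ Ioc V (N / m), (Λ n : ℂ) * Φ (m * n)‖ := by
  have hT0 : ∀ k ∈ Icc 1 (U * V), 0 ≤ T k := fun k hk ↦
    (norm_nonneg _).trans (hT k hk 0 (Nat.zero_le _))
  have hid : ∑ n ∈ Icc 1 N, (Λ n : ℂ) * Φ n =
      ∑ n ∈ Icc 1 N, (truncate V Λ n : ℂ) * Φ n +
      ∑ n ∈ Icc 1 N, ((truncate U μ * ArithmeticFunction.log) n : ℂ) * Φ n -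
      ∑ n ∈ Icc 1 N, ((truncate U μ * truncate V Λ * ζ) n : ℂ) * Φ n +
      ∑ n ∈ Icc 1 N, ((bilinearCoeff U * (Λ - truncate V Λ)) n : ℂ) * Φ n := by
    rw [← sum_add_distrib, ← sum_sub_distrib, ← sum_add_distrib]
    refine sum_congr rfl fun n _ ↦ ?_
    have h := congrArg (fun f : ArithmeticFunction ℝ ↦ f n) (vaughan_identity U V)
    simp only [ArithmeticFunction.add_apply, arith_sub_apply] at h
    rw [h]; push_cast; ring
  have hlogle : ∀ k : ℕ, 1 ≤ k → k ≤ N → Real.log k ≤ Real.log N := fun k h1 h2 ↦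
    Real.log_le_log (by exact_mod_cast h1) (by exact_mod_cast h2)
  have h1 : ‖∑ n ∈ Icc 1 N, (truncate V Λ n : ℂ) * Φ n‖ ≤ ∑ n ∈ Icc 1 V, Λ n * ‖Φ n‖ := by
    have : ∑ n ∈ Icc 1 N, (truncate V Λ n : ℂ) * Φ n =
        ∑ n ∈ (Icc 1 N).filter (· ≤ V), (Λ n : ℂ) * Φ n := by
      rw [sum_filter]
      refine sum_congr rfl fun n _ ↦ ?_
      rw [truncate_apply]; split_ifs <;> simp
    rw [this]
    refine (norm_sum_le _ _).trans ?_
    refine (sum_le_sum_of_subset_of_nonneg (t := Icc 1 V) ?_ fun _ _ _ ↦ norm_nonneg _).trans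
      (sum_le_sum fun n _ ↦ ?_)
    · intro n; simp only [mem_filter, mem_Icc]; omega
    · rw [norm_mul, Complex.norm_real, Real.norm_of_nonneg ArithmeticFunction.vonMangoldt_nonneg]
  have h2 : ‖∑ n ∈ Icc 1 N, ((truncate U μ * ArithmeticFunction.log) n : ℂ) * Φ n‖ ≤
      2 * Real.log N * ∑ k ∈ Icc 1 (U * V), T k := by
    rw [sum_mul_arith_eq, mul_sum]
    refine (norm_sum_le _ _).trans ?_
    have hz : ∀ k ∈ Icc 1 N, k ∉ Icc 1 (U * V) → ‖(truncate U μ k : ℂ) *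
        ∑ n ∈ Icc 1 (N / k), (ArithmeticFunction.log n : ℂ) * Φ (k * n)‖ = 0 := by
      intro k hk hk'
      have : U < k := by
        rw [mem_Icc] at hk hk'
        have := Nat.le_mul_of_pos_right U hV
        omega
      rw [truncate_apply, if_neg (by omega)]; simp
    rw [← sum_subset (Icc_subset_Icc_right hN) hz]
    refine sum_le_sum fun k hk ↦ ?_
    rw [norm_mul]
    have hk1 := mem_Icc.1 hk
    have hμ : ‖(truncate U μ k : ℂ)‖ ≤ 1 := by
      rw [Complex.norm_real, truncate_apply, Real.norm_eq_abs, ArithmeticFunction.intCoe_apply]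
      split_ifs
      · exact abs_moebius_le_one k
      · simp
    have h3 := norm_sum_log_mul_le (f := fun e ↦ Φ (k * e)) (hT k hk)
    have h4 : Real.log (N / k : ℕ) ≤ Real.log N := by
      rcases Nat.eq_zero_or_pos (N / k) with h | h
      · rw [h]; simpa using Real.log_natCast_nonneg N
      · exact hlogle _ h (Nat.div_le_self N k)
    calc _ ≤ 1 * (2 * Real.log (N / k : ℕ) * T k) := by
          gcongr
          simpa only [ArithmeticFunction.log_apply] using h3
      _ ≤ _ := by
          rw [one_mul]
          have := hT0 k hk
          gcongr
  have h3 : ‖∑ n ∈ Icc 1 N, ((truncate U μ * truncate V Λ * ζ) n : ℂ) * Φ n‖ ≤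
      Real.log N * ∑ k ∈ Icc 1 (U * V), T k := by
    rw [sum_mul_arith_eq, mul_sum]
    refine (norm_sum_le _ _).trans ?_
    have hz : ∀ k ∈ Icc 1 N, k ∉ Icc 1 (U * V) → ‖((truncate U μ * truncate V Λ) k : ℂ) *
        ∑ n ∈ Icc 1 (N / k), (((ζ : ArithmeticFunction ℝ) n : ℝ) : ℂ) * Φ (k * n)‖ = 0 := by
      intro k hk hk'
      rw [mem_Icc] at hk hk'
      rw [mul_truncate_eq_zero (by omega)]; simp
    rw [← sum_subset (Icc_subset_Icc_right hN) hz]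
    refine sum_le_sum fun k hk ↦ ?_
    have hk1 := mem_Icc.1 hk
    have e : ∑ n ∈ Icc 1 (N / k), (((ζ : ArithmeticFunction ℝ) n : ℝ) : ℂ) * Φ (k * n) =
        ∑ n ∈ Icc 1 (N / k), Φ (k * n) := by
      refine sum_congr rfl fun n hn ↦ ?_
      have : n ≠ 0 := by have := mem_Icc.1 hn; omega
      rw [ArithmeticFunction.natCoe_apply, ArithmeticFunction.zeta_apply, if_neg this]; simp
    rw [e, norm_mul, Complex.norm_real, Real.norm_eq_abs]
    have h4 := (abs_mul_truncate_le U V k).trans (hlogle k hk1.1 (hk1.2.trans hN))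
    have h5 := hT k hk (N / k) le_rfl
    have h6 := Real.log_natCast_nonneg N
    gcongr
  have h4 : ∑ n ∈ Icc 1 N, ((bilinearCoeff U * (Λ - truncate V Λ)) n : ℂ) * Φ n =
      ∑ m ∈ Icc 1 N, (bilinearCoeff U m : ℂ) *
        ∑ n ∈ Ioc V (N / m), (Λ n : ℂ) * Φ (m * n) := by
    rw [sum_mul_arith_eq]
    refine sum_congr rfl fun m _ ↦ ?_
    congr 1
    rw [← sum_subset (s₁ := Ioc V (N / m))]
    · refine sum_congr rfl fun n hn ↦ ?_
      rw [mem_Ioc] at hn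
      rw [arith_sub_apply, truncate_apply, if_neg (by omega), sub_zero]
    · intro n; simp only [mem_Ioc, mem_Icc]; omega
    · intro n hn hn'
      rw [mem_Icc] at hn; rw [mem_Ioc] at hn'
      rw [arith_sub_apply, truncate_apply, if_pos (by omega)]; simp
  rw [hid, h4]
  refine (norm_add_le _ _).trans (add_le_add ?_ le_rfl)
  refine (norm_sub_le _ _).trans ?_
  have := norm_add_le (∑ n ∈ Icc 1 N, (truncate V Λ n : ℂ) * Φ n)
    (∑ n ∈ Icc 1 N, ((truncate U μ * ArithmeticFunction.log) n : ℂ) * Φ n)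
  linarith

/-- The bilinear part of Vaughan's identity, after a dyadic subdivision and Cauchy's inequality. -/
lemma norm_bilinear_le {N U V : ℕ} (hN : 1 ≤ N) (Φ : ℕ → ℂ) {η : ℝ}
    (hη : ∀ j, U < 2 ^ (j + 1) → 2 ^ j ≤ N →
      ∑ m ∈ (Icc 1 N).filter (fun m ↦ Nat.log 2 m = j),
        ‖∑ n ∈ Ioc V (N / m), (Λ n : ℂ) * Φ (m * n)‖ ^ 2 ≤ N ^ 2 / 2 ^ j * η) :
    ‖∑ m ∈ Icc 1 N, (bilinearCoeff U m : ℂ) * ∑ n ∈ Ioc V (N / m), (Λ n : ℂ) * Φ (m * n)‖ ≤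
      (Nat.log 2 N + 1) * (N * √(2 * (1 + Real.log (2 * N)) ^ 3 * η)) := by
  have hN1 : (1 : ℝ) ≤ N := by exact_mod_cast hN
  rw [← sum_fiberwise_of_maps_to (s := Icc 1 N) (t := range (Nat.log 2 N + 1))
    (g := fun m ↦ Nat.log 2 m) fun m hm ↦ by
      rw [mem_Icc] at hm
      exact mem_range.2 (Nat.lt_succ_of_le (Nat.log_mono_right hm.2))]
  refine (norm_sum_le_of_le (f := fun j ↦ ∑ m ∈ (Icc 1 N).filter (fun m ↦ Nat.log 2 m = j), _)
    (n := fun _ ↦ N * √(2 * (1 + Real.log (2 * N)) ^ 3 * η)) _ ?_).trans ?_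
  swap
  · rw [sum_const, card_range, nsmul_eq_mul]; push_cast; exact le_rfl
  intro j hj
  have hjN : 2 ^ j ≤ N := by
    rw [mem_range] at hj
    exact Nat.pow_le_of_le_log (by omega) (by omega)
  have hlogN : 0 ≤ Real.log (2 * N) := Real.log_nonneg (by linarith)
  have hblock : ∀ m ∈ (Icc 1 N).filter (fun m ↦ Nat.log 2 m = j), m < 2 ^ (j + 1) := by
    intro m hm
    rw [mem_filter] at hm
    rw [← hm.2]; exact Nat.lt_pow_succ_log_self (by norm_num) m
  by_cases hU : U < 2 ^ (j + 1)
  swap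
  · rw [sum_eq_zero]
    · rw [norm_zero]; positivity
    · intro m hm
      rw [bilinearCoeff_eq_zero ((hblock m hm).le.trans (not_lt.1 hU))]; simp
  have hd : ∑ m ∈ (Icc 1 N).filter (fun m ↦ Nat.log 2 m = j), ‖(bilinearCoeff U m : ℂ)‖ ^ 2 ≤
      2 * 2 ^ j * (1 + Real.log (2 * N)) ^ 3 := by
    calc _ ≤ ∑ m ∈ (Icc 1 N).filter (fun m ↦ Nat.log 2 m = j), (m.divisors.card : ℝ) ^ 2 := by
          refine sum_le_sum fun m _ ↦ ?_
          gcongr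
          rw [Complex.norm_real, Real.norm_eq_abs]; exact abs_bilinearCoeff_le U m
      _ ≤ ∑ m ∈ Icc 1 (2 ^ (j + 1)), (m.divisors.card : ℝ) ^ 2 := by
          refine sum_le_sum_of_subset_of_nonneg ?_ fun _ _ _ ↦ by positivity
          intro m hm
          have := hblock m hm
          rw [mem_filter, mem_Icc] at hm
          exact mem_Icc.2 ⟨hm.1.1, this.le⟩
      _ ≤ _ := sum_card_divisors_sq_le _
      _ ≤ _ := by
          have h2 : ((2 ^ (j + 1) : ℕ) : ℝ) ≤ 2 * N := by
            rw [pow_succ, mul_comm]; exact_mod_cast Nat.mul_le_mul_left 2 hjN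
          have h3 : Real.log (2 ^ (j + 1) : ℕ) ≤ Real.log (2 * N) :=
            Real.log_le_log (by positivity) h2
          have h4 := Real.log_natCast_nonneg (2 ^ (j + 1))
          have e : ((2 ^ (j + 1) : ℕ) : ℝ) = 2 * 2 ^ j := by push_cast; ring
          nth_rewrite 1 [e]
          gcongr
  refine (norm_sum_le _ _).trans ?_
  simp_rw [norm_mul]
  refine (Real.sum_mul_le_sqrt_mul_sqrt _ _ _).trans ?_
  rw [← Real.sqrt_mul (sum_nonneg fun _ _ ↦ by positivity)]
  have hN0 : (0 : ℝ) ≤ N := by positivity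
  have e : (N : ℝ) * √(2 * (1 + Real.log (2 * N)) ^ 3 * η) =
      √((N : ℝ) ^ 2 * (2 * (1 + Real.log (2 * N)) ^ 3 * η)) := by
    rw [Real.sqrt_mul (x := (N : ℝ) ^ 2) (by positivity), Real.sqrt_sq hN0]
  rw [e]
  apply Real.sqrt_le_sqrt
  calc _ ≤ 2 * 2 ^ j * (1 + Real.log (2 * N)) ^ 3 * (N ^ 2 / 2 ^ j * η) := by
        refine mul_le_mul hd (hη j hU hjN) (sum_nonneg fun _ _ ↦ by positivity) (by positivity)
    _ = _ := by field_simp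

end TwistedBV

namespace TwistedBV

open Finset
open scoped ArithmeticFunction.vonMangoldt ComplexConjugate

/-- The correlation sum produced by opening the square in a dyadic block of the bilinear sum. -/
noncomputable def correlation (N j : ℕ) (f g : ℕ → ℂ) (n₁ n₂ : ℕ) : ℂ :=
  ∑ m ∈ Ico (2 ^ j) (min (2 ^ (j + 1)) (N / max n₁ n₂ + 1)), f (m * n₁) * conj (g (m * n₂))

lemma mem_block_iff {N j m n₁ n₂ : ℕ} (h₁ : 1 ≤ n₁) :
    (m ∈ (Icc 1 N).filter (fun m ↦ Nat.log 2 m = j) ∧ n₁ ≤ N / m ∧ n₂ ≤ N / m) ↔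
      m ∈ Ico (2 ^ j) (min (2 ^ (j + 1)) (N / max n₁ n₂ + 1)) := by
  rw [mem_filter, mem_Icc, mem_Ico, lt_min_iff, Nat.lt_succ_iff,
    Nat.le_div_iff_mul_le (x := m) (k := max n₁ n₂) (lt_max_of_lt_left h₁)]
  constructor
  · rintro ⟨⟨⟨hm, hmN⟩, hj⟩, hn₁, hn₂⟩
    rw [Nat.le_div_iff_mul_le hm] at hn₁ hn₂
    have := (Nat.log_eq_iff (b := 2) (m := j) (n := m) (Or.inr ⟨by norm_num, by omega⟩)).1 hj
    refine ⟨this.1, this.2, ?_⟩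
    rcases max_cases n₁ n₂ with h | h <;> rw [h.1] <;> linarith
  · rintro ⟨hj, hj', hN⟩
    have hm : 1 ≤ m := (Nat.one_le_two_pow).trans hj
    have a1 : m * n₁ ≤ N := (Nat.mul_le_mul_left m (le_max_left _ _)).trans hN
    have a2 : m * n₂ ≤ N := (Nat.mul_le_mul_left m (le_max_right _ _)).trans hN
    refine ⟨⟨⟨hm, by nlinarith⟩, ?_⟩, ?_, ?_⟩
    · exact (Nat.log_eq_iff (Or.inr ⟨by norm_num, by omega⟩)).2 ⟨hj, hj'⟩
    · rw [Nat.le_div_iff_mul_le (by omega)]; linarith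
    · rw [Nat.le_div_iff_mul_le (by omega)]; linarith

lemma sum_norm_sq_block_eq {N j V : ℕ} (Φ : ℕ → ℂ) :
    ((∑ m ∈ (Icc 1 N).filter (fun m ↦ Nat.log 2 m = j),
        ‖∑ n ∈ Ioc V (N / m), (Λ n : ℂ) * Φ (m * n)‖ ^ 2 : ℝ) : ℂ) =
      ∑ n₁ ∈ Ioc V (N / 2 ^ j), ∑ n₂ ∈ Ioc V (N / 2 ^ j),
        (Λ n₁ * Λ n₂ : ℂ) * correlation N j Φ Φ n₁ n₂ := by
  have hB : ∀ m ∈ (Icc 1 N).filter (fun m ↦ Nat.log 2 m = j),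
      ((‖∑ n ∈ Ioc V (N / m), (Λ n : ℂ) * Φ (m * n)‖ ^ 2 : ℝ) : ℂ) =
      ∑ n₁ ∈ Ioc V (N / 2 ^ j), ∑ n₂ ∈ Ioc V (N / 2 ^ j),
        if n₁ ≤ N / m ∧ n₂ ≤ N / m then
          (Λ n₁ * Λ n₂ : ℂ) * (Φ (m * n₁) * conj (Φ (m * n₂))) else 0 := by
    intro m hm
    rw [mem_filter, mem_Icc] at hm
    have h2 : 2 ^ j ≤ m := by rw [← hm.2]; exact Nat.pow_log_le_self 2 (by omega)
    have hsub : Ioc V (N / m) = (Ioc V (N / 2 ^ j)).filter (· ≤ N / m) := by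
      ext n
      have : N / m ≤ N / 2 ^ j := Nat.div_le_div_left h2 (by positivity)
      simp only [mem_filter, mem_Ioc]; omega
    have := Complex.mul_conj' (∑ n ∈ Ioc V (N / m), (Λ n : ℂ) * Φ (m * n))
    push_cast
    rw [← this, map_sum, sum_mul_sum, hsub, sum_filter]
    refine sum_congr rfl fun n₁ _ ↦ ?_
    rw [sum_filter]
    by_cases h : n₁ ≤ N / m
    · simp only [h, if_true, true_and]
      refine sum_congr rfl fun n₂ _ ↦ ?_
      split_ifs
      · rw [map_mul, Complex.conj_ofReal]; ring
      · rfl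
    · simp [h]
  push_cast at hB ⊢
  rw [sum_congr rfl hB, sum_comm]
  refine sum_congr rfl fun n₁ hn₁ ↦ ?_
  rw [sum_comm]
  refine sum_congr rfl fun n₂ hn₂ ↦ ?_
  rw [← sum_filter, correlation, mul_sum]
  rw [mem_Ioc] at hn₁ hn₂
  refine sum_congr ?_ fun _ _ ↦ rfl
  ext m
  rw [mem_filter, mem_block_iff (by omega)]

lemma correlation_sum_mul {ι : Type*} (s : Finset ι) (c : ι → ℂ) (φ : ι → ℕ → ℂ) (N j n₁ n₂ : ℕ) :
    correlation N j (fun n ↦ ∑ d ∈ s, c d * φ d n) (fun n ↦ ∑ d ∈ s, c d * φ d n) n₁ n₂ =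
      ∑ d₁ ∈ s, ∑ d₂ ∈ s, c d₁ * conj (c d₂) * correlation N j (φ d₁) (φ d₂) n₁ n₂ := by
  unfold correlation
  simp_rw [map_sum, sum_mul_sum, mul_sum]
  rw [sum_comm]
  refine sum_congr rfl fun d₁ _ ↦ ?_
  rw [sum_comm]
  refine sum_congr rfl fun d₂ _ ↦ sum_congr rfl fun m _ ↦ ?_
  rw [map_mul]; ring

/-- The combination of Vaughan's identity with the dispersion method: the mean value over `s` of
the sums of `Λ φ_d` is controlled by linear sums and correlations. -/
theorem sum_norm_sum_vonMangoldt_mul_le {ι : Type*} {N U V : ℕ} (hV : 1 ≤ V) (hN : U * V ≤ N)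
    (hN1 : 1 ≤ N) (s : Finset ι) (φ : ι → ℕ → ℂ) (T : ℕ → ℝ) {η : ℝ}
    (hφ : ∀ d ∈ s, ∀ n, ‖φ d n‖ ≤ 1)
    (hT : ∀ k ∈ Icc 1 (U * V), ∀ y ≤ N / k, ∑ d ∈ s, ‖∑ e ∈ Icc 1 y, φ d (k * e)‖ ≤ T k)
    (hη : ∀ j, U < 2 ^ (j + 1) → 2 ^ j ≤ N → ∑ d₁ ∈ s, ∑ d₂ ∈ s,
      ‖∑ n₁ ∈ Ioc V (N / 2 ^ j), ∑ n₂ ∈ Ioc V (N / 2 ^ j),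
        (Λ n₁ * Λ n₂ : ℂ) * correlation N j (φ d₁) (φ d₂) n₁ n₂‖ ≤ N ^ 2 / 2 ^ j * η) :
    ∑ d ∈ s, ‖∑ n ∈ Icc 1 N, (Λ n : ℂ) * φ d n‖ ≤ s.card * (V * Real.log V) +
      3 * Real.log N * ∑ k ∈ Icc 1 (U * V), T k +
      (Nat.log 2 N + 1) * (N * √(2 * (1 + Real.log (2 * N)) ^ 3 * η)) := by
  choose c hc hcS using fun d ↦ Complex.exists_norm_eq_mul_self
    (∑ n ∈ Icc 1 N, (Λ n : ℂ) * φ d n)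
  set Φ : ℕ → ℂ := fun n ↦ ∑ d ∈ s, c d * φ d n with hΦ
  have hsum : ∑ d ∈ s, ‖∑ n ∈ Icc 1 N, (Λ n : ℂ) * φ d n‖ =
      ‖∑ n ∈ Icc 1 N, (Λ n : ℂ) * Φ n‖ := by
    have h1 : ((∑ d ∈ s, ‖∑ n ∈ Icc 1 N, (Λ n : ℂ) * φ d n‖ : ℝ) : ℂ) =
        ∑ n ∈ Icc 1 N, (Λ n : ℂ) * Φ n := by
      push_cast
      rw [sum_congr rfl fun d _ ↦ hcS d]
      simp_rw [hΦ, mul_sum]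
      rw [sum_comm]
      exact sum_congr rfl fun n _ ↦ sum_congr rfl fun d _ ↦ by ring
    rw [← h1, Complex.norm_real, Real.norm_of_nonneg (sum_nonneg fun _ _ ↦ norm_nonneg _)]
  rw [hsum]
  have hlin : ∀ k ∈ Icc 1 (U * V), ∀ y ≤ N / k, ‖∑ e ∈ Icc 1 y, Φ (k * e)‖ ≤ T k := by
    intro k hk y hy
    refine le_trans ?_ (hT k hk y hy)
    rw [hΦ, sum_comm]
    refine norm_sum_le_of_le _ fun d _ ↦ ?_
    rw [← mul_sum, norm_mul, hc, one_mul]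
  refine (norm_sum_vonMangoldt_mul_le hV hN Φ T hlin).trans ?_
  gcongr ?_ + _ + ?_
  · have : ∀ n ∈ Icc 1 V, Λ n * ‖Φ n‖ ≤ Real.log V * s.card := by
      intro n hn
      rw [mem_Icc] at hn
      have h1 : Λ n ≤ Real.log V := ArithmeticFunction.vonMangoldt_le_log.trans
        (Real.log_le_log (by exact_mod_cast hn.1) (by exact_mod_cast hn.2))
      have h2 : ‖Φ n‖ ≤ s.card := by
        rw [hΦ, card_eq_sum_ones]
        push_cast
        refine norm_sum_le_of_le _ fun d hd ↦ ?_
        rw [norm_mul, hc, one_mul]; exact hφ d hd n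
      exact mul_le_mul h1 h2 (norm_nonneg _) (Real.log_natCast_nonneg V)
    refine (sum_le_sum this).trans (le_of_eq ?_)
    rw [sum_const, Nat.card_Icc, nsmul_eq_mul, Nat.add_sub_cancel]; ring
  · refine norm_bilinear_le hN1 Φ fun j hj hjN ↦ le_trans ?_ (hη j hj hjN)
    have h0 : 0 ≤ ∑ m ∈ (Icc 1 N).filter (fun m ↦ Nat.log 2 m = j),
        ‖∑ n ∈ Ioc V (N / m), (Λ n : ℂ) * Φ (m * n)‖ ^ 2 := sum_nonneg fun _ _ ↦ by positivity
    rw [← Real.norm_of_nonneg h0, ← Complex.norm_real, sum_norm_sq_block_eq]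
    simp_rw [hΦ, correlation_sum_mul, mul_sum]
    rw [sum_congr rfl fun n₁ _ ↦ sum_comm, sum_comm]
    refine norm_sum_le_of_le _ fun d₁ _ ↦ ?_
    rw [sum_congr rfl fun n₁ _ ↦ sum_comm, sum_comm]
    refine norm_sum_le_of_le _ fun d₂ _ ↦ ?_
    have : ∀ n₁ n₂ : ℕ, (Λ n₁ * Λ n₂ : ℂ) * (c d₁ * conj (c d₂) *
        correlation N j (φ d₁) (φ d₂) n₁ n₂) = c d₁ * conj (c d₂) *
        ((Λ n₁ * Λ n₂ : ℂ) * correlation N j (φ d₁) (φ d₂) n₁ n₂) := fun _ _ ↦ by ring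
    simp_rw [this, ← mul_sum]
    rw [norm_mul, norm_mul, RCLike.norm_conj, hc, hc, one_mul, one_mul]

end TwistedBV

namespace TwistedBV

open Finset

lemma abs_card_filter_sub_le {q : ℕ} [NeZero q] (x : ZMod q) (A B : ℕ) :
    |(((Ico A B).filter (fun m : ℕ ↦ (m : ZMod q) = x)).card : ℝ) - (B - A : ℕ) / q| ≤ 1 := by
  have hq : (0 : ℝ) < q := by exact_mod_cast NeZero.pos q
  rcases le_or_gt B A with h | h
  · simp [Ico_eq_empty_of_le h, Nat.sub_eq_zero_of_le h]
  have e : (Ico A B).filter (fun m : ℕ ↦ (m : ZMod q) = x) =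
      (Ico A B).filter (fun m : ℕ ↦ m ≡ x.val [MOD q]) := by
    refine filter_congr fun m _ ↦ ?_
    rw [← ZMod.natCast_eq_natCast_iff, ZMod.natCast_val, ZMod.cast_id', id]
  have h1 := Nat.Ico_filter_modEq_card A B (NeZero.pos q) x.val
  rw [← e] at h1
  set c := ((Ico A B).filter (fun m : ℕ ↦ (m : ZMod q) = x)).card
  have a1 := Int.ceil_lt_add_one (((B : ℚ) - x.val) / q)
  have a2 := Int.le_ceil (((B : ℚ) - x.val) / q)
  have b1 := Int.ceil_lt_add_one (((A : ℚ) - x.val) / q)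
  have b2 := Int.le_ceil (((A : ℚ) - x.val) / q)
  have hmono : ⌈((A : ℚ) - x.val) / q⌉ ≤ ⌈((B : ℚ) - x.val) / q⌉ := by
    apply Int.ceil_le_ceil
    have : (A : ℚ) ≤ B := by exact_mod_cast h.le
    gcongr
  rw [max_eq_left (by linarith)] at h1
  have h2 : (c : ℚ) = ⌈((B : ℚ) - x.val) / q⌉ - ⌈((A : ℚ) - x.val) / q⌉ := by exact_mod_cast h1
  have h3 : ((B : ℚ) - x.val) / q - ((A : ℚ) - x.val) / q = (B - A) / q := by ring
  have h4 : |(c : ℚ) - (B - A) / q| ≤ 1 := by rw [abs_le]; constructor <;> linarith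
  rw [Nat.cast_sub h.le]
  exact_mod_cast h4

lemma abs_sum_sub_sum_units_le {q : ℕ} [NeZero q] {f : ℕ → ℝ} (F : (ZMod q)ˣ → ℝ)
    (h0 : ∀ m : ℕ, ¬ IsUnit (m : ZMod q) → f m = 0)
    (hF : ∀ (m : ℕ) (u : (ZMod q)ˣ), (m : ZMod q) = u → f m = F u) (A B : ℕ) :
    |∑ m ∈ Ico A B, f m - (B - A : ℕ) / q * ∑ u, F u| ≤ ∑ u, |F u| := by
  have h1 : ∀ m : ℕ, f m = ∑ u : (ZMod q)ˣ, if (m : ZMod q) = u then F u else 0 := by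
    intro m
    by_cases hm : IsUnit (m : ZMod q)
    · obtain ⟨v, hv⟩ := hm
      rw [hF m v hv.symm, ← hv, sum_eq_single v]
      · simp
      · intro u _ hu
        rw [if_neg]; exact fun h ↦ hu (Units.ext h.symm)
      · simp
    · rw [h0 m hm, sum_eq_zero]
      intro u _
      rw [if_neg]; rintro h; exact hm (h ▸ u.isUnit)
  have h2 : ∑ m ∈ Ico A B, f m =
      ∑ u : (ZMod q)ˣ, (((Ico A B).filter (fun m : ℕ ↦ (m : ZMod q) = u)).card : ℝ) * F u := by
    rw [sum_congr rfl fun m _ ↦ h1 m, sum_comm]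
    refine sum_congr rfl fun u _ ↦ ?_
    rw [← sum_filter, sum_const, nsmul_eq_mul]
  rw [h2, mul_sum, ← sum_sub_distrib]
  refine (abs_sum_le_sum_abs _ _).trans (sum_le_sum fun u _ ↦ ?_)
  rw [← sub_mul, abs_mul]
  exact mul_le_of_le_one_left (abs_nonneg _) (abs_card_filter_sub_le _ A B)

lemma card_unitsMap_fiber_mul {d q : ℕ} [NeZero q] (h : d ∣ q) (b : (ZMod d)ˣ) :
    ((univ.filter fun u : (ZMod q)ˣ ↦ ZMod.unitsMap h u = b).card : ℝ) * d.totient =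
      q.totient := by
  have : NeZero d := ⟨fun hd ↦ NeZero.ne q (by simpa [hd] using h)⟩
  have h1 : (univ : Finset (ZMod q)ˣ).card =
      ∑ b' : (ZMod d)ˣ, (univ.filter fun u : (ZMod q)ˣ ↦ ZMod.unitsMap h u = b').card :=
    card_eq_sum_card_fiberwise fun _ _ ↦ mem_univ _
  rw [sum_congr rfl fun b' _ ↦ MonoidHom.card_fiber_eq_of_mem_range (ZMod.unitsMap h)
    (ZMod.unitsMap_surjective h b') (ZMod.unitsMap_surjective h b)] at h1
  rw [sum_const, card_univ, card_univ, ZMod.card_units_eq_totient, ZMod.card_units_eq_totient,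
    smul_eq_mul] at h1
  rw [h1]; push_cast; ring

lemma totient_lcm_mul_totient_gcd (a b : ℕ) :
    (a.lcm b).totient * (a.gcd b).totient = a.totient * b.totient := by
  rcases Nat.eq_zero_or_pos a with rfl | ha
  · simp
  have hg : 0 < a.gcd b := Nat.gcd_pos_of_pos_left b ha
  have h1 := Nat.totient_gcd_mul_totient_mul a b
  have h2 := Nat.totient_gcd_mul_totient_mul (a.gcd b) (a.lcm b)
  rw [Nat.gcd_eq_left ((Nat.gcd_dvd_left a b).trans (Nat.dvd_lcm_left a b)), Nat.gcd_mul_lcm,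
    h1] at h2
  have := Nat.eq_of_mul_eq_mul_right hg h2
  rw [this]; ring

lemma unitsMap_apply_val {d q : ℕ} (h : d ∣ q) (u : (ZMod q)ˣ) :
    ((ZMod.unitsMap h u : (ZMod d)ˣ) : ZMod d) = ZMod.castHom h (ZMod d) u := rfl

lemma unitsMap_eq_iff {d q m : ℕ} (h : d ∣ q) {u : (ZMod q)ˣ} (hm : (m : ZMod q) = u)
    (b : (ZMod d)ˣ) : ZMod.unitsMap h u = b ↔ (m : ZMod d) = b := by
  rw [Units.ext_iff, unitsMap_apply_val, ← hm, map_natCast]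

lemma exists_natCast_eq {q : ℕ} [NeZero q] (x : ZMod q) : ∃ m : ℕ, (m : ZMod q) = x :=
  ⟨x.val, by rw [ZMod.natCast_val, ZMod.cast_id', id]⟩

/-- Chinese remainder theorem for units with not necessarily coprime moduli. -/
lemma card_filter_unitsMap_pair {d₁ d₂ : ℕ} [NeZero d₁] [NeZero d₂] [NeZero (d₁.lcm d₂)]
    (b₁ : (ZMod d₁)ˣ) (b₂ : (ZMod d₂)ˣ) :
    (univ.filter fun u : (ZMod (d₁.lcm d₂))ˣ ↦ ZMod.unitsMap (Nat.dvd_lcm_left d₁ d₂) u = b₁ ∧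
      ZMod.unitsMap (Nat.dvd_lcm_right d₁ d₂) u = b₂).card =
    if ZMod.unitsMap (Nat.gcd_dvd_left d₁ d₂) b₁ = ZMod.unitsMap (Nat.gcd_dvd_right d₁ d₂) b₂
      then 1 else 0 := by
  obtain ⟨k₁, hk₁⟩ := exists_natCast_eq (b₁ : ZMod d₁)
  obtain ⟨k₂, hk₂⟩ := exists_natCast_eq (b₂ : ZMod d₂)
  split_ifs with h
  · rw [unitsMap_eq_iff _ hk₁, unitsMap_apply_val, ← hk₂, map_natCast,
      ZMod.natCast_eq_natCast_iff] at h
    obtain ⟨k, h₁, h₂⟩ := Nat.chineseRemainder' h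
    rw [← ZMod.natCast_eq_natCast_iff] at h₁ h₂
    have hu : IsUnit (k : ZMod (d₁.lcm d₂)) := by
      rw [ZMod.isUnit_iff_coprime]
      have c₁ : k.Coprime d₁ := by
        rw [← ZMod.isUnit_iff_coprime, h₁, hk₁]; exact b₁.isUnit
      have c₂ : k.Coprime d₂ := by
        rw [← ZMod.isUnit_iff_coprime, h₂, hk₂]; exact b₂.isUnit
      exact Nat.Coprime.coprime_dvd_right (Nat.lcm_dvd_mul d₁ d₂) (Nat.Coprime.mul_right c₁ c₂)
    obtain ⟨u, hu⟩ := hu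
    rw [card_eq_one]
    refine ⟨u, ?_⟩
    ext v
    simp only [mem_filter, mem_univ, true_and, mem_singleton]
    obtain ⟨l, hl⟩ := exists_natCast_eq (v : ZMod (d₁.lcm d₂))
    rw [unitsMap_eq_iff _ hl, unitsMap_eq_iff _ hl, Units.ext_iff, hu, ← hl,
      ← hk₁, ← hk₂, ← h₁, ← h₂, ZMod.natCast_eq_natCast_iff, ZMod.natCast_eq_natCast_iff,
      ZMod.natCast_eq_natCast_iff, Nat.modEq_iff_dvd, Nat.modEq_iff_dvd, Nat.modEq_iff_dvd,
      Int.natCast_dvd, Int.natCast_dvd, Int.natCast_dvd, Nat.lcm_dvd_iff]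
  · rw [card_eq_zero, filter_eq_empty_iff]
    rintro u - ⟨h₁, h₂⟩
    apply h
    rw [← h₁, ← h₂, ← MonoidHom.comp_apply, ← MonoidHom.comp_apply, ZMod.unitsMap_comp,
      ZMod.unitsMap_comp]

end TwistedBV

namespace TwistedBV

open Finset

/-- The indicator of the class `a` modulo `d`, minus its expected value on reduced classes. -/
noncomputable def residue (a : ℤ) (d n : ℕ) : ℝ :=
  (if (n : ZMod d) = (a : ZMod d) then 1 else 0) - (if n.Coprime d then 1 / (d.totient : ℝ) else 0)

lemma residue_eq_zero {a : ℤ} {d n : ℕ} (ha : IsUnit (a : ZMod d)) (hn : ¬ n.Coprime d) :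
    residue a d n = 0 := by
  rw [residue, if_neg hn, if_neg, sub_zero]
  intro h
  rw [← h, ZMod.isUnit_iff_coprime] at ha
  exact hn ha

lemma one_div_totient_le_one (d : ℕ) : 1 / (d.totient : ℝ) ≤ 1 := by
  rcases Nat.eq_zero_or_pos d.totient with h | h
  · simp [h]
  · rw [div_le_one (by exact_mod_cast h)]; exact_mod_cast h

lemma abs_residue_le (a : ℤ) (d n : ℕ) : |residue a d n| ≤ 1 := by
  have h1 := one_div_totient_le_one d
  have h2 : (0 : ℝ) ≤ 1 / (d.totient : ℝ) := by positivity
  unfold residue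
  rw [abs_le]
  split_ifs <;> constructor <;> linarith

lemma residue_mul_eq {a : ℤ} {d q m n : ℕ} (h : d ∣ q) {α ν : (ZMod d)ˣ}
    (hα : (a : ZMod d) = α) (hν : (n : ZMod d) = ν) {u : (ZMod q)ˣ} (hm : (m : ZMod q) = u) :
    residue a d (m * n) =
      (if ZMod.unitsMap h u = α * ν⁻¹ then 1 else 0) - 1 / (d.totient : ℝ) := by
  have hmd : (m : ZMod d) = (ZMod.unitsMap h u : (ZMod d)ˣ) :=
    ((unitsMap_eq_iff h hm _).1 rfl)
  have hcop : (m * n).Coprime d := by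
    rw [← ZMod.isUnit_iff_coprime, Nat.cast_mul, hmd, hν, ← Units.val_mul]; exact Units.isUnit _
  rw [residue, if_pos hcop]
  congr 2
  rw [Nat.cast_mul, hmd, hν, hα, ← Units.val_mul, ← Units.ext_iff, eq_mul_inv_iff_mul_eq]

lemma sum_unitsMap_indicator {d q : ℕ} [NeZero q] (h : d ∣ q) (b : (ZMod d)ˣ) :
    ∑ u : (ZMod q)ˣ, (if ZMod.unitsMap h u = b then 1 else 0 : ℝ) = q.totient / d.totient := by
  have hd : 0 < d := Nat.pos_of_dvd_of_pos h (NeZero.pos q)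
  have : (d.totient : ℝ) ≠ 0 := by exact_mod_cast (Nat.totient_pos.2 hd).ne'
  rw [sum_boole, eq_div_iff this, card_unitsMap_fiber_mul]

lemma abs_sum_residue_mul_le {a : ℤ} {d : ℕ} [NeZero d] (ha : IsUnit (a : ZMod d)) (k y : ℕ) :
    |∑ e ∈ Icc 1 y, residue a d (k * e)| ≤ 2 := by
  by_cases hk : k.Coprime d
  swap
  · rw [sum_eq_zero, abs_zero]
    · norm_num
    · intro e _
      refine residue_eq_zero ha fun h ↦ hk (Nat.Coprime.coprime_mul_right h)
  obtain ⟨α, hα⟩ := ha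
  obtain ⟨ν, hν⟩ := (ZMod.isUnit_iff_coprime k d).2 hk
  have hφ : (d.totient : ℝ) ≠ 0 := by exact_mod_cast (Nat.totient_pos.2 (NeZero.pos d)).ne'
  have h := abs_sum_sub_sum_units_le (q := d) (f := fun e ↦ residue a d (e * k))
    (fun u ↦ (if ZMod.unitsMap dvd_rfl u = α * ν⁻¹ then 1 else 0) - 1 / (d.totient : ℝ))
    (fun m hm ↦ residue_eq_zero ⟨α, hα⟩ fun h ↦
      hm ((ZMod.isUnit_iff_coprime m d).2 (Nat.Coprime.coprime_mul_right h)))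
    (fun m u hm ↦ residue_mul_eq dvd_rfl hα.symm hν.symm hm) 1 (y + 1)
  have hcard : ∑ _u : (ZMod d)ˣ, 1 / (d.totient : ℝ) = 1 := by
    rw [sum_const, card_univ, ZMod.card_units_eq_totient, nsmul_eq_mul, mul_one_div_cancel hφ]
  rw [sum_sub_distrib, sum_unitsMap_indicator, hcard, div_self hφ, sub_self, mul_zero,
    sub_zero] at h
  rw [Icc_eq_Ico_succ, sum_congr rfl fun e _ ↦ by rw [mul_comm k e]]
  refine h.trans ?_
  calc _ ≤ ∑ u : (ZMod d)ˣ, ((if ZMod.unitsMap dvd_rfl u = α * ν⁻¹ then 1 else 0 : ℝ) +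
          1 / (d.totient : ℝ)) := by
        refine sum_le_sum fun u _ ↦ (abs_sub _ _).trans (le_of_eq ?_)
        rw [abs_of_nonneg (by split_ifs <;> norm_num), abs_of_nonneg (by positivity)]
    _ = 2 := by
        rw [sum_add_distrib, sum_unitsMap_indicator, hcard, div_self hφ]; norm_num

lemma abs_sum_residue_mul_residue_sub_le {a : ℤ} {d₁ d₂ n₁ n₂ : ℕ} [NeZero d₁] [NeZero d₂]
    (ha₁ : IsUnit (a : ZMod d₁)) (ha₂ : IsUnit (a : ZMod d₂)) (h₁ : n₁.Coprime d₁)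
    (h₂ : n₂.Coprime d₂) (A B : ℕ) :
    |∑ m ∈ Ico A B, residue a d₁ (m * n₁) * residue a d₂ (m * n₂) -
      (B - A : ℕ) / (d₁.lcm d₂ : ℕ) * ((if (n₁ : ZMod (d₁.gcd d₂)) = n₂ then 1 else 0) -
        1 / ((d₁.gcd d₂).totient : ℝ))| ≤ 4 := by
  have : NeZero (d₁.lcm d₂) := ⟨Nat.lcm_ne_zero (NeZero.ne d₁) (NeZero.ne d₂)⟩
  have hl₁ := Nat.dvd_lcm_left d₁ d₂
  have hl₂ := Nat.dvd_lcm_right d₁ d₂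
  obtain ⟨α₁, hα₁⟩ := id ha₁
  obtain ⟨α₂, hα₂⟩ := id ha₂
  obtain ⟨ν₁, hν₁⟩ := (ZMod.isUnit_iff_coprime n₁ d₁).2 h₁
  obtain ⟨ν₂, hν₂⟩ := (ZMod.isUnit_iff_coprime n₂ d₂).2 h₂
  set I₁ : (ZMod (d₁.lcm d₂))ˣ → ℝ := fun u ↦
    if ZMod.unitsMap hl₁ u = α₁ * ν₁⁻¹ then 1 else 0 with hI₁
  set I₂ : (ZMod (d₁.lcm d₂))ˣ → ℝ := fun u ↦
    if ZMod.unitsMap hl₂ u = α₂ * ν₂⁻¹ then 1 else 0 with hI₂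
  have hφ₁ : (0 : ℝ) < d₁.totient := by exact_mod_cast Nat.totient_pos.2 (NeZero.pos d₁)
  have hφ₂ : (0 : ℝ) < d₂.totient := by exact_mod_cast Nat.totient_pos.2 (NeZero.pos d₂)
  have hφ : (0 : ℝ) < (d₁.lcm d₂).totient := by
    exact_mod_cast Nat.totient_pos.2 (NeZero.pos (d₁.lcm d₂))
  have hφg : (0 : ℝ) < (d₁.gcd d₂).totient := by
    exact_mod_cast Nat.totient_pos.2 (Nat.gcd_pos_of_pos_left _ (NeZero.pos d₁))
  have hφφ : ((d₁.lcm d₂).totient : ℝ) * (d₁.gcd d₂).totient = d₁.totient * d₂.totient := by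
    exact_mod_cast totient_lcm_mul_totient_gcd d₁ d₂
  have hS₁ : ∑ u, I₁ u = (d₁.lcm d₂).totient / d₁.totient := sum_unitsMap_indicator hl₁ _
  have hS₂ : ∑ u, I₂ u = (d₁.lcm d₂).totient / d₂.totient := sum_unitsMap_indicator hl₂ _
  have hcard : ∑ _u : (ZMod (d₁.lcm d₂))ˣ, (1 : ℝ) = (d₁.lcm d₂).totient := by
    rw [sum_const, card_univ, ZMod.card_units_eq_totient, nsmul_eq_mul, mul_one]
  have hS : ∑ u, I₁ u * I₂ u = if (n₁ : ZMod (d₁.gcd d₂)) = n₂ then 1 else 0 := by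
    have e : ∀ u, I₁ u * I₂ u = if ZMod.unitsMap hl₁ u = α₁ * ν₁⁻¹ ∧
        ZMod.unitsMap hl₂ u = α₂ * ν₂⁻¹ then 1 else 0 := by
      intro u
      simp only [hI₁, hI₂]
      split_ifs <;> simp_all
    rw [sum_congr rfl fun u _ ↦ e u, sum_boole, card_filter_unitsMap_pair]
    have hαα : ZMod.unitsMap (Nat.gcd_dvd_left d₁ d₂) α₁ =
        ZMod.unitsMap (Nat.gcd_dvd_right d₁ d₂) α₂ := by
      rw [Units.ext_iff, unitsMap_apply_val, unitsMap_apply_val, hα₁, hα₂, map_intCast,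
        map_intCast]
    have hiff : ZMod.unitsMap (Nat.gcd_dvd_left d₁ d₂) (α₁ * ν₁⁻¹) =
        ZMod.unitsMap (Nat.gcd_dvd_right d₁ d₂) (α₂ * ν₂⁻¹) ↔
        (n₁ : ZMod (d₁.gcd d₂)) = n₂ := by
      rw [map_mul, map_mul, map_inv, map_inv, hαα, mul_right_inj, inv_inj,
        unitsMap_eq_iff _ hν₁.symm, unitsMap_apply_val, hν₂, map_natCast]
    simp only [hiff]
    split_ifs <;> simp
  have key := abs_sum_sub_sum_units_le (q := d₁.lcm d₂)
    (f := fun m ↦ residue a d₁ (m * n₁) * residue a d₂ (m * n₂))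
    (fun u ↦ (I₁ u - 1 / d₁.totient) * (I₂ u - 1 / d₂.totient))
    (fun m hm ↦ by
      by_cases c₁ : m.Coprime d₁
      · by_cases c₂ : m.Coprime d₂
        · refine absurd ((ZMod.isUnit_iff_coprime _ _).2 ?_) hm
          exact Nat.Coprime.coprime_dvd_right (Nat.lcm_dvd_mul d₁ d₂) (Nat.Coprime.mul_right c₁ c₂)
        · rw [residue_eq_zero ha₂ fun h ↦ c₂ (Nat.Coprime.coprime_mul_right h), mul_zero]
      · rw [residue_eq_zero ha₁ fun h ↦ c₁ (Nat.Coprime.coprime_mul_right h), zero_mul])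
    (fun m u hm ↦ by
      rw [residue_mul_eq hl₁ hα₁.symm hν₁.symm hm, residue_mul_eq hl₂ hα₂.symm hν₂.symm hm]) A B
  have hmul : ((d₁.lcm d₂).totient : ℝ) * (1 / d₁.totient * (1 / d₂.totient)) =
      1 / (d₁.gcd d₂).totient := by
    field_simp; linarith
  have hexp : ∀ σ : ℝ, ∑ u, (I₁ u * I₂ u + σ * (I₁ u * (1 / d₂.totient)) +
      σ * (I₂ u * (1 / d₁.totient)) + 1 / d₁.totient * (1 / d₂.totient)) =
      (if (n₁ : ZMod (d₁.gcd d₂)) = n₂ then 1 else 0) +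
        (2 * σ + 1) * (1 / (d₁.gcd d₂).totient) := by
    intro σ
    have hc : ∑ _u : (ZMod (d₁.lcm d₂))ˣ, (1 / d₁.totient * (1 / d₂.totient) : ℝ) =
        1 / (d₁.gcd d₂).totient := by
      rw [← hmul, ← hcard, sum_mul]; simp only [one_mul]
    rw [sum_add_distrib, sum_add_distrib, sum_add_distrib, ← mul_sum, ← mul_sum, ← sum_mul,
      ← sum_mul, hS, hS₁, hS₂, hc, ← hmul]
    ring
  have e1 : ∑ u, (I₁ u - 1 / d₁.totient) * (I₂ u - 1 / d₂.totient) =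
      (if (n₁ : ZMod (d₁.gcd d₂)) = n₂ then 1 else 0) - 1 / ((d₁.gcd d₂).totient : ℝ) := by
    have h3 : ∀ u, (I₁ u - 1 / d₁.totient) * (I₂ u - 1 / d₂.totient) =
      (I₁ u * I₂ u + (-1) * (I₁ u * (1 / d₂.totient)) +
      (-1) * (I₂ u * (1 / d₁.totient)) + 1 / d₁.totient * (1 / d₂.totient)) :=
      fun u ↦ by ring
    rw [sum_congr rfl fun u _ ↦ h3 u, hexp (-1)]; ring
  rw [e1] at key
  refine key.trans ?_
  calc _ ≤ ∑ u, (I₁ u * I₂ u + 1 * (I₁ u * (1 / d₂.totient)) +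
      1 * (I₂ u * (1 / d₁.totient)) + 1 / d₁.totient * (1 / d₂.totient)) := by
        refine sum_le_sum fun u _ ↦ ?_
        have p₁ : 0 ≤ I₁ u := by simp only [hI₁]; split_ifs <;> norm_num
        have p₂ : 0 ≤ I₂ u := by simp only [hI₂]; split_ifs <;> norm_num
        have q₁ : 0 ≤ 1 / (d₁.totient : ℝ) := by positivity
        have q₂ : 0 ≤ 1 / (d₂.totient : ℝ) := by positivity
        rw [abs_le]
        constructor <;> nlinarith [mul_nonneg p₁ p₂, mul_nonneg p₁ q₂, mul_nonneg p₂ q₁,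
          mul_nonneg q₁ q₂]
    _ ≤ 4 := by
        rw [hexp 1]
        have := one_div_totient_le_one (d₁.gcd d₂)
        split_ifs <;> linarith

end TwistedBV

namespace TwistedBV

open Finset
open scoped ArithmeticFunction.vonMangoldt ComplexConjugate

/-- The indicator of `n₁ ≡ n₂ (mod g)` minus the density of a reduced class. -/
noncomputable def classDeviation (g n₁ n₂ : ℕ) : ℝ :=
  (if (n₁ : ZMod g) = n₂ then 1 else 0) - 1 / (g.totient : ℝ)

/-- The number of `m` contributing to a correlation sum. -/
def overlap (N j n₁ n₂ : ℕ) : ℕ := min (2 ^ (j + 1)) (N / max n₁ n₂ + 1) - 2 ^ j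

lemma overlap_le (N j n₁ n₂ : ℕ) : overlap N j n₁ n₂ ≤ 2 ^ j := by
  have : 2 ^ (j + 1) = 2 ^ j + 2 ^ j := by ring
  refine Nat.sub_le_of_le_add ((min_le_left _ _).trans this.le)

lemma overlap_anti {N j n n' n₂ : ℕ} (hn : 1 ≤ n) (h : n ≤ n') :
    overlap N j n' n₂ ≤ overlap N j n n₂ := by
  unfold overlap
  gcongr

lemma abs_sum_Ioc_antitone_mul_le {f w : ℕ → ℝ} {V K : ℕ} {W B : ℝ} (hVK : V ≤ K)
    (hw : ∀ n, V < n → n < K → w (n + 1) ≤ w n) (hw0 : ∀ n, 0 ≤ w n) (hW : ∀ n, w n ≤ W)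
    (hB : ∀ y, V ≤ y → y ≤ K → |∑ n ∈ Ioc V y, f n| ≤ B) :
    |∑ n ∈ Ioc V K, w n * f n| ≤ W * B := by
  have e : ∀ (y : ℕ) (F : ℕ → ℝ), V ≤ y →
      ∑ n ∈ Ioc V y, F n = ∑ i ∈ range (y - V), F (V + 1 + i) := by
    intro y F hy
    rw [show Ioc V y = Ico (V + 1) (y + 1) by ext; simp only [mem_Ioc, mem_Ico]; omega,
      sum_Ico_eq_sum_range, Nat.add_sub_add_right]
  have hB0 : 0 ≤ B := (abs_nonneg _).trans (hB V le_rfl hVK)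
  rcases hVK.eq_or_lt with rfl | hlt
  · simp only [Ioc_self, sum_empty, abs_zero]
    exact mul_nonneg ((hw0 0).trans (hW 0)) hB0
  set w' : ℕ → ℝ := fun i ↦ if i < K - V then w (V + 1 + i) else 0 with hw'
  have h := norm_sum_antitone_mul_le (f := fun i ↦ (f (V + 1 + i) : ℂ)) (w := w') (B := B)
    (n := K - V) ?_ (by simp [hw']) ?_
  · have h2 : ∑ i ∈ range (K - V), (w' i : ℂ) * (f (V + 1 + i) : ℂ) =
        ((∑ n ∈ Ioc V K, w n * f n : ℝ) : ℂ) := by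
      rw [e K _ hVK]
      push_cast
      refine sum_congr rfl fun i hi ↦ ?_
      simp only [hw', if_pos (mem_range.1 hi)]
    rw [h2, Complex.norm_real, Real.norm_eq_abs] at h
    refine h.trans (mul_le_mul_of_nonneg_right ?_ hB0)
    simp only [hw']
    split_ifs
    · exact hW _
    · exact (hw0 0).trans (hW 0)
  · intro i hi
    simp only [hw', if_pos hi]
    split_ifs with h3
    · exact hw (V + 1 + i) (by omega) (by omega)
    · exact hw0 _
  · intro i hi
    have := hB (V + i) (by omega) (by omega)
    rw [e _ _ (by omega), Nat.add_sub_cancel_left] at this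
    rw [← Complex.ofReal_sum, Complex.norm_real]
    exact this

lemma sum_vonMangoldt_le (N : ℕ) : ∑ n ∈ Icc 1 N, Λ n ≤ N * Real.log N := by
  calc _ ≤ ∑ n ∈ Icc 1 N, Real.log N := by
        refine sum_le_sum fun n hn ↦ ?_
        rw [mem_Icc] at hn
        exact ArithmeticFunction.vonMangoldt_le_log.trans
          (Real.log_le_log (by exact_mod_cast hn.1) (by exact_mod_cast hn.2))
    _ = _ := by rw [sum_const, Nat.card_Icc, nsmul_eq_mul, Nat.add_sub_cancel]

lemma sum_Ioc_vonMangoldt_le (V N : ℕ) : ∑ n ∈ Ioc V N, Λ n ≤ N * Real.log N := by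
  refine le_trans ?_ (sum_vonMangoldt_le N)
  refine sum_le_sum_of_subset_of_nonneg ?_ fun _ _ _ ↦ ArithmeticFunction.vonMangoldt_nonneg
  intro n; simp only [mem_Ioc, mem_Icc]; omega

lemma norm_correlation_residue_sub_le {a : ℤ} {d₁ d₂ n₁ n₂ : ℕ} [NeZero d₁] [NeZero d₂]
    (ha₁ : IsUnit (a : ZMod d₁)) (ha₂ : IsUnit (a : ZMod d₂)) (N j : ℕ) :
    ‖correlation N j (fun n ↦ (residue a d₁ n : ℂ)) (fun n ↦ (residue a d₂ n : ℂ)) n₁ n₂ -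
      ((if n₁.Coprime d₁ ∧ n₂.Coprime d₂ then overlap N j n₁ n₂ / (d₁.lcm d₂ : ℕ) *
        classDeviation (d₁.gcd d₂) n₁ n₂ else 0 : ℝ) : ℂ)‖ ≤ 4 := by
  have e : correlation N j (fun n ↦ (residue a d₁ n : ℂ)) (fun n ↦ (residue a d₂ n : ℂ)) n₁ n₂ =
      ((∑ m ∈ Ico (2 ^ j) (min (2 ^ (j + 1)) (N / max n₁ n₂ + 1)),
        residue a d₁ (m * n₁) * residue a d₂ (m * n₂) : ℝ) : ℂ) := by
    unfold correlation
    push_cast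
    exact sum_congr rfl fun m _ ↦ by rw [Complex.conj_ofReal]
  rw [e, ← Complex.ofReal_sub, Complex.norm_real, Real.norm_eq_abs]
  by_cases h : n₁.Coprime d₁ ∧ n₂.Coprime d₂
  · rw [if_pos h]
    exact abs_sum_residue_mul_residue_sub_le ha₁ ha₂ h.1 h.2 _ _
  · rw [if_neg h, sum_eq_zero]
    · norm_num
    · intro m _
      by_cases h₁ : n₁.Coprime d₁
      · rw [residue_eq_zero ha₂ fun h' ↦ h ⟨h₁, Nat.Coprime.coprime_mul_left h'⟩, mul_zero]
      · rw [residue_eq_zero ha₁ fun h' ↦ h₁ (Nat.Coprime.coprime_mul_left h'), zero_mul]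

/-- Reduction of the correlation sums of residues to partial sums of `Λ` in progressions. -/
lemma norm_sum_correlation_residue_le {a : ℤ} {d₁ d₂ : ℕ} [NeZero d₁] [NeZero d₂]
    (ha₁ : IsUnit (a : ZMod d₁)) (ha₂ : IsUnit (a : ZMod d₂)) {N j V K : ℕ} {ρ : ℝ}
    (hVK : V ≤ K)
    (hρ : ∀ n₂, n₂.Coprime (d₁.gcd d₂) → ∀ y, V ≤ y → y ≤ K →
      |∑ n₁ ∈ Ioc V y, if n₁.Coprime d₁ then Λ n₁ * classDeviation (d₁.gcd d₂) n₁ n₂ else 0| ≤ ρ) :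
    ‖∑ n₁ ∈ Ioc V K, ∑ n₂ ∈ Ioc V K, (Λ n₁ * Λ n₂ : ℂ) *
      correlation N j (fun n ↦ (residue a d₁ n : ℂ)) (fun n ↦ (residue a d₂ n : ℂ)) n₁ n₂‖ ≤
      4 * (K * Real.log K) ^ 2 + 1 / (d₁.lcm d₂ : ℕ) * (2 ^ j * ρ * (K * Real.log K)) := by
  set corr : ℕ → ℕ → ℂ := fun n₁ n₂ ↦
    correlation N j (fun n ↦ (residue a d₁ n : ℂ)) (fun n ↦ (residue a d₂ n : ℂ)) n₁ n₂
  set main : ℕ → ℕ → ℝ := fun n₁ n₂ ↦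
    if n₁.Coprime d₁ ∧ n₂.Coprime d₂ then overlap N j n₁ n₂ / (d₁.lcm d₂ : ℕ) *
        classDeviation (d₁.gcd d₂) n₁ n₂ else 0 with hmain
  have hΛ := fun n ↦ ArithmeticFunction.vonMangoldt_nonneg (n := n)
  have hψ := sum_Ioc_vonMangoldt_le V K
  have hψ0 : 0 ≤ ∑ n ∈ Ioc V K, Λ n := sum_nonneg fun _ _ ↦ hΛ _
  have hsplit : ∑ n₁ ∈ Ioc V K, ∑ n₂ ∈ Ioc V K, (Λ n₁ * Λ n₂ : ℂ) * corr n₁ n₂ =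
      ∑ n₁ ∈ Ioc V K, ∑ n₂ ∈ Ioc V K, (Λ n₁ * Λ n₂ : ℂ) * (corr n₁ n₂ - (main n₁ n₂ : ℂ)) +
      ((∑ n₂ ∈ Ioc V K, ∑ n₁ ∈ Ioc V K, Λ n₁ * Λ n₂ * main n₁ n₂ : ℝ) : ℂ) := by
    push_cast
    rw [sum_comm (s := Ioc V K) (t := Ioc V K)
      (f := fun n₂ n₁ ↦ (Λ n₁ : ℂ) * Λ n₂ * main n₁ n₂), ← sum_add_distrib]
    refine sum_congr rfl fun n₁ _ ↦ ?_
    rw [← sum_add_distrib]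
    exact sum_congr rfl fun n₂ _ ↦ by ring
  rw [hsplit]
  refine (norm_add_le _ _).trans (add_le_add ?_ ?_)
  · calc _ ≤ ∑ n₁ ∈ Ioc V K, ∑ n₂ ∈ Ioc V K, Λ n₁ * Λ n₂ * 4 := by
          refine norm_sum_le_of_le _ fun n₁ _ ↦ norm_sum_le_of_le _ fun n₂ _ ↦ ?_
          rw [norm_mul, norm_mul, Complex.norm_real, Complex.norm_real,
            Real.norm_of_nonneg (hΛ _), Real.norm_of_nonneg (hΛ _)]
          exact mul_le_mul_of_nonneg_left (norm_correlation_residue_sub_le ha₁ ha₂ N j)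
            (mul_nonneg (hΛ _) (hΛ _))
      _ = 4 * (∑ n ∈ Ioc V K, Λ n) ^ 2 := by
          simp_rw [← sum_mul]
          rw [pow_two, sum_mul_sum, mul_comm]
      _ ≤ _ := by gcongr
  · rw [Complex.norm_real, Real.norm_eq_abs]
    have hρ0 : 0 ≤ ρ := (abs_nonneg _).trans (hρ 1 (Nat.coprime_one_left _) V le_rfl hVK)
    calc _ ≤ ∑ n₂ ∈ Ioc V K, Λ n₂ * (1 / (d₁.lcm d₂ : ℕ) * (2 ^ j * ρ)) := by
          refine (abs_sum_le_sum_abs _ _).trans (sum_le_sum fun n₂ _ ↦ ?_)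
          by_cases h₂ : n₂.Coprime d₂
          swap
          · rw [sum_eq_zero, abs_zero]
            · have := hΛ n₂; positivity
            · intro n₁ _; simp [hmain, h₂]
          have h3 : ∀ n₁, Λ n₁ * Λ n₂ * main n₁ n₂ = Λ n₂ * (1 / (d₁.lcm d₂ : ℕ) *
              (overlap N j n₁ n₂ * if n₁.Coprime d₁ then
                Λ n₁ * classDeviation (d₁.gcd d₂) n₁ n₂ else 0)) := by
            intro n₁
            by_cases h₁ : n₁.Coprime d₁
            · simp only [hmain, if_pos h₁, if_pos (And.intro h₁ h₂)]; ring
            · simp [hmain, h₁]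
          rw [sum_congr rfl fun n₁ _ ↦ h3 n₁, ← mul_sum, ← mul_sum, abs_mul, abs_mul,
            abs_of_nonneg (hΛ _), abs_of_nonneg (by positivity : (0:ℝ) ≤ 1 / (d₁.lcm d₂ : ℕ))]
          refine mul_le_mul_of_nonneg_left (mul_le_mul_of_nonneg_left ?_ (by positivity)) (hΛ _)
          refine abs_sum_Ioc_antitone_mul_le (w := fun n₁ ↦ (overlap N j n₁ n₂ : ℝ)) hVK
            (fun n hn _ ↦ by exact_mod_cast overlap_anti (by omega) (by omega))
            (fun _ ↦ by positivity) (fun n ↦ by exact_mod_cast overlap_le N j n n₂)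
            (hρ n₂ (Nat.Coprime.coprime_dvd_right (Nat.gcd_dvd_right _ _) h₂))
      _ = 1 / (d₁.lcm d₂ : ℕ) * (2 ^ j * ρ * ∑ n ∈ Ioc V K, Λ n) := by
          rw [← sum_mul]; ring
      _ ≤ _ := by gcongr

end TwistedBV

namespace TwistedBV

open Finset
open scoped ArithmeticFunction.vonMangoldt

lemma abs_classDeviation_le (g n₁ n₂ : ℕ) :
    |classDeviation g n₁ n₂| ≤ (if (n₁ : ZMod g) = n₂ then 1 else 0) + 1 / (g.totient : ℝ) := by
  refine (abs_sub _ _).trans (le_of_eq ?_)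
  rw [abs_of_nonneg (by split_ifs <;> norm_num), abs_of_nonneg (by positivity)]

lemma abs_classDeviation_le_one (g n₁ n₂ : ℕ) : |classDeviation g n₁ n₂| ≤ 1 := by
  have h1 := one_div_totient_le_one g
  have h2 : (0 : ℝ) ≤ 1 / (g.totient : ℝ) := by positivity
  unfold classDeviation
  rw [abs_le]
  split_ifs <;> constructor <;> linarith

lemma abs_sum_classDeviation_le_trivial {g : ℕ} [NeZero g] (d n₂ V : ℕ) {y K : ℕ} (hy : y ≤ K) :
    |∑ n₁ ∈ Ioc V y, if n₁.Coprime d then Λ n₁ * classDeviation g n₁ n₂ else 0| ≤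
      Real.log K * (K / g + 1 + K / (g.totient : ℝ)) := by
  calc _ ≤ ∑ n₁ ∈ Ico 1 (K + 1), Real.log K *
        ((if (n₁ : ZMod g) = n₂ then 1 else 0) + 1 / (g.totient : ℝ)) := by
        refine (abs_sum_le_sum_abs _ _).trans ?_
        refine (sum_le_sum (g := fun n₁ : ℕ ↦ Real.log K *
          ((if (n₁ : ZMod g) = n₂ then 1 else 0) + 1 / (g.totient : ℝ))) fun n₁ hn ↦ ?_).trans ?_
        · rw [mem_Ioc] at hn
          have hL : Λ n₁ ≤ Real.log K := ArithmeticFunction.vonMangoldt_le_log.trans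
            (Real.log_le_log (by exact_mod_cast (by omega : 0 < n₁))
              (by exact_mod_cast hn.2.trans hy))
          split_ifs with h1 h2
          all_goals first | (rw [abs_mul, abs_of_nonneg ArithmeticFunction.vonMangoldt_nonneg]
                             have := abs_classDeviation_le g n₁ n₂
                             simp only [*, if_true, if_false] at this
                             exact mul_le_mul hL this (abs_nonneg _) (Real.log_natCast_nonneg K))
                          | (rw [abs_zero]
                             have := Real.log_natCast_nonneg K; positivity)
        · refine sum_le_sum_of_subset_of_nonneg ?_ fun n _ _ ↦ ?_
          · intro n; simp only [mem_Ioc, mem_Ico]; omega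
          · have := Real.log_natCast_nonneg K
            split_ifs <;> positivity
    _ = Real.log K * (((Ico 1 (K + 1)).filter (fun m : ℕ ↦ (m : ZMod g) = n₂)).card +
        K / (g.totient : ℝ)) := by
        rw [← mul_sum, sum_add_distrib, sum_boole, sum_const, Nat.card_Ico, nsmul_eq_mul,
          Nat.add_sub_cancel, mul_one_div]
    _ ≤ _ := by
        have h := (abs_le.1 (abs_card_filter_sub_le (n₂ : ZMod g) 1 (K + 1))).2
        rw [Nat.add_sub_cancel] at h
        refine mul_le_mul_of_nonneg_left ?_ (Real.log_natCast_nonneg K)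
        linarith

lemma exists_abs_sum_classDeviation_le (A : ℕ) : ∃ C > 0, ∀ {d g n₂ V y K N : ℕ} [NeZero g],
    g ∣ d → 1 ≤ d → d ≤ N → n₂.Coprime g → 2 ≤ V → V ≤ y → y ≤ K → K ≤ N →
    |∑ n₁ ∈ Ioc V y, if n₁.Coprime d then Λ n₁ * classDeviation g n₁ n₂ else 0| ≤
      C * g * K / Real.log V ^ A + 4 * Real.log N ^ 3 := by
  obtain ⟨C₁, hC₁, h₁⟩ := siegel_walfisz A
  obtain ⟨C₂, hC₂, h₂⟩ := exists_abs_sum_vonMangoldt_sub_le A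
  refine ⟨2 * (C₁ + C₂), by positivity, ?_⟩
  intro d g n₂ V y K N _ hgd hd hdN hn₂ hV hVy hyK hKN
  have hg1 : (1 : ℝ) ≤ g := by exact_mod_cast NeZero.pos g
  have hlogV : 0 < Real.log V := Real.log_pos (by exact_mod_cast hV)
  have hφ : (0 : ℝ) < g.totient := by exact_mod_cast Nat.totient_pos.2 (NeZero.pos g)
  have hfull : ∀ z, V ≤ z → z ≤ K → |∑ n ∈ Icc 1 z, Λ n * classDeviation g n n₂| ≤
      (C₁ + C₂) * g * K / Real.log V ^ A := by
    intro z hVz hzK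
    have e : ∑ n ∈ Icc 1 z, Λ n * classDeviation g n n₂ =
        (∑ n ∈ (Icc 1 z).filter (fun n : ℕ ↦ (n : ZMod g) = n₂), Λ n - z / g.totient) -
        (∑ n ∈ Icc 1 z, Λ n - z) / g.totient := by
      rw [sum_filter, sub_div, sum_div, sub_sub_sub_cancel_right, ← sum_sub_distrib]
      refine sum_congr rfl fun n _ ↦ ?_
      unfold classDeviation
      split_ifs <;> ring
    have hz2 : 2 ≤ z := hV.trans hVz
    have hlog : Real.log V ≤ Real.log z :=
      Real.log_le_log (by exact_mod_cast (by omega : 0 < V)) (by exact_mod_cast hVz)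
    have b₁ := h₁ g n₂ ((ZMod.isUnit_iff_coprime n₂ g).2 hn₂) z hz2
    have b₂ := h₂ z hz2
    have hzK' : (z : ℝ) ≤ K := by exact_mod_cast hzK
    rw [e]
    refine (abs_sub _ _).trans ?_
    have c₁ : C₁ * g * z / Real.log z ^ A ≤ C₁ * g * K / Real.log V ^ A := by gcongr
    have c₂ : |(∑ n ∈ Icc 1 z, Λ n - z) / g.totient| ≤ C₂ * g * K / Real.log V ^ A := by
      rw [abs_div, abs_of_pos hφ]
      calc _ ≤ |∑ n ∈ Icc 1 z, Λ n - (z : ℝ)| := by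
            apply div_le_self (abs_nonneg _)
            exact_mod_cast Nat.totient_pos.2 (NeZero.pos g)
        _ ≤ _ := b₂
        _ = C₂ * 1 * z / Real.log z ^ A := by ring
        _ ≤ _ := by gcongr
    calc _ ≤ _ := add_le_add (b₁.trans c₁) c₂
      _ = _ := by ring
  have hsplit : ∑ n₁ ∈ Ioc V y, (if n₁.Coprime d then Λ n₁ * classDeviation g n₁ n₂ else 0) =
      ∑ n ∈ Icc 1 y, Λ n * classDeviation g n n₂ - ∑ n ∈ Icc 1 V, Λ n * classDeviation g n n₂ -
      ∑ n ∈ (Ioc V y).filter (fun n ↦ ¬ n.Coprime d), Λ n * classDeviation g n n₂ := by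
    have h3 := sum_filter_add_sum_filter_not (Ioc V y) (fun n ↦ n.Coprime d)
      (fun n ↦ Λ n * classDeviation g n n₂)
    have h4 := sum_Ioc_consecutive (fun n ↦ Λ n * classDeviation g n n₂) (Nat.zero_le V) hVy
    have h5 : ∀ z : ℕ, Icc 1 z = Ioc 0 z := fun z ↦ rfl
    rw [← sum_filter, h5, h5]
    linarith
  have hnc : |∑ n ∈ (Ioc V y).filter (fun n ↦ ¬ n.Coprime d), Λ n * classDeviation g n n₂| ≤
      4 * Real.log N ^ 3 := by
    have hy1 : 1 ≤ y := by omega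
    have hlogy : Real.log y ≤ Real.log N :=
      Real.log_le_log (by exact_mod_cast hy1) (by exact_mod_cast hyK.trans hKN)
    have hlogd : Real.log d ≤ Real.log N :=
      Real.log_le_log (by exact_mod_cast hd) (by exact_mod_cast hdN)
    calc _ ≤ ∑ n ∈ (Ioc V y).filter (fun n ↦ ¬ n.Coprime d), Λ n := by
          refine (abs_sum_le_sum_abs _ _).trans (sum_le_sum fun n _ ↦ ?_)
          rw [abs_mul, abs_of_nonneg ArithmeticFunction.vonMangoldt_nonneg]
          exact mul_le_of_le_one_right ArithmeticFunction.vonMangoldt_nonneg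
            (abs_classDeviation_le_one _ _ _)
      _ ≤ ∑ n ∈ (Icc 1 y).filter (fun n ↦ ¬ n.Coprime d), Λ n := by
          refine sum_le_sum_of_subset_of_nonneg (filter_subset_filter _ ?_)
            fun _ _ _ ↦ ArithmeticFunction.vonMangoldt_nonneg
          intro n; simp only [mem_Ioc, mem_Icc]; omega
      _ ≤ 2 * Nat.log 2 d * Real.log y ^ 2 := sum_vonMangoldt_not_coprime_le (by omega) hy1
      _ ≤ 2 * (2 * Real.log N) * Real.log N ^ 2 := by
          have := natLog_two_le hd
          have := Real.log_natCast_nonneg y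
          gcongr
          linarith
      _ = _ := by ring
  rw [hsplit]
  have f₁ := hfull y hVy hyK
  have f₂ := hfull V le_rfl (hVy.trans hyK)
  calc _ ≤ |∑ n ∈ Icc 1 y, Λ n * classDeviation g n n₂| +
        |∑ n ∈ Icc 1 V, Λ n * classDeviation g n n₂| +
        |∑ n ∈ (Ioc V y).filter (fun n ↦ ¬ n.Coprime d), Λ n * classDeviation g n n₂| :=
        (abs_sub _ _).trans (add_le_add_left (abs_sub _ _) _)
    _ ≤ (C₁ + C₂) * g * K / Real.log V ^ A + (C₁ + C₂) * g * K / Real.log V ^ A +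
        4 * Real.log N ^ 3 := by gcongr
    _ = _ := by ring

end TwistedBV

namespace TwistedBV

open Finset Filter
open scoped ArithmeticFunction.vonMangoldt

lemma eventually_const_mul_log_pow_le (c : ℝ) (k : ℕ) {δ : ℝ} (hδ : 0 < δ) :
    ∀ᶠ x : ℝ in atTop, c * Real.log x ^ k ≤ x ^ δ := by
  have h := (isLittleO_log_rpow_rpow_atTop (k : ℝ) hδ).def (c := 1 / (|c| + 1)) (by positivity)
  filter_upwards [h, eventually_ge_atTop 1] with x hx hx1
  have hl := Real.log_nonneg hx1
  rw [Real.rpow_natCast, Real.norm_of_nonneg (by positivity), Real.norm_of_nonneg (by positivity),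
    div_mul_eq_mul_div, one_mul, le_div_iff₀ (by positivity)] at hx
  calc c * Real.log x ^ k ≤ (|c| + 1) * Real.log x ^ k := by
        gcongr; linarith [le_abs_self c]
    _ ≤ _ := by linarith

lemma sum_inv_lcm_le_of_forall_le {s : Finset ℕ} {D : ℕ} (hs : ∀ d ∈ s, 1 ≤ d ∧ d ≤ D) :
    ∑ d₁ ∈ s, ∑ d₂ ∈ s, (1 / (d₁.lcm d₂ : ℕ) : ℝ) ≤ (1 + Real.log D) ^ 3 := by
  refine le_trans ?_ (sum_inv_lcm_le D)
  have hsub : s ⊆ Icc 1 D := fun d hd ↦ mem_Icc.2 (hs d hd)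
  calc _ ≤ ∑ d₁ ∈ s, ∑ d₂ ∈ Icc 1 D, (1 / (d₁.lcm d₂ : ℕ) : ℝ) :=
        sum_le_sum fun d₁ _ ↦ sum_le_sum_of_subset_of_nonneg hsub fun _ _ _ ↦ by positivity
    _ ≤ _ := sum_le_sum_of_subset_of_nonneg hsub fun _ _ _ ↦ by positivity

/-- The parameter `P = N^(1/20)` governing all ranges: `U = ⌊P^11⌋`, `V = ⌊P^2⌋`, `D = ⌊P^4⌋`. -/
structure Scale (N : ℕ) (P L : ℝ) (k : ℕ) : Prop where
  pow_eq : P ^ 20 = N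
  two_le : 2 ≤ P
  log_eq : L = Real.log N
  log_P : Real.log P = L / 20
  one_le_log : 1 ≤ L
  log_pow_le : 8 * L ^ k ≤ P

lemma eventually_scale (k : ℕ) : ∃ N₀ : ℕ, 2 ≤ N₀ ∧ ∀ N : ℕ, N₀ ≤ N →
    Scale N ((N : ℝ) ^ (1 / 20 : ℝ)) (Real.log N) k := by
  have h1 := (eventually_const_mul_log_pow_le 8 k (δ := 1 / 20) (by norm_num)).and
    (eventually_ge_atTop (2 ^ 20 : ℝ))
  obtain ⟨x₀, hx₀⟩ := eventually_atTop.1 h1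
  refine ⟨max 2 ⌈x₀⌉₊, le_max_left _ _, fun N hN ↦ ?_⟩
  obtain ⟨h2, h3⟩ := hx₀ N ((Nat.le_ceil x₀).trans (by exact_mod_cast (le_max_right _ _).trans hN))
  have hN0 : (0 : ℝ) < N := lt_of_lt_of_le (by positivity) h3
  refine ⟨?_, ?_, rfl, ?_, ?_, h2⟩
  · rw [← Real.rpow_natCast, ← Real.rpow_mul hN0.le]; norm_num
  · calc (2 : ℝ) = (2 ^ (20 : ℕ)) ^ (1 / 20 : ℝ) := by
          rw [← Real.rpow_natCast, ← Real.rpow_mul (by norm_num)]; norm_num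
      _ ≤ _ := Real.rpow_le_rpow (by positivity) h3 (by norm_num)
  · rw [Real.log_rpow hN0]; ring
  · rw [Real.le_log_iff_exp_le hN0]
    linarith [Real.exp_one_lt_d9]

namespace Scale

variable {N : ℕ} {P L : ℝ} {k : ℕ}

lemma pow_le (h : Scale N P L k) {i : ℕ} (hi : i ≤ k) : 8 * L ^ i ≤ P :=
  (mul_le_mul_of_nonneg_left (pow_le_pow_right₀ h.one_le_log hi) (by norm_num)).trans h.log_pow_le

lemma one_le (h : Scale N P L k) : 1 ≤ P := by linarith [h.two_le]

lemma one_le_N (h : Scale N P L k) : 1 ≤ N := by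
  have : (1 : ℝ) ≤ N := by rw [← h.pow_eq]; exact one_le_pow₀ h.one_le
  exact_mod_cast this

lemma le_V (h : Scale N P L k) : P ≤ ⌊P ^ 2⌋₊ := by
  have := Nat.lt_floor_add_one (P ^ 2)
  nlinarith [h.two_le]

lemma V_le (h : Scale N P L k) : (⌊P ^ 2⌋₊ : ℝ) ≤ P ^ 2 :=
  Nat.floor_le (by have := h.one_le; positivity)

lemma U_le (h : Scale N P L k) : (⌊P ^ 11⌋₊ : ℝ) ≤ P ^ 11 :=
  Nat.floor_le (by have := h.one_le; positivity)

lemma UV_le (h : Scale N P L k) : ((⌊P ^ 11⌋₊ * ⌊P ^ 2⌋₊ : ℕ) : ℝ) ≤ P ^ 13 := by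
  have := h.one_le
  calc ((⌊P ^ 11⌋₊ * ⌊P ^ 2⌋₊ : ℕ) : ℝ) = ⌊P ^ 11⌋₊ * ⌊P ^ 2⌋₊ := by push_cast; ring
    _ ≤ P ^ 11 * P ^ 2 := by gcongr; exacts [h.U_le, h.V_le]
    _ = _ := by ring

lemma UV_le_N (h : Scale N P L k) : ⌊P ^ 11⌋₊ * ⌊P ^ 2⌋₊ ≤ N := by
  have : ((⌊P ^ 11⌋₊ * ⌊P ^ 2⌋₊ : ℕ) : ℝ) ≤ N := by
    rw [← h.pow_eq]
    exact h.UV_le.trans (pow_le_pow_right₀ h.one_le (by norm_num))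
  exact_mod_cast this

lemma two_le_V (h : Scale N P L k) : 2 ≤ ⌊P ^ 2⌋₊ := by
  have : (2 : ℝ) ≤ ⌊P ^ 2⌋₊ := h.two_le.trans h.le_V
  exact_mod_cast this

lemma le_two_pow {P : ℝ} {j : ℕ} (hj : ⌊P ^ 11⌋₊ < 2 ^ (j + 1)) : P ^ 11 ≤ 2 * 2 ^ j := by
  have h1 := Nat.lt_floor_add_one (P ^ 11)
  have h2 : ((⌊P ^ 11⌋₊ + 1 : ℕ) : ℝ) ≤ ((2 ^ (j + 1) : ℕ) : ℝ) := by exact_mod_cast hj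
  push_cast at h2
  have h3 : (2 : ℝ) ^ (j + 1) = 2 * 2 ^ j := by ring
  linarith

lemma log_V (h : Scale N P L k) : L / 20 ≤ Real.log ⌊P ^ 2⌋₊ := by
  rw [← h.log_P]
  exact Real.log_le_log (by linarith [h.two_le]) h.le_V

end Scale

end TwistedBV

namespace TwistedBV

open Finset Filter
open scoped ArithmeticFunction.vonMangoldt

namespace Scale

variable {N : ℕ} {P L : ℝ} {k : ℕ}

lemma natLog_succ_le (h : Scale N P L k) : (Nat.log 2 N + 1 : ℝ) ≤ 3 * L := by
  have := natLog_two_le h.one_le_N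
  rw [← h.log_eq] at this
  linarith [h.one_le_log]

lemma log_le (h : Scale N P L k) {n : ℕ} (hn : n ≤ N) : Real.log n ≤ L := by
  rw [h.log_eq]
  rcases Nat.eq_zero_or_pos n with rfl | h0
  · simpa using Real.log_natCast_nonneg N
  · exact Real.log_le_log (by exact_mod_cast h0) (by exact_mod_cast hn)

lemma V_le_N (h : Scale N P L k) : ⌊P ^ 2⌋₊ ≤ N := by
  have : (⌊P ^ 2⌋₊ : ℝ) ≤ N := by
    rw [← h.pow_eq]
    exact h.V_le.trans (pow_le_pow_right₀ h.one_le (by norm_num))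
  exact_mod_cast this

/-- A saving of one power of `P` beats any power of the logarithm. -/
lemma pow_le_div (h : Scale N P L k) {i : ℕ} (hi : i ≤ k) {x : ℝ} (hx : x ≤ P ^ 19) :
    x ≤ N / L ^ i := by
  have hL : 0 < L := by linarith [h.one_le_log]
  have hP := h.one_le
  rw [le_div_iff₀ (by positivity), ← h.pow_eq]
  have h1 := h.pow_le hi
  have h2 : 0 < L ^ i := by positivity
  calc x * L ^ i ≤ P ^ 19 * P := by gcongr; linarith
    _ = _ := by ring

lemma sum_norm_sum_vonMangoldt_mul_le {ι : Type*} (h : Scale N P L k) {A : ℕ} (hA : A + 1 ≤ k)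
    (s : Finset ι) (φ : ι → ℕ → ℂ) (T : ℕ → ℝ) {B : ℝ} (hB : 0 ≤ B)
    (hs : (s.card : ℝ) ≤ P ^ 4) (hφ : ∀ d ∈ s, ∀ n, ‖φ d n‖ ≤ 1)
    (hT : ∀ k ∈ Icc 1 (⌊P ^ 11⌋₊ * ⌊P ^ 2⌋₊), ∀ y ≤ N / k,
      ∑ d ∈ s, ‖∑ e ∈ Icc 1 y, φ d (k * e)‖ ≤ T k)
    (hTs : ∑ k ∈ Icc 1 (⌊P ^ 11⌋₊ * ⌊P ^ 2⌋₊), T k ≤ B * N / L ^ (A + 1))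
    (hη : ∀ j, ⌊P ^ 11⌋₊ < 2 ^ (j + 1) → 2 ^ j ≤ N → ∑ d₁ ∈ s, ∑ d₂ ∈ s,
      ‖∑ n₁ ∈ Ioc ⌊P ^ 2⌋₊ (N / 2 ^ j), ∑ n₂ ∈ Ioc ⌊P ^ 2⌋₊ (N / 2 ^ j),
        (Λ n₁ * Λ n₂ : ℂ) * correlation N j (φ d₁) (φ d₂) n₁ n₂‖ ≤
          N ^ 2 / 2 ^ j * (B / L ^ (2 * A + 5))) :
    ∑ d ∈ s, ‖∑ n ∈ Icc 1 N, (Λ n : ℂ) * φ d n‖ ≤ (25 + 27 * B) * N / L ^ A := by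
  have hL1 := h.one_le_log
  have hL : 0 < L := by linarith
  have hP := h.one_le
  have hN0 : (0 : ℝ) < N := by exact_mod_cast h.one_le_N
  refine (TwistedBV.sum_norm_sum_vonMangoldt_mul_le (by linarith [h.two_le_V]) h.UV_le_N
    h.one_le_N s φ T hφ hT hη).trans ?_
  have h1 : s.card * (⌊P ^ 2⌋₊ * Real.log ⌊P ^ 2⌋₊) ≤ N / L ^ A := by
    refine h.pow_le_div (by omega) ?_
    have hlog := h.log_le h.V_le_N
    have hLP : L ≤ P := by
      have := h.pow_le (i := 1) (by omega)
      rw [pow_one] at this; linarith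
    calc s.card * (⌊P ^ 2⌋₊ * Real.log ⌊P ^ 2⌋₊) ≤ P ^ 4 * (P ^ 2 * P) := by
          gcongr
          · exact h.V_le
          · linarith
      _ = P ^ 7 := by ring
      _ ≤ P ^ 19 := pow_le_pow_right₀ hP (by norm_num)
  have h2 : 3 * Real.log N * ∑ k ∈ Icc 1 (⌊P ^ 11⌋₊ * ⌊P ^ 2⌋₊), T k ≤ 3 * B * N / L ^ A := by
    rw [← h.log_eq]
    calc _ ≤ 3 * L * (B * N / L ^ (A + 1)) := by gcongr
      _ = _ := by field_simp; ring
  have h3 : (1 + Real.log (2 * N)) ≤ 3 * L := by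
    rw [Real.log_mul (by norm_num) hN0.ne', ← h.log_eq]
    linarith [Real.log_two_lt_d9]
  have h3' : 0 ≤ 1 + Real.log (2 * N) := by
    rw [Real.log_mul (by norm_num) hN0.ne', ← h.log_eq]
    linarith [Real.log_two_gt_d9]
  have h4 : √(2 * (1 + Real.log (2 * N)) ^ 3 * (B / L ^ (2 * A + 5))) ≤
      8 * (1 + B) / L ^ (A + 1) := by
    refine Real.sqrt_le_iff.2 ⟨by positivity, ?_⟩
    calc 2 * (1 + Real.log (2 * N)) ^ 3 * (B / L ^ (2 * A + 5)) ≤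
          2 * (3 * L) ^ 3 * (B / L ^ (2 * A + 5)) := by gcongr
      _ = 54 * B / L ^ (2 * A + 2) := by field_simp; ring
      _ ≤ (8 * (1 + B)) ^ 2 / L ^ (2 * A + 2) := by gcongr; nlinarith
      _ = _ := by rw [div_pow, ← pow_mul]; ring
  have h5 : (Nat.log 2 N + 1) * (N * √(2 * (1 + Real.log (2 * N)) ^ 3 * (B / L ^ (2 * A + 5)))) ≤
      24 * (1 + B) * N / L ^ A := by
    calc _ ≤ 3 * L * (N * (8 * (1 + B) / L ^ (A + 1))) := by
          gcongr; exact h.natLog_succ_le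
      _ = _ := by field_simp; ring
  calc _ ≤ N / L ^ A + 3 * B * N / L ^ A + 24 * (1 + B) * N / L ^ A := add_le_add_three h1 h2 h5
    _ = _ := by ring

end Scale

/-- The deviation sums over `Ioc V y` save any power of the logarithm, for every modulus `g`. -/
lemma exists_abs_sum_classDeviation_le_div (E : ℕ) : ∃ C > 0, ∀ {N : ℕ} {P L : ℝ} {k : ℕ},
    Scale N P L k → E + 3 ≤ k → ∀ {d g n₂ y K : ℕ} [NeZero g], g ∣ d → 1 ≤ d → d ≤ N →
    n₂.Coprime g → ⌊P ^ 2⌋₊ ≤ y → y ≤ K → K ≤ N →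
    |∑ n₁ ∈ Ioc ⌊P ^ 2⌋₊ y, if n₁.Coprime d then Λ n₁ * classDeviation g n₁ n₂ else 0| ≤
      C * K / L ^ E := by
  obtain ⟨C, hC, hSW⟩ := exists_abs_sum_classDeviation_le (2 * E + 2)
  refine ⟨20 ^ (2 * E + 2) * C + 5, by positivity, ?_⟩
  intro N P L k h hk d g n₂ y K _ hgd hd hdN hn₂ hVy hyK hKN
  have hL1 := h.one_le_log
  have hL : 0 < L := by linarith
  have hg0 : (0 : ℝ) < g := by exact_mod_cast NeZero.pos g
  have hPK : P ≤ K := h.le_V.trans (by exact_mod_cast hVy.trans hyK)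
  have hKL : L ^ 3 ≤ K / L ^ E := by
    rw [le_div_iff₀ (by positivity), ← pow_add, add_comm 3]
    have := h.pow_le hk
    have h2 : 0 < L ^ (E + 3) := by positivity
    linarith
  have hK0 : (0 : ℝ) ≤ K := by positivity
  rcases le_or_gt (g : ℝ) (L ^ (E + 2)) with hg | hg
  · refine (hSW hgd hd hdN hn₂ h.two_le_V hVy hyK hKN).trans ?_
    rw [← h.log_eq]
    calc C * g * K / Real.log ⌊P ^ 2⌋₊ ^ (2 * E + 2) + 4 * L ^ 3 ≤
          C * L ^ (E + 2) * K / (L / 20) ^ (2 * E + 2) + 4 * (K / L ^ E) := by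
          gcongr; exact h.log_V
      _ = 20 ^ (2 * E + 2) * C * (K / L ^ E) + 4 * (K / L ^ E) := by
          rw [div_pow]
          field_simp
          ring
      _ ≤ (20 ^ (2 * E + 2) * C + 5) * (K / L ^ E) := by
          have : 0 ≤ K / L ^ E := by positivity
          linarith
      _ = _ := by ring
  · refine (abs_sum_classDeviation_le_trivial d n₂ _ hyK).trans ?_
    have hφ0 : (0 : ℝ) < g.totient := by exact_mod_cast Nat.totient_pos.2 (NeZero.pos g)
    have hφ : K / (g.totient : ℝ) ≤ K / g * (3 * L) := by
      have h1 : (Nat.log 2 g + 1 : ℝ) ≤ 3 * L :=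
        le_trans (by
          have : Nat.log 2 g ≤ Nat.log 2 N :=
            Nat.log_mono_right ((Nat.le_of_dvd hd hgd).trans hdN)
          have : (Nat.log 2 g : ℝ) ≤ Nat.log 2 N := by exact_mod_cast this
          linarith) h.natLog_succ_le
      rw [div_mul_eq_mul_div, div_le_div_iff₀ hφ0 hg0]
      have h2 := le_totient_mul_log g
      calc (K : ℝ) * g ≤ K * (g.totient * (3 * L)) := by
            gcongr; exact h2.trans (by gcongr)
        _ = _ := by ring
    have hKg : (K : ℝ) / g ≤ K / L ^ (E + 2) := by gcongr
    have h3 : K / L ^ (E + 2) * L ^ 2 = K / L ^ E := by field_simp; ring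
    have h4 : (1 : ℝ) ≤ L ^ 2 := one_le_pow₀ hL1
    have h5 : 0 ≤ K / L ^ (E + 2) := by positivity
    calc Real.log K * (K / g + 1 + K / (g.totient : ℝ)) ≤
          L * (K / L ^ (E + 2) + 1 + K / L ^ (E + 2) * (3 * L)) := by
          gcongr
          · exact h.log_le hKN
          · exact hφ.trans (by gcongr)
      _ ≤ L + 4 * (K / L ^ (E + 2) * L ^ 2) := by
          have h6 := mul_le_mul_of_nonneg_left (by nlinarith : L ≤ L ^ 2) h5
          linarith
      _ ≤ K / L ^ E + 4 * (K / L ^ E) := by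
          rw [h3]; gcongr; exact le_trans (by nlinarith) hKL
      _ ≤ (20 ^ (2 * E + 2) * C + 5) * (K / L ^ E) := by
          have : 0 ≤ 20 ^ (2 * E + 2) * C * (K / L ^ E) := by positivity
          linarith
      _ = _ := by ring

end TwistedBV

namespace TwistedBV

open Finset Filter
open scoped ArithmeticFunction.vonMangoldt

lemma Scale.sum_correlation_residue_le {N : ℕ} {P L : ℝ} {k : ℕ} (h : Scale N P L k) {a : ℤ}
    {s : Finset ℕ} (hs : ∀ d ∈ s, 1 ≤ d ∧ (d : ℝ) ≤ P ^ 4 ∧ IsUnit (a : ZMod d))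
    (hcard : (s.card : ℝ) ≤ P ^ 4) {C : ℝ} {F : ℕ} (hC : 0 < C) (hF : F + 2 ≤ k)
    (hρ : ∀ {d g n₂ y K : ℕ} [NeZero g], g ∣ d → 1 ≤ d → d ≤ N →
      n₂.Coprime g → ⌊P ^ 2⌋₊ ≤ y → y ≤ K → K ≤ N →
      |∑ n₁ ∈ Ioc ⌊P ^ 2⌋₊ y, if n₁.Coprime d then Λ n₁ * classDeviation g n₁ n₂ else 0| ≤
        C * K / L ^ (F + 4)) {j : ℕ} (hj : ⌊P ^ 11⌋₊ < 2 ^ (j + 1)) :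
    ∑ d₁ ∈ s, ∑ d₂ ∈ s, ‖∑ n₁ ∈ Ioc ⌊P ^ 2⌋₊ (N / 2 ^ j), ∑ n₂ ∈ Ioc ⌊P ^ 2⌋₊ (N / 2 ^ j),
      (Λ n₁ * Λ n₂ : ℂ) * correlation N j (fun n ↦ (residue a d₁ n : ℂ))
        (fun n ↦ (residue a d₂ n : ℂ)) n₁ n₂‖ ≤ N ^ 2 / 2 ^ j * ((1 + 8 * C) / L ^ F) := by
  have hL1 := h.one_le_log
  have hL : 0 < L := by linarith
  have hP := h.one_le
  set K := N / 2 ^ j with hK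
  have hKN : K ≤ N := Nat.div_le_self _ _
  rcases lt_or_ge K ⌊P ^ 2⌋₊ with hVK | hVK
  · rw [Ioc_eq_empty (by omega)]
    simp only [sum_empty, norm_zero, sum_const_zero]
    positivity
  have hdN : ∀ d ∈ s, d ≤ N := fun d hd ↦ by
    have : (d : ℝ) ≤ N := by
      rw [← h.pow_eq]; exact (hs d hd).2.1.trans (pow_le_pow_right₀ hP (by norm_num))
    exact_mod_cast this
  have hKM : (K : ℝ) ≤ N / 2 ^ j := by
    have := Nat.cast_div_le (α := ℝ) (m := N) (n := 2 ^ j)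
    push_cast at this; exact this
  have hlK := h.log_le hKN
  have hlK0 := Real.log_natCast_nonneg K
  have hterm : ∀ d₁ ∈ s, ∀ d₂ ∈ s, ‖∑ n₁ ∈ Ioc ⌊P ^ 2⌋₊ K, ∑ n₂ ∈ Ioc ⌊P ^ 2⌋₊ K,
      (Λ n₁ * Λ n₂ : ℂ) * correlation N j (fun n ↦ (residue a d₁ n : ℂ))
        (fun n ↦ (residue a d₂ n : ℂ)) n₁ n₂‖ ≤ 4 * (K * L) ^ 2 +
        1 / (d₁.lcm d₂ : ℕ) * (2 ^ j * (C * K / L ^ (F + 4)) * (K * L)) := by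
    intro d₁ h₁ d₂ h₂
    have : NeZero d₁ := ⟨by linarith [(hs d₁ h₁).1]⟩
    have : NeZero d₂ := ⟨by linarith [(hs d₂ h₂).1]⟩
    have : NeZero (d₁.gcd d₂) := ⟨(Nat.gcd_pos_of_pos_left _ (hs d₁ h₁).1).ne'⟩
    refine (norm_sum_correlation_residue_le (hs d₁ h₁).2.2 (hs d₂ h₂).2.2 hVK
      fun n₂ hn y hy hyK ↦ hρ (Nat.gcd_dvd_left _ _) (hs d₁ h₁).1 (hdN d₁ h₁) hn hy hyK
        hKN).trans ?_
    gcongr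
  refine (sum_le_sum fun d₁ h₁ ↦ sum_le_sum fun d₂ h₂ ↦ hterm d₁ h₁ d₂ h₂).trans ?_
  simp_rw [sum_add_distrib, sum_const, ← sum_mul]
  rw [smul_smul, nsmul_eq_mul]
  push_cast
  have hlcm : ∑ d₁ ∈ s, ∑ d₂ ∈ s, (1 / (d₁.lcm d₂ : ℕ) : ℝ) ≤ 8 * L ^ 3 := by
    refine (sum_inv_lcm_le_of_forall_le (D := N) fun d hd ↦ ⟨(hs d hd).1, hdN d hd⟩).trans ?_
    rw [← h.log_eq]
    calc (1 + L) ^ 3 ≤ (2 * L) ^ 3 := by gcongr; linarith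
      _ = _ := by ring
  have hM : (0 : ℝ) < 2 ^ j := by positivity
  have hKK : (K : ℝ) ^ 2 ≤ (N / 2 ^ j) ^ 2 := by gcongr
  have hPL : 4 * P ^ 8 * L ^ 2 / 2 ^ j ≤ 1 / L ^ F := by
    rw [div_le_div_iff₀ hM (by positivity), one_mul]
    have h1 := le_two_pow hj
    have h2 := h.pow_le hF
    have h3 : 4 * P ^ 8 * L ^ 2 * L ^ F ≤ P ^ 11 / 2 := by
      calc 4 * P ^ 8 * L ^ 2 * L ^ F = P ^ 8 * (8 * L ^ (F + 2)) / 2 := by ring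
        _ ≤ P ^ 8 * P / 2 := by gcongr
        _ = P ^ 9 / 2 := by ring
        _ ≤ P ^ 11 / 2 := by gcongr; norm_num
    linarith
  calc (s.card : ℝ) * s.card * (4 * (K * L) ^ 2) + (∑ d₁ ∈ s, ∑ d₂ ∈ s,
        (1 / (d₁.lcm d₂ : ℕ) : ℝ)) * (2 ^ j * (C * K / L ^ (F + 4)) * (K * L)) ≤
        P ^ 4 * P ^ 4 * (4 * (K * L) ^ 2) +
          8 * L ^ 3 * (2 ^ j * (C * K / L ^ (F + 4)) * (K * L)) := by gcongr
    _ = (K : ℝ) ^ 2 * 2 ^ j * (4 * P ^ 8 * L ^ 2 / 2 ^ j + 8 * C / L ^ F) := by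
        field_simp; ring
    _ ≤ (N / 2 ^ j) ^ 2 * 2 ^ j * (1 / L ^ F + 8 * C / L ^ F) := by gcongr
    _ = _ := by field_simp

theorem exists_sum_abs_sum_vonMangoldt_mul_residue_le (a : ℤ) (A : ℕ) : ∃ C > 0, ∃ N₀ : ℕ,
    ∀ N ≥ N₀, ∀ s : Finset ℕ, (∀ d ∈ s, 1 ≤ d ∧ (d : ℝ) ^ 5 ≤ N ∧ IsUnit (a : ZMod d)) →
    ∑ d ∈ s, |∑ n ∈ Icc 1 N, Λ n * residue a d n| ≤ C * N / Real.log N ^ A := by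
  obtain ⟨C, hC, hρ⟩ := exists_abs_sum_classDeviation_le_div (2 * A + 5 + 4)
  obtain ⟨N₀, hN₀, hsc⟩ := eventually_scale (2 * A + 12)
  refine ⟨25 + 27 * (1 + 8 * C), by positivity, N₀, fun N hN s hs ↦ ?_⟩
  have h := hsc N hN
  set P := (N : ℝ) ^ (1 / 20 : ℝ)
  have hP := h.one_le
  have hs' : ∀ d ∈ s, 1 ≤ d ∧ (d : ℝ) ≤ P ^ 4 ∧ IsUnit (a : ZMod d) := fun d hd ↦ by
    refine ⟨(hs d hd).1, ?_, (hs d hd).2.2⟩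
    refine le_of_pow_le_pow_left₀ (n := 5) (by norm_num) (by positivity) ?_
    rw [← pow_mul, h.pow_eq]
    exact (hs d hd).2.1
  have hcard : (s.card : ℝ) ≤ P ^ 4 := by
    have hsub : s ⊆ Icc 1 ⌊P ^ 4⌋₊ := fun d hd ↦
      mem_Icc.2 ⟨(hs d hd).1, Nat.le_floor (hs' d hd).2.1⟩
    have := card_le_card hsub
    rw [Nat.card_Icc, Nat.add_sub_cancel] at this
    exact (by exact_mod_cast this : (s.card : ℝ) ≤ ⌊P ^ 4⌋₊).trans (Nat.floor_le (by positivity))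
  have key := h.sum_norm_sum_vonMangoldt_mul_le (A := A) (by omega) s
    (fun d n ↦ (residue a d n : ℂ)) (fun _ ↦ s.card * 2) (B := 1 + 8 * C) (by positivity) hcard
    (fun d _ n ↦ by rw [Complex.norm_real]; exact abs_residue_le a d n) ?_ ?_
    (fun j hj _ ↦ h.sum_correlation_residue_le hs' hcard hC (by omega)
      (hρ h (by omega)) hj)
  · refine le_trans (le_of_eq (sum_congr rfl fun d _ ↦ ?_)) key
    rw [← Real.norm_eq_abs, ← Complex.norm_real]
    push_cast; rfl
  · intro k _ y _
    refine (sum_le_card_nsmul s _ 2 fun d hd ↦ ?_).trans (by rw [nsmul_eq_mul])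
    have : NeZero d := ⟨by linarith [(hs d hd).1]⟩
    have := abs_sum_residue_mul_le (hs d hd).2.2 k y
    rw [← Complex.ofReal_sum, Complex.norm_real]
    exact this
  · rw [sum_const, Nat.card_Icc, Nat.add_sub_cancel, nsmul_eq_mul]
    have h1 : ((⌊P ^ 11⌋₊ * ⌊P ^ 2⌋₊ : ℕ) : ℝ) * (s.card * 2) ≤ N / Real.log N ^ (A + 1) := by
      refine h.pow_le_div (by omega) ?_
      calc _ ≤ P ^ 13 * (P ^ 4 * P) := by
            gcongr
            · exact h.UV_le
            · exact h.two_le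
        _ = P ^ 18 := by ring
        _ ≤ _ := pow_le_pow_right₀ hP (by norm_num)
    refine h1.trans ?_
    have hl := h.one_le_log
    gcongr
    nlinarith [(Nat.cast_nonneg N : (0 : ℝ) ≤ N)]

end TwistedBV

namespace TwistedBV

open Finset Filter
open scoped ArithmeticFunction.vonMangoldt

/-- The summand of `ψ(x; d, a) - x / φ(d)`. -/
noncomputable def progressionDeviation (a : ℤ) (d n : ℕ) : ℝ :=
  (if (n : ZMod d) = (a : ZMod d) then Λ n else 0) - 1 / (d.totient : ℝ)

lemma abs_sum_progressionDeviation_le {a : ℤ} {d n : ℕ} (hd : 1 ≤ d) (hn : 1 ≤ n) :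
    |∑ m ∈ Icc 1 n, progressionDeviation a d m| ≤ |∑ m ∈ Icc 1 n, Λ m * residue a d m| +
      1 / (d.totient : ℝ) * (|∑ m ∈ Icc 1 n, Λ m - n| + 2 * Nat.log 2 d * Real.log n ^ 2) := by
  have h : ∑ m ∈ Icc 1 n, progressionDeviation a d m = ∑ m ∈ Icc 1 n, Λ m * residue a d m +
      1 / (d.totient : ℝ) * (∑ m ∈ Icc 1 n, Λ m - n -
        ∑ m ∈ (Icc 1 n).filter (fun m ↦ ¬ m.Coprime d), Λ m) := by
    have hn' : (n : ℝ) = ∑ m ∈ Icc 1 n, 1 := by simp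
    rw [hn', sum_filter, ← sum_sub_distrib, ← sum_sub_distrib, mul_sum, ← sum_add_distrib]
    refine sum_congr rfl fun m _ ↦ ?_
    unfold progressionDeviation residue
    split_ifs <;> ring
  have h2 := sum_vonMangoldt_not_coprime_le (q := d) (by omega) hn
  have h3 : 0 ≤ ∑ m ∈ (Icc 1 n).filter (fun m ↦ ¬ m.Coprime d), Λ m :=
    sum_nonneg fun _ _ ↦ ArithmeticFunction.vonMangoldt_nonneg
  rw [h]
  refine (abs_add_le _ _).trans ?_
  rw [abs_mul, abs_of_nonneg (by positivity : (0 : ℝ) ≤ 1 / (d.totient : ℝ))]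
  gcongr
  refine (abs_sub _ _).trans ?_
  rw [abs_of_nonneg h3]
  gcongr

lemma abs_sum_progressionDeviation_le_trivial (a : ℤ) {d : ℕ} (hd : 1 ≤ d) (n : ℕ) :
    |∑ m ∈ Icc 1 n, progressionDeviation a d m| ≤
      Real.log n * (n * (1 / d) + 1) + n * (1 / (d.totient : ℝ)) := by
  have : NeZero d := ⟨by omega⟩
  unfold progressionDeviation
  rw [sum_sub_distrib, sum_const, Nat.card_Icc, Nat.add_sub_cancel, nsmul_eq_mul]
  refine (abs_sub _ _).trans ?_
  rw [abs_of_nonneg (by positivity : (0 : ℝ) ≤ n * (1 / (d.totient : ℝ)))]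
  gcongr
  rw [abs_of_nonneg (sum_nonneg fun m _ ↦ by
    split_ifs; exacts [ArithmeticFunction.vonMangoldt_nonneg, le_rfl])]
  have h := (abs_le.1 (abs_card_filter_sub_le (a : ZMod d) 1 (n + 1))).2
  rw [Nat.add_sub_cancel] at h
  calc ∑ m ∈ Icc 1 n, (if (m : ZMod d) = (a : ZMod d) then Λ m else 0) ≤
        ∑ m ∈ Icc 1 n, (if (m : ZMod d) = (a : ZMod d) then Real.log n else 0) := by
        refine sum_le_sum fun m hm ↦ ?_
        rw [mem_Icc] at hm
        split_ifs
        · exact ArithmeticFunction.vonMangoldt_le_log.trans (Real.log_le_log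
            (by exact_mod_cast hm.1) (by exact_mod_cast hm.2))
        · rfl
    _ = Real.log n * ((Ico 1 (n + 1)).filter (fun m : ℕ ↦ (m : ZMod d) = a)).card := by
        rw [← sum_filter, sum_const, nsmul_eq_mul, mul_comm]; rfl
    _ ≤ _ := by
        refine mul_le_mul_of_nonneg_left ?_ (Real.log_natCast_nonneg n)
        rw [mul_one_div]; linarith

namespace Scale

variable {N : ℕ} {P L : ℝ} {k : ℕ}

lemma sum_inv_le (h : Scale N P L k) {s : Finset ℕ} (hs : ∀ d ∈ s, 1 ≤ d ∧ d ≤ N) :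
    ∑ d ∈ s, (1 / d : ℝ) ≤ 2 * L := by
  have hsub : s ⊆ Icc 1 N := fun d hd ↦ mem_Icc.2 (hs d hd)
  refine (sum_le_sum_of_subset_of_nonneg hsub fun _ _ _ ↦ by positivity).trans ?_
  refine (sum_inv_Icc_le N).trans ?_
  rw [← h.log_eq]; linarith [h.one_le_log]

lemma natLog_le (h : Scale N P L k) {d : ℕ} (hd : d ≤ N) : (Nat.log 2 d + 1 : ℝ) ≤ 3 * L :=
  le_trans (by
    have : (Nat.log 2 d : ℝ) ≤ Nat.log 2 N := by exact_mod_cast Nat.log_mono_right hd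
    linarith) h.natLog_succ_le

lemma inv_totient_le (h : Scale N P L k) {d : ℕ} (hd : 1 ≤ d) (hdN : d ≤ N) :
    1 / (d.totient : ℝ) ≤ 1 / d * (3 * L) := by
  have hφ0 : (0 : ℝ) < d.totient := by exact_mod_cast Nat.totient_pos.2 hd
  have hd0 : (0 : ℝ) < d := by exact_mod_cast hd
  rw [div_mul_eq_mul_div, one_mul, div_le_div_iff₀ hφ0 hd0, one_mul]
  have := h.natLog_le hdN
  calc (d : ℝ) ≤ d.totient * (Nat.log 2 d + 1) := le_totient_mul_log d
    _ ≤ d.totient * (3 * L) := by gcongr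
    _ = _ := by ring

lemma sum_inv_totient_le (h : Scale N P L k) {s : Finset ℕ} (hs : ∀ d ∈ s, 1 ≤ d ∧ d ≤ N) :
    ∑ d ∈ s, 1 / (d.totient : ℝ) ≤ 6 * L ^ 2 := by
  have hL := h.one_le_log
  calc ∑ d ∈ s, 1 / (d.totient : ℝ) ≤ ∑ d ∈ s, 1 / (d : ℝ) * (3 * L) :=
        sum_le_sum fun d hd ↦ h.inv_totient_le (hs d hd).1 (hs d hd).2
    _ ≤ 2 * L * (3 * L) := by rw [← sum_mul]; gcongr; exact h.sum_inv_le hs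
    _ = _ := by ring

/-- A level `d ≤ N ^ (21 / 110)` is below `P ^ 4 = N ^ (1 / 5)`. -/
lemma le_of_pow_le (h : Scale N P L k) {d : ℕ} (hd : d ^ 110 ≤ N ^ 21) : (d : ℝ) ≤ P ^ 4 := by
  have hP := h.one_le
  refine le_of_pow_le_pow_left₀ (n := 110) (by norm_num) (by positivity) ?_
  calc (d : ℝ) ^ 110 ≤ (N : ℝ) ^ 21 := by exact_mod_cast hd
    _ ≤ (N : ℝ) ^ 22 := pow_le_pow_right₀ (by exact_mod_cast h.one_le_N) (by norm_num)
    _ = _ := by rw [← h.pow_eq]; ring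

lemma le_N_of_pow_le (h : Scale N P L k) {d : ℕ} (hd : d ^ 110 ≤ N ^ 21) : d ≤ N := by
  have : (d : ℝ) ≤ N := by
    rw [← h.pow_eq]
    exact (h.le_of_pow_le hd).trans (pow_le_pow_right₀ h.one_le (by norm_num))
  exact_mod_cast this

lemma card_le (h : Scale N P L k) {s : Finset ℕ} (hs : ∀ d ∈ s, 1 ≤ d ∧ d ^ 110 ≤ N ^ 21) :
    (s.card : ℝ) ≤ P ^ 4 := by
  have hP := h.one_le
  have hsub : s ⊆ Icc 1 ⌊P ^ 4⌋₊ := fun d hd ↦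
    mem_Icc.2 ⟨(hs d hd).1, Nat.le_floor (h.le_of_pow_le (hs d hd).2)⟩
  have := card_le_card hsub
  rw [Nat.card_Icc, Nat.add_sub_cancel] at this
  exact (by exact_mod_cast this : (s.card : ℝ) ≤ ⌊P ^ 4⌋₊).trans (Nat.floor_le (by positivity))

end Scale

/-- **Bombieri–Vinogradov** with a fixed residue class, at level `N ^ (21 / 110)`. -/
theorem exists_sum_abs_sum_progressionDeviation_le (a : ℤ) (A : ℕ) : ∃ C > 0, ∃ N₀ : ℕ,
    ∀ N ≥ N₀, ∀ s : Finset ℕ, (∀ d ∈ s, 1 ≤ d ∧ d ^ 110 ≤ N ^ 21 ∧ IsUnit (a : ZMod d)) →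
    ∀ n ≤ N, ∑ d ∈ s, |∑ m ∈ Icc 1 n, progressionDeviation a d m| ≤
      C * N / Real.log N ^ A := by
  obtain ⟨C₁, hC₁, N₁, h₁⟩ := exists_sum_abs_sum_vonMangoldt_mul_residue_le a A
  obtain ⟨C₂, hC₂, h₂⟩ := exists_abs_sum_vonMangoldt_sub_le (A + 2)
  obtain ⟨N₂, -, hsc⟩ := eventually_scale (A + 5)
  obtain ⟨x₀, hx₀⟩ := eventually_atTop.1
    (eventually_const_mul_log_pow_le 1 (A + 2) (δ := 1 / 22) (by norm_num))
  refine ⟨2 ^ A * C₁ + 6 * 2 ^ (A + 2) * C₂ + 9, by positivity,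
    max (max N₂ ⌈x₀⌉₊) (max (N₁ ^ 2) 4), fun N hN s hs n hn ↦ ?_⟩
  have h := hsc N (le_trans (by simp) hN)
  set P := (N : ℝ) ^ (1 / 20 : ℝ)
  set L := Real.log N with hLdef
  have hL1 := h.one_le_log
  have hL : 0 < L := by linarith
  have hP := h.one_le
  have hN1 := h.one_le_N
  have hdN : ∀ d ∈ s, 1 ≤ d ∧ d ≤ N := fun d hd ↦
    ⟨(hs d hd).1, h.le_N_of_pow_le (hs d hd).2.1⟩
  have hφ := h.sum_inv_totient_le hdN
  have hN0 : (0 : ℝ) < N := by exact_mod_cast hN1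
  have hnN : (n : ℝ) ≤ N := by exact_mod_cast hn
  have hln := h.log_le hn
  have hln0 := Real.log_natCast_nonneg n
  rcases le_or_gt (N ^ 21) (n ^ 22) with hbig | hsmall
  · have hN1n : N ≤ n ^ 2 := by
      have h21 : N ^ 11 ≤ (n ^ 2) ^ 11 :=
        calc N ^ 11 ≤ N ^ 21 := Nat.pow_le_pow_right hN1 (by norm_num)
          _ ≤ n ^ 22 := hbig
          _ = _ := by ring
      exact le_of_pow_le_pow_left₀ (by norm_num) (by positivity) h21
    have hn1 : N₁ ≤ n := le_of_pow_le_pow_left₀ (n := 2) (by norm_num) (by positivity)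
      ((le_trans (by simp) hN).trans hN1n)
    have hn2 : 2 ≤ n := le_of_pow_le_pow_left₀ (n := 2) (by norm_num) (by positivity)
      (le_trans (le_trans (by simp) hN) hN1n)
    have hlog : L / 2 ≤ Real.log n := by
      have := Real.log_le_log hN0 (by exact_mod_cast hN1n : (N : ℝ) ≤ (n : ℝ) ^ 2)
      rw [Real.log_pow] at this
      push_cast at this; linarith
    have hB := h₁ n hn1 s fun d hd ↦ ⟨(hs d hd).1, by
      refine le_of_pow_le_pow_left₀ (n := 22) (by norm_num) (by positivity) ?_
      rw [← pow_mul]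
      exact_mod_cast (hs d hd).2.1.trans hbig, (hs d hd).2.2⟩
    have hsum := sum_le_sum fun d hd ↦
      abs_sum_progressionDeviation_le (a := a) (hs d hd).1 (by omega : 1 ≤ n)
    refine hsum.trans ?_
    rw [sum_add_distrib]
    have hA : C₁ * n / Real.log n ^ A ≤ 2 ^ A * C₁ * (N / L ^ A) := by
      calc C₁ * n / Real.log n ^ A ≤ C₁ * N / (L / 2) ^ A := by gcongr
        _ = _ := by rw [div_pow]; field_simp
    have hR : ∑ d ∈ s, 1 / (d.totient : ℝ) * (|∑ m ∈ Icc 1 n, Λ m - n| +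
        2 * Nat.log 2 d * Real.log n ^ 2) ≤
        6 * L ^ 2 * (C₂ * N / (L / 2) ^ (A + 2) + 6 * L ^ 3) := by
      calc _ ≤ ∑ d ∈ s, 1 / (d.totient : ℝ) * (C₂ * N / (L / 2) ^ (A + 2) + 6 * L ^ 3) := by
            refine sum_le_sum fun d hd ↦ ?_
            refine mul_le_mul_of_nonneg_left (add_le_add ?_ ?_) (by positivity)
            · refine (h₂ n hn2).trans ?_
              gcongr
            · have h3 := h.natLog_le (hdN d hd).2
              calc 2 * (Nat.log 2 d : ℝ) * Real.log n ^ 2 ≤ 2 * (3 * L) * L ^ 2 := by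
                    gcongr; linarith
                _ = _ := by ring
        _ ≤ _ := by rw [← sum_mul]; gcongr
    have hR2 : 6 * L ^ 2 * (C₂ * N / (L / 2) ^ (A + 2)) = 6 * 2 ^ (A + 2) * C₂ * (N / L ^ A) := by
      rw [div_pow]; field_simp; ring
    have hR3 : 6 * L ^ 2 * (6 * L ^ 3) ≤ N / L ^ A := by
      refine h.pow_le_div (by omega) ?_
      have h5 := h.pow_le (i := 5) (by omega)
      have h6 : (2 : ℝ) ^ 3 ≤ P ^ 3 := by gcongr; exact h.two_le
      calc 6 * L ^ 2 * (6 * L ^ 3) = 36 * L ^ 5 := by ring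
        _ ≤ P ^ 3 * P := by nlinarith
        _ = P ^ 4 := by ring
        _ ≤ P ^ 19 := pow_le_pow_right₀ hP (by norm_num)
    have h0 : 0 ≤ N / L ^ A := by positivity
    calc _ ≤ 2 ^ A * C₁ * (N / L ^ A) +
          (6 * 2 ^ (A + 2) * C₂ * (N / L ^ A) + N / L ^ A) := by
          refine add_le_add (hB.trans hA) (hR.trans ?_)
          rw [mul_add, hR2]; gcongr
      _ ≤ (2 ^ A * C₁ + 6 * 2 ^ (A + 2) * C₂ + 9) * (N / L ^ A) := by linarith
      _ = _ := by ring
  · have hq := hx₀ N ((Nat.le_ceil x₀).trans (by exact_mod_cast le_trans (by simp) hN))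
    rw [one_mul, ← hLdef] at hq
    have hnL : n * L ^ 2 ≤ N / L ^ A := by
      rw [le_div_iff₀ (by positivity), mul_assoc, ← pow_add, add_comm 2]
      refine le_of_pow_le_pow_left₀ (n := 22) (by norm_num) (by positivity) ?_
      calc (n * L ^ (A + 2)) ^ 22 ≤ (n * (N : ℝ) ^ (1 / 22 : ℝ)) ^ 22 := by gcongr
        _ = (n : ℝ) ^ 22 * N := by
            rw [mul_pow, ← Real.rpow_natCast ((N : ℝ) ^ (1 / 22 : ℝ)), ← Real.rpow_mul hN0.le]
            norm_num
        _ ≤ (N : ℝ) ^ 21 * N := by gcongr; exact_mod_cast hsmall.le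
        _ = _ := by ring
    have hcard := h.card_le fun d hd ↦ ⟨(hs d hd).1, (hs d hd).2.1⟩
    have hLP : L * P ^ 4 ≤ N / L ^ A := by
      refine h.pow_le_div (by omega) ?_
      have h5 := h.pow_le (i := 1) (by omega)
      calc L * P ^ 4 ≤ P * P ^ 4 := by gcongr; linarith
        _ = P ^ 5 := by ring
        _ ≤ P ^ 19 := pow_le_pow_right₀ hP (by norm_num)
    refine (sum_le_sum fun d hd ↦ abs_sum_progressionDeviation_le_trivial a (hs d hd).1 n).trans ?_
    rw [sum_add_distrib, ← mul_sum, ← mul_sum, sum_add_distrib, ← mul_sum, sum_const,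
      nsmul_eq_mul, mul_one]
    have h0 : 0 ≤ N / L ^ A := by positivity
    calc _ ≤ L * (n * (2 * L) + P ^ 4) + n * (6 * L ^ 2) := by
          gcongr
          exact h.sum_inv_le hdN
      _ = 8 * (n * L ^ 2) + L * P ^ 4 := by ring
      _ ≤ 9 * (N / L ^ A) := by linarith
      _ ≤ (2 ^ A * C₁ + 6 * 2 ^ (A + 2) * C₂ + 9) * (N / L ^ A) := by
          gcongr
          linarith [(by positivity : 0 ≤ 2 ^ A * C₁ + 6 * 2 ^ (A + 2) * C₂)]
      _ = _ := by ring

end TwistedBV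

namespace TwistedBV

open Finset

lemma e_add (x y : ℝ) : e (x + y) = e x * e y := by
  simp only [e, ← Complex.exp_add]; push_cast; ring_nf

lemma norm_e (x : ℝ) : ‖e x‖ = 1 := by
  rw [e, show (2 * Real.pi * Complex.I * x : ℂ) = ((2 * Real.pi * x : ℝ) : ℂ) * Complex.I by
    push_cast; ring]
  exact Complex.norm_exp_ofReal_mul_I _

lemma e_intCast (k : ℤ) : e k = 1 := by
  rw [e, Complex.exp_eq_one_iff]
  exact ⟨k, by push_cast; ring⟩

lemma e_neg (x : ℝ) : e (-x) = starRingEnd ℂ (e x) := by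
  simp only [e, ← Complex.exp_conj, map_mul, Complex.conj_I, Complex.conj_ofReal, map_ofNat]
  push_cast; ring_nf

lemma e_eq_cos_add_sin (x : ℝ) :
    e x = (Real.cos (2 * (Real.pi * x)) : ℝ) + (Real.sin (2 * (Real.pi * x)) : ℝ) * Complex.I := by
  rw [e, show (2 * Real.pi * Complex.I * x : ℂ) = ((2 * (Real.pi * x) : ℝ) : ℂ) * Complex.I by
    push_cast; ring, Complex.exp_mul_I, ← Complex.ofReal_cos, ← Complex.ofReal_sin]

lemma two_mul_le_sin_pi_mul {θ x : ℝ} (h1 : θ ≤ x) (h2 : x ≤ 1 - θ) (hθ : 0 ≤ θ) :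
    2 * θ ≤ Real.sin (Real.pi * x) := by
  have key : ∀ y : ℝ, 0 ≤ y → y ≤ 1 / 2 → 2 * y ≤ Real.sin (Real.pi * y) := fun y hy hy2 ↦ by
    have := Real.mul_le_sin (x := Real.pi * y) (by positivity) (by nlinarith [Real.pi_pos])
    have h3 : 2 / Real.pi * (Real.pi * y) = 2 * y := by field_simp
    linarith
  rcases le_total x (1 / 2) with h | h
  · linarith [key x (by linarith) h]
  · have := key (1 - x) (by linarith) (by linarith)
    rw [show Real.pi * (1 - x) = Real.pi - Real.pi * x by ring, Real.sin_pi_sub] at this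
    linarith

/-- `1 / (e(x) - 1) = -1/2 - (i/2) cot(πx)`, in multiplied-out form. -/
lemma e_sub_one_mul_cot {x : ℝ} (hx : Real.sin (Real.pi * x) ≠ 0) :
    (e x - 1) * (-1 / 2 - (Real.cot (Real.pi * x) : ℝ) / 2 * Complex.I) = 1 := by
  rw [e_eq_cos_add_sin, Real.cot_eq_cos_div_sin]
  have hsc := Real.sin_sq_add_cos_sq (Real.pi * x)
  rw [Real.cos_two_mul, Real.sin_two_mul]
  generalize Real.sin (Real.pi * x) = s at *
  generalize Real.cos (Real.pi * x) = c at *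
  apply Complex.ext
  · simp [pow_two]
    field_simp
    ring
  · simp [pow_two]
    field_simp
    linear_combination (-2 * c) * hsc

lemma norm_cot_factor_le {x θ : ℝ} (hθ : 0 < θ) (h1 : θ ≤ x) (h2 : x ≤ 1 - θ) :
    ‖(-1 / 2 - (Real.cot (Real.pi * x) : ℝ) / 2 * Complex.I : ℂ)‖ ≤ 1 / (4 * θ) := by
  have hs := two_mul_le_sin_pi_mul h1 h2 hθ.le
  have hs0 : 0 < Real.sin (Real.pi * x) := by linarith
  have h := congrArg norm (e_sub_one_mul_cot hs0.ne')
  rw [norm_mul, norm_one] at h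
  have h3 : ‖e x - 1‖ = 2 * Real.sin (Real.pi * x) := by
    have hsc := Real.sin_sq_add_cos_sq (Real.pi * x)
    rw [e_eq_cos_add_sin, Real.cos_two_mul, Real.sin_two_mul]
    generalize Real.sin (Real.pi * x) = s at *
    generalize Real.cos (Real.pi * x) = c at *
    rw [Complex.norm_eq_sqrt_sq_add_sq, Real.sqrt_eq_iff_mul_self_eq_of_pos (by positivity)]
    simp [pow_two]
    linear_combination (4 - 4 * c ^ 2) * hsc
  rw [h3] at h
  have h4 : ‖(-1 / 2 - (Real.cot (Real.pi * x) : ℝ) / 2 * Complex.I : ℂ)‖ =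
      1 / (2 * Real.sin (Real.pi * x)) := by
    rw [eq_div_iff (by positivity)]; linarith
  rw [h4]
  exact one_div_le_one_div_of_le (by positivity) (by linarith)

lemma abs_cot_le {x θ : ℝ} (hθ : 0 < θ) (h1 : θ ≤ x) (h2 : x ≤ 1 - θ) :
    |Real.cot (Real.pi * x)| ≤ 1 / (2 * θ) := by
  have hs := two_mul_le_sin_pi_mul h1 h2 hθ.le
  have hs0 : 0 < Real.sin (Real.pi * x) := by linarith
  rw [Real.cot_eq_cos_div_sin, abs_div, abs_of_pos hs0]
  gcongr
  exact Real.abs_cos_le_one _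

lemma cot_pi_mul_antitone {x y : ℝ} (hx : 0 < x) (hxy : x ≤ y) (hy : y < 1) :
    Real.cot (Real.pi * y) ≤ Real.cot (Real.pi * x) := by
  have hsx : 0 < Real.sin (Real.pi * x) :=
    Real.sin_pos_of_pos_of_lt_pi (by positivity) (by nlinarith [Real.pi_pos])
  have hsy : 0 < Real.sin (Real.pi * y) :=
    Real.sin_pos_of_pos_of_lt_pi (mul_pos Real.pi_pos (by linarith)) (by nlinarith [Real.pi_pos])
  have h := Real.sin_nonneg_of_nonneg_of_le_pi (x := Real.pi * y - Real.pi * x)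
    (by nlinarith [Real.pi_pos]) (by nlinarith [Real.pi_pos])
  rw [Real.sin_sub] at h
  rw [Real.cot_eq_cos_div_sin, Real.cot_eq_cos_div_sin, div_le_div_iff₀ hsy hsx]
  linarith

/-- The Kusmin–Landau inequality. -/
lemma norm_sum_e_le_of_forall_mem_Icc {f : ℕ → ℝ} {a b : ℕ} {θ : ℝ} (hθ : 0 < θ)
    (hf : ∀ j ∈ Ico a b, θ ≤ f (j + 1) - f j ∧ f (j + 1) - f j ≤ 1 - θ)
    (hmono : ∀ j, a ≤ j → j + 1 < b → f (j + 1) - f j ≤ f (j + 2) - f (j + 1)) :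
    ‖∑ j ∈ Ico a b, e (f j)‖ ≤ 1 / θ := by
  rcases le_or_gt b a with hab | hab
  · rw [Ico_eq_empty (by omega), sum_empty, norm_zero]; positivity
  set C : ℕ → ℝ := fun j ↦ Real.cot (Real.pi * (f (j + 1) - f j)) with hC
  set g : ℕ → ℂ := fun j ↦ -1 / 2 - (C j : ℝ) / 2 * Complex.I with hg
  have hstep : ∀ j ∈ Ico a b, e (f j) = (e (f (j + 1)) - e (f j)) * g j := fun j hj ↦ by
    have hs := two_mul_le_sin_pi_mul (hf j hj).1 (hf j hj).2 hθ.le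
    have h := e_sub_one_mul_cot (x := f (j + 1) - f j) (by linarith)
    have h2 : e (f (j + 1)) = e (f j) * e (f (j + 1) - f j) := by rw [← e_add]; congr 1; ring
    calc e (f j) = e (f j) * ((e (f (j + 1) - f j) - 1) * g j) := by rw [h, mul_one]
      _ = _ := by rw [h2]; ring
  have hind : ∀ n, a + n < b → ‖∑ j ∈ Ico a (a + n + 1), e (f j) - e (f (a + n + 1)) * g (a + n)‖ ≤
      ‖g a‖ + (C a - C (a + n)) / 2 := by
    intro n
    induction n with
    | zero =>
      intro h
      have := hstep a (by simp [hab])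
      simp only [add_zero, Nat.Ico_succ_singleton, sum_singleton, sub_self, zero_div]
      rw [show e (f a) - e (f (a + 1)) * g a = - (e (f a) * g a) by linear_combination this,
        norm_neg, norm_mul, norm_e, one_mul]
    | succ n ih =>
      intro h
      have h1 := ih (by omega)
      have h2 := hstep (a + n + 1) (by simp; omega)
      rw [show a + (n + 1) + 1 = (a + n + 1) + 1 by ring, sum_Ico_succ_top (by omega)]
      rw [show a + (n + 1) = a + n + 1 by ring]
      have h3 : g (a + n) - g (a + n + 1) = ((C (a + n + 1) - C (a + n)) / 2 : ℝ) * Complex.I := by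
        simp only [hg]; push_cast; ring
      have h4 : C (a + n + 1) ≤ C (a + n) :=
        cot_pi_mul_antitone (hθ.trans_le (hf (a + n) (by simp; omega)).1)
          (hmono (a + n) (by omega) (by omega))
          (by linarith [(hf (a + n + 1) (by simp; omega)).2])
      calc _ = ‖(∑ j ∈ Ico a (a + n + 1), e (f j) - e (f (a + n + 1)) * g (a + n)) +
            e (f (a + n + 1)) * (g (a + n) - g (a + n + 1))‖ := by
            congr 1; linear_combination h2
        _ ≤ ‖g a‖ + (C a - C (a + n)) / 2 + (C (a + n) - C (a + n + 1)) / 2 := by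
            refine (norm_add_le _ _).trans (add_le_add h1 ?_)
            rw [norm_mul, norm_e, one_mul, h3, norm_mul, Complex.norm_I, mul_one,
              Complex.norm_real, Real.norm_eq_abs, abs_of_nonpos (by linarith)]
            linarith
        _ = _ := by ring
  obtain ⟨n, rfl⟩ : ∃ n, b = a + n + 1 := ⟨b - a - 1, by omega⟩
  have h1 := hind n (by omega)
  have ha := hf a (by simp)
  have hb := hf (a + n) (by simp)
  have hga := norm_cot_factor_le hθ ha.1 ha.2
  have hgb := norm_cot_factor_le hθ hb.1 hb.2
  have hCa := (abs_le.1 (abs_cot_le hθ ha.1 ha.2)).2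
  have hCb := (abs_le.1 (abs_cot_le hθ hb.1 hb.2)).1
  calc ‖∑ j ∈ Ico a (a + n + 1), e (f j)‖ = ‖(∑ j ∈ Ico a (a + n + 1), e (f j) -
        e (f (a + n + 1)) * g (a + n)) + e (f (a + n + 1)) * g (a + n)‖ := by congr 1; ring
    _ ≤ (1 / (4 * θ) + (1 / (2 * θ) - (-(1 / (2 * θ)))) / 2) + 1 / (4 * θ) := by
        refine (norm_add_le _ _).trans (add_le_add (h1.trans (add_le_add hga ?_)) ?_)
        · simp only [hC]; linarith
        · rw [norm_mul, norm_e, one_mul]; exact hgb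
    _ = 1 / θ := by field_simp; ring

end TwistedBV

namespace TwistedBV

open Finset

lemma exists_filter_eq_Ico {δ : ℕ → ℝ} {n : ℕ} (hδ : ∀ i j, i ≤ j → j < n → δ i ≤ δ j) (x y : ℝ) :
    ∃ a b, b ≤ n ∧ (range n).filter (fun j ↦ x ≤ δ j ∧ δ j < y) = Ico a b := by
  set s := (range n).filter (fun j ↦ x ≤ δ j ∧ δ j < y) with hs
  rcases s.eq_empty_or_nonempty with h | h
  · exact ⟨0, 0, by omega, by rw [h]; simp⟩
  have hmin := s.min'_mem h
  have hmax := s.max'_mem h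
  simp only [hs, mem_filter, mem_range] at hmin hmax
  refine ⟨s.min' h, s.max' h + 1, hmax.1, ?_⟩
  ext j
  rw [mem_Ico]
  constructor
  · intro hj
    exact ⟨s.min'_le j hj, Nat.lt_succ_of_le (s.le_max' j hj)⟩
  · rintro ⟨h1, h2⟩
    have h2 : j ≤ s.max' h := by omega
    have hjn : j < n := h2.trans_lt hmax.1
    rw [hs, mem_filter, mem_range]
    exact ⟨hjn, hmin.2.1.trans (hδ _ _ h1 hjn), (hδ _ _ h2 hmax.1).trans_lt hmax.2.2⟩

section SecondDifference

variable {f : ℕ → ℝ} {n : ℕ} {l : ℝ}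

lemma mul_sub_le_of_forall_second_difference
    (h1 : ∀ j, j + 1 < n → l ≤ (f (j + 2) - f (j + 1)) - (f (j + 1) - f j)) {i j : ℕ} (hij : i ≤ j)
    (hj : j < n) : (j - i : ℝ) * l ≤ (f (j + 1) - f j) - (f (i + 1) - f i) := by
  induction j, hij using Nat.le_induction with
  | base => simp
  | succ j hij ih =>
    have := ih (by omega)
    have h2 := h1 j hj
    push_cast
    linarith

lemma sub_le_mul_of_forall_second_difference
    (h1 : ∀ j, j + 1 < n → (f (j + 2) - f (j + 1)) - (f (j + 1) - f j) ≤ l) {i j : ℕ} (hij : i ≤ j)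
    (hj : j < n) : (f (j + 1) - f j) - (f (i + 1) - f i) ≤ (j - i : ℝ) * l := by
  induction j, hij using Nat.le_induction with
  | base => simp
  | succ j hij ih =>
    have := ih (by omega)
    have h2 := h1 j hj
    push_cast
    linarith

lemma norm_sum_filter_e_le_card (hl : 0 < l)
    (h1 : ∀ j, j + 1 < n → l ≤ (f (j + 2) - f (j + 1)) - (f (j + 1) - f j)) {x y : ℝ}
    (hxy : x ≤ y) :
    ‖∑ j ∈ (range n).filter (fun j ↦ x ≤ f (j + 1) - f j ∧ f (j + 1) - f j < y), e (f j)‖ ≤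
      (y - x) / l + 1 := by
  have hmono : ∀ i j, i ≤ j → j < n → f (i + 1) - f i ≤ f (j + 1) - f j := fun i j hij hj ↦ by
    have := mul_sub_le_of_forall_second_difference h1 hij hj
    have h2 : (0 : ℝ) ≤ j - i := sub_nonneg.2 (by exact_mod_cast hij)
    nlinarith [mul_nonneg h2 hl.le]
  obtain ⟨a, b, hb, hs⟩ := exists_filter_eq_Ico (δ := fun j ↦ f (j + 1) - f j) hmono x y
  refine (norm_sum_le _ _).trans ?_
  simp only [norm_e, sum_const, nsmul_eq_mul, mul_one]
  rw [hs, Nat.card_Ico]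
  rcases le_or_gt b a with hab | hab
  · rw [Nat.sub_eq_zero_of_le hab, Nat.cast_zero]
    have : 0 ≤ (y - x) / l := div_nonneg (by linarith) hl.le
    linarith
  · have ha : a ∈ Ico a b := by simp [hab]
    have hb' : b - 1 ∈ Ico a b := by simp; omega
    rw [← hs, mem_filter] at ha hb'
    have := mul_sub_le_of_forall_second_difference h1 (by omega : a ≤ b - 1) (by omega)
    have h3 : ((b - 1 : ℕ) - a : ℝ) ≤ (y - x) / l := by
      rw [le_div_iff₀ hl]; linarith [ha.2.1, hb'.2.2]
    have h4 : ((b - a : ℕ) : ℝ) = ((b - 1 : ℕ) - a : ℝ) + 1 := by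
      rw [Nat.cast_sub hab.le, Nat.cast_sub (by omega : 1 ≤ b)]; push_cast; ring
    linarith

lemma norm_sum_filter_e_le_inv (hl : 0 < l)
    (h1 : ∀ j, j + 1 < n → l ≤ (f (j + 2) - f (j + 1)) - (f (j + 1) - f j)) {θ : ℝ} (hθ : 0 < θ)
    (k : ℤ) :
    ‖∑ j ∈ (range n).filter (fun j ↦ k + θ ≤ f (j + 1) - f j ∧ f (j + 1) - f j < k + 1 - θ),
      e (f j)‖ ≤ 1 / θ := by
  have hmono : ∀ i j, i ≤ j → j < n → f (i + 1) - f i ≤ f (j + 1) - f j := fun i j hij hj ↦ by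
    have := mul_sub_le_of_forall_second_difference h1 hij hj
    have h2 : (0 : ℝ) ≤ j - i := sub_nonneg.2 (by exact_mod_cast hij)
    nlinarith [mul_nonneg h2 hl.le]
  obtain ⟨a, b, hb, hs⟩ := exists_filter_eq_Ico (δ := fun j ↦ f (j + 1) - f j) hmono
    (k + θ) (k + 1 - θ)
  have he : ∀ j, e (f j) = e (f j - k * j) := fun j ↦ by
    have : e (f j) = e (f j - k * j) * e ((k * j : ℤ) : ℝ) := by
      rw [← e_add]; congr 1; push_cast; ring
    rw [this, e_intCast, mul_one]
  rw [hs, sum_congr rfl fun j _ ↦ he j]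
  refine norm_sum_e_le_of_forall_mem_Icc (f := fun j ↦ f j - k * j) hθ (fun j hj ↦ ?_)
    fun j hj hjb ↦ ?_
  · rw [← hs, mem_filter] at hj
    push_cast
    constructor <;> linarith [hj.2.1, hj.2.2]
  · have := h1 j (by omega)
    push_cast
    linarith

/-- Van der Corput's second derivative test, for sequences with controlled second differences. -/
theorem norm_sum_e_le_of_second_difference {h : ℝ} (hl : 0 < l) (hh : 1 ≤ h)
    (h1 : ∀ j, j + 1 < n → l ≤ (f (j + 2) - f (j + 1)) - (f (j + 1) - f j))
    (h2 : ∀ j, j + 1 < n → (f (j + 2) - f (j + 1)) - (f (j + 1) - f j) ≤ h * l) :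
    ‖∑ j ∈ range n, e (f j)‖ ≤ 5 * h * n * √l + 10 / √l := by
  have hs0 : 0 < √l := Real.sqrt_pos.2 hl
  have htriv : ‖∑ j ∈ range n, e (f j)‖ ≤ n := by
    refine (norm_sum_le _ _).trans ?_
    simp [norm_e]
  rcases Nat.eq_zero_or_pos n with rfl | hn
  · simp; positivity
  have hn0 : (0 : ℝ) < n := by exact_mod_cast hn
  rcases le_or_gt (1 / 2) (√l) with hbig | hsmall
  · refine htriv.trans ?_
    have h3 : 0 ≤ 10 / √l := by positivity
    have h5 : 1 ≤ 5 * h * √l := by nlinarith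
    nlinarith
  have hsq : √l * √l = l := Real.mul_self_sqrt hl.le
  set θ := √l with hθ
  have hper : ∀ k : ℤ, ‖∑ j ∈ (range n).filter
      (fun j ↦ (k : ℝ) ≤ f (j + 1) - f j ∧ f (j + 1) - f j < k + 1), e (f j)‖ ≤ 5 / θ := by
    intro k
    have hA := norm_sum_filter_e_le_card hl h1 (x := k) (y := k + θ) (by linarith)
    have hB := norm_sum_filter_e_le_inv hl h1 hs0 k
    have hC := norm_sum_filter_e_le_card hl h1 (x := k + 1 - θ) (y := k + 1) (by linarith)
    have hsplit : ∑ j ∈ (range n).filter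
        (fun j ↦ (k : ℝ) ≤ f (j + 1) - f j ∧ f (j + 1) - f j < k + 1), e (f j) =
        ∑ j ∈ (range n).filter (fun j ↦ (k : ℝ) ≤ f (j + 1) - f j ∧ f (j + 1) - f j < k + θ),
          e (f j) +
        ∑ j ∈ (range n).filter
          (fun j ↦ k + θ ≤ f (j + 1) - f j ∧ f (j + 1) - f j < k + 1 - θ), e (f j) +
        ∑ j ∈ (range n).filter
          (fun j ↦ k + 1 - θ ≤ f (j + 1) - f j ∧ f (j + 1) - f j < k + 1), e (f j) := by
      simp only [sum_filter, ← sum_add_distrib]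
      refine sum_congr rfl fun j _ ↦ ?_
      generalize f (j + 1) - f j = z
      rcases lt_or_ge z k with h3 | h3
      · rw [if_neg (by intro h; linarith [h.1]), if_neg (by intro h; linarith [h.1]),
          if_neg (by intro h; linarith [h.1]), if_neg (by intro h; linarith [h.1])]; simp
      rcases lt_or_ge z (k + θ) with h4 | h4
      · rw [if_pos ⟨h3, by linarith⟩, if_pos ⟨h3, h4⟩, if_neg (by intro h; linarith [h.1]),
          if_neg (by intro h; linarith [h.1])]; simp
      rcases lt_or_ge z (k + 1 - θ) with h5 | h5
      · rw [if_pos ⟨h3, by linarith⟩, if_neg (by intro h; linarith [h.2]), if_pos ⟨h4, h5⟩,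
          if_neg (by intro h; linarith [h.1])]; simp
      rcases lt_or_ge z (k + 1) with h6 | h6
      · rw [if_pos ⟨h3, h6⟩, if_neg (by intro h; linarith [h.2]),
          if_neg (by intro h; linarith [h.2]), if_pos ⟨h5, h6⟩]; simp
      · rw [if_neg (by intro h; linarith [h.2]), if_neg (by intro h; linarith [h.2]),
          if_neg (by intro h; linarith [h.2]), if_neg (by intro h; linarith [h.2])]; simp
    rw [hsplit]
    refine (norm_add₃_le).trans ?_
    have h3 : (k + θ - k) / l = 1 / θ := by rw [← hsq]; field_simp; ring
    have h4 : (k + 1 - (k + 1 - θ)) / l = 1 / θ := by rw [← hsq]; field_simp; ring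
    have h5 : 1 ≤ 1 / θ := by rw [le_div_iff₀ hs0]; linarith
    rw [h3] at hA
    rw [h4] at hC
    have h6 : 5 / θ = 5 * (1 / θ) := by ring
    linarith
  set K₀ := ⌊f 1 - f 0⌋ with hK₀
  have hlow : ∀ j < n, (K₀ : ℝ) ≤ f (j + 1) - f j := fun j hj ↦ by
    have h3 := mul_sub_le_of_forall_second_difference h1 (Nat.zero_le j) hj
    have h4 : (0 : ℝ) ≤ (j - (0 : ℕ) : ℝ) * l := by simp; positivity
    have h5 := Int.floor_le (f 1 - f 0)
    rw [zero_add] at h3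
    linarith
  have hind : ∀ m : ℕ, ‖∑ j ∈ (range n).filter (fun j ↦ f (j + 1) - f j < K₀ + m), e (f j)‖ ≤
      m * (5 / θ) := by
    intro m
    induction m with
    | zero =>
      rw [sum_eq_zero]
      · simp
      · intro j hj
        rw [mem_filter, mem_range] at hj
        have := hlow j hj.1
        push_cast at hj
        linarith [hj.2]
    | succ m ih =>
      have hstep := hper (K₀ + m)
      have hsplit : ∑ j ∈ (range n).filter (fun j ↦ f (j + 1) - f j < K₀ + (m + 1 : ℕ)), e (f j) =
          ∑ j ∈ (range n).filter (fun j ↦ f (j + 1) - f j < K₀ + m), e (f j) +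
          ∑ j ∈ (range n).filter (fun j ↦ ((K₀ + m : ℤ) : ℝ) ≤ f (j + 1) - f j ∧
            f (j + 1) - f j < (K₀ + m : ℤ) + 1), e (f j) := by
        simp only [sum_filter, ← sum_add_distrib]
        refine sum_congr rfl fun j _ ↦ ?_
        generalize f (j + 1) - f j = z
        push_cast
        rcases lt_or_ge z (K₀ + m) with h3 | h3
        · rw [if_pos (by linarith), if_pos h3, if_neg (by intro h; linarith [h.1])]; simp
        rcases lt_or_ge z (K₀ + m + 1) with h4 | h4
        · rw [if_pos (by linarith), if_neg (by linarith), if_pos ⟨h3, h4⟩]; simp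
        · rw [if_neg (by linarith), if_neg (by linarith), if_neg (by intro h; linarith [h.2])]
          simp
      rw [hsplit]
      refine (norm_add_le _ _).trans ((add_le_add ih hstep).trans (le_of_eq ?_))
      push_cast
      ring
  set W := (f (n - 1 + 1) - f (n - 1)) - (f (0 + 1) - f 0)
  have hW : W ≤ n * (h * l) := by
    refine (sub_le_mul_of_forall_second_difference h2 (Nat.zero_le (n - 1)) (by omega)).trans ?_
    gcongr
    rw [Nat.cast_sub hn]; simp
  have hW0 : 0 ≤ W := by
    refine le_trans ?_
      (mul_sub_le_of_forall_second_difference h1 (Nat.zero_le (n - 1)) (by omega))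
    simp; positivity
  have hfull : (range n).filter (fun j ↦ f (j + 1) - f j < K₀ + (⌊W⌋₊ + 2 : ℕ)) = range n := by
    refine filter_true_of_mem fun j hj ↦ ?_
    rw [mem_range] at hj
    have h3 := mul_sub_le_of_forall_second_difference h1 (by omega : j ≤ n - 1) (by omega)
    have h4 : (0 : ℝ) ≤ ((n - 1 : ℕ) - j : ℝ) * l :=
      mul_nonneg (sub_nonneg.2 (by exact_mod_cast (by omega : j ≤ n - 1))) hl.le
    have h5 := Int.lt_floor_add_one (f 1 - f 0)
    have h6 := Nat.lt_floor_add_one W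
    have h7 : W = (f (n - 1 + 1) - f (n - 1)) - (f (0 + 1) - f 0) := rfl
    rw [zero_add] at h7
    rw [← hK₀] at h5
    push_cast
    linarith
  have hmain := hind (⌊W⌋₊ + 2)
  rw [hfull] at hmain
  refine hmain.trans ?_
  have h3 := Nat.floor_le hW0
  push_cast
  calc ((⌊W⌋₊ : ℝ) + 2) * (5 / θ) ≤ (n * (h * l) + 2) * (5 / θ) := by gcongr; linarith
    _ = 5 * h * n * θ + 10 / θ := by rw [← hsq]; field_simp; ring

end SecondDifference

end TwistedBV

namespace TwistedBV

open Finset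

lemma exists_rpow_second_difference_eq {c x q : ℝ} (hx : 0 < x) (hq : 0 < q) :
    ∃ ξ ∈ Set.Icc x (x + 2 * q), ((x + 2 * q) ^ c - (x + q) ^ c) - ((x + q) ^ c - x ^ c) =
      c * (c - 1) * q ^ 2 * ξ ^ (c - 2) := by
  have hd : ∀ (b y : ℝ), 0 < y → HasDerivAt (fun y : ℝ ↦ y ^ b) (b * y ^ (b - 1)) y :=
    fun b y hy ↦ Real.hasDerivAt_rpow_const (Or.inl hy.ne')
  have hd1 : ∀ (b y : ℝ), 0 < y → HasDerivAt (fun y : ℝ ↦ (y + q) ^ b - y ^ b)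
      (b * (y + q) ^ (b - 1) - b * y ^ (b - 1)) y := fun b y hy ↦
    (((hd b (y + q) (by linarith)).comp_add_const y q)).sub (hd b y hy)
  obtain ⟨y, hy, hy'⟩ := exists_hasDerivAt_eq_slope (fun y : ℝ ↦ (y + q) ^ c - y ^ c)
    (fun y ↦ c * (y + q) ^ (c - 1) - c * y ^ (c - 1)) (show x < x + q by linarith)
    (fun y hy ↦ (hd1 c y (hx.trans_le hy.1)).continuousAt.continuousWithinAt)
    (fun y hy ↦ hd1 c y (hx.trans hy.1))
  have hy0 : 0 < y := hx.trans hy.1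
  obtain ⟨ξ, hξ, hξ'⟩ := exists_hasDerivAt_eq_slope (fun y : ℝ ↦ y ^ (c - 1))
    (fun y ↦ (c - 1) * y ^ (c - 1 - 1)) (show y < y + q by linarith)
    (fun z hz ↦ (hd (c - 1) z (hy0.trans_le hz.1)).continuousAt.continuousWithinAt)
    (fun z hz ↦ hd (c - 1) z (hy0.trans hz.1))
  refine ⟨ξ, ⟨by linarith [hy.1, hξ.1], by linarith [hy.2, hξ.2]⟩, ?_⟩
  rw [add_sub_cancel_left, eq_div_iff hq.ne'] at hy' hξ'
  rw [show c - 1 - 1 = c - 2 by ring] at hξ'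
  rw [show x + q + q = x + 2 * q by ring] at hy'
  linear_combination -hy' - c * q * hξ'

lemma rpow_sub_two_bounds {c M ξ : ℝ} (hc1 : 1 < c) (hc3 : c < 3) (hM : 0 < M) (h1 : M ≤ ξ)
    (h2 : ξ ≤ 2 * M) : M ^ (c - 2) / 2 ≤ ξ ^ (c - 2) ∧ ξ ^ (c - 2) ≤ 2 * M ^ (c - 2) := by
  have hr1 : 1 ≤ ξ / M := (one_le_div hM).2 h1
  have hr2 : ξ / M ≤ 2 := (div_le_iff₀ hM).2 h2
  have hξ : ξ ^ (c - 2) = (ξ / M) ^ (c - 2) * M ^ (c - 2) := by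
    rw [← Real.mul_rpow (by positivity) hM.le, div_mul_cancel₀ _ hM.ne']
  have hM' : 0 < M ^ (c - 2) := by positivity
  have hu : (ξ / M) ^ (c - 2) ≤ 2 := by
    calc (ξ / M) ^ (c - 2) ≤ (ξ / M) ^ (1 : ℝ) :=
          Real.rpow_le_rpow_of_exponent_le hr1 (by linarith)
      _ ≤ 2 := by rw [Real.rpow_one]; exact hr2
  have hl : 1 / 2 ≤ (ξ / M) ^ (c - 2) := by
    calc (1 / 2 : ℝ) ≤ (ξ / M) ^ (-1 : ℝ) := by
          rw [Real.rpow_neg_one, one_div]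
          exact inv_anti₀ (by linarith) hr2
      _ ≤ _ := Real.rpow_le_rpow_of_exponent_le hr1 (by linarith)
  rw [hξ]
  constructor <;> nlinarith

lemma exists_norm_sum_e_mul_rpow_le {c : ℝ} (hc1 : 1 < c) (hc3 : c < 3) :
    ∃ C > 0, ∀ {τ x q M : ℝ} {n : ℕ}, τ ≠ 0 → 0 < M → 0 < q → M ≤ x → x + q * n ≤ 2 * M →
    ‖∑ j ∈ range (n + 1), e (τ * (x + q * j) ^ c)‖ ≤
      C * (√(|τ| * M ^ c) + M / q / √(|τ| * M ^ c)) + 1 := by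
  set κ := √(c * (c - 1) / 2) with hκ
  have hcc : 0 < c * (c - 1) / 2 := by nlinarith
  have hκ0 : 0 < κ := Real.sqrt_pos.2 hcc
  have hκ2 : κ ^ 2 = c * (c - 1) / 2 := Real.sq_sqrt hcc.le
  refine ⟨20 * κ + 10 / κ, by positivity, ?_⟩
  have hpos : ∀ {τ x q M : ℝ} {n : ℕ}, 0 < τ → 0 < M → 0 < q → M ≤ x → x + q * n ≤ 2 * M →
      ‖∑ j ∈ range (n + 1), e (τ * (x + q * j) ^ c)‖ ≤
      (20 * κ + 10 / κ) * (√(τ * M ^ c) + M / q / √(τ * M ^ c)) + 1 := by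
    intro τ x q M n hτ hM hq hx hn
    set Z := √(τ * M ^ c) with hZ
    have hZ0 : 0 < Z := Real.sqrt_pos.2 (by positivity)
    have hZ2 : Z ^ 2 = τ * M ^ c := Real.sq_sqrt (by positivity)
    set l := (κ * (q / M) * Z) ^ 2 with hl
    have hleq : l = τ * (c * (c - 1) * q ^ 2 * (M ^ (c - 2) / 2)) := by
      rw [hl, mul_pow, mul_pow, hκ2, hZ2, Real.rpow_sub hM, Real.rpow_two, div_pow]
      field_simp
    have hsec : ∀ j, j + 1 < n → ∃ ξ ∈ Set.Icc M (2 * M),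
        (τ * (x + q * (j + 2 : ℕ)) ^ c - τ * (x + q * (j + 1 : ℕ)) ^ c) -
        (τ * (x + q * (j + 1 : ℕ)) ^ c - τ * (x + q * j) ^ c) =
        τ * (c * (c - 1) * q ^ 2 * ξ ^ (c - 2)) := by
      intro j hj
      have hj0 : (0 : ℝ) ≤ q * j := by positivity
      have hjn : q * (j + 2) ≤ q * n := by
        gcongr; exact_mod_cast (by omega : j + 2 ≤ n)
      obtain ⟨ξ, hξ, h⟩ := exists_rpow_second_difference_eq (c := c) (x := x + q * j) (q := q)
        (by linarith) hq
      refine ⟨ξ, ⟨by linarith [hξ.1], by linarith [hξ.2]⟩, ?_⟩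
      rw [← h]
      push_cast
      ring_nf
    have hmain := norm_sum_e_le_of_second_difference (f := fun j ↦ τ * (x + q * j) ^ c) (n := n)
      (l := l) (h := 4) (by positivity) (by norm_num) (fun j hj ↦ ?_) (fun j hj ↦ ?_)
    · rw [hl, Real.sqrt_sq (by positivity)] at hmain
      rw [sum_range_succ]
      refine (norm_add_le _ _).trans ?_
      rw [norm_e]
      gcongr
      refine hmain.trans ?_
      have hnq : n * (q / M) ≤ 1 := by
        rw [mul_div_assoc', div_le_one hM]; linarith
      calc 5 * 4 * n * (κ * (q / M) * Z) + 10 / (κ * (q / M) * Z) =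
            20 * κ * Z * (n * (q / M)) + 10 / κ * (M / q / Z) := by field_simp; ring
        _ ≤ 20 * κ * Z * 1 + 10 / κ * (M / q / Z) := by gcongr
        _ ≤ (20 * κ + 10 / κ) * (Z + M / q / Z) := by
            have h1 : 0 ≤ 10 / κ * Z := by positivity
            have h2 : 0 ≤ 20 * κ * (M / q / Z) := by positivity
            linarith
    · obtain ⟨ξ, hξ, h⟩ := hsec j hj
      rw [h, hleq]
      have := (rpow_sub_two_bounds hc1 hc3 hM hξ.1 hξ.2).1
      have h1 : 0 < c * (c - 1) * q ^ 2 := by nlinarith [pow_pos hq 2]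
      gcongr
    · obtain ⟨ξ, hξ, h⟩ := hsec j hj
      rw [h, hleq]
      have := (rpow_sub_two_bounds hc1 hc3 hM hξ.1 hξ.2).2
      have h1 : 0 < c * (c - 1) * q ^ 2 := by nlinarith [pow_pos hq 2]
      calc τ * (c * (c - 1) * q ^ 2 * ξ ^ (c - 2)) ≤
            τ * (c * (c - 1) * q ^ 2 * (2 * M ^ (c - 2))) := by gcongr
        _ = _ := by ring
  intro τ x q M n hτ hM hq hx hn
  rcases lt_or_gt_of_ne hτ with h | h
  · rw [abs_of_neg h]
    have h1 := hpos (τ := -τ) (by linarith) hM hq hx hn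
    simp only [neg_mul, e_neg] at h1
    rw [← map_sum, RCLike.norm_conj] at h1
    simpa only [neg_mul] using h1
  · rw [abs_of_pos h]; exact hpos h hM hq hx hn

end TwistedBV

namespace TwistedBV

open Finset Filter

/-- A residue class inside an interval is a finite arithmetic progression. -/
lemma exists_filter_eq_image {q : ℕ} [NeZero q] (x : ZMod q) (A B : ℕ)
    (hne : {m ∈ Ico A B | ((m : ℕ) : ZMod q) = x}.Nonempty) :
    ∃ m₀ n : ℕ, A ≤ m₀ ∧ m₀ + q * n < B ∧
      {m ∈ Ico A B | ((m : ℕ) : ZMod q) = x} = (range (n + 1)).image (fun j ↦ m₀ + q * j) := by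
  have hq : 0 < q := NeZero.pos q
  set S := {m ∈ Ico A B | ((m : ℕ) : ZMod q) = x} with hS
  obtain ⟨hmem, hmin⟩ : S.min' hne ∈ S ∧ ∀ m ∈ S, S.min' hne ≤ m :=
    ⟨S.min'_mem hne, fun m hm ↦ S.min'_le m hm⟩
  generalize S.min' hne = m₀ at hmem hmin
  have hm₀ := hmem
  simp only [hS, mem_filter, mem_Ico] at hm₀
  have hdiv := Nat.div_mul_le_self (B - 1 - m₀) q
  have hlast : m₀ + q * ((B - 1 - m₀) / q) < B := by
    rw [mul_comm]; omega
  refine ⟨m₀, (B - 1 - m₀) / q, hm₀.1.1, hlast, ?_⟩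
  ext m
  simp only [mem_image, mem_range]
  constructor
  · intro hm
    have hle := hmin m hm
    simp only [hS, mem_filter, mem_Ico] at hm
    have hdvd : q ∣ m - m₀ := by
      rw [← (ZMod.natCast_eq_zero_iff (m - m₀) q), Nat.cast_sub hle, hm.2, hm₀.2, sub_self]
    obtain ⟨j, hj⟩ := hdvd
    refine ⟨j, ?_, by omega⟩
    rw [Nat.lt_succ_iff, Nat.le_div_iff_mul_le hq, mul_comm]
    omega
  · rintro ⟨j, hj, rfl⟩
    have : q * j ≤ q * ((B - 1 - m₀) / q) := Nat.mul_le_mul_left q (by omega)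
    simp only [hS, mem_filter, mem_Ico]
    refine ⟨⟨by omega, by omega⟩, ?_⟩
    push_cast
    rw [ZMod.natCast_self, zero_mul, add_zero, hm₀.2]

/-- Exponential sums with phase `τ m ^ c` over a residue class in a dyadic block. -/
theorem exists_norm_sum_filter_e_mul_rpow_le {c : ℝ} (hc1 : 1 < c) (hc3 : c < 3) :
    ∃ C > 0, ∀ {τ : ℝ} {M B q : ℕ} [NeZero q] (x : ZMod q), τ ≠ 0 → 0 < M → B ≤ 2 * M →
      ‖∑ m ∈ Ico M B with ((m : ℕ) : ZMod q) = x, e (τ * (m : ℝ) ^ c)‖ ≤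
        C * (√(|τ| * (M : ℝ) ^ c) + M / q / √(|τ| * (M : ℝ) ^ c)) + 1 := by
  obtain ⟨C, hC, h⟩ := exists_norm_sum_e_mul_rpow_le hc1 hc3
  refine ⟨C, hC, fun {τ M B q} _ x hτ hM hB ↦ ?_⟩
  rcases Finset.eq_empty_or_nonempty {m ∈ Ico M B | ((m : ℕ) : ZMod q) = x} with he | hne
  · rw [he, sum_empty, norm_zero]
    positivity
  obtain ⟨m₀, n, hm₀, hn, himage⟩ := exists_filter_eq_image x M B hne
  have hq : 0 < q := NeZero.pos q
  rw [himage, sum_image fun i _ j _ hij ↦ Nat.eq_of_mul_eq_mul_left hq (Nat.add_left_cancel hij)]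
  have := @h τ m₀ q M n hτ (by exact_mod_cast hM) (by exact_mod_cast hq) (by exact_mod_cast hm₀)
    (by exact_mod_cast hn.le.trans hB)
  push_cast
  exact this

/-- The trivial bound for a bounded sequence over a residue class. -/
lemma norm_sum_filter_le {q : ℕ} [NeZero q] (x : ZMod q) {M B : ℕ} (hB : B ≤ 2 * M)
    {f : ℕ → ℂ} (hf : ∀ n, ‖f n‖ ≤ 1) :
    ‖∑ m ∈ Ico M B with ((m : ℕ) : ZMod q) = x, f m‖ ≤ (M : ℝ) / q + 1 := by
  have hq : (0 : ℝ) < q := by exact_mod_cast NeZero.pos q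
  have hcard := (abs_le.1 (abs_card_filter_sub_le x M B)).2
  have hBM : ((B - M : ℕ) : ℝ) ≤ M := by exact_mod_cast (by omega : B - M ≤ M)
  have hdiv : ((B - M : ℕ) : ℝ) / q ≤ M / q := by gcongr
  calc ‖∑ m ∈ Ico M B with ((m : ℕ) : ZMod q) = x, f m‖
      ≤ ∑ m ∈ Ico M B with ((m : ℕ) : ZMod q) = x, (1 : ℝ) := norm_sum_le_of_le _ fun m _ ↦ hf m
    _ = (#{m ∈ Ico M B | ((m : ℕ) : ZMod q) = x} : ℝ) := by simp
    _ ≤ _ := by linarith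

end TwistedBV

namespace TwistedBV

open Finset Filter
open scoped ArithmeticFunction.vonMangoldt ComplexConjugate

/-- The additive twist `e (t n ^ c)` restricted to the residue class `a` modulo `d`. -/
noncomputable def twist (a : ℤ) (c t : ℝ) (d n : ℕ) : ℂ :=
  if (n : ZMod d) = (a : ZMod d) then e (t * (n : ℝ) ^ c) else 0

lemma norm_twist_le (a : ℤ) (c t : ℝ) (d n : ℕ) : ‖twist a c t d n‖ ≤ 1 := by
  unfold twist
  split_ifs
  · rw [norm_e]
  · simp

lemma exists_norm_sum_filter_le_sqrt {c : ℝ} (hc1 : 1 < c) (hc3 : c < 3) :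
    ∃ C ≥ 1, ∀ {τ T η : ℝ} {M B q : ℕ} [NeZero q] (x : ZMod q), 0 < M → B ≤ 2 * M → 0 < η →
      1 ≤ T → |τ| * (M : ℝ) ^ c ≤ T →
      ‖∑ m ∈ Ico M B with ((m : ℕ) : ZMod q) = x, e (τ * (m : ℝ) ^ c)‖ ≤
        C * (√T + M / q * (η + if |τ| * (M : ℝ) ^ c * η ^ 2 < 1 then 1 else 0)) := by
  obtain ⟨C, hC, h⟩ := exists_norm_sum_filter_e_mul_rpow_le hc1 hc3
  refine ⟨C + 1, by linarith, fun {τ T η M B q} _ x hM hB hη hT hZ ↦ ?_⟩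
  have hq : (0 : ℝ) < q := by exact_mod_cast NeZero.pos q
  have hM0 : (0 : ℝ) < M := by exact_mod_cast hM
  have hT1 : 1 ≤ √T := Real.one_le_sqrt.2 hT
  split_ifs with hlt
  · refine (norm_sum_filter_le x hB fun n ↦ (norm_e _).le).trans ?_
    have h1 : 0 ≤ (M : ℝ) / q * η := by positivity
    have h2 : 0 ≤ (M : ℝ) / q := by positivity
    nlinarith
  · push Not at hlt
    have hZ0 : 0 < |τ| * (M : ℝ) ^ c := by
      by_contra! hneg
      nlinarith [sq_nonneg η]
    have hτ : τ ≠ 0 := by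
      rintro rfl
      simp at hZ0
    refine (h x hτ hM hB).trans ?_
    generalize |τ| * (M : ℝ) ^ c = Z at *
    have hZs : 0 < √Z := Real.sqrt_pos.2 hZ0
    have h1 : √Z ≤ √T := Real.sqrt_le_sqrt hZ
    have h2 : 1 ≤ η * √Z := by
      rw [← Real.sqrt_sq hη.le, ← Real.sqrt_mul (by positivity)]
      exact Real.one_le_sqrt.2 (by linarith)
    have h3 : (M : ℝ) / q / √Z ≤ M / q * η := by
      rw [div_le_iff₀ hZs, mul_assoc]
      exact le_mul_of_one_le_right (by positivity) h2
    have h4 : 0 ≤ (M : ℝ) / q * η := by positivity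
    have h5 : C * (√Z + M / q / √Z) ≤ C * (√T + M / q * η) := by gcongr
    rw [add_zero]
    linarith

lemma lt_of_abs_mul_rpow_lt {c t η u : ℝ} {N : ℕ} (hc1 : 1 < c) (hc3 : c < 3) (hη : 0 < η)
    (hη1 : η ≤ 1) (hT : 1 ≤ |t| * (N : ℝ) ^ c * η ^ 5)
    (h : |t| * u ^ c * η ^ 2 < 1) : u < η * N := by
  by_contra! hle
  have h1 : (η * N) ^ c ≤ u ^ c := Real.rpow_le_rpow (by positivity) hle (by linarith)
  rw [Real.mul_rpow hη.le (by positivity)] at h1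
  have h2 : η ^ 3 ≤ η ^ c := by
    rw [← Real.rpow_natCast]
    exact Real.rpow_le_rpow_of_exponent_ge hη hη1 (by push_cast; linarith)
  have h3 : η ^ 3 * (N : ℝ) ^ c ≤ u ^ c := le_trans (by gcongr) h1
  have h4 : |t| * (N : ℝ) ^ c * η ^ 5 ≤ |t| * u ^ c * η ^ 2 := by
    calc |t| * (N : ℝ) ^ c * η ^ 5 = |t| * (η ^ 3 * (N : ℝ) ^ c) * η ^ 2 := by ring
      _ ≤ _ := by gcongr
  linarith

lemma one_le_of_one_le_mul_pow {T η : ℝ} (hη : 0 < η) (hη1 : η ≤ 1) (hT : 1 ≤ T * η ^ 5) :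
    1 ≤ T := by
  have h1 : η ^ 5 ≤ 1 := pow_le_one₀ hη.le hη1
  have h2 : 0 < η ^ 5 := by positivity
  by_contra! hlt
  nlinarith

/-- Linear congruences with unit right-hand side have at most one solution. -/
lemma exists_filter_twist_eq {a : ℤ} {d : ℕ} (ha : IsUnit (a : ZMod d)) (k M B : ℕ) :
    ∃ x : ZMod d, {m ∈ Ico M B | ((k * m : ℕ) : ZMod d) = a} = ∅ ∨
      {m ∈ Ico M B | ((k * m : ℕ) : ZMod d) = a} = {m ∈ Ico M B | ((m : ℕ) : ZMod d) = x} := by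
  by_cases hk : IsUnit (k : ZMod d)
  · obtain ⟨u, hu⟩ := hk
    refine ⟨↑u⁻¹ * a, Or.inr (filter_congr fun m _ ↦ ?_)⟩
    push_cast
    rw [← hu, Units.eq_inv_mul_iff_mul_eq]
  · refine ⟨0, Or.inl (filter_false_of_mem fun m _ hm ↦ hk ?_)⟩
    rw [Nat.cast_mul] at hm
    exact isUnit_of_mul_isUnit_left (hm ▸ ha)

/-- Sums of the twist over the multiples of `k` in a dyadic block. -/
lemma exists_norm_sum_Ico_twist_le {c : ℝ} (hc1 : 1 < c) (hc3 : c < 3) :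
    ∃ C ≥ 1, ∀ {a : ℤ} {t η : ℝ} {N d k M B : ℕ}, IsUnit (a : ZMod d) → 1 ≤ d → 1 ≤ k → 0 < M →
      B ≤ 2 * M → k * M ≤ N → 0 < η → η ≤ 1 → 1 ≤ |t| * (N : ℝ) ^ c * η ^ 5 →
      ‖∑ m ∈ Ico M B, twist a c t d (k * m)‖ ≤
        C * (√(|t| * (N : ℝ) ^ c) + η * N / (k * d)) := by
  obtain ⟨C, hC, h⟩ := exists_norm_sum_filter_le_sqrt hc1 hc3
  refine ⟨2 * C, by linarith, fun {a t η N d k M B} ha hd hk hM hB hkM hη hη1 hT ↦ ?_⟩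
  have : NeZero d := ⟨by omega⟩
  have hd0 : (0 : ℝ) < d := by exact_mod_cast hd
  have hk0 : (0 : ℝ) < k := by exact_mod_cast hk
  have hkM' : (k : ℝ) * M ≤ N := by exact_mod_cast hkM
  have hrhs : 0 ≤ 2 * C * (√(|t| * (N : ℝ) ^ c) + η * N / (k * d)) := by positivity
  have hsum : ∑ m ∈ Ico M B, twist a c t d (k * m) =
      ∑ m ∈ Ico M B with ((k * m : ℕ) : ZMod d) = a, e (t * (k : ℝ) ^ c * (m : ℝ) ^ c) := by
    rw [sum_filter]
    refine sum_congr rfl fun m _ ↦ ?_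
    rw [twist, Nat.cast_mul (α := ℝ), Real.mul_rpow (by positivity) (by positivity), mul_assoc]
  rw [hsum]
  obtain ⟨x, hx | hx⟩ := exists_filter_twist_eq ha k M B
  · rwa [hx, sum_empty, norm_zero]
  rw [hx]
  have hZ : |t * (k : ℝ) ^ c| * (M : ℝ) ^ c = |t| * ((k : ℝ) * M) ^ c := by
    rw [abs_mul, abs_of_pos (Real.rpow_pos_of_pos hk0 c),
      Real.mul_rpow (by positivity) (by positivity), mul_assoc]
  refine (h x hM hB hη (one_le_of_one_le_mul_pow hη hη1 hT) (hZ.trans_le (by gcongr))).trans ?_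
  rw [hZ]
  have hmain : (M : ℝ) / d * (η + if |t| * ((k : ℝ) * M) ^ c * η ^ 2 < 1 then 1 else 0) ≤
      2 * (η * N / (k * d)) := by
    rw [show 2 * (η * N / (k * d)) = 2 * (η * N) / k / d by field_simp, div_mul_eq_mul_div]
    gcongr
    rw [le_div_iff₀ hk0]
    split_ifs with hlt
    · have := lt_of_abs_mul_rpow_lt hc1 hc3 hη hη1 hT hlt
      nlinarith [mul_nonneg hk0.le (Nat.cast_nonneg (α := ℝ) M)]
    · nlinarith
  nlinarith [Real.sqrt_nonneg (|t| * (N : ℝ) ^ c)]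

/-- Sums of the twist over the multiples of `k`. -/
lemma exists_norm_sum_twist_le {c : ℝ} (hc1 : 1 < c) (hc3 : c < 3) :
    ∃ C ≥ 1, ∀ {a : ℤ} {t η : ℝ} {N d k y : ℕ}, IsUnit (a : ZMod d) → 1 ≤ d → 1 ≤ k →
      y ≤ N / k → 0 < η → η ≤ 1 → 1 ≤ |t| * (N : ℝ) ^ c * η ^ 5 →
      ‖∑ m ∈ Icc 1 y, twist a c t d (k * m)‖ ≤
        C * (Nat.log 2 N + 1) * (√(|t| * (N : ℝ) ^ c) + η * N / (k * d)) := by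
  obtain ⟨C, hC, h⟩ := exists_norm_sum_Ico_twist_le hc1 hc3
  refine ⟨C, hC, fun {a t η N d k y} ha hd hk hy hη hη1 hT ↦ ?_⟩
  have hyN : k * y ≤ N := by
    rw [Nat.le_div_iff_mul_le (by omega)] at hy
    linarith
  have hblock : ∀ j, {m ∈ Icc 1 y | Nat.log 2 m = j} = Ico (2 ^ j) (min (2 ^ (j + 1)) (y + 1)) := by
    intro j
    ext m
    have hiff := mem_block_iff (N := y) (j := j) (m := m) (n₂ := 1) le_rfl
    rw [max_self, Nat.div_one] at hiff
    rw [← hiff]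
    refine ⟨fun hm ↦ ⟨hm, ?_, ?_⟩, fun hm ↦ hm.1⟩ <;>
    · simp only [mem_filter, mem_Icc] at hm
      exact (Nat.one_le_div_iff (by omega)).2 hm.1.2
  have hmaps : ∀ m ∈ Icc 1 y, Nat.log 2 m ∈ range (Nat.log 2 N + 1) := by
    intro m hm
    rw [mem_Icc] at hm
    rw [mem_range, Nat.lt_succ_iff]
    exact Nat.log_mono_right (by nlinarith)
  rw [← sum_fiberwise_of_maps_to hmaps]
  calc _ ≤ ∑ j ∈ range (Nat.log 2 N + 1), C * (√(|t| * (N : ℝ) ^ c) + η * N / (k * d)) := by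
        refine norm_sum_le_of_le _ fun j _ ↦ ?_
        rw [hblock]
        rcases le_or_gt (2 ^ j) y with hj | hj
        · exact h ha hd hk (by positivity) ((min_le_left _ _).trans (by rw [pow_succ']))
            ((Nat.mul_le_mul_left k hj).trans hyN) hη hη1 hT
        · rw [Ico_eq_empty_of_le ((min_le_right _ _).trans (by omega)), sum_empty, norm_zero]
          positivity
    _ = _ := by
        rw [sum_const, card_range, nsmul_eq_mul]
        push_cast
        ring

end TwistedBV

namespace TwistedBV

open Finset Filter
open scoped ArithmeticFunction.vonMangoldt ComplexConjugate

lemma abs_sub_rpow_le {c x y : ℝ} (hc : 1 ≤ c) (hx : 0 ≤ x) (hy : 0 ≤ y) :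
    |x - y| ^ c ≤ |x ^ c - y ^ c| := by
  wlog hxy : y ≤ x generalizing x y
  · rw [abs_sub_comm, abs_sub_comm (x ^ c)]
    exact this hy hx (by linarith)
  have h := NNReal.add_rpow_le_rpow_add ⟨x - y, by linarith⟩ ⟨y, hy⟩ hc
  have h' : (x - y) ^ c + y ^ c ≤ (x - y + y) ^ c := by exact_mod_cast h
  rw [sub_add_cancel] at h'
  rw [abs_of_nonneg (by linarith : 0 ≤ x - y)]
  exact (by linarith : (x - y) ^ c ≤ x ^ c - y ^ c).trans (le_abs_self _)

lemma card_filter_abs_sub_lt_le (S : Finset ℕ) (n : ℕ) {R : ℝ} (hR : 0 ≤ R) :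
    (#{m ∈ S | |(n : ℝ) - (m : ℕ)| < R} : ℝ) ≤ 2 * R + 1 := by
  have hsub : {m ∈ S | |(n : ℝ) - (m : ℕ)| < R} ⊆ Icc (n - ⌊R⌋₊) (n + ⌊R⌋₊) := by
    intro m hm
    have hlt := abs_lt.1 (mem_filter.1 hm).2
    have h1 : m - n ≤ ⌊R⌋₊ := Nat.le_floor <| by
      rcases le_total n m with h | h
      · rw [Nat.cast_sub h]; linarith
      · simpa [Nat.sub_eq_zero_of_le h] using hR
    have h2 : n - m ≤ ⌊R⌋₊ := Nat.le_floor <| by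
      rcases le_total m n with h | h
      · rw [Nat.cast_sub h]; linarith
      · simpa [Nat.sub_eq_zero_of_le h] using hR
    rw [mem_Icc]
    omega
  have hcard : #{m ∈ S | |(n : ℝ) - (m : ℕ)| < R} ≤ 2 * ⌊R⌋₊ + 1 := by
    refine (card_le_card hsub).trans ?_
    rw [Nat.card_Icc]
    omega
  have hfloor := Nat.floor_le hR
  have : (#{m ∈ S | |(n : ℝ) - (m : ℕ)| < R} : ℝ) ≤ 2 * (⌊R⌋₊ : ℝ) + 1 := by exact_mod_cast hcard
  linarith

/-- Two simultaneous linear congruences with unit right-hand side confine `m` to at most one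
class modulo the least common multiple. -/
lemma exists_filter_pair_eq {a : ℤ} {d₁ d₂ : ℕ} (h₁ : IsUnit (a : ZMod d₁))
    (h₂ : IsUnit (a : ZMod d₂)) (n₁ n₂ M B : ℕ) :
    ∃ x : ZMod (d₁.lcm d₂),
      {m ∈ Ico M B | ((m * n₁ : ℕ) : ZMod d₁) = a ∧ ((m * n₂ : ℕ) : ZMod d₂) = a} = ∅ ∨
      {m ∈ Ico M B | ((m * n₁ : ℕ) : ZMod d₁) = a ∧ ((m * n₂ : ℕ) : ZMod d₂) = a} =
        {m ∈ Ico M B | ((m : ℕ) : ZMod (d₁.lcm d₂)) = x} := by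
  rcases Finset.eq_empty_or_nonempty
    {m ∈ Ico M B | ((m * n₁ : ℕ) : ZMod d₁) = a ∧ ((m * n₂ : ℕ) : ZMod d₂) = a} with h | ⟨r, hr⟩
  · exact ⟨0, Or.inl h⟩
  refine ⟨r, Or.inr (filter_congr fun m _ ↦ ?_)⟩
  obtain ⟨hr₁, hr₂⟩ := (mem_filter.1 hr).2
  have key : ∀ {d n : ℕ}, IsUnit (a : ZMod d) → ((r * n : ℕ) : ZMod d) = a →
      (((m * n : ℕ) : ZMod d) = a ↔ m ≡ r [MOD d]) := by
    intro d n hu hrn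
    rw [← hrn, ← ZMod.natCast_eq_natCast_iff, Nat.cast_mul, Nat.cast_mul]
    rw [← hrn, Nat.cast_mul] at hu
    exact (isUnit_of_mul_isUnit_right hu).mul_left_inj
  rw [key h₁ hr₁, key h₂ hr₂, ZMod.natCast_eq_natCast_iff]
  exact ⟨fun h ↦ Nat.mod_lcm h.1 h.2,
    fun h ↦ ⟨h.of_dvd (Nat.dvd_lcm_left _ _), h.of_dvd (Nat.dvd_lcm_right _ _)⟩⟩

/-- Correlations of twists in two residue classes. -/
lemma exists_norm_correlation_twist_le {c : ℝ} (hc1 : 1 < c) (hc3 : c < 3) :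
    ∃ C ≥ 1, ∀ {a : ℤ} {t η : ℝ} {N d₁ d₂ j n₁ n₂ : ℕ}, IsUnit (a : ZMod d₁) →
      IsUnit (a : ZMod d₂) → 1 ≤ d₁ → 1 ≤ d₂ → n₁ ≤ N / 2 ^ j → n₂ ≤ N / 2 ^ j →
      0 < η → η ≤ 1 → 1 ≤ |t| * (N : ℝ) ^ c * η ^ 5 →
      ‖correlation N j (twist a c t d₁) (twist a c t d₂) n₁ n₂‖ ≤
        C * (√(|t| * (N : ℝ) ^ c) + 2 ^ j / (d₁.lcm d₂ : ℕ) *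
          (η + if |(n₁ : ℝ) - n₂| < η * (N / 2 ^ j) then 1 else 0)) := by
  obtain ⟨C, hC, h⟩ := exists_norm_sum_filter_le_sqrt hc1 hc3
  refine ⟨C, hC, fun {a t η N d₁ d₂ j n₁ n₂} h₁ h₂ hd₁ hd₂ hn₁ hn₂ hη hη1 hT ↦ ?_⟩
  have : NeZero (d₁.lcm d₂) := ⟨Nat.lcm_ne_zero (by omega) (by omega)⟩
  set B := min (2 ^ (j + 1)) (N / max n₁ n₂ + 1) with hB
  have hsum : correlation N j (twist a c t d₁) (twist a c t d₂) n₁ n₂ =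
      ∑ m ∈ Ico (2 ^ j) B with ((m * n₁ : ℕ) : ZMod d₁) = a ∧ ((m * n₂ : ℕ) : ZMod d₂) = a,
        e (t * ((n₁ : ℝ) ^ c - (n₂ : ℝ) ^ c) * (m : ℝ) ^ c) := by
    rw [correlation, ← hB, sum_filter]
    refine sum_congr rfl fun m _ ↦ ?_
    unfold twist
    by_cases hm₁ : ((m * n₁ : ℕ) : ZMod d₁) = a
    · by_cases hm₂ : ((m * n₂ : ℕ) : ZMod d₂) = a
      · rw [if_pos hm₁, if_pos hm₂, if_pos ⟨hm₁, hm₂⟩, ← e_neg, ← e_add]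
        push_cast
        rw [Real.mul_rpow (by positivity) (by positivity),
          Real.mul_rpow (by positivity) (by positivity)]
        ring_nf
      · rw [if_neg hm₂, if_neg (not_and_of_not_right _ hm₂), map_zero, mul_zero]
    · rw [if_neg hm₁, if_neg (not_and_of_not_left _ hm₁), zero_mul]
  rw [hsum]
  obtain ⟨x, hx | hx⟩ := exists_filter_pair_eq h₁ h₂ n₁ n₂ (2 ^ j) B
  · rw [hx, sum_empty, norm_zero]
    have : (0 : ℝ) ≤ if |(n₁ : ℝ) - n₂| < η * (N / 2 ^ j) then 1 else 0 := by
      split_ifs <;> norm_num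
    positivity
  rw [hx]
  have hM : (0 : ℝ) < 2 ^ j := by positivity
  have hZ : |t * ((n₁ : ℝ) ^ c - (n₂ : ℝ) ^ c)| * ((2 ^ j : ℕ) : ℝ) ^ c =
      |t| * (|(n₁ : ℝ) ^ c - (n₂ : ℝ) ^ c| * (2 ^ j : ℝ) ^ c) := by
    rw [abs_mul]; push_cast; ring
  have hle : ∀ n, n ≤ N / 2 ^ j → (n : ℝ) ^ c ≤ (N / 2 ^ j : ℝ) ^ c := by
    intro n hn
    have h1 : (n : ℝ) ≤ (N / 2 ^ j : ℕ) := by exact_mod_cast hn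
    have h2 : ((N / 2 ^ j : ℕ) : ℝ) ≤ N / 2 ^ j := by
      have := @Nat.cast_div_le ℝ _ _ _ N (2 ^ j); push_cast at this; exact this
    exact Real.rpow_le_rpow (by positivity) (h1.trans h2) (by linarith)
  have hZle : |t * ((n₁ : ℝ) ^ c - (n₂ : ℝ) ^ c)| * ((2 ^ j : ℕ) : ℝ) ^ c ≤ |t| * (N : ℝ) ^ c := by
    rw [hZ]
    gcongr
    calc |(n₁ : ℝ) ^ c - (n₂ : ℝ) ^ c| * (2 ^ j : ℝ) ^ c
        ≤ (N / 2 ^ j : ℝ) ^ c * (2 ^ j : ℝ) ^ c := by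
          gcongr
          exact abs_sub_le_of_nonneg_of_le (by positivity) (hle n₁ hn₁) (by positivity)
            (hle n₂ hn₂)
      _ = (N : ℝ) ^ c := by
          rw [← Real.mul_rpow (by positivity) (by positivity), div_mul_cancel₀ _ hM.ne']
  refine (h x (by positivity) ((min_le_left _ _).trans (by rw [pow_succ'])) hη
    (one_le_of_one_le_mul_pow hη hη1 hT) hZle).trans ?_
  rw [hZ]
  push_cast
  have himp : |t| * (|(n₁ : ℝ) ^ c - (n₂ : ℝ) ^ c| * (2 ^ j : ℝ) ^ c) * η ^ 2 < 1 →
      |(n₁ : ℝ) - n₂| < η * (N / 2 ^ j) := by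
    intro hlt
    rw [← mul_div_assoc, lt_div_iff₀ hM]
    refine lt_of_abs_mul_rpow_lt hc1 hc3 hη hη1 hT (lt_of_le_of_lt ?_ hlt)
    rw [Real.mul_rpow (by positivity) (by positivity)]
    gcongr
    exact abs_sub_rpow_le hc1.le (by positivity) (by positivity)
  gcongr
  split_ifs with i1 i2
  · exact le_rfl
  · exact absurd (himp i1) i2
  · norm_num
  · exact le_rfl

end TwistedBV

namespace TwistedBV

open Finset Filter
open scoped ArithmeticFunction.vonMangoldt ComplexConjugate

lemma Scale.norm_sum_correlation_twist_le {N k j : ℕ} {P L η : ℝ} (h : Scale N P L k) (hη : 0 < η)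
    (hηP : 1 ≤ η * P) {f g : ℕ → ℂ} {Q M : ℝ} (hQ : 0 ≤ Q) (hM : 0 ≤ M)
    (hfg : ∀ n₁ n₂, n₁ ≤ N / 2 ^ j → n₂ ≤ N / 2 ^ j → ‖correlation N j f g n₁ n₂‖ ≤
      Q + M * (η + if |(n₁ : ℝ) - n₂| < η * (N / 2 ^ j) then 1 else 0)) :
    ‖∑ n₁ ∈ Ioc ⌊P ^ 2⌋₊ (N / 2 ^ j), ∑ n₂ ∈ Ioc ⌊P ^ 2⌋₊ (N / 2 ^ j),
        (Λ n₁ * Λ n₂ : ℂ) * correlation N j f g n₁ n₂‖ ≤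
      L ^ 2 * (N / 2 ^ j) ^ 2 * (Q + 4 * η * M) := by
  have hL1 := h.one_le_log
  have hP := h.one_le
  set S := Ioc ⌊P ^ 2⌋₊ (N / 2 ^ j) with hS
  set κ : ℝ := N / 2 ^ j with hκ
  have hκ0 : 0 ≤ κ := by positivity
  rcases S.eq_empty_or_nonempty with he | ⟨n, hn⟩
  · rw [he, sum_empty, norm_zero]
    positivity
  have hK : ((N / 2 ^ j : ℕ) : ℝ) ≤ κ := by
    have := @Nat.cast_div_le ℝ _ _ _ N (2 ^ j)
    push_cast at this
    exact this
  have hPκ : P ≤ κ := by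
    rw [hS, mem_Ioc] at hn
    have h1 : (⌊P ^ 2⌋₊ : ℝ) ≤ (N / 2 ^ j : ℕ) := by exact_mod_cast hn.1.le.trans hn.2
    linarith [h.le_V]
  have hηκ : 1 ≤ η * κ := hηP.trans (by gcongr)
  have hcard : (#S : ℝ) ≤ κ := by
    refine le_trans ?_ hK
    rw [hS, Nat.card_Ioc]
    exact_mod_cast Nat.sub_le _ _
  have hΛ : ∀ n ∈ S, Λ n ≤ L := by
    intro n hn
    rw [hS, mem_Ioc] at hn
    exact ArithmeticFunction.vonMangoldt_le_log.trans (h.log_le (hn.2.trans (Nat.div_le_self _ _)))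
  have hterm : ∀ n₁ ∈ S, ∀ n₂ ∈ S, ‖(Λ n₁ * Λ n₂ : ℂ) * correlation N j f g n₁ n₂‖ ≤
      L ^ 2 * (Q + M * (η + if |(n₁ : ℝ) - n₂| < η * κ then 1 else 0)) := by
    intro n₁ hn₁ n₂ hn₂
    have h1 := hΛ n₁ hn₁
    have h2 := hΛ n₂ hn₂
    rw [hS, mem_Ioc] at hn₁ hn₂
    rw [norm_mul, norm_mul, Complex.norm_real, Complex.norm_real,
      Real.norm_of_nonneg ArithmeticFunction.vonMangoldt_nonneg,
      Real.norm_of_nonneg ArithmeticFunction.vonMangoldt_nonneg]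
    refine mul_le_mul ?_ (hfg n₁ n₂ hn₁.2 hn₂.2) (norm_nonneg _) (by positivity)
    rw [sq]
    exact mul_le_mul h1 h2 ArithmeticFunction.vonMangoldt_nonneg (by linarith)
  have hinner : ∀ n₁ ∈ S, ‖∑ n₂ ∈ S, (Λ n₁ * Λ n₂ : ℂ) * correlation N j f g n₁ n₂‖ ≤
      L ^ 2 * (κ * (Q + 4 * η * M)) := by
    intro n₁ hn₁
    refine (norm_sum_le_of_le _ fun n₂ hn₂ ↦ hterm n₁ hn₁ n₂ hn₂).trans ?_
    rw [← mul_sum, sum_add_distrib, ← mul_sum, sum_add_distrib, sum_const, sum_const, sum_boole,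
      nsmul_eq_mul, nsmul_eq_mul]
    gcongr
    have h3 := card_filter_abs_sub_lt_le S n₁ (by positivity : 0 ≤ η * κ)
    calc (#S : ℝ) * Q + M * (#S * η + (#{m ∈ S | |(n₁ : ℝ) - (m : ℕ)| < η * κ} : ℝ))
        ≤ κ * Q + M * (κ * η + (2 * (η * κ) + 1)) := by gcongr
      _ ≤ κ * Q + M * (κ * η + (2 * (η * κ) + η * κ)) := by gcongr
      _ = κ * (Q + 4 * η * M) := by ring
  refine (norm_sum_le_of_le _ hinner).trans ?_
  rw [sum_const, nsmul_eq_mul]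
  calc (#S : ℝ) * (L ^ 2 * (κ * (Q + 4 * η * M))) ≤ κ * (L ^ 2 * (κ * (Q + 4 * η * M))) := by gcongr
    _ = _ := by ring

/-- The bilinear estimate for twists. -/
lemma exists_sum_norm_sum_correlation_twist_le {c : ℝ} (hc1 : 1 < c) (hc3 : c < 3) :
    ∃ C ≥ 1, ∀ {a : ℤ} {t η P L : ℝ} {N k j : ℕ} {s : Finset ℕ}, Scale N P L k →
      (∀ d ∈ s, 1 ≤ d ∧ d ^ 110 ≤ N ^ 21 ∧ IsUnit (a : ZMod d)) →
      0 < η → η ≤ 1 → 1 ≤ η * P → 1 ≤ |t| * (N : ℝ) ^ c * η ^ 5 → ⌊P ^ 11⌋₊ < 2 ^ (j + 1) →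
      ∑ d₁ ∈ s, ∑ d₂ ∈ s, ‖∑ n₁ ∈ Ioc ⌊P ^ 2⌋₊ (N / 2 ^ j), ∑ n₂ ∈ Ioc ⌊P ^ 2⌋₊ (N / 2 ^ j),
        (Λ n₁ * Λ n₂ : ℂ) * correlation N j (twist a c t d₁) (twist a c t d₂) n₁ n₂‖ ≤
          N ^ 2 / 2 ^ j * (C * (L ^ 2 * √(|t| * (N : ℝ) ^ c) / P ^ 3 + η * L ^ 5)) := by
  obtain ⟨C, hC, hcorr⟩ := exists_norm_correlation_twist_le hc1 hc3
  refine ⟨32 * C, by linarith, fun {a t η P L N k j s} h hs hη hη1 hηP hT hj ↦ ?_⟩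
  have hL1 := h.one_le_log
  have hP := h.one_le
  have hM : (0 : ℝ) < 2 ^ j := by positivity
  set Q := √(|t| * (N : ℝ) ^ c) with hQ
  have hQ0 : 0 ≤ Q := Real.sqrt_nonneg _
  have hpair : ∀ d₁ ∈ s, ∀ d₂ ∈ s,
      ‖∑ n₁ ∈ Ioc ⌊P ^ 2⌋₊ (N / 2 ^ j), ∑ n₂ ∈ Ioc ⌊P ^ 2⌋₊ (N / 2 ^ j),
        (Λ n₁ * Λ n₂ : ℂ) * correlation N j (twist a c t d₁) (twist a c t d₂) n₁ n₂‖ ≤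
      L ^ 2 * (N / 2 ^ j) ^ 2 * (C * Q + 4 * η * (C * 2 ^ j * (1 / (d₁.lcm d₂ : ℕ)))) := by
    intro d₁ hd₁ d₂ hd₂
    refine h.norm_sum_correlation_twist_le hη hηP (by positivity) (by positivity)
      fun n₁ n₂ hn₁ hn₂ ↦ ?_
    refine (hcorr (hs d₁ hd₁).2.2 (hs d₂ hd₂).2.2 (hs d₁ hd₁).1 (hs d₂ hd₂).1 hn₁ hn₂ hη hη1
      hT).trans_eq ?_
    rw [hQ]
    ring
  have hlcm : ∑ d₁ ∈ s, ∑ d₂ ∈ s, 1 / ((d₁.lcm d₂ : ℕ) : ℝ) ≤ 8 * L ^ 3 := by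
    have h1 := sum_inv_lcm_le_of_forall_le (D := N)
      fun d hd ↦ ⟨(hs d hd).1, h.le_N_of_pow_le (hs d hd).2.1⟩
    refine h1.trans ?_
    rw [← h.log_eq]
    calc (1 + L) ^ 3 ≤ (2 * L) ^ 3 := by gcongr; linarith
      _ = 8 * L ^ 3 := by ring
  have hcard : (#s : ℝ) * #s ≤ P ^ 8 := by
    have h1 := h.card_le fun d hd ↦ ⟨(hs d hd).1, (hs d hd).2.1⟩
    calc (#s : ℝ) * #s ≤ P ^ 4 * P ^ 4 := by gcongr
      _ = P ^ 8 := by ring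
  have hMP := Scale.le_two_pow hj
  calc _ ≤ ∑ d₁ ∈ s, ∑ d₂ ∈ s,
        L ^ 2 * (N / 2 ^ j) ^ 2 * (C * Q + 4 * η * (C * 2 ^ j * (1 / (d₁.lcm d₂ : ℕ)))) :=
        sum_le_sum fun d₁ hd₁ ↦ sum_le_sum fun d₂ hd₂ ↦ hpair d₁ hd₁ d₂ hd₂
    _ = L ^ 2 * (N / 2 ^ j) ^ 2 * C * (Q * (#s * #s) +
          4 * η * 2 ^ j * ∑ d₁ ∈ s, ∑ d₂ ∈ s, 1 / ((d₁.lcm d₂ : ℕ) : ℝ)) := by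
        simp only [← mul_sum, sum_add_distrib, sum_const, nsmul_eq_mul]
        ring
    _ ≤ L ^ 2 * (N / 2 ^ j) ^ 2 * C * (Q * P ^ 8 + 4 * η * 2 ^ j * (8 * L ^ 3)) := by
        gcongr
    _ ≤ L ^ 2 * (N / 2 ^ j) ^ 2 * C * (2 ^ j * (2 * Q / P ^ 3) + 4 * η * 2 ^ j * (8 * L ^ 3)) := by
        have h1 : Q * P ^ 8 ≤ 2 ^ j * (2 * Q / P ^ 3) := by
          rw [← mul_div_assoc, le_div_iff₀ (by positivity)]
          calc Q * P ^ 8 * P ^ 3 = Q * P ^ 11 := by ring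
            _ ≤ Q * (2 * 2 ^ j) := by gcongr
            _ = _ := by ring
        gcongr
    _ = N ^ 2 / 2 ^ j * (C * (2 * (L ^ 2 * Q / P ^ 3) + 32 * (η * L ^ 5))) := by
        field_simp
        ring
    _ ≤ N ^ 2 / 2 ^ j * (32 * C * (L ^ 2 * Q / P ^ 3 + η * L ^ 5)) := by
        have h2 : 0 ≤ L ^ 2 * Q / P ^ 3 := by positivity
        rw [show 32 * C * (L ^ 2 * Q / P ^ 3 + η * L ^ 5) =
          C * (32 * (L ^ 2 * Q / P ^ 3) + 32 * (η * L ^ 5)) by ring]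
        gcongr
        norm_num

end TwistedBV

namespace TwistedBV

open Finset Filter
open scoped ArithmeticFunction.vonMangoldt ComplexConjugate

lemma Scale.sqrt_le {N k E : ℕ} {P L T : ℝ} (h : Scale N P L k) (hE : 2 * E ≤ k)
    (hT : T ≤ 4 * P ^ 5) : √T ≤ 2 * P ^ 3 / L ^ E := by
  have hL1 := h.one_le_log
  have hP := h.one_le
  have hLP : L ^ (2 * E) ≤ P := by
    have := h.pow_le hE
    have : 0 ≤ L ^ (2 * E) := by positivity
    linarith
  rw [Real.sqrt_le_left (by positivity), div_pow, le_div_iff₀ (by positivity), ← pow_mul,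
    mul_comm E]
  calc T * L ^ (2 * E) ≤ 4 * P ^ 5 * P := by gcongr
    _ = (2 * P ^ 3) ^ 2 := by ring

lemma twist_one (a : ℤ) (c t : ℝ) (n : ℕ) : twist a c t 1 n = e (t * (n : ℝ) ^ c) :=
  if_pos (Subsingleton.elim _ _)

lemma Scale.div_pow_le {N k i j E : ℕ} {P L : ℝ} (h : Scale N P L k) (hij : i + j ≤ E) :
    L ^ i / L ^ E ≤ 1 / L ^ j := by
  have hL1 := h.one_le_log
  rw [div_le_div_iff₀ (by positivity) (by positivity), ← pow_add, one_mul]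
  exact pow_le_pow_right₀ hL1 hij

/-- Cancellation in the twisted sums when the twist oscillates, for the von Mangoldt part. -/
lemma exists_sum_norm_sum_vonMangoldt_twist_le {c : ℝ} (hc1 : 1 < c) (hc3 : c < 3) (A : ℕ) :
    ∃ C > 0, ∀ {a : ℤ} {t P L : ℝ} {N k : ℕ} {s : Finset ℕ}, Scale N P L k → 4 * A + 20 ≤ k →
      (∀ d ∈ s, 1 ≤ d ∧ d ^ 110 ≤ N ^ 21 ∧ IsUnit (a : ZMod d)) →
      L ^ (5 * (2 * A + 10)) ≤ |t| * (N : ℝ) ^ c → |t| * (N : ℝ) ^ c ≤ 4 * P ^ 5 →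
      ∑ d ∈ s, ‖∑ n ∈ Icc 1 N, (Λ n : ℂ) * twist a c t d n‖ ≤ C * N / L ^ A := by
  obtain ⟨C₁, hC₁, hI⟩ := exists_norm_sum_twist_le hc1 hc3
  obtain ⟨C₂, hC₂, hII⟩ := exists_sum_norm_sum_correlation_twist_le hc1 hc3
  refine ⟨25 + 27 * (18 * C₁ + 3 * C₂), by positivity, fun {a t P L N k s} h hk hs hT hT' ↦ ?_⟩
  have hL1 := h.one_le_log
  have hP := h.one_le
  have hL0 : 0 < L := by linarith
  have hN0 : (0 : ℝ) < N := by exact_mod_cast h.one_le_N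
  set E := 2 * A + 10 with hE
  have hQ := h.sqrt_le (E := E) (by omega) hT'
  set Q := √(|t| * (N : ℝ) ^ c) with hQdef
  have hη : 0 < 1 / L ^ E := by positivity
  have hη1 : 1 / L ^ E ≤ 1 := by
    rw [div_le_one (by positivity)]
    exact one_le_pow₀ hL1
  have hηP : 1 ≤ 1 / L ^ E * P := by
    rw [one_div_mul_eq_div, one_le_div (by positivity)]
    have := h.pow_le (i := E) (by omega)
    have : 0 ≤ L ^ E := by positivity
    linarith
  have hηT : 1 ≤ |t| * (N : ℝ) ^ c * (1 / L ^ E) ^ 5 := by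
    rw [div_pow, one_pow, mul_one_div, one_le_div (by positivity), ← pow_mul, mul_comm E]
    exact hT
  have hs' : ∀ d ∈ s, 1 ≤ d ∧ d ^ 110 ≤ N ^ 21 := fun d hd ↦ ⟨(hs d hd).1, (hs d hd).2.1⟩
  have hcard := h.card_le hs'
  have hinv := h.sum_inv_le fun d hd ↦ ⟨(hs d hd).1, h.le_N_of_pow_le (hs d hd).2.1⟩
  refine h.sum_norm_sum_vonMangoldt_mul_le (by omega) s (twist a c t)
    (fun k ↦ 3 * L * C₁ * (P ^ 4 * Q + 2 * L * (1 / L ^ E * N) * (1 / k))) (by positivity)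
    hcard (fun d _ n ↦ norm_twist_le a c t d n) ?_ ?_ ?_
  · intro k hk y hy
    rw [mem_Icc] at hk
    have hk0 : (0 : ℝ) < k := by exact_mod_cast hk.1
    calc ∑ d ∈ s, ‖∑ m ∈ Icc 1 y, twist a c t d (k * m)‖
        ≤ ∑ d ∈ s, C₁ * (3 * L) * (Q + 1 / L ^ E * N * (1 / k) * (1 / d)) := by
          refine sum_le_sum fun d hd ↦ ?_
          refine (hI (hs d hd).2.2 (hs d hd).1 hk.1 hy hη hη1 hηT).trans ?_
          rw [show 1 / L ^ E * N / (k * d) = 1 / L ^ E * N * (1 / k) * (1 / d) by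
            rw [mul_one_div, mul_one_div, div_div]]
          have := h.natLog_succ_le
          gcongr
      _ = 3 * L * C₁ * (#s * Q + (∑ d ∈ s, 1 / (d : ℝ)) * (1 / L ^ E * N * (1 / k))) := by
          rw [← mul_sum, sum_add_distrib, sum_const, ← mul_sum, nsmul_eq_mul]
          ring
      _ ≤ 3 * L * C₁ * (P ^ 4 * Q + 2 * L * (1 / L ^ E * N * (1 / k))) := by gcongr
      _ = _ := by ring
  · rw [← mul_sum, sum_add_distrib, sum_const, ← mul_sum, nsmul_eq_mul, Nat.card_Icc,
      Nat.add_sub_cancel]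
    have h1 := h.UV_le
    have h2 : ∑ k ∈ Icc 1 (⌊P ^ 11⌋₊ * ⌊P ^ 2⌋₊), 1 / (k : ℝ) ≤ 2 * L := by
      refine (sum_inv_Icc_le _).trans ?_
      linarith [h.log_le h.UV_le_N]
    have h3 : P ^ 17 * Q ≤ 2 * (N / L ^ E) := by
      calc P ^ 17 * Q ≤ P ^ 17 * (2 * P ^ 3 / L ^ E) := by gcongr
        _ = 2 * (P ^ 20 / L ^ E) := by ring
        _ = _ := by rw [h.pow_eq]
    calc 3 * L * C₁ * (((⌊P ^ 11⌋₊ * ⌊P ^ 2⌋₊ : ℕ) : ℝ) * (P ^ 4 * Q) + 2 * L * (1 / L ^ E * N) *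
          ∑ k ∈ Icc 1 (⌊P ^ 11⌋₊ * ⌊P ^ 2⌋₊), 1 / (k : ℝ))
        ≤ 3 * L * C₁ * (P ^ 13 * (P ^ 4 * Q) + 2 * L * (1 / L ^ E * N) * (2 * L)) := by gcongr
      _ = 3 * L * C₁ * (P ^ 17 * Q + 4 * L ^ 2 * (N / L ^ E)) := by ring
      _ ≤ 3 * L * C₁ * (2 * (N / L ^ E) + 4 * L ^ 2 * (N / L ^ E)) := by gcongr
      _ = (6 * C₁) * N * (L ^ 1 / L ^ E) + (12 * C₁) * N * (L ^ 3 / L ^ E) := by ring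
      _ ≤ (6 * C₁) * N * (1 / L ^ (A + 1)) + (12 * C₁) * N * (1 / L ^ (A + 1)) := by
          exact add_le_add (mul_le_mul_of_nonneg_left (h.div_pow_le (by omega)) (by positivity))
            (mul_le_mul_of_nonneg_left (h.div_pow_le (by omega)) (by positivity))
      _ = (18 * C₁) * N / L ^ (A + 1) := by ring
      _ ≤ (18 * C₁ + 3 * C₂) * N / L ^ (A + 1) := by
          gcongr
          linarith
  · intro j hj _
    refine (hII h hs hη hη1 hηP hηT hj).trans ?_
    refine mul_le_mul_of_nonneg_left ?_ (by positivity)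
    have h1 : L ^ 2 * Q / P ^ 3 ≤ 2 * (L ^ 2 / L ^ E) := by
      rw [div_le_iff₀ (by positivity)]
      calc L ^ 2 * Q ≤ L ^ 2 * (2 * P ^ 3 / L ^ E) := by gcongr
        _ = _ := by ring
    have h2 : L ^ 2 / L ^ E ≤ 1 / L ^ (2 * A + 5) := h.div_pow_le (by omega)
    have h3 : L ^ 5 / L ^ E ≤ 1 / L ^ (2 * A + 5) := h.div_pow_le (by omega)
    calc C₂ * (L ^ 2 * Q / P ^ 3 + 1 / L ^ E * L ^ 5)
        ≤ C₂ * (2 * (1 / L ^ (2 * A + 5)) + 1 / L ^ (2 * A + 5)) := by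
          rw [one_div_mul_eq_div]
          refine mul_le_mul_of_nonneg_left ?_ (by positivity)
          linarith
      _ = 3 * C₂ / L ^ (2 * A + 5) := by ring
      _ ≤ _ := by
          gcongr
          linarith

/-- Cancellation in the twisted sums when the twist oscillates. -/
theorem exists_sum_norm_sum_deviation_le_of_le {c : ℝ} (hc1 : 1 < c) (hc3 : c < 3) (A : ℕ) :
    ∃ C > 0, ∀ {a : ℤ} {t P L : ℝ} {N k : ℕ} {s : Finset ℕ}, Scale N P L k → 4 * A + 20 ≤ k →
      (∀ d ∈ s, 1 ≤ d ∧ d ^ 110 ≤ N ^ 21 ∧ IsUnit (a : ZMod d)) →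
      L ^ (5 * (2 * A + 10)) ≤ |t| * (N : ℝ) ^ c → |t| * (N : ℝ) ^ c ≤ 4 * P ^ 5 →
      ∑ d ∈ s, ‖∑ n ∈ Icc 1 N, (progressionDeviation a d n : ℂ) * e (t * (n : ℝ) ^ c)‖ ≤
        C * N / L ^ A := by
  obtain ⟨C₁, hC₁, hΛ⟩ := exists_sum_norm_sum_vonMangoldt_twist_le hc1 hc3 A
  obtain ⟨C₂, hC₂, hI⟩ := exists_norm_sum_twist_le hc1 hc3
  refine ⟨C₁ + 54 * C₂, by positivity, fun {a t P L N k s} h hk hs hT hT' ↦ ?_⟩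
  have hL1 := h.one_le_log
  have hP := h.one_le
  have hL0 : 0 < L := by linarith
  have hN0 : (0 : ℝ) < N := by exact_mod_cast h.one_le_N
  have hphi := h.sum_inv_totient_le fun d hd ↦ ⟨(hs d hd).1, h.le_N_of_pow_le (hs d hd).2.1⟩
  set E := 2 * A + 10 with hE
  have hsplit : ∀ d, ∑ n ∈ Icc 1 N, (progressionDeviation a d n : ℂ) * e (t * (n : ℝ) ^ c) =
      ∑ n ∈ Icc 1 N, (Λ n : ℂ) * twist a c t d n -
        (1 / (d.totient : ℝ) : ℝ) * ∑ n ∈ Icc 1 N, e (t * (n : ℝ) ^ c) := by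
    intro d
    rw [mul_sum, ← sum_sub_distrib]
    refine sum_congr rfl fun n _ ↦ ?_
    rw [progressionDeviation, twist]
    split_ifs <;> push_cast <;> ring
  have hW : ‖∑ n ∈ Icc 1 N, e (t * (n : ℝ) ^ c)‖ ≤ 9 * C₂ * L * (N / L ^ E) := by
    have h1 := hI (a := 1) (t := t) (η := 1 / L ^ E) (N := N) (d := 1) (k := 1) (y := N) (by simp)
      le_rfl le_rfl (by simp) (by positivity)
      (by rw [div_le_one (by positivity)]; exact one_le_pow₀ hL1)
      (by
        rw [div_pow, one_pow, mul_one_div, one_le_div (by positivity), ← pow_mul, mul_comm E]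
        exact hT)
    simp only [one_mul, twist_one, Nat.cast_one, div_one] at h1
    refine h1.trans ?_
    have hQ := h.sqrt_le (E := E) (by omega) hT'
    have h2 : P ^ 3 / L ^ E ≤ N / L ^ E := by
      rw [← h.pow_eq]
      gcongr
      norm_num
    have h3 := h.natLog_succ_le
    calc C₂ * (Nat.log 2 N + 1) * (√(|t| * (N : ℝ) ^ c) + 1 / L ^ E * N)
        ≤ C₂ * (3 * L) * (2 * (N / L ^ E) + N / L ^ E) := by
          gcongr
          · rw [mul_div_assoc] at hQ; linarith
          · rw [one_div_mul_eq_div]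
      _ = _ := by ring
  have hmain : ∀ d ∈ s, ‖∑ n ∈ Icc 1 N, (progressionDeviation a d n : ℂ) * e (t * (n : ℝ) ^ c)‖ ≤
      ‖∑ n ∈ Icc 1 N, (Λ n : ℂ) * twist a c t d n‖ +
        1 / (d.totient : ℝ) * (9 * C₂ * L * (N / L ^ E)) := by
    intro d _
    rw [hsplit d]
    refine (norm_sub_le _ _).trans ?_
    rw [norm_mul, Complex.norm_real, Real.norm_of_nonneg (by positivity)]
    gcongr
  calc _ ≤ ∑ d ∈ s, ‖∑ n ∈ Icc 1 N, (Λ n : ℂ) * twist a c t d n‖ +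
        (∑ d ∈ s, 1 / (d.totient : ℝ)) * (9 * C₂ * L * (N / L ^ E)) := by
        refine (sum_le_sum hmain).trans_eq ?_
        rw [sum_add_distrib, sum_mul]
    _ ≤ C₁ * N / L ^ A + 6 * L ^ 2 * (9 * C₂ * L * (N / L ^ E)) := by
        gcongr
        exact hΛ h hk hs hT hT'
    _ = C₁ * N / L ^ A + 54 * C₂ * N * (L ^ 3 / L ^ E) := by ring
    _ ≤ C₁ * N / L ^ A + 54 * C₂ * N * (1 / L ^ A) :=
        add_le_add_right
          (mul_le_mul_of_nonneg_left (h.div_pow_le (by omega)) (by positivity)) _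
    _ = _ := by ring

end TwistedBV

namespace TwistedBV

open Finset Filter
open scoped ArithmeticFunction.vonMangoldt

lemma norm_e_sub_e_le (x y : ℝ) : ‖e x - e y‖ ≤ 2 * Real.pi * |x - y| := by
  have h1 : e x - e y = e y * (e (x - y) - 1) := by
    rw [mul_sub, ← e_add, add_sub_cancel, mul_one]
  have h2 : e (x - y) = Complex.exp (Complex.I * ((2 * Real.pi * (x - y) : ℝ) : ℂ)) := by
    rw [e]
    push_cast
    ring_nf
  have h3 := Real.norm_exp_I_mul_ofReal_sub_one_le (x := 2 * Real.pi * (x - y))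
  rw [h1, norm_mul, norm_e, one_mul, h2]
  refine h3.trans_eq ?_
  rw [Real.norm_eq_abs, abs_mul, abs_of_pos Real.two_pi_pos]

lemma sum_Icc_mul_eq (r w : ℕ → ℂ) (N : ℕ) :
    ∑ n ∈ Icc 1 N, r n * w n = (∑ n ∈ Icc 1 N, r n) * w N -
      ∑ n ∈ range N, (∑ m ∈ Icc 1 n, r m) * (w (n + 1) - w n) := by
  induction N with
  | zero => simp
  | succ N ih =>
    rw [sum_Icc_succ_top (by omega), ih, sum_Icc_succ_top (by omega), sum_range_succ]
    ring

/-- Partial summation against the twist `e (t n ^ c)`, averaged over a family of sequences. -/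
lemma sum_norm_sum_mul_e_le {ι : Type*} {c t G : ℝ} (hc : 1 < c) {N : ℕ} (s : Finset ι)
    (r : ι → ℕ → ℝ) (hG : ∀ n ≤ N, ∑ d ∈ s, |∑ m ∈ Icc 1 n, r d m| ≤ G) :
    ∑ d ∈ s, ‖∑ n ∈ Icc 1 N, (r d n : ℂ) * e (t * (n : ℝ) ^ c)‖ ≤
      G * (1 + 2 * Real.pi * (|t| * (N : ℝ) ^ c)) := by
  have hstep : ∀ n : ℕ, ‖e (t * ((n + 1 : ℕ) : ℝ) ^ c) - e (t * (n : ℝ) ^ c)‖ ≤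
      2 * Real.pi * |t| * (((n + 1 : ℕ) : ℝ) ^ c - (n : ℝ) ^ c) := by
    intro n
    have hmono : (n : ℝ) ^ c ≤ ((n + 1 : ℕ) : ℝ) ^ c :=
      Real.rpow_le_rpow (by positivity) (by push_cast; linarith) (by linarith)
    refine (norm_e_sub_e_le _ _).trans_eq ?_
    rw [← mul_sub, abs_mul, abs_of_nonneg (by linarith : 0 ≤ ((n + 1 : ℕ) : ℝ) ^ c - (n : ℝ) ^ c),
      mul_assoc (2 * Real.pi)]
  have hterm : ∀ d ∈ s, ‖∑ n ∈ Icc 1 N, (r d n : ℂ) * e (t * (n : ℝ) ^ c)‖ ≤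
      |∑ m ∈ Icc 1 N, r d m| + ∑ n ∈ range N, |∑ m ∈ Icc 1 n, r d m| *
        (2 * Real.pi * |t| * (((n + 1 : ℕ) : ℝ) ^ c - (n : ℝ) ^ c)) := by
    intro d _
    rw [sum_Icc_mul_eq (fun n ↦ (r d n : ℂ)) (fun n ↦ e (t * (n : ℝ) ^ c))]
    refine (norm_sub_le _ _).trans (add_le_add ?_ (norm_sum_le_of_le _ fun n _ ↦ ?_))
    · rw [norm_mul, norm_e, mul_one, ← Complex.ofReal_sum, Complex.norm_real, Real.norm_eq_abs]
    · rw [norm_mul, ← Complex.ofReal_sum, Complex.norm_real, Real.norm_eq_abs]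
      exact mul_le_mul_of_nonneg_left (hstep n) (abs_nonneg _)
  calc _ ≤ ∑ d ∈ s, |∑ m ∈ Icc 1 N, r d m| + ∑ n ∈ range N,
        (∑ d ∈ s, |∑ m ∈ Icc 1 n, r d m|) *
          (2 * Real.pi * |t| * (((n + 1 : ℕ) : ℝ) ^ c - (n : ℝ) ^ c)) := by
        refine (sum_le_sum hterm).trans_eq ?_
        rw [sum_add_distrib, sum_comm]
        simp only [sum_mul]
    _ ≤ G + ∑ n ∈ range N, G * (2 * Real.pi * |t| * (((n + 1 : ℕ) : ℝ) ^ c - (n : ℝ) ^ c)) := by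
        refine add_le_add (hG N le_rfl) (sum_le_sum fun n hn ↦ ?_)
        exact mul_le_mul_of_nonneg_right (hG n (mem_range.1 hn).le)
          ((norm_nonneg _).trans (hstep n))
    _ = _ := by
        rw [← mul_sum, ← mul_sum, sum_range_sub fun n : ℕ ↦ (n : ℝ) ^ c, Nat.cast_zero,
          Real.zero_rpow (by linarith)]
        ring

/-- The twisted mean-value theorem over all integers. -/
theorem exists_sum_norm_sum_deviation_le {c : ℝ} (hc1 : 1 < c) (hc3 : c < 3) (a : ℤ) (A : ℕ) :
    ∃ C > 0, ∃ N₀ : ℕ, ∀ N ≥ N₀, ∀ t : ℝ, |t| * (N : ℝ) ^ c ≤ 4 * ((N : ℝ) ^ (1 / 20 : ℝ)) ^ 5 →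
      ∀ s : Finset ℕ, (∀ d ∈ s, 1 ≤ d ∧ d ^ 110 ≤ N ^ 21 ∧ IsUnit (a : ZMod d)) →
      ∑ d ∈ s, ‖∑ n ∈ Icc 1 N, (progressionDeviation a d n : ℂ) * e (t * (n : ℝ) ^ c)‖ ≤
        C * N / Real.log N ^ A := by
  obtain ⟨C₁, hC₁, hlarge⟩ := exists_sum_norm_sum_deviation_le_of_le hc1 hc3 A
  obtain ⟨C₂, hC₂, N₂, hsmall⟩ :=
    exists_sum_abs_sum_progressionDeviation_le a (A + 5 * (2 * A + 10))
  obtain ⟨N₁, -, hscale⟩ := eventually_scale (4 * A + 20)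
  refine ⟨C₁ + 8 * C₂, by positivity, max N₁ N₂, fun N hN t ht s hs ↦ ?_⟩
  have h := hscale N ((le_max_left _ _).trans hN)
  have hL1 := h.one_le_log
  have hL0 : 0 < Real.log N := by linarith
  rcases le_total (Real.log N ^ (5 * (2 * A + 10))) (|t| * (N : ℝ) ^ c) with hT | hT
  · refine (hlarge h le_rfl hs hT ht).trans ?_
    gcongr
    linarith
  · have hB := one_le_pow₀ hL1 (n := 5 * (2 * A + 10))
    refine (sum_norm_sum_mul_e_le hc1 s _
      (hsmall N ((le_max_right _ _).trans hN) s hs)).trans ?_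
    have hpi : 1 + 2 * Real.pi * (|t| * (N : ℝ) ^ c) ≤ 8 * Real.log N ^ (5 * (2 * A + 10)) := by
      have := Real.pi_lt_d2
      have := Real.pi_pos
      have : 0 ≤ |t| * (N : ℝ) ^ c := by positivity
      nlinarith
    calc _ ≤ C₂ * N / Real.log N ^ (A + 5 * (2 * A + 10)) *
          (8 * Real.log N ^ (5 * (2 * A + 10))) := by gcongr
      _ = 8 * C₂ * N / Real.log N ^ A := by
          rw [pow_add]
          field_simp
      _ ≤ _ := by
          gcongr
          linarith

end TwistedBV

namespace TwistedBV

open Finset Filter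
open scoped ArithmeticFunction.vonMangoldt

/-- The weight attached to a Piatetski-Shapiro sequence is nearly constant. -/
lemma abs_rpow_mul_sub_le {γ x : ℝ} (hγ0 : 0 ≤ γ) (hγ1 : γ ≤ 1) (hx : 1 ≤ x) :
    |x ^ (1 - γ) * ((x + 1) ^ γ - x ^ γ) - γ| ≤ 1 / x := by
  have hx0 : 0 < x := by linarith
  have h1 : x ^ (1 - γ) * ((x + 1) ^ γ - x ^ γ) = x * ((1 + 1 / x) ^ γ - 1) := by
    rw [show x + 1 = x * (1 + 1 / x) by field_simp, Real.mul_rpow hx0.le (by positivity),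
      Real.rpow_sub hx0, Real.rpow_one]
    field_simp
  have hup : (1 + 1 / x) ^ γ ≤ 1 + γ * (1 / x) :=
    rpow_one_add_le_one_add_mul_self (by linarith [show 0 < 1 / x by positivity]) hγ0 hγ1
  have hlow : 1 + γ / (x + 1) ≤ (1 + 1 / x) ^ γ := by
    have h2 : (1 + -(1 / (x + 1))) ^ γ ≤ 1 + γ * -(1 / (x + 1)) :=
      rpow_one_add_le_one_add_mul_self
        (by rw [neg_le_neg_iff, div_le_one (by linarith)]; linarith) hγ0 hγ1
    rw [show 1 + -(1 / (x + 1)) = (1 + 1 / x)⁻¹ by field_simp; ring,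
      Real.inv_rpow (by positivity)] at h2
    have h3 : 0 < (1 + 1 / x) ^ γ := by positivity
    have hy : γ / (x + 1) < 1 := by rw [div_lt_one (by linarith)]; linarith
    have hy0 : 0 ≤ γ / (x + 1) := by positivity
    rw [show γ * -(1 / (x + 1)) = -(γ / (x + 1)) by ring, inv_le_iff_one_le_mul₀ h3] at h2
    nlinarith
  rw [h1, abs_le]
  constructor
  · have h4 : x * (γ / (x + 1)) ≤ x * ((1 + 1 / x) ^ γ - 1) := by gcongr; linarith
    have h5 : γ - 1 / x ≤ x * (γ / (x + 1)) := by
      rw [← sub_nonneg, show x * (γ / (x + 1)) - (γ - 1 / x) = (x * (1 - γ) + 1) / (x * (x + 1)) by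
        field_simp; ring]
      have : 0 ≤ 1 - γ := by linarith
      positivity
    linarith
  · have h4 : x * ((1 + 1 / x) ^ γ - 1) ≤ x * (γ * (1 / x)) := by gcongr; linarith
    have h5 : x * (γ * (1 / x)) = γ := by field_simp
    have : 0 < 1 / x := by positivity
    linarith

lemma continuous_e_mul_rpow {c : ℝ} (hc : 0 ≤ c) (t : ℝ) :
    Continuous fun y : ℝ ↦ e (t * y ^ c) := by
  unfold e
  have := Real.continuous_rpow_const hc
  fun_prop

lemma norm_sum_sub_integral_zero_le {c : ℝ} (hc : 1 < c) (t : ℝ) (N : ℕ) :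
    ‖∑ n ∈ range N, e (t * (n : ℝ) ^ c) - ∫ y in (0 : ℝ)..N, e (t * y ^ c)‖ ≤
      2 * Real.pi * (|t| * (N : ℝ) ^ c) := by
  have hcont := continuous_e_mul_rpow (c := c) (by linarith) t
  have hintegral : ∀ x y : ℝ, IntervalIntegrable (fun y : ℝ ↦ e (t * y ^ c)) MeasureTheory.volume x y :=
    fun x y ↦ hcont.intervalIntegrable x y
  have hsum := intervalIntegral.sum_integral_adjacent_intervals (a := fun n : ℕ ↦ (n : ℝ)) (n := N)
    (f := fun y : ℝ ↦ e (t * y ^ c)) (μ := MeasureTheory.volume) fun k _ ↦ hintegral _ _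
  rw [Nat.cast_zero] at hsum
  rw [← hsum, ← sum_sub_distrib]
  have hterm : ∀ n ∈ range N,
      ‖e (t * (n : ℝ) ^ c) - ∫ y in (n : ℝ)..((n + 1 : ℕ) : ℝ), e (t * y ^ c)‖ ≤
        2 * Real.pi * |t| * (((n + 1 : ℕ) : ℝ) ^ c - (n : ℝ) ^ c) := by
    intro n _
    have hconst : e (t * (n : ℝ) ^ c) =
        ∫ _ in (n : ℝ)..((n + 1 : ℕ) : ℝ), e (t * (n : ℝ) ^ c) := by
      rw [intervalIntegral.integral_const]
      push_cast
      rw [add_sub_cancel_left, one_smul]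
    rw [hconst, ← intervalIntegral.integral_sub intervalIntegrable_const (hintegral _ _)]
    refine (intervalIntegral.norm_integral_le_of_norm_le_const
      (C := 2 * Real.pi * |t| * (((n + 1 : ℕ) : ℝ) ^ c - (n : ℝ) ^ c)) fun y hy ↦ ?_).trans_eq ?_
    · rw [Set.uIoc_of_le (by push_cast; linarith)] at hy
      have hn : (0 : ℝ) ≤ n := by positivity
      have h1 : (n : ℝ) ^ c ≤ y ^ c := Real.rpow_le_rpow hn hy.1.le (by linarith)
      have h2 : y ^ c ≤ ((n + 1 : ℕ) : ℝ) ^ c :=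
        Real.rpow_le_rpow (hn.trans hy.1.le) hy.2 (by linarith)
      refine (norm_e_sub_e_le _ _).trans ?_
      rw [← mul_sub, abs_mul, mul_assoc (2 * Real.pi), abs_sub_comm,
        abs_of_nonneg (by linarith : 0 ≤ y ^ c - (n : ℝ) ^ c)]
      gcongr
    · push_cast
      rw [add_sub_cancel_left, abs_one, mul_one]
  refine (norm_sum_le_of_le _ hterm).trans_eq ?_
  rw [← mul_sum, sum_range_sub fun n : ℕ ↦ (n : ℝ) ^ c, Nat.cast_zero, Real.zero_rpow (by linarith)]
  ring

/-- Comparison of the sum and the integral of a slowly oscillating twist. -/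
lemma norm_sum_sub_integral_le {c X : ℝ} (hc : 1 < c) (t : ℝ) (hX : 0 ≤ X) :
    ‖∑ n ∈ Icc 1 ⌊X⌋₊, e (t * (n : ℝ) ^ c) - ∫ y in (2 : ℝ)..X, e (t * y ^ c)‖ ≤
      5 + 2 * Real.pi * (|t| * (⌊X⌋₊ : ℝ) ^ c) := by
  have hcont := continuous_e_mul_rpow (c := c) (by linarith) t
  have hintegral : ∀ x y : ℝ, IntervalIntegrable (fun y : ℝ ↦ e (t * y ^ c)) MeasureTheory.volume x y :=
    fun x y ↦ hcont.intervalIntegrable x y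
  set N := ⌊X⌋₊ with hN
  have hbound : ∀ x y : ℝ, ‖∫ y in x..y, e (t * y ^ c)‖ ≤ |y - x| := by
    intro x y
    refine (intervalIntegral.norm_integral_le_of_norm_le_const (C := 1)
      fun y _ ↦ (norm_e _).le).trans_eq (one_mul _)
  have h1 := norm_sum_sub_integral_zero_le hc t N
  have h2 := hbound 0 2
  have h3 := hbound N X
  have h4 : |X - N| ≤ 1 := by
    have := Nat.floor_le hX
    have := Nat.lt_floor_add_one X
    rw [abs_le]
    constructor <;> linarith
  have h5 : ∑ n ∈ Icc 1 N, e (t * (n : ℝ) ^ c) = ∑ n ∈ range N, e (t * (n : ℝ) ^ c) +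
      (e (t * (N : ℝ) ^ c) - e (t * ((0 : ℕ) : ℝ) ^ c)) := by
    rw [← sum_range_sub fun n : ℕ ↦ e (t * (n : ℝ) ^ c), ← sum_add_distrib,
      ← Ico_add_one_right_eq_Icc, sum_Ico_eq_sum_range]
    refine sum_congr (by simp) fun n _ ↦ ?_
    rw [add_sub_cancel, add_comm]
  have h6 : ∫ y in (2 : ℝ)..X, e (t * y ^ c) = (∫ y in (0 : ℝ)..N, e (t * y ^ c)) +
      (∫ y in (N : ℝ)..X, e (t * y ^ c)) - ∫ y in (0 : ℝ)..2, e (t * y ^ c) := by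
    rw [intervalIntegral.integral_add_adjacent_intervals (hintegral _ _) (hintegral _ _),
      intervalIntegral.integral_interval_sub_left (hintegral _ _) (hintegral _ _)]
  rw [h5, h6]
  have h7 : ‖e (t * (N : ℝ) ^ c) - e (t * ((0 : ℕ) : ℝ) ^ c)‖ ≤ 2 := by
    refine (norm_sub_le _ _).trans ?_
    rw [norm_e, norm_e]
    norm_num
  rw [sub_zero, abs_two] at h2
  calc _ = ‖(∑ n ∈ range N, e (t * (n : ℝ) ^ c) - ∫ y in (0 : ℝ)..N, e (t * y ^ c)) +
        (e (t * (N : ℝ) ^ c) - e (t * ((0 : ℕ) : ℝ) ^ c)) -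
        (∫ y in (N : ℝ)..X, e (t * y ^ c)) + ∫ y in (0 : ℝ)..2, e (t * y ^ c)‖ := by
        congr 1
        ring
    _ ≤ 2 * Real.pi * (|t| * (N : ℝ) ^ c) + 2 + 1 + 2 :=
        norm_add_le_of_le (norm_sub_le_of_le (norm_add_le_of_le h1 h7) (h3.trans h4)) h2
    _ = _ := by ring

end TwistedBV

namespace TwistedBV

open Finset Filter
open scoped ArithmeticFunction.vonMangoldt

/-- The Piatetski-Shapiro weight `n ^ (1 - γ) ((n + 1) ^ γ - n ^ γ) log n`. -/
noncomputable def weight (γ : ℝ) (n : ℕ) : ℝ :=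
  (n : ℝ) ^ (1 - γ) * (((n : ℝ) + 1) ^ γ - (n : ℝ) ^ γ) * Real.log n

lemma abs_weight_sub_le {γ : ℝ} (hγ0 : 0 ≤ γ) (hγ1 : γ ≤ 1) {n N : ℕ} (hn : n ∈ Icc 1 N)
    (p : Prop) [Decidable p] :
    |(if n.Prime ∧ p then weight γ n else 0) - γ * (if p then Λ n else 0)| ≤
      Real.log N * (1 / n) + if ¬n.Prime then Λ n else 0 := by
  rw [mem_Icc] at hn
  have hn1 : (1 : ℝ) ≤ n := by exact_mod_cast hn.1
  have hΛ : 0 ≤ Λ n := ArithmeticFunction.vonMangoldt_nonneg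
  have hlog : Real.log n ≤ Real.log N := Real.log_le_log (by linarith) (by exact_mod_cast hn.2)
  have hlog0 : 0 ≤ Real.log n := Real.log_natCast_nonneg n
  have h0 : 0 ≤ Real.log N * (1 / n) := mul_nonneg (hlog0.trans hlog) (by positivity)
  by_cases hp : p
  · by_cases hprime : n.Prime
    · simp only [hp, hprime, and_self, if_true, not_true, if_false, add_zero]
      rw [ArithmeticFunction.vonMangoldt_apply_prime hprime, weight, ← sub_mul, abs_mul,
        abs_of_nonneg hlog0, mul_comm]
      exact mul_le_mul hlog (abs_rpow_mul_sub_le hγ0 hγ1 hn1) (abs_nonneg _) (hlog0.trans hlog)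
    · simp only [hp, hprime, and_true, if_true, not_false_eq_true, if_false, zero_sub, abs_neg]
      rw [abs_of_nonneg (by positivity)]
      nlinarith
  · simp only [hp, and_false, if_false, mul_zero, sub_zero, abs_zero]
    split_ifs <;> linarith

lemma sum_abs_weight_sub_le {γ : ℝ} (hγ0 : 0 ≤ γ) (hγ1 : γ ≤ 1) {N : ℕ} (hN : 1 ≤ N)
    (p : ℕ → Prop) [DecidablePred p] :
    ∑ n ∈ Icc 1 N, |(if n.Prime ∧ p n then weight γ n else 0) - γ * (if p n then Λ n else 0)| ≤
      Real.log N * (1 + Real.log N) + 2 * √N * Real.log N := by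
  have hN1 : (1 : ℝ) ≤ N := by exact_mod_cast hN
  refine (sum_le_sum fun n hn ↦ abs_weight_sub_le hγ0 hγ1 hn (p n)).trans ?_
  rw [sum_add_distrib, ← mul_sum, ← sum_filter]
  have h1 := Chebyshev.psi_sub_theta_eq_sum_not_prime (N : ℝ)
  rw [Nat.floor_natCast] at h1
  exact add_le_add (mul_le_mul_of_nonneg_left (sum_inv_Icc_le N) (Real.log_natCast_nonneg N))
    (h1.symm.trans_le (Chebyshev.psi_sub_theta_le hN1))

/-- Passage from primes with the smooth weight to the von Mangoldt function. -/
lemma norm_prime_sum_sub_le {γ c X : ℝ} (hγ0 : 0 ≤ γ) (hγ1 : γ ≤ 1) (hc : 1 < c) (hX : 1 ≤ X)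
    (a : ℤ) (t : ℝ) {d : ℕ} (hd : 1 ≤ d) :
    ‖(∑ n ∈ Icc 1 ⌊X⌋₊ with Nat.Prime n ∧ ((n : ℕ) : ZMod d) = a,
          (weight γ n : ℂ) * e (t * (n : ℝ) ^ c)) -
        ((γ / (d.totient : ℝ) : ℝ) : ℂ) * ∫ y in (2 : ℝ)..X, e (t * y ^ c)‖ ≤
      ‖∑ n ∈ Icc 1 ⌊X⌋₊, (progressionDeviation a d n : ℂ) * e (t * (n : ℝ) ^ c)‖ +
        (Real.log ⌊X⌋₊ * (1 + Real.log ⌊X⌋₊) + 2 * √⌊X⌋₊ * Real.log ⌊X⌋₊ +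
          (5 + 2 * Real.pi * (|t| * (⌊X⌋₊ : ℝ) ^ c))) := by
  have hN : 1 ≤ ⌊X⌋₊ := Nat.one_le_floor_iff X |>.2 hX
  have hintegral := norm_sum_sub_integral_le hc t (by linarith : 0 ≤ X)
  have hsum := sum_abs_weight_sub_le hγ0 hγ1 hN fun n ↦ (n : ZMod d) = a
  generalize ⌊X⌋₊ = N at *
  generalize ∫ y in (2 : ℝ)..X, e (t * y ^ c) = J at *
  have hphi : (1 : ℝ) ≤ d.totient := by exact_mod_cast Nat.totient_pos.2 hd
  have hγφ : γ / (d.totient : ℝ) ≤ 1 := (div_le_one (by linarith)).2 (by linarith)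
  have hsplit : (∑ n ∈ Icc 1 N with Nat.Prime n ∧ ((n : ℕ) : ZMod d) = a,
        (weight γ n : ℂ) * e (t * (n : ℝ) ^ c)) - ((γ / (d.totient : ℝ) : ℝ) : ℂ) * J =
      γ * ∑ n ∈ Icc 1 N, (progressionDeviation a d n : ℂ) * e (t * (n : ℝ) ^ c) +
      (∑ n ∈ Icc 1 N, (((if n.Prime ∧ (n : ZMod d) = a then weight γ n else 0) -
        γ * (if (n : ZMod d) = a then Λ n else 0) : ℝ) : ℂ) * e (t * (n : ℝ) ^ c) +
      ((γ / (d.totient : ℝ) : ℝ) : ℂ) * (∑ n ∈ Icc 1 N, e (t * (n : ℝ) ^ c) - J)) := by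
    rw [mul_sub, ← add_assoc, ← add_sub_assoc, sub_left_inj, mul_sum, mul_sum, ← sum_add_distrib,
      ← sum_add_distrib, sum_filter]
    refine sum_congr rfl fun n _ ↦ ?_
    rw [progressionDeviation]
    split_ifs <;> push_cast <;> ring
  rw [hsplit]
  refine norm_add_le_of_le ?_ (norm_add_le_of_le ?_ ?_)
  · rw [norm_mul, Complex.norm_real, Real.norm_of_nonneg hγ0]
    exact mul_le_of_le_one_left (norm_nonneg _) hγ1
  · refine (norm_sum_le_of_le _ fun n _ ↦ ?_).trans hsum
    rw [norm_mul, norm_e, mul_one, Complex.norm_real, Real.norm_eq_abs]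
  · rw [norm_mul, Complex.norm_real, Real.norm_of_nonneg (by positivity)]
    exact (mul_le_of_le_one_left (norm_nonneg _) hγφ).trans hintegral

/-- The twisted mean-value theorem over primes with the Piatetski-Shapiro weight, in terms of the
integer part of the length. -/
theorem exists_sum_norm_prime_sum_sub_le {γ c : ℝ} (hγ0 : 0 ≤ γ) (hγ1 : γ ≤ 1) (hc1 : 1 < c)
    (hc3 : c < 3) (a : ℤ) (A : ℕ) :
    ∃ C > 0, ∃ N₀ : ℕ, ∀ X : ℝ, 1 ≤ X → N₀ ≤ ⌊X⌋₊ → ∀ t : ℝ,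
      |t| * (⌊X⌋₊ : ℝ) ^ c ≤ 4 * ((⌊X⌋₊ : ℝ) ^ (1 / 20 : ℝ)) ^ 5 →
      ∀ s : Finset ℕ, (∀ d ∈ s, 1 ≤ d ∧ d ^ 110 ≤ ⌊X⌋₊ ^ 21 ∧ IsUnit (a : ZMod d)) →
      ∑ d ∈ s, ‖(∑ n ∈ Icc 1 ⌊X⌋₊ with Nat.Prime n ∧ ((n : ℕ) : ZMod d) = a,
          (weight γ n : ℂ) * e (t * (n : ℝ) ^ c)) -
        ((γ / (d.totient : ℝ) : ℝ) : ℂ) * ∫ y in (2 : ℝ)..X, e (t * y ^ c)‖ ≤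
        C * ⌊X⌋₊ / Real.log ⌊X⌋₊ ^ A := by
  obtain ⟨C, hC, N₁, hdev⟩ := exists_sum_norm_sum_deviation_le hc1 hc3 a A
  obtain ⟨N₂, -, hscale⟩ := eventually_scale (A + 1)
  refine ⟨C + 37, by positivity, max N₁ N₂, fun X hX hN t ht s hs ↦ ?_⟩
  have hdev' := hdev _ ((le_max_left _ _).trans hN) t ht s hs
  have h := hscale _ ((le_max_right _ _).trans hN)
  refine (sum_le_sum fun d hd ↦
    norm_prime_sum_sub_le hγ0 hγ1 hc1 hX a t (hs d hd).1).trans ?_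
  rw [sum_add_distrib, sum_const, nsmul_eq_mul]
  have hcard := h.card_le fun d hd ↦ ⟨(hs d hd).1, (hs d hd).2.1⟩
  have hLP := h.pow_le (i := 1) (by omega)
  have hL1 := h.one_le_log
  have hP := h.one_le
  have hpow := h.pow_eq
  generalize (⌊X⌋₊ : ℝ) ^ (1 / 20 : ℝ) = P at *
  generalize Real.log ⌊X⌋₊ = L at *
  generalize ⌊X⌋₊ = N at *
  have hsqrt : √(N : ℝ) = P ^ 10 := by
    rw [← hpow, show P ^ 20 = (P ^ 10) ^ 2 by ring, Real.sqrt_sq (by positivity)]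
  rw [pow_one] at hLP
  have hLP' : L ≤ P := by linarith
  have herr : L * (1 + L) + 2 * √N * L + (5 + 2 * Real.pi * (|t| * (N : ℝ) ^ c)) ≤ 37 * P ^ 11 := by
    have h1 : L * (1 + L) ≤ 2 * P ^ 11 := by
      calc L * (1 + L) ≤ P * (P + P) := by gcongr
        _ = 2 * P ^ 2 := by ring
        _ ≤ 2 * P ^ 11 := by gcongr 2 * ?_; exact pow_le_pow_right₀ hP (by norm_num)
    have h2 : 2 * √N * L ≤ 2 * P ^ 11 := by
      rw [hsqrt]
      calc 2 * P ^ 10 * L ≤ 2 * P ^ 10 * P := by gcongr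
        _ = 2 * P ^ 11 := by ring
    have h3 : 2 * Real.pi * (|t| * (N : ℝ) ^ c) ≤ 28 * P ^ 11 := by
      have h5 : P ^ 5 ≤ P ^ 11 := pow_le_pow_right₀ hP (by norm_num)
      calc 2 * Real.pi * (|t| * (N : ℝ) ^ c) ≤ 2 * 3.5 * (4 * P ^ 5) := by
            have := Real.pi_lt_d2
            gcongr
            linarith
        _ ≤ 28 * P ^ 11 := by linarith
    have h4 : 1 ≤ P ^ 11 := one_le_pow₀ hP
    linarith
  have hfin : P ^ 15 ≤ N / L ^ A :=
    h.pow_le_div (by omega) (pow_le_pow_right₀ hP (by norm_num))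
  calc _ ≤ C * N / L ^ A + P ^ 4 * (37 * P ^ 11) := by
        refine add_le_add hdev' (mul_le_mul hcard herr ?_ (by positivity))
        have := Real.pi_pos
        positivity
    _ = C * N / L ^ A + 37 * P ^ 15 := by ring
    _ ≤ C * N / L ^ A + 37 * (N / L ^ A) := by gcongr
    _ = (C + 37) * N / L ^ A := by ring

end TwistedBV

namespace TwistedBV

open Finset Filter

lemma half_le_floor {X : ℝ} (hX : 1 ≤ X) : X / 2 ≤ ⌊X⌋₊ := by
  have h1 : (1 : ℝ) ≤ ⌊X⌋₊ := by exact_mod_cast (Nat.one_le_floor_iff X).2 hX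
  have h2 := Nat.lt_floor_add_one X
  linarith

lemma half_log_le_log_floor {X : ℝ} (hX : 4 ≤ X) : Real.log X / 2 ≤ Real.log ⌊X⌋₊ := by
  have hfloor := half_le_floor (by linarith : 1 ≤ X)
  have h : X ≤ (⌊X⌋₊ : ℝ) ^ 2 := by nlinarith
  have := Real.log_le_log (by linarith) h
  rw [Real.log_pow] at this
  push_cast at this
  linarith

lemma pow_le_floor_pow {X θ ε : ℝ} (hX : 1 ≤ X) (hθ : θ ≤ 21 / 110 - ε)
    (hε : 2 ^ 21 ≤ X ^ (110 * ε)) {d : ℕ} (hd : d ≤ ⌊X ^ θ⌋₊) : d ^ 110 ≤ ⌊X⌋₊ ^ 21 := by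
  have hX0 : 0 < X := by linarith
  have hdX : (d : ℝ) ≤ X ^ (21 / 110 - ε) :=
    ((Nat.cast_le.2 hd).trans (Nat.floor_le (by positivity))).trans
      (Real.rpow_le_rpow_of_exponent_le hX hθ)
  have h : (d : ℝ) ^ 110 ≤ (⌊X⌋₊ : ℝ) ^ 21 := by
    calc (d : ℝ) ^ 110 ≤ (X ^ (21 / 110 - ε)) ^ 110 := by gcongr
      _ = X ^ (21 - 110 * ε) := by
          rw [← Real.rpow_natCast, ← Real.rpow_mul hX0.le]
          norm_num
          ring_nf
      _ = X ^ 21 / X ^ (110 * ε) := by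
          rw [Real.rpow_sub hX0]
          norm_cast
      _ ≤ X ^ 21 / 2 ^ 21 := by gcongr
      _ = (X / 2) ^ 21 := by rw [div_pow]
      _ ≤ (⌊X⌋₊ : ℝ) ^ 21 := by
          gcongr
          exact half_le_floor hX
  exact_mod_cast h

lemma abs_mul_floor_rpow_le {X c t : ℝ} (hX : 1 ≤ X) (hc : 0 ≤ c)
    (ht : |t| < X ^ ((1 : ℝ) / 4 - c)) :
    |t| * (⌊X⌋₊ : ℝ) ^ c ≤ 4 * ((⌊X⌋₊ : ℝ) ^ (1 / 20 : ℝ)) ^ 5 := by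
  have hX0 : 0 < X := by linarith
  have hfloor := half_le_floor hX
  calc |t| * (⌊X⌋₊ : ℝ) ^ c ≤ X ^ ((1 : ℝ) / 4 - c) * X ^ c :=
        mul_le_mul ht.le (Real.rpow_le_rpow (by positivity) (Nat.floor_le hX0.le) hc)
          (by positivity) (by positivity)
    _ = X ^ ((1 : ℝ) / 4) := by rw [← Real.rpow_add hX0, sub_add_cancel]
    _ ≤ (4 ^ 4 * (⌊X⌋₊ : ℝ)) ^ ((1 : ℝ) / 4) := by
        gcongr
        linarith
    _ = 4 * ((⌊X⌋₊ : ℝ) ^ (1 / 20 : ℝ)) ^ 5 := by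
        rw [Real.mul_rpow (by norm_num) (by positivity), ← Real.rpow_natCast,
          ← Real.rpow_natCast, ← Real.rpow_mul (by norm_num), ← Real.rpow_mul (by positivity)]
        norm_num

lemma div_log_floor_pow_le {C X A : ℝ} (hC : 0 ≤ C) (hX : 4 ≤ X) :
    C * ⌊X⌋₊ / Real.log ⌊X⌋₊ ^ ⌈A⌉₊ ≤ C * 2 ^ ⌈A⌉₊ * X / Real.log X ^ A := by
  have hlog : 1 ≤ Real.log X := by
    rw [Real.le_log_iff_exp_le (by linarith)]
    linarith [Real.exp_one_lt_d9]
  have hhalf := half_log_le_log_floor hX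
  have hA : Real.log X ^ A ≤ Real.log X ^ ⌈A⌉₊ := by
    rw [← Real.rpow_natCast]
    exact Real.rpow_le_rpow_of_exponent_le hlog (Nat.le_ceil A)
  calc C * ⌊X⌋₊ / Real.log ⌊X⌋₊ ^ ⌈A⌉₊ ≤ C * X / (Real.log X / 2) ^ ⌈A⌉₊ := by
        gcongr
        exact Nat.floor_le (by linarith)
    _ = C * 2 ^ ⌈A⌉₊ * X / Real.log X ^ ⌈A⌉₊ := by
        rw [div_pow]
        field_simp
    _ ≤ C * 2 ^ ⌈A⌉₊ * X / Real.log X ^ A := by gcongr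

end TwistedBV

open scoped Classical in
/-- For `865/886 < γ < 1`, `a ≠ 0`, `1 < c < 3`, `c ≠ 2`, `A > 0`, sufficiently small
`ε > 0`, `θ = (443/55)γ - 173/22 - ε`, `D = X^θ`, sufficiently large `X` and
`|t| < X^{1/4-c}`,
`∑_{d ≤ D, (d,a)=1} |∑_{p ≤ X, p ≡ a (d)} p^{1-γ}((p+1)^γ - p^γ) e(tp^c) log p
  - (γ/φ(d)) ∫_2^X e(ty^c) dy| ≪ X/(log X)^A`. -/
theorem BV_main_term (γ : ℝ) (hγ₁ : 865 / 886 < γ) (hγ₂ : γ < 1)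
    (a : ℤ) (ha : a ≠ 0) (c : ℝ) (hc₁ : 1 < c) (hc₂ : c < 3) (hc₃ : c ≠ 2)
    (A : ℝ) (hA : 0 < A) :
    ∃ ε₀ : ℝ, 0 < ε₀ ∧ ∀ ε : ℝ, 0 < ε → ε < ε₀ →
      ∃ C : ℝ, 0 < C ∧ ∃ X₀ : ℝ, ∀ X : ℝ, X₀ ≤ X → ∀ t : ℝ, |t| < X ^ ((1 : ℝ) / 4 - c) →
        ∑ d ∈ (Finset.Icc 1 ⌊X ^ ((443 / 55) * γ - 173 / 22 - ε)⌋₊).filter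
            (fun d : ℕ => Int.gcd (d : ℤ) a = 1),
          ‖(∑ p ∈ (Finset.Icc 1 ⌊X⌋₊).filter
                (fun p : ℕ => p.Prime ∧ (d : ℤ) ∣ ((p : ℤ) - a)),
              (((p : ℝ) ^ (1 - γ) * (((p : ℝ) + 1) ^ γ - (p : ℝ) ^ γ) * Real.log p : ℝ) : ℂ)
                * e (t * (p : ℝ) ^ c))
            - ((γ / (Nat.totient d : ℝ) : ℝ) : ℂ) * ∫ y in (2 : ℝ)..X, e (t * y ^ c)‖
        ≤ C * X / (Real.log X) ^ A := by
  obtain ⟨C, hC, N₀, hmain⟩ := TwistedBV.exists_sum_norm_prime_sum_sub_le (γ := γ) (c := c)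
    (by linarith) hγ₂.le hc₁ hc₂ a ⌈A⌉₊
  refine ⟨1, one_pos, fun ε hε _ ↦ ⟨C * 2 ^ ⌈A⌉₊, by positivity, ?_⟩⟩
  obtain ⟨X₁, hX₁⟩ := Filter.eventually_atTop.1
    ((tendsto_rpow_atTop (by linarith : 0 < 110 * ε)).eventually_ge_atTop (2 ^ 21))
  refine ⟨max (max 4 N₀) X₁, fun X hX t ht ↦ ?_⟩
  obtain ⟨⟨hX4, hXN⟩, hXε⟩ : (4 ≤ X ∧ (N₀ : ℝ) ≤ X) ∧ X₁ ≤ X := by simpa using hX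
  have hX1 : 1 ≤ X := by linarith
  refine le_trans (le_of_eq ?_) ((hmain X hX1 (Nat.le_floor hXN) t
    (TwistedBV.abs_mul_floor_rpow_le hX1 (by linarith) ht)
    ((Finset.Icc 1 ⌊X ^ ((443 / 55) * γ - 173 / 22 - ε)⌋₊).filter
      (fun d : ℕ => Int.gcd (d : ℤ) a = 1)) fun d hd ↦ ?_).trans
    (TwistedBV.div_log_floor_pow_le hC.le hX4))
  · refine Finset.sum_congr rfl fun d _ ↦ ?_
    congr 2
    refine Finset.sum_congr (Finset.filter_congr fun p _ ↦ and_congr_right fun _ ↦ ?_)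
      fun p _ ↦ rfl
    rw [← ZMod.intCast_zmod_eq_zero_iff_dvd]
    push_cast
    exact sub_eq_zero
  · rw [Finset.mem_filter, Finset.mem_Icc] at hd
    refine ⟨hd.1.1, TwistedBV.pow_le_floor_pow hX1 (by linarith) (hX₁ X hXε) hd.1.2, ?_⟩
    rw [ZMod.coe_int_isUnit_iff_isCoprime]
    exact Int.isCoprime_iff_gcd_eq_one.2 hd.2
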